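/- Let (R, m) be an analytically unramified Cohen-Macaulay local ring of dimension d ≥ 3, type t(R), infinite residue field; I an ideal with closure(I) = m and J a minimal reduction. If ē₃(I) = 0 and λ(closure(I²)/(J·closure(I))) ≥ t(R) − 1, then the associated graded ring Ḡ of the normal filtration is Cohen-Macaulay. -/

import Mathlib

set_option synthInstance.maxHeartbeats 1000000
set_option maxHeartbeats 2000000

open IsLocalRing Polynomial Finset

variable {R : Type*}

/-- `x` is integral over the ideal `I`: it satisfies an equation
`x^n + a₁ x^{n-1} + ⋯ + aₙ = 0` with `aᵢ ∈ Iⁱ`. -/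
def IsIntegralOverIdeal [CommRing R] (I : Ideal R) (x : R) : Prop :=
  ∃ n : ℕ, 0 < n ∧ ∃ a : ℕ → R, (∀ i ∈ Finset.Icc 1 n, a i ∈ I ^ i) ∧
    x ^ n + ∑ i ∈ Finset.Icc 1 n, a i * x ^ (n - i) = 0

/-- The integral closure of an ideal (the set of integral elements is an ideal,
so the span equals it). -/
def intCl [CommRing R] (I : Ideal R) : Ideal R :=
  Ideal.span {x | IsIntegralOverIdeal I x}

/-- Length of a module, as the Krull dimension of its lattice of submodules. -/
noncomputable def mlen (R M : Type*) [CommRing R] [AddCommGroup M] [Module R M] :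
    WithBot ℕ∞ :=
  Order.krullDim (Submodule R M)

/-- The quotient module `N/(K ∩ N)` for ideals `N K`. -/
abbrev idealQuot [CommRing R] (N K : Ideal R) :=
  N ⧸ (Submodule.comap N.subtype K)

/-- Depth of `M` with respect to the ideal `J`: sup of lengths of `M`-regular
sequences contained in `J`. -/
noncomputable def rdepth (A : Type*) [CommRing A] (J : Ideal A)
    (M : Type*) [AddCommGroup M] [Module A M] : ℕ∞ :=
  sSup {n : ℕ∞ | ∃ rs : List A, (rs.length : ℕ∞) = n ∧ (∀ x ∈ rs, x ∈ J) ∧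
    RingTheory.Sequence.IsRegular M rs}

/-- A local ring is Cohen-Macaulay if its depth equals its Krull dimension. -/
def IsCMLocal (R : Type*) [CommRing R] [IsLocalRing R] : Prop :=
  (rdepth R (maximalIdeal R) R : WithBot ℕ∞) = ringKrullDim R

/-- A local ring is analytically unramified if its `m`-adic completion is reduced. -/
def AnalyticallyUnramified (R : Type*) [CommRing R] [IsLocalRing R] : Prop :=
  IsReduced (AdicCompletion (maximalIdeal R) R)

/-- An ideal is `m`-primary. -/
def IsMPrimary [CommRing R] [IsLocalRing R] (I : Ideal R) : Prop :=
  I.radical = maximalIdeal R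

/-- `J ⊆ I` is a minimal reduction: generated by `d = dim R` elements and
`I^{n+1} = J I^n` for `n ≫ 0`. -/
def IsMinimalReduction [CommRing R] (d : ℕ) (J I : Ideal R) : Prop :=
  J ≤ I ∧ (∃ s : Fin d → R, J = Ideal.span (Set.range s)) ∧
    ∃ N : ℕ, ∀ n ≥ N, I ^ (n + 1) = J * I ^ n

/-- Normal Hilbert data: `L n = λ(R/ intCl(I^{n+1}))` and for `n ≫ 0` this agrees
with the polynomial whose normalized coefficients are the `e i`. -/
def NormalHilbertData [CommRing R] (d : ℕ) (I : Ideal R) (L : ℕ → ℕ) (e : ℕ → ℤ) : Prop :=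
  (∀ n, mlen R (R ⧸ intCl (I ^ (n + 1))) = (L n : WithBot ℕ∞)) ∧
    ∃ N : ℕ, ∀ n ≥ N, (L n : ℤ) =
      ∑ i ∈ Finset.range (d + 1), (-1 : ℤ) ^ i * e i * ((n + d - i).choose (d - i))

/-- `t` is the Cohen-Macaulay type of the local ring `R` of dimension `d`:
`t = λ((Q : m)/Q)` for every ideal `Q` generated by a maximal regular sequence in `m`. -/
def CMTypeData (R : Type*) [CommRing R] [IsLocalRing R] (d t : ℕ) : Prop :=
  ∀ s : List R, s.length = d → (∀ x ∈ s, x ∈ maximalIdeal R) →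
    RingTheory.Sequence.IsRegular R s →
      mlen R (idealQuot ((Ideal.span {x | x ∈ s}).colon (maximalIdeal R))
        (Ideal.span {x | x ∈ s})) = (t : WithBot ℕ∞)

/-- The quotient module `N/(K ∩ N)` for submodules `N K` of a module. -/
abbrev submoduleQuot {A M : Type*} [CommRing A] [AddCommGroup M] [Module A M]
    (N K : Submodule A M) :=
  N ⧸ (Submodule.comap N.subtype K)

section

open IsLocalRing Polynomial Finset

namespace CMproof

/-- the ideal generated by the family `x`. -/
abbrev JJ {R : Type*} [CommRing R] {d : ℕ} (x : Fin d → R) : Ideal R := Ideal.span (Set.range x)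

/-- quasi-regular setting. -/
structure Ctx {R : Type*} [CommRing R] {d : ℕ} (x : Fin d → R) (M : Ideal R) : Prop where
  prime : M.IsPrime
  le : JJ x ≤ M
  pow : ∃ s : ℕ, M ^ s ≤ JJ x
  canc : ∀ a b, a ∉ M → a * b ∈ JJ x → b ∈ JJ x
  qreg : ∀ (n : ℕ) (f : MvPolynomial (Fin d) R), f.IsHomogeneous n →
    MvPolynomial.eval x f ∈ JJ x ^ (n + 1) → ∀ m, f.coeff m ∈ JJ x

section
variable {R : Type*} [CommRing R] {d : ℕ} {x : Fin d → R} {M : Ideal R}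

theorem mem_pow_iff {n : ℕ} {y : R} : y ∈ JJ x ^ n ↔
    ∃ p : MvPolynomial (Fin d) R, p.IsHomogeneous n ∧ p.eval x = y :=
  Ideal.mem_span_pow_iff_exists_isHomogeneous x y

/-- evaluation of a homogeneous polynomial with coefficients in an ideal. -/
theorem eval_mem_mul {n : ℕ} (A : Ideal R) {f : MvPolynomial (Fin d) R} (hf : f.IsHomogeneous n)
    (h : ∀ m, f.coeff m ∈ A) : f.eval x ∈ A * JJ x ^ n := by
  classical
  rw [MvPolynomial.eval_eq]
  refine Ideal.sum_mem _ fun m hm => Ideal.mul_mem_mul (h m) ?_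
  have hd := hf (MvPolynomial.mem_support_iff.1 hm)
  rw [mem_pow_iff]
  refine ⟨MvPolynomial.monomial m 1, ?_, ?_⟩
  · apply MvPolynomial.isHomogeneous_monomial
    rw [← hd, Finsupp.degree_eq_weight_one]
    rfl
  · rw [MvPolynomial.eval_monomial, one_mul]
    rfl

theorem exists_of_mem_mul {n : ℕ} (A : Ideal R) {y : R} (hy : y ∈ A * JJ x ^ n) :
    ∃ f : MvPolynomial (Fin d) R, f.IsHomogeneous n ∧ (∀ m, f.coeff m ∈ A) ∧ f.eval x = y := by
  refine Submodule.mul_induction_on hy ?_ ?_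
  · intro a ha b hb
    obtain ⟨p, hp, rfl⟩ := mem_pow_iff.1 hb
    refine ⟨MvPolynomial.C a * p, ?_, ?_, by simp⟩
    · simpa using (MvPolynomial.isHomogeneous_C (Fin d) a).mul hp
    · intro m
      rw [MvPolynomial.coeff_C_mul]
      exact A.mul_mem_right _ ha
  · rintro _ _ ⟨f, hf, hf', rfl⟩ ⟨g, hg, hg', rfl⟩
    exact ⟨f + g, hf.add hg, fun m => by simpa using A.add_mem (hf' m) (hg' m), by simp⟩

namespace Ctx

/-- nonzerodivisor lemma for polynomials -/
theorem nzd (h : Ctx x M) {f g : MvPolynomial (Fin d) R} (hf : ∃ m, f.coeff m ∉ M)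
    (hfg : ∀ m, (f * g).coeff m ∈ JJ x) : ∀ m, g.coeff m ∈ JJ x := by
  classical
  let q := Ideal.Quotient.mk (JJ x)
  have key : ∀ p : MvPolynomial (Fin d) R, MvPolynomial.map q p = 0 ↔ ∀ m, p.coeff m ∈ JJ x := by
    intro p
    rw [MvPolynomial.ext_iff]
    simp only [MvPolynomial.coeff_map, MvPolynomial.coeff_zero]
    exact forall_congr' fun m => Ideal.Quotient.eq_zero_iff_mem
  rw [← key] at hfg ⊢
  rw [map_mul] at hfg
  -- decomposition
  set f1 : MvPolynomial (Fin d) R := ∑ m ∈ f.support.filter (fun m => f.coeff m ∉ M),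
    MvPolynomial.monomial m (f.coeff m) with hf1
  have c1 : ∀ m, f1.coeff m = if f.coeff m ∈ M then 0 else f.coeff m := by
    intro m
    rw [hf1, MvPolynomial.coeff_sum]
    simp only [MvPolynomial.coeff_monomial, Finset.sum_ite_eq', Finset.mem_filter,
      MvPolynomial.mem_support_iff]
    by_cases h1 : f.coeff m ∈ M
    · simp [h1]
    · have : f.coeff m ≠ 0 := fun h0 => h1 (h0 ▸ M.zero_mem)
      simp [h1, this]
  have c2 : ∀ m, (f - f1).coeff m ∈ M := by
    intro m
    rw [MvPolynomial.coeff_sub, c1]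
    split_ifs with h1
    · simpa using h1
    · simp
  -- nilpotent part
  obtain ⟨s, hs⟩ := h.pow
  have hnil : (MvPolynomial.map q (f - f1)) ^ s = 0 := by
    rw [← map_pow, key]
    have h1 : f - f1 ∈ M.map (MvPolynomial.C : R →+* MvPolynomial (Fin d) R) := by
      rw [MvPolynomial.mem_map_C_iff]; exact c2
    have h2 := Ideal.pow_mem_pow h1 s
    rw [← Ideal.map_pow] at h2
    have h3 := Ideal.map_mono (f := (MvPolynomial.C : R →+* MvPolynomial (Fin d) R)) hs h2
    rw [MvPolynomial.mem_map_C_iff] at h3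
    exact h3
  -- regular part
  have hreg : MvPolynomial.map q f1 ∈ nonZeroDivisors (MvPolynomial (Fin d) (R ⧸ JJ x)) := by
    apply MonomialOrder.lex.mem_nonZeroDivisors_of_leadingCoeff_mem_nonZeroDivisors
    have hne : MvPolynomial.map q f1 ≠ 0 := by
      obtain ⟨m, hm⟩ := hf
      intro h0
      rw [key] at h0
      have := h0 m
      rw [c1, if_neg hm] at this
      exact hm (h.le this)
    have hlc := MonomialOrder.lex.leadingCoeff_ne_zero_iff.2 hne
    rw [MonomialOrder.leadingCoeff, MvPolynomial.coeff_map] at hlc ⊢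
    set m0 := MonomialOrder.lex.degree (MvPolynomial.map q f1)
    have hm0 : f1.coeff m0 ∉ M := by
      intro h0
      apply hlc
      rw [c1] at h0 ⊢
      split_ifs with h1
      · simp
      · rw [if_neg h1] at h0
        exact absurd h0 h1
    rw [mem_nonZeroDivisors_iff_right]
    intro b hb
    obtain ⟨b, rfl⟩ := Ideal.Quotient.mk_surjective b
    rw [← map_mul, Ideal.Quotient.eq_zero_iff_mem, mul_comm] at hb
    rw [Ideal.Quotient.eq_zero_iff_mem]
    exact h.canc _ _ hm0 hb
  have hpow : ∀ j : ℕ, (MvPolynomial.map q f1) ^ j * MvPolynomial.map q g =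
      (-MvPolynomial.map q (f - f1)) ^ j * MvPolynomial.map q g := by
    intro j
    induction j with
    | zero => simp
    | succ j ih =>
      have : MvPolynomial.map q f1 * MvPolynomial.map q g =
          - MvPolynomial.map q (f - f1) * MvPolynomial.map q g := by
        rw [map_sub]; linear_combination hfg
      rw [pow_succ, mul_assoc, this, pow_succ]
      linear_combination (- MvPolynomial.map q (f - f1)) * ih
  have := hpow s
  rw [neg_pow (MvPolynomial.map q (f - f1)) s, hnil, mul_zero, zero_mul, mul_comm] at this
  exact (mem_nonZeroDivisors_iff_right.1 (pow_mem hreg s)) _ this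

theorem not_mem_of_coeff (h : Ctx x M) {c : ℕ} {f : MvPolynomial (Fin d) R} (hf : f.IsHomogeneous c)
    (hf' : ∃ m, f.coeff m ∉ M) : f.eval x ∉ M * JJ x ^ c := by
  intro hm
  obtain ⟨g, hg, hg', he⟩ := exists_of_mem_mul M hm
  obtain ⟨m, hm⟩ := hf'
  have := h.qreg c (f - g) (hf.sub hg) (by simp [he]) m
  apply hm
  have h2 := M.add_mem (h.le this) (hg' m)
  simpa using h2

theorem exists_of_not_mem {c : ℕ} {F : R} (hF : F ∈ JJ x ^ c)
    (hF' : F ∉ M * JJ x ^ c) : ∃ f : MvPolynomial (Fin d) R, f.IsHomogeneous c ∧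
      (∃ m, f.coeff m ∉ M) ∧ f.eval x = F := by
  obtain ⟨f, hf, rfl⟩ := mem_pow_iff.1 hF
  refine ⟨f, hf, ?_, rfl⟩
  by_contra hcon
  push Not at hcon
  exact hF' (eval_mem_mul M hf hcon)

theorem cancel (h : Ctx x M) {c n : ℕ} {F a : R} (hF : F ∈ JJ x ^ c)
    (hF' : F ∉ M * JJ x ^ c) (ha : F * a ∈ JJ x ^ (n + c)) : a ∈ JJ x ^ n := by
  obtain ⟨f, hf, hfc, rfl⟩ := exists_of_not_mem hF hF'
  suffices H : ∀ k ≤ n, a ∈ JJ x ^ k from H n le_rfl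
  intro k
  induction k with
  | zero => intro; simp
  | succ k ih =>
    intro hk
    obtain ⟨g, hg, rfl⟩ := mem_pow_iff.1 (ih (by omega))
    have h1 : ∀ m, (f * g).coeff m ∈ JJ x := by
      apply h.qreg (c + k) _ (hf.mul hg)
      rw [map_mul]
      exact Ideal.pow_le_pow_right (by omega) ha
    have h2 := h.nzd hfc h1
    have := eval_mem_mul (x := x) _ hg h2
    rwa [← pow_succ'] at this

theorem mul_not_mem (h : Ctx x M) {c e : ℕ} {F G : R} (hF : F ∈ JJ x ^ c)
    (hF' : F ∉ M * JJ x ^ c) (hG : G ∈ JJ x ^ e)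
    (hG' : G ∉ M * JJ x ^ e) : F * G ∉ M * JJ x ^ (c + e) := by
  obtain ⟨f, hf, hfc, rfl⟩ := exists_of_not_mem hF hF'
  obtain ⟨g, hg, hgc, rfl⟩ := exists_of_not_mem hG hG'
  rw [← map_mul]
  apply h.not_mem_of_coeff (hf.mul hg)
  by_contra hcon
  push Not at hcon
  have hp := h.prime
  have key : ∀ p : MvPolynomial (Fin d) R, MvPolynomial.map (Ideal.Quotient.mk M) p = 0 ↔
      ∀ m, p.coeff m ∈ M := by
    intro p
    rw [MvPolynomial.ext_iff]
    simp only [MvPolynomial.coeff_map, MvPolynomial.coeff_zero]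
    exact forall_congr' fun m => Ideal.Quotient.eq_zero_iff_mem
  rw [← key, map_mul, mul_eq_zero, key, key] at hcon
  rcases hcon with h1 | h1
  · obtain ⟨m, hm⟩ := hfc; exact hm (h1 m)
  · obtain ⟨m, hm⟩ := hgc; exact hm (h1 m)

theorem pow_not_mem (h : Ctx x M) {c : ℕ} {F : R} (hF : F ∈ JJ x ^ c)
    (hF' : F ∉ M * JJ x ^ c) (k : ℕ) : F ^ k ∉ M * JJ x ^ (c * k) := by
  induction k with
  | zero =>
    simp only [pow_zero, mul_zero, Ideal.one_eq_top, Ideal.mul_top]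
    exact fun h1 => h.prime.ne_top ((Ideal.eq_top_iff_one _).2 h1)
  | succ k ih =>
    rw [pow_succ, mul_add, mul_one]
    exact h.mul_not_mem (by rw [pow_mul]; exact Ideal.pow_mem_pow hF k) ih hF hF'

theorem x_mem (i : Fin d) : x i ∈ JJ x := Ideal.subset_span ⟨i, rfl⟩

theorem x_not_mem (h : Ctx x M) (i : Fin d) : x i ∉ M * JJ x ^ 1 := by
  have := h.not_mem_of_coeff (f := MvPolynomial.X i) (MvPolynomial.isHomogeneous_X R i)
    ⟨Finsupp.single i 1, by
      rw [MvPolynomial.coeff_X, if_pos rfl]; exact fun h1 => h.prime.ne_top ((Ideal.eq_top_iff_one _).2 h1)⟩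
  simpa using this

end Ctx

/-- asymptotic filtration -/
def wcl (J : Ideal R) (r : ℝ) : Ideal R where
  carrier := {a | ∃ c : ℝ, ∀ M s : ℕ, (s : ℝ) ≤ r * M - c → a ^ M ∈ J ^ s}
  zero_mem' := by
    refine ⟨1, fun M s h => ?_⟩
    by_cases hM : M = 0
    · subst hM
      exfalso
      have : (0:ℝ) ≤ s := Nat.cast_nonneg s
      push_cast at h
      linarith
    · rw [zero_pow hM]; exact Ideal.zero_mem _
  add_mem' := by
    rintro a b ⟨c, hc⟩ ⟨c', hc'⟩
    refine ⟨c + c' + 2, fun M s h => ?_⟩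
    rw [(Commute.all a b).add_pow']
    refine Ideal.sum_mem _ fun ij hij => ?_
    rw [Finset.HasAntidiagonal.mem_antidiagonal] at hij
    apply nsmul_mem
    have h1 := hc ij.1 ⌊r * ij.1 - c⌋₊
    have h2 := hc' ij.2 ⌊r * ij.2 - c'⌋₊
    have f1 := Nat.lt_floor_add_one (r * ij.1 - c)
    have f2 := Nat.lt_floor_add_one (r * ij.2 - c')
    have hij' : (ij.1 : ℝ) + ij.2 = M := by exact_mod_cast hij
    have hsum : s ≤ ⌊r * ij.1 - c⌋₊ + ⌊r * ij.2 - c'⌋₊ := by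
      have : (s:ℝ) ≤ ((⌊r * ij.1 - c⌋₊ + ⌊r * ij.2 - c'⌋₊ : ℕ) : ℝ) := by
        push_cast
        rw [← hij'] at h
        linarith
      exact_mod_cast this
    refine Ideal.pow_le_pow_right hsum ?_
    rw [pow_add]
    have g : ∀ (a : R) (i : ℕ) (y : ℝ), ((⌊y⌋₊ : ℝ) ≤ y → a ^ i ∈ J ^ ⌊y⌋₊) → a ^ i ∈ J ^ ⌊y⌋₊ := by
      intro a i y hy
      rcases le_total 0 y with h0 | h0
      · exact hy (Nat.floor_le h0)
      · rw [Nat.floor_of_nonpos h0]; simp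
    exact Ideal.mul_mem_mul (g _ _ _ h1) (g _ _ _ h2)
  smul_mem' := by
    rintro r a ⟨c, hc⟩
    refine ⟨c, fun M s h => ?_⟩
    rw [smul_eq_mul, mul_pow]
    exact Ideal.mul_mem_left _ _ (hc M s h)

theorem mem_wcl {J : Ideal R} {r : ℝ} {a : R} : a ∈ wcl J r ↔
    ∃ c : ℝ, ∀ M s : ℕ, (s : ℝ) ≤ r * M - c → a ^ M ∈ J ^ s := Iff.rfl

theorem wcl_anti {J : Ideal R} {r r' : ℝ} (h : r ≤ r') : wcl J r' ≤ wcl J r := by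
  rintro a ⟨c, hc⟩
  refine ⟨c, fun M s hs => hc M s (hs.trans ?_)⟩
  have : r * M ≤ r' * M := mul_le_mul_of_nonneg_right h (Nat.cast_nonneg _)
  linarith

theorem mul_mem_wcl {J : Ideal R} {r r' : ℝ} {a b : R} (ha : a ∈ wcl J r) (hb : b ∈ wcl J r') :
    a * b ∈ wcl J (r + r') := by
  obtain ⟨c, hc⟩ := ha
  obtain ⟨c', hc'⟩ := hb
  refine ⟨c + c' + 2, fun M s h => ?_⟩
  have f1 := Nat.lt_floor_add_one (r * M - c)
  have f2 := Nat.lt_floor_add_one (r' * M - c')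
  have hsum : s ≤ ⌊r * M - c⌋₊ + ⌊r' * M - c'⌋₊ := by
    have : (s:ℝ) ≤ ((⌊r * M - c⌋₊ + ⌊r' * M - c'⌋₊ : ℕ) : ℝ) := by
      push_cast
      linarith
    exact_mod_cast this
  refine Ideal.pow_le_pow_right hsum ?_
  rw [pow_add, mul_pow]
  have g : ∀ (a : R) (i : ℕ) (y : ℝ), ((⌊y⌋₊ : ℝ) ≤ y → a ^ i ∈ J ^ ⌊y⌋₊) → a ^ i ∈ J ^ ⌊y⌋₊ := by
    intro a i y hy
    rcases le_total 0 y with h0 | h0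
    · exact hy (Nat.floor_le h0)
    · rw [Nat.floor_of_nonpos h0]; simp
  exact Ideal.mul_mem_mul (g _ _ _ (hc _ _)) (g _ _ _ (hc' _ _))

theorem pow_le_wcl {J : Ideal R} (n : ℕ) : J ^ n ≤ wcl J n := by
  intro a ha
  refine ⟨0, fun M s h => ?_⟩
  have : s ≤ n * M := by
    have : (s:ℝ) ≤ ((n * M : ℕ) : ℝ) := by push_cast; linarith
    exact_mod_cast this
  exact Ideal.pow_le_pow_right this (by rw [pow_mul]; exact Ideal.pow_mem_pow ha M)

theorem wcl_nonpos {J : Ideal R} {r : ℝ} (hr : r ≤ 0) : wcl J r = ⊤ := by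
  rw [Ideal.eq_top_iff_one]
  refine wcl_anti hr ⟨0, fun M s h => ?_⟩
  have : s = 0 := by
    have : (s:ℝ) ≤ 0 := by linarith
    exact_mod_cast le_antisymm this (Nat.cast_nonneg _)
  subst this; simp

theorem mem_wcl_of_pow {J : Ideal R} {r : ℝ} {a : R} {k : ℕ} (hk : 0 < k)
    (h : a ^ k ∈ wcl J (k * r)) : a ∈ wcl J r := by
  obtain ⟨c, hc⟩ := h
  refine ⟨|c| + k * |r|, fun M s h => ?_⟩
  have hM := Nat.div_add_mod M k
  set q := M / k
  set m := M % k
  have hm : m < k := Nat.mod_lt _ hk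
  rw [← hM, pow_add, pow_mul]
  refine Ideal.mul_mem_right _ _ (hc q s (h.trans ?_))
  rw [← hM]
  push_cast
  have h1 : r * m ≤ k * |r| := by
    calc r * m ≤ |r| * m := mul_le_mul_of_nonneg_right (le_abs_self r) (Nat.cast_nonneg _)
      _ ≤ |r| * k := mul_le_mul_of_nonneg_left (by exact_mod_cast hm.le) (abs_nonneg r)
      _ = _ := mul_comm _ _
  have h2 := le_abs_self c
  nlinarith

theorem pow_mem_wcl {J : Ideal R} {r : ℝ} {a : R} {k : ℕ}
    (h : a ∈ wcl J r) : a ^ k ∈ wcl J (k * r) := by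
  obtain ⟨c, hc⟩ := h
  refine ⟨c, fun M s h => ?_⟩
  rw [← pow_mul]
  refine hc _ _ (h.trans ?_)
  push_cast
  linarith

namespace Ctx

theorem cancel_wcl (h : Ctx x M) {c : ℕ} {r : ℝ} {F a : R} (hF : F ∈ JJ x ^ c)
    (hF' : F ∉ M * JJ x ^ c) (ha : F * a ∈ wcl (JJ x) (r + c)) : a ∈ wcl (JJ x) r := by
  obtain ⟨k, hk⟩ := ha
  refine ⟨k, fun m s hs => ?_⟩
  apply h.cancel (c := c * m) (F := F ^ m) (by rw [pow_mul]; exact Ideal.pow_mem_pow hF m)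
    (h.pow_not_mem hF hF' m)
  rw [← mul_pow]
  apply hk
  push_cast
  linarith

end Ctx

/-- monomial in x -/
noncomputable abbrev xm (x : Fin d → R) (α : Fin d →₀ ℕ) : R := MvPolynomial.eval x (MvPolynomial.monomial α 1)

theorem xm_mem (α : Fin d →₀ ℕ) : xm x α ∈ JJ x ^ α.degree := by
  rw [mem_pow_iff]
  exact ⟨_, MvPolynomial.isHomogeneous_monomial _ rfl, rfl⟩

theorem xm_add (α β : Fin d →₀ ℕ) : xm x (α + β) = xm x α * xm x β := by
  rw [xm, xm, xm, ← map_mul, MvPolynomial.monomial_mul, one_mul]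

theorem xm_single (i : Fin d) (k : ℕ) : xm x (Finsupp.single i k) = x i ^ k := by
  rw [xm, MvPolynomial.eval_monomial, one_mul, Finsupp.prod_single_index (by exact pow_zero _)]

theorem eval_eq_sum_xm (f : MvPolynomial (Fin d) R) :
    f.eval x = ∑ m ∈ f.support, f.coeff m * xm x m := by
  conv_lhs => rw [f.as_sum, map_sum]
  refine Finset.sum_congr rfl fun m _ => ?_
  rw [xm, ← mul_one (f.coeff m), ← MvPolynomial.C_mul_monomial, map_mul]
  simp

/-- monomial-type ideals -/
def monI (x : Fin d → R) (S : Set (Fin d →₀ ℕ)) : Ideal R := Ideal.span (xm x '' S)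

theorem monI_mono {S S' : Set (Fin d →₀ ℕ)} (h : S ⊆ S') : monI x S ≤ monI x S' :=
  Ideal.span_mono (Set.image_mono h)

theorem mem_monI {S : Set (Fin d →₀ ℕ)} {z : R} (hz : z ∈ monI x S) :
    ∃ f : MvPolynomial (Fin d) R, (∀ m, f.coeff m ≠ 0 → m ∈ S) ∧ f.eval x = z := by
  classical
  refine Submodule.span_induction ?_ ?_ ?_ ?_ hz
  · rintro _ ⟨α, hα, rfl⟩
    refine ⟨MvPolynomial.monomial α 1, fun m hm => ?_, rfl⟩
    rw [MvPolynomial.coeff_monomial] at hm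
    split_ifs at hm with h1
    · rwa [← h1]
    · exact absurd rfl hm
  · exact ⟨0, by simp, by simp⟩
  · rintro _ _ _ _ ⟨f, hf, rfl⟩ ⟨g, hg, rfl⟩
    refine ⟨f + g, fun m hm => ?_, by simp⟩
    rw [MvPolynomial.coeff_add] at hm
    by_contra hcon
    apply hm
    rw [not_imp_comm.1 (hf m) hcon, not_imp_comm.1 (hg m) hcon, add_zero]
  · rintro a _ _ ⟨f, hf, rfl⟩
    refine ⟨MvPolynomial.C a * f, fun m hm => hf m fun h0 => hm ?_, by simp⟩
    rw [MvPolynomial.coeff_C_mul, h0, mul_zero]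

theorem eval_mem_monI {S : Set (Fin d →₀ ℕ)} {f : MvPolynomial (Fin d) R}
    (h : ∀ m, f.coeff m ≠ 0 → m ∈ S) : f.eval x ∈ monI x S := by
  rw [eval_eq_sum_xm]
  exact Ideal.sum_mem _ fun m hm => Ideal.mul_mem_left _ _
    (Ideal.subset_span ⟨m, h m (MvPolynomial.mem_support_iff.1 hm), rfl⟩)

theorem monI_deg_le (S : Set (Fin d →₀ ℕ)) (s : ℕ) :
    monI x {α | α ∈ S ∧ s ≤ α.degree} ≤ JJ x ^ s := by
  rw [monI, Ideal.span_le]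
  rintro _ ⟨α, ⟨_, hα⟩, rfl⟩
  exact Ideal.pow_le_pow_right hα (xm_mem α)

theorem monI_split {S : Set (Fin d →₀ ℕ)} {s : ℕ} {z : R}
    (hz : z ∈ monI x {α | α ∈ S ∧ s ≤ α.degree}) :
    ∃ g : MvPolynomial (Fin d) R, g.IsHomogeneous s ∧ (∀ m, g.coeff m ≠ 0 → m ∈ S) ∧
      z - g.eval x ∈ monI x {α | α ∈ S ∧ s + 1 ≤ α.degree} := by
  classical
  obtain ⟨f, hf, rfl⟩ := mem_monI hz
  refine ⟨MvPolynomial.homogeneousComponent s f, MvPolynomial.homogeneousComponent_isHomogeneous s f,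
    ?_, ?_⟩
  · intro m hm
    rw [MvPolynomial.coeff_homogeneousComponent] at hm
    split_ifs at hm with h1
    · exact (hf m hm).1
    · exact absurd rfl hm
  · rw [← map_sub]
    apply eval_mem_monI
    intro m hm
    rw [MvPolynomial.coeff_sub, MvPolynomial.coeff_homogeneousComponent] at hm
    split_ifs at hm with h1
    · exact absurd (sub_self _) hm
    · rw [sub_zero] at hm
      have := hf m hm
      exact ⟨this.1, lt_of_le_of_ne this.2 (Ne.symm h1)⟩

namespace Ctx

theorem monI_inf (h : Ctx x M) {S : Set (Fin d →₀ ℕ)} (hS : IsUpperSet S) {s : ℕ} {z : R}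
    (hz : z ∈ monI x S) (hzs : z ∈ JJ x ^ s) : z ∈ monI x {α | α ∈ S ∧ s ≤ α.degree} := by
  induction s with
  | zero => simpa using hz
  | succ s ih =>
    obtain ⟨g, hg, hgS, hzg⟩ := monI_split (ih (Ideal.pow_le_pow_right (by omega) hzs))
    have h1 : g.eval x ∈ JJ x ^ (s + 1) := by
      have := Ideal.sub_mem _ hzs (monI_deg_le _ _ hzg)
      simpa using this
    have h2 := h.qreg s g hg h1
    have h3 : g.eval x ∈ monI x {α | α ∈ S ∧ s + 1 ≤ α.degree} := by
      rw [eval_eq_sum_xm]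
      refine Ideal.sum_mem _ fun m hm => ?_
      rw [MvPolynomial.mem_support_iff] at hm
      have hdeg : m.degree = s := by
        have := hg hm
        rw [← this, Finsupp.degree_eq_weight_one]; rfl
      refine Submodule.span_induction (p := fun y _ => y * xm x m ∈ _) ?_ ?_ ?_ ?_ (h2 m)
      · rintro _ ⟨i, rfl⟩
        refine Ideal.subset_span ⟨Finsupp.single i 1 + m, ⟨hS le_add_self (hgS m hm), ?_⟩, ?_⟩
        · rw [map_add, Finsupp.degree_single, hdeg]; omega
        · rw [xm_add, xm_single, pow_one]
      · simp
      · intro a b _ _ ha hb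
        rw [add_mul]; exact Ideal.add_mem _ ha hb
      · intro a b _ hb
        rw [smul_eq_mul, mul_assoc]; exact Ideal.mul_mem_left _ _ hb
    simpa using Ideal.add_mem _ hzg h3

/-- support of leading forms of elements of monomial ideals -/
theorem lead_mem (h : Ctx x M) {S : Set (Fin d →₀ ℕ)} (hS : IsUpperSet S) {r : ℕ}
    {g : MvPolynomial (Fin d) R} (hg : g.IsHomogeneous r) (hz : g.eval x ∈ monI x S)
    {β : Fin d →₀ ℕ} (hβ : g.coeff β ∉ JJ x) : β ∈ S := by
  have hz' := h.monI_inf hS hz (mem_pow_iff.2 ⟨g, hg, rfl⟩)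
  obtain ⟨g', hg', hgS, hgg⟩ := monI_split hz'
  rw [← map_sub] at hgg
  have := h.qreg r _ (hg.sub hg') (monI_deg_le _ _ hgg) β
  apply hgS β
  intro h0
  rw [MvPolynomial.coeff_sub, h0, sub_zero] at this
  exact hβ this

/-- every element not in `J^n` has a nontrivial leading form. -/
theorem exists_lead {n : ℕ} {a : R} (ha : a ∉ JJ x ^ n) :
    ∃ r < n, ∃ g : MvPolynomial (Fin d) R, g.IsHomogeneous r ∧ g.eval x = a ∧
      ∃ β, g.coeff β ∉ JJ x := by
  classical
  have hex : ∃ k, a ∉ JJ x ^ k := ⟨n, ha⟩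
  have h0 : Nat.find hex ≠ 0 := by
    intro h0
    have := Nat.find_spec hex
    rw [h0] at this
    simp at this
  obtain ⟨r, hr⟩ := Nat.exists_eq_succ_of_ne_zero h0
  have h1 : a ∈ JJ x ^ r := by
    by_contra h1
    have := Nat.find_min' hex h1
    omega
  have h2 : a ∉ JJ x ^ (r + 1) := by
    have := Nat.find_spec hex
    rwa [hr] at this
  obtain ⟨g, hg, rfl⟩ := mem_pow_iff.1 h1
  refine ⟨r, ?_, g, hg, rfl, ?_⟩
  · have := Nat.find_min' hex ha
    omega
  · by_contra hcon
    push Not at hcon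
    apply h2
    have := eval_mem_mul (x := x) _ hg hcon
    rwa [← pow_succ'] at this

end Ctx
end
end CMproof

end

section

open IsLocalRing Polynomial Finset

namespace CMproof
section
variable {R : Type*} [CommRing R]

/-- auxiliary filtration -/
def auxN (J : Ideal R) (n : ℕ) (a : R) (s : ℕ) : Ideal R :=
  ⨆ i : Fin (s + 1), J ^ (n * (s - i)) * Ideal.span {a ^ (i : ℕ)}

def auxF (J : Ideal R) (n : ℕ) (a : R) : (J ^ n).Filtration R where
  N := auxN J n a
  mono := by
    intro s
    refine iSup_le fun i => ?_
    by_cases hi : (i : ℕ) = s + 1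
    · refine le_trans ?_ (le_iSup _ (Fin.last s))
      rw [hi]
      simp only [Fin.val_last, tsub_self, mul_zero, pow_zero, one_mul, Ideal.one_eq_top, Ideal.top_mul]
      rw [Ideal.span_singleton_le_span_singleton]
      exact pow_dvd_pow _ (by omega)
    · refine le_trans ?_ (le_iSup _ (⟨i, by omega⟩ : Fin (s + 1)))
      exact Ideal.mul_mono_left (Ideal.pow_le_pow_right (Nat.mul_le_mul_left _ (by
        simp only []; omega)))
  smul_le := by
    intro s
    rw [smul_eq_mul, auxN, Ideal.mul_iSup]
    refine iSup_le fun i => ?_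
    refine le_trans ?_ (le_iSup _ (⟨i, by omega⟩ : Fin (s + 1 + 1)))
    rw [← mul_assoc, ← pow_add]
    have := i.2
    rw [show n + n * (s - (i:ℕ)) = n * (s + 1 - i) by
      rw [show s + 1 - (i:ℕ) = (s - i) + 1 by omega]; ring]

def powF (J : Ideal R) (n c : ℕ) : (J ^ n).Filtration R where
  N := fun s => J ^ (n * s - c)
  mono := fun s => Ideal.pow_le_pow_right (by rw [mul_add]; omega)
  smul_le := fun s => by
    rw [smul_eq_mul, ← pow_add]
    exact Ideal.pow_le_pow_right (by rw [mul_add]; omega)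

theorem int_of_wcl [IsNoetherianRing R] {J : Ideal R} {n : ℕ} {a : R} (ha : a ∈ wcl J n) :
    IsIntegralOverIdeal (J ^ n) a := by
  obtain ⟨c, hc⟩ := ha
  set c' := ⌈c⌉₊
  have hpow : ∀ i : ℕ, a ^ i ∈ J ^ (n * i - c') := by
    intro i
    by_cases h : n * i ≤ c'
    · rw [Nat.sub_eq_zero_of_le h]; simp
    apply hc
    rw [Nat.cast_sub (by omega)]
    push_cast
    have := Nat.le_ceil c
    linarith
  have hle : auxF J n a ≤ powF J n c' := by
    intro s
    refine iSup_le fun i => ?_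
    have := i.2
    refine (Ideal.mul_mono_right ((Ideal.span_singleton_le_iff_mem _).2 (hpow i))).trans ?_
    rw [← pow_add]
    apply Ideal.pow_le_pow_right
    have : n * s = n * (s - i) + n * i := by rw [← mul_add]; congr 1; omega
    omega
  have hst : (powF J n c').Stable := by
    by_cases hn : n = 0
    · refine ⟨0, fun s _ => ?_⟩
      subst hn
      simp [powF]
    · refine ⟨c', fun s hs => ?_⟩
      change J ^ n * J ^ (n * s - c') = J ^ (n * (s + 1) - c')
      rw [← pow_add]
      congr 1
      have : c' ≤ n * s := hs.trans (Nat.le_mul_of_pos_left _ (Nat.pos_of_ne_zero hn))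
      rw [mul_add]; omega
  obtain ⟨s, hs⟩ := hst.of_le hle
  have hs := hs s le_rfl
  change J ^ n * auxN J n a s = auxN J n a (s + 1) at hs
  have hmem : a ^ (s + 1) ∈ auxN J n a (s + 1) := by
    refine (le_iSup (fun i : Fin (s + 1 + 1) => J ^ (n * (s + 1 - i)) * Ideal.span {a ^ (i : ℕ)})
      (Fin.last (s+1))) ?_
    simp [Ideal.mem_span_singleton_self]
  rw [← hs, auxN, Ideal.mul_iSup, Submodule.mem_iSup_iff_exists_finsupp] at hmem
  obtain ⟨f, hf, hsum⟩ := hmem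
  have : ∀ i : Fin (s+1), ∃ b ∈ (J ^ n) ^ (s + 1 - i), f i = b * a ^ (i : ℕ) := by
    intro i
    have h1 := hf i
    rw [← mul_assoc, Ideal.mem_mul_span_singleton] at h1
    obtain ⟨b, hb, hb'⟩ := h1
    refine ⟨b, ?_, hb'.symm⟩
    rw [← pow_mul]
    rw [← pow_add] at hb
    have := i.2
    rwa [show n + n * (s - (i:ℕ)) = n * (s + 1 - i) by
      rw [show s + 1 - (i:ℕ) = (s - i) + 1 by omega]; ring] at hb
  choose b hb hfb using this
  refine ⟨s + 1, by omega, fun j => if h : s + 1 - j < s + 1 then - b ⟨s + 1 - j, h⟩ else 0, ?_, ?_⟩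
  · intro j hj
    rw [Finset.mem_Icc] at hj
    have h : s + 1 - j < s + 1 := by omega
    simp only [dif_pos h]
    have := hb ⟨s + 1 - j, h⟩
    simp only [show s + 1 - (s + 1 - j) = j by omega] at this
    exact neg_mem this
  · have h1 : ∑ i : Fin (s+1), b i * a ^ (i:ℕ) = a ^ (s + 1) := by
      rw [← hsum, Finsupp.sum_fintype _ _ (fun _ => rfl)]
      exact Finset.sum_congr rfl fun i _ => (hfb i).symm
    have h2 : ∑ i ∈ Finset.Icc 1 (s + 1), (if h : s + 1 - i < s + 1 then - b ⟨s + 1 - i, h⟩ else 0) *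
        a ^ (s + 1 - i) = - ∑ i : Fin (s+1), b i * a ^ (i:ℕ) := by
      rw [← Finset.sum_neg_distrib]
      refine Finset.sum_bij' (fun j hj => ⟨s + 1 - j, by rw [Finset.mem_Icc] at hj; omega⟩)
        (fun i _ => s + 1 - i) ?_ ?_ ?_ ?_ ?_
      · intro j hj; simp
      · intro i _; rw [Finset.mem_Icc]; omega
      · intro j hj; rw [Finset.mem_Icc] at hj; simp; omega
      · intro i _; ext; have := i.2; simp; omega
      · intro j hj
        rw [Finset.mem_Icc] at hj
        have h : s + 1 - j < s + 1 := by omega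
        rw [dif_pos h]
        ring
    rw [h2, h1]
    ring

theorem wcl_of_int {I J : Ideal R} {N : ℕ} (hN : ∀ n ≥ N, I ^ (n + 1) = J * I ^ n) {n : ℕ} {a : R}
    (ha : IsIntegralOverIdeal (I ^ n) a) : a ∈ wcl J n := by
  have hI : ∀ s, I ^ (N + s) ≤ J ^ s := by
    intro s
    induction s with
    | zero => simp
    | succ s ih =>
      rw [← add_assoc, hN _ (by omega), pow_succ']
      exact Ideal.mul_mono_right ih
  obtain ⟨k, hk, b, hb, hab⟩ := ha
  have key : ∀ m, a ^ m ∈ I ^ (n * m - n * k) := by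
    intro m
    induction m using Nat.strong_induction_on with
    | _ m ih =>
      by_cases hm : m < k
      · rw [Nat.sub_eq_zero_of_le (Nat.mul_le_mul_left _ hm.le)]; simp
      · have h1 : a ^ m = - ∑ i ∈ Finset.Icc 1 k, b i * a ^ (m - i) := by
          have : a ^ m = a ^ (m - k) * a ^ k := by rw [← pow_add]; congr 1; omega
          rw [this, eq_neg_of_add_eq_zero_left hab, mul_neg, Finset.mul_sum]
          congr 1
          refine Finset.sum_congr rfl fun i hi => ?_
          rw [Finset.mem_Icc] at hi
          rw [show m - i = (m - k) + (k - i) by omega, pow_add]; ring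
        rw [h1]
        refine neg_mem (Ideal.sum_mem _ fun i hi => ?_)
        have hb' := hb i hi
        rw [Finset.mem_Icc] at hi
        rw [← pow_mul] at hb'
        have h2 := Ideal.mul_mem_mul hb' (ih (m - i) (by omega))
        rw [← pow_add] at h2
        refine Ideal.pow_le_pow_right ?_ h2
        have : n * m = n * i + n * (m - i) := by rw [← mul_add]; congr 1; omega
        omega
  refine ⟨n * k + N, fun m s hs => ?_⟩
  have hs' : s + n * k + N ≤ n * m := by
    have : ((s + n * k + N : ℕ) : ℝ) ≤ ((n * m : ℕ) : ℝ) := by push_cast; linarith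
    exact_mod_cast this
  exact hI s (Ideal.pow_le_pow_right (by omega) (key m))

theorem int_mono {I J : Ideal R} (h : J ≤ I) {a : R} (ha : IsIntegralOverIdeal J a) :
    IsIntegralOverIdeal I a := by
  obtain ⟨k, hk, b, hb, hab⟩ := ha
  exact ⟨k, hk, b, fun i hi => Ideal.pow_right_mono h i (hb i hi), hab⟩

theorem intCl_eq [IsNoetherianRing R] {I J : Ideal R} (hJI : J ≤ I) {N : ℕ}
    (hN : ∀ n ≥ N, I ^ (n + 1) = J * I ^ n) (n : ℕ) : intCl (I ^ n) = wcl J n := by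
  apply le_antisymm
  · rw [intCl, Ideal.span_le]
    intro a ha
    exact wcl_of_int hN ha
  · intro a ha
    exact Ideal.subset_span (int_mono (Ideal.pow_right_mono hJI n) (int_of_wcl ha))

end
end CMproof

end

section

open IsLocalRing Polynomial Finset

namespace CMproof
section
variable {R : Type*} [CommRing R] {d : ℕ} {x : Fin d → R} {M : Ideal R}

theorem floor_mem {J : Ideal R} {a : R} {i : ℕ} {y : ℝ}
    (h : ∀ s : ℕ, (s : ℝ) ≤ y → a ^ i ∈ J ^ s) : a ^ i ∈ J ^ ⌊y⌋₊ := by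
  rcases le_total 0 y with h0 | h0
  · exact h _ (Nat.floor_le h0)
  · rw [Nat.floor_of_nonpos h0]; simp

theorem Ctx.B_step (h : Ctx x M) {p q : Fin d} (hpq : p ≠ q) {k : ℕ} (hk : 0 < k) {a b : R} {w : ℝ}
    (hw0 : 0 ≤ w) (hwk : w ≤ k) (hb : b ∈ wcl (JJ x) w)
    (hC : a * x q ^ k - b * x p ^ k ∈ wcl (JJ x) (2 * k)) :
    a ∈ wcl (JJ x) ((k : ℝ) ^ 2 / (2 * k - w)) := by
  obtain ⟨c1, hc1⟩ := hb
  obtain ⟨c0, hc0⟩ := hC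
  set C := a * x q ^ k - b * x p ^ k with hCdef
  have hk' : (0:ℝ) < k := by exact_mod_cast hk
  refine ⟨|c0 + c1 + 2|, fun m n hn => ?_⟩
  by_contra hcon
  obtain ⟨r, hrn, g, hg, hga, β, hβ⟩ := Ctx.exists_lead hcon
  let S : Set (Fin d →₀ ℕ) := {α | ∃ i j : ℕ, i + j = m ∧ k * i ≤ α p ∧
    k * i + (⌊w * i - c1⌋₊ + ⌊2 * k * j - c0⌋₊) ≤ α.degree}
  have hS : IsUpperSet S := by
    rintro α γ hle ⟨i, j, h1, h2, h3⟩
    exact ⟨i, j, h1, h2.trans (hle p), h3.trans (Finsupp.degree_mono hle)⟩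
  have hmem : (g * MvPolynomial.monomial (Finsupp.single q (k * m)) 1).eval x ∈ monI x S := by
    have e1 : (g * MvPolynomial.monomial (Finsupp.single q (k * m)) 1).eval x =
        (b * x p ^ k + C) ^ m := by
      rw [map_mul, hga]
      change a ^ m * xm x _ = _
      rw [xm_single, hCdef, pow_mul]
      ring
    rw [e1, (Commute.all _ _).add_pow']
    refine Ideal.sum_mem _ fun ij hij => ?_
    rw [Finset.HasAntidiagonal.mem_antidiagonal] at hij
    apply nsmul_mem
    have h1 : b ^ ij.1 * C ^ ij.2 ∈ JJ x ^ (⌊w * ij.1 - c1⌋₊ + ⌊2 * k * ij.2 - c0⌋₊) := by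
      rw [pow_add]
      exact Ideal.mul_mem_mul (floor_mem (hc1 ij.1)) (floor_mem (hc0 ij.2))
    obtain ⟨f, hf, hfe⟩ := mem_pow_iff.1 h1
    have e2 : (b * x p ^ k) ^ ij.1 * C ^ ij.2 = x p ^ (k * ij.1) * f.eval x := by
      rw [hfe, pow_mul]; ring
    rw [e2, ← xm_single, ← map_mul]
    apply eval_mem_monI
    intro α hα
    rw [MvPolynomial.coeff_monomial_mul'] at hα
    split_ifs at hα with hle
    · rw [one_mul] at hα
      have hdeg : (α - Finsupp.single p (k * ij.1)).degree =
          (⌊w * ij.1 - c1⌋₊ + ⌊2 * k * ij.2 - c0⌋₊) := by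
        have := hf hα
        rw [← this, Finsupp.degree_eq_weight_one]; rfl
      refine ⟨ij.1, ij.2, hij, ?_, ?_⟩
      · have := hle p
        simpa using this
      · rw [← hdeg]
        have : α = Finsupp.single p (k * ij.1) + (α - Finsupp.single p (k * ij.1)) :=
          (add_tsub_cancel_of_le hle).symm
        conv_rhs => rw [this, map_add, Finsupp.degree_single]
    · exact absurd rfl hα
  have hhom : (g * MvPolynomial.monomial (Finsupp.single q (k * m)) (1:R)).IsHomogeneous (r + k * m) :=
    hg.mul (MvPolynomial.isHomogeneous_monomial _ (Finsupp.degree_single _ _))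
  have hβ' : (g * MvPolynomial.monomial (Finsupp.single q (k * m)) (1:R)).coeff
      (β + Finsupp.single q (k * m)) ∉ JJ x := by
    rwa [MvPolynomial.coeff_mul_monomial, mul_one]
  obtain ⟨i, j, hij, h1, h2⟩ := h.lead_mem hS hhom hmem hβ'
  rw [Finsupp.add_apply, Finsupp.single_eq_of_ne hpq, add_zero] at h1
  have hβr : β.degree = r := by
    have h0 : g.coeff β ≠ 0 := fun h0 => hβ (h0 ▸ Ideal.zero_mem _)
    have := hg h0
    rw [← this, Finsupp.degree_eq_weight_one]; rfl
  rw [map_add, hβr, Finsupp.degree_single] at h2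
  have h3 : k * i ≤ r := h1.trans (hβr ▸ Finsupp.le_degree p β)
  have f1 := Nat.lt_floor_add_one (w * i - c1)
  have f2 := Nat.lt_floor_add_one (2 * k * j - c0)
  have h2' : (k:ℝ) * i + (⌊w * i - c1⌋₊ + ⌊2 * k * j - c0⌋₊) ≤ r + k * m := by exact_mod_cast h2
  have h3' : (k:ℝ) * i ≤ r := by exact_mod_cast h3
  have hij' : (i : ℝ) + j = m := by exact_mod_cast hij
  have hrn' : (r:ℝ) + 1 ≤ n := by exact_mod_cast hrn
  have hD : 0 < 2 * k - w := by linarith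
  have habs := le_abs_self (c0 + c1 + 2)
  have habs0 := abs_nonneg (c0 + c1 + 2)
  set A := |c0 + c1 + 2|
  -- r ≥ k m - (k-w) i - A
  have h4 : (k:ℝ) * m - (k - w) * i - A ≤ r := by
    rw [← hij'] at h2' ⊢
    nlinarith
  have h5 : (k:ℝ)^2 * m - k * A ≤ (2 * k - w) * r := by
    have e1 := mul_le_mul_of_nonneg_left h4 hk'.le
    have e2 := mul_le_mul_of_nonneg_left h3' (sub_nonneg.2 hwk)
    nlinarith
  have h6 : (k:ℝ)^2 / (2 * k - w) * m - A ≤ r := by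
    rw [div_mul_eq_mul_div, sub_le_iff_le_add, div_le_iff₀ hD]
    nlinarith
  linarith

/-- with the Rees bound, `wcl` is continuous at natural numbers. -/
theorem wcl_of_lt {J : Ideal R} {c : ℕ} (hR : ∀ n : ℕ, wcl J n ≤ J ^ (n - c)) {k : ℕ} {a : R}
    (ha : ∀ r : ℝ, r < k → a ∈ wcl J r) : a ∈ wcl J k := by
  refine ⟨c + 1, fun m s hs => ?_⟩
  by_cases hm : m = 0
  · subst hm
    exfalso
    have : (0:ℝ) ≤ s := Nat.cast_nonneg s
    have : (0:ℝ) ≤ c := Nat.cast_nonneg c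
    push_cast at hs
    linarith
  have hs' : s + (c + 1) ≤ k * m := by
    have : ((s + (c + 1) : ℕ) : ℝ) ≤ ((k * m : ℕ) : ℝ) := by push_cast; linarith
    exact_mod_cast this
  have hm' : (0:ℝ) < m := by exact_mod_cast Nat.pos_of_ne_zero hm
  have h1 := pow_mem_wcl (k := m) (ha (k - 1 / m) (by
    have : 0 < 1 / (m:ℝ) := by positivity
    linarith))
  rw [mul_sub, mul_one_div_cancel hm'.ne'] at h1
  have h2 : a ^ m ∈ wcl J ((k * m - 1 : ℕ) : ℝ) := by
    rw [Nat.cast_sub (by omega)]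
    push_cast
    rwa [mul_comm (k:ℝ)]
  exact Ideal.pow_le_pow_right (by omega) (hR _ h2)

theorem Ctx.B (h : Ctx x M) {c : ℕ} (hR : ∀ n : ℕ, wcl (JJ x) n ≤ JJ x ^ (n - c))
    {p q : Fin d} (hpq : p ≠ q) {k : ℕ} {a b : R}
    (hC : a * x q ^ k - b * x p ^ k ∈ wcl (JJ x) (2 * k)) :
    a ∈ wcl (JJ x) k ∧ b ∈ wcl (JJ x) k := by
  rcases Nat.eq_zero_or_pos k with rfl | hk
  · constructor <;> simp [wcl_nonpos]
  have hk' : (0:ℝ) < k := by exact_mod_cast hk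
  have hC' : b * x p ^ k - a * x q ^ k ∈ wcl (JJ x) (2 * k) := by
    rw [← neg_sub]; exact neg_mem hC
  have key : ∀ n : ℕ, a ∈ wcl (JJ x) (k * n / (n + 1)) ∧ b ∈ wcl (JJ x) (k * n / (n + 1)) := by
    intro n
    induction n with
    | zero => constructor <;> simp [wcl_nonpos]
    | succ n ih =>
      have hn : (0:ℝ) < n + 1 := by positivity
      have e : (k:ℝ) ^ 2 / (2 * k - k * n / (n + 1)) = k * ((n + 1 : ℕ) : ℝ) / (((n+1:ℕ):ℝ) + 1) := by
        push_cast
        have : 2 * (k:ℝ) - k * n / (n + 1) = k * (n + 2) / (n + 1) := by field_simp; ring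
        rw [this]
        field_simp
        ring
      rw [← e]
      have hw0 : (0:ℝ) ≤ k * n / (n + 1) := by positivity
      have hw1 : (k * n / (n + 1) : ℝ) ≤ k := by
        rw [div_le_iff₀ hn]; nlinarith
      exact ⟨h.B_step hpq hk hw0 hw1 ih.2 hC, h.B_step hpq.symm hk hw0 hw1 ih.1 hC'⟩
  have fin : ∀ r : ℝ, r < k → ∃ n : ℕ, r ≤ k * n / (n + 1) := by
    intro r hr
    obtain ⟨n, hn⟩ := exists_nat_gt (k / (k - r))
    refine ⟨n, ?_⟩
    have hkr : 0 < k - r := by linarith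
    rw [div_lt_iff₀ hkr] at hn
    rw [le_div_iff₀ (by positivity)]
    nlinarith
  constructor
  · refine wcl_of_lt hR fun r hr => ?_
    obtain ⟨n, hn⟩ := fin r hr
    exact wcl_anti hn (key n).1
  · refine wcl_of_lt hR fun r hr => ?_
    obtain ⟨n, hn⟩ := fin r hr
    exact wcl_anti hn (key n).2

end
end CMproof

end

section

open IsLocalRing Polynomial Finset
set_option maxHeartbeats 2000000

namespace CMproof
section
variable {R : Type*} [CommRing R] {d : ℕ} {x : Fin d → R} {M : Ideal R}

/-- colength -/
noncomputable abbrev lam (I : Ideal R) : ℕ∞ := Module.length R (R ⧸ I)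
/-- relative length -/
noncomputable abbrev rel (A B : Ideal R) : ℕ∞ := Module.length R (idealQuot A B)

theorem length_quot {N : Type*} [AddCommGroup N] [Module R N] {A B : Submodule R N} (h : B ≤ A) :
    Module.length R (N ⧸ B) = Module.length R (A ⧸ B.comap A.subtype) + Module.length R (N ⧸ A) := by
  refine Module.length_eq_add_of_exact
    (Submodule.mapQ (B.comap A.subtype) B A.subtype le_rfl)
    (Submodule.mapQ B A LinearMap.id h) ?_ ?_ ?_
  · rw [← LinearMap.ker_eq_bot, Submodule.ker_mapQ]
    simp
  · intro y
    obtain ⟨y, rfl⟩ := Submodule.mkQ_surjective _ y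
    exact ⟨B.mkQ y, by simp⟩
  · rw [LinearMap.exact_iff, Submodule.ker_mapQ, Submodule.range_mapQ]
    simp

theorem lam_add {A B : Ideal R} (h : B ≤ A) : lam B = rel A B + lam A := length_quot h

theorem lam_anti {A B : Ideal R} (h : B ≤ A) : lam A ≤ lam B := by
  rw [lam_add h]; exact le_add_self

theorem eq_of_lam {A B : Ideal R} (h : B ≤ A) (hf : lam B ≠ ⊤) (hl : lam B ≤ lam A) : A = B := by
  have h1 := lam_add h
  have h2 : lam A ≠ ⊤ := fun h2 => hf (by rw [h1, h2, add_top])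
  have h3 : rel A B = 0 := by
    rw [h1] at hl
    by_contra hne
    have : lam A < rel A B + lam A := ENat.lt_add_left h2 (pos_iff_ne_zero.2 hne)
    exact absurd hl (not_le.2 this)
  rw [rel, Module.length_eq_zero_iff, Submodule.Quotient.subsingleton_iff] at h3
  apply le_antisymm _ h
  intro a ha
  have : (⟨a, ha⟩ : A) ∈ Submodule.comap A.subtype B := h3 ▸ trivial
  exact this

theorem lam_mul_le (K : Ideal R) (u v : R) :
    lam (Ideal.span {u * v} ⊔ K) ≤ lam (Ideal.span {v} ⊔ K) + lam (Ideal.span {u} ⊔ K) := by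
  have h1 : Ideal.span {u * v} ⊔ K ≤ Ideal.span {u} ⊔ K :=
    sup_le_sup_right ((Ideal.span_singleton_le_span_singleton).2 (dvd_mul_right _ _)) _
  rw [lam_add h1]
  refine add_le_add_left ?_ _
  -- surjection R/(v,K) → (u,K)/(uv,K)
  let φ : R →ₗ[R] idealQuot (Ideal.span {u} ⊔ K) (Ideal.span {u * v} ⊔ K) :=
    (Submodule.mkQ _).comp (LinearMap.codRestrict _ (LinearMap.mulLeft R u) (fun r =>
      Ideal.mem_sup_left (Ideal.mul_mem_right _ _ (Ideal.mem_span_singleton_self u))))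
  have hφ : Ideal.span {v} ⊔ K ≤ LinearMap.ker φ := by
    refine sup_le ?_ ?_
    · rw [Ideal.span_singleton_le_iff_mem, LinearMap.mem_ker]
      refine (Submodule.Quotient.mk_eq_zero _).2 ?_
      exact Ideal.mem_sup_left (Ideal.mem_span_singleton_self _)
    · intro r hr
      refine (Submodule.Quotient.mk_eq_zero _).2 ?_
      exact Ideal.mem_sup_right (K.mul_mem_left _ hr)
  refine Module.length_le_of_surjective (Submodule.liftQ _ φ hφ) ?_
  intro y
  obtain ⟨⟨y, hy⟩, rfl⟩ := Submodule.mkQ_surjective _ y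
  obtain ⟨a, ha, b, hb, hab⟩ := Submodule.mem_sup.1 hy
  obtain ⟨c, rfl⟩ := Ideal.mem_span_singleton'.1 ha
  refine ⟨Submodule.Quotient.mk c, ?_⟩
  rw [Submodule.liftQ_apply]
  refine (Submodule.Quotient.eq _).2 ?_
  refine Ideal.mem_sup_right ?_
  have : u * c - y = - b := by rw [← hab]; ring
  change u * c - y ∈ K
  rw [this]; exact K.neg_mem hb

theorem lam_pow_le (K : Ideal R) (u : R) (k : ℕ) :
    lam (Ideal.span {u ^ k} ⊔ K) ≤ k * lam (Ideal.span {u} ⊔ K) := by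
  induction k with
  | zero =>
    have : Ideal.span {u ^ 0} ⊔ K = ⊤ := by simp
    rw [this]
    simp [lam]
  | succ k ih =>
    rw [pow_succ]
    refine (lam_mul_le K _ _).trans ?_
    push_cast
    rw [add_mul, one_mul, add_comm]
    gcongr

/-- number of monomials -/
theorem card_D (n : ℕ) : #((univ : Finset (Fin d)).finsuppAntidiag n) = (d + n - 1).choose n := by
  rw [Finset.card_finsuppAntidiag_nat_eq_choose]; simp

theorem mem_D {n : ℕ} {α : Fin d →₀ ℕ} :
    α ∈ (univ : Finset (Fin d)).finsuppAntidiag n ↔ α.degree = n := by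
  simp [Finset.mem_finsuppAntidiag, Finsupp.degree_eq_sum]

/-- the polynomial with given coefficients -/
noncomputable def mkP {n : ℕ} (c : ((univ : Finset (Fin d)).finsuppAntidiag n) → R) :
    MvPolynomial (Fin d) R := ∑ α, MvPolynomial.monomial α.1 (c α)

theorem mkP_hom {n : ℕ} (c : ((univ : Finset (Fin d)).finsuppAntidiag n) → R) :
    (mkP c).IsHomogeneous n :=
  MvPolynomial.IsHomogeneous.sum _ _ _ fun α _ => MvPolynomial.isHomogeneous_monomial _ (mem_D.1 α.2)

theorem mkP_coeff {n : ℕ} (c : ((univ : Finset (Fin d)).finsuppAntidiag n) → R)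
    (α : (univ : Finset (Fin d)).finsuppAntidiag n) : (mkP c).coeff α.1 = c α := by
  classical
  rw [mkP, MvPolynomial.coeff_sum]
  simp [MvPolynomial.coeff_monomial, Subtype.coe_inj]

theorem mkP_surj {n : ℕ} {f : MvPolynomial (Fin d) R} (hf : f.IsHomogeneous n) :
    mkP (fun α : (univ : Finset (Fin d)).finsuppAntidiag n => f.coeff α.1) = f := by
  classical
  ext m
  by_cases hm : m.degree = n
  · exact mkP_coeff _ (⟨m, mem_D.2 hm⟩ : (univ : Finset (Fin d)).finsuppAntidiag n)
  · rw [(mkP_hom _).coeff_eq_zero hm, hf.coeff_eq_zero hm]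

theorem mkP_coeff_zero {n : ℕ} (c : ((univ : Finset (Fin d)).finsuppAntidiag n) → R)
    {m} (hm : m.degree ≠ n) : (mkP c).coeff m = 0 := (mkP_hom _).coeff_eq_zero hm

theorem Ctx.rel_pow (h : Ctx x M) (n : ℕ) {A : Ideal R} (hA : JJ x ≤ A) :
    rel (JJ x ^ n) (A * JJ x ^ n) = (d + n - 1).choose n * lam A := by
  classical
  let D := (univ : Finset (Fin d)).finsuppAntidiag n
  let φ0 : (D → R) →ₗ[R] R :=
    { toFun := fun c => (mkP c).eval x
      map_add' := fun c c' => by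
        simp [mkP, map_add, Finset.sum_add_distrib]
      map_smul' := fun r c => by
        simp [mkP, Finset.mul_sum, MvPolynomial.eval_monomial, mul_assoc] }
  have hmem : ∀ c, φ0 c ∈ JJ x ^ n := fun c => mem_pow_iff.2 ⟨_, mkP_hom c, rfl⟩
  let φ : (D → R) →ₗ[R] idealQuot (JJ x ^ n) (A * JJ x ^ n) :=
    (Submodule.mkQ _).comp (LinearMap.codRestrict _ φ0 hmem)
  have hsurj : Function.Surjective φ := by
    intro y
    obtain ⟨⟨y, hy⟩, rfl⟩ := Submodule.mkQ_surjective _ y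
    obtain ⟨f, hf, rfl⟩ := mem_pow_iff.1 hy
    refine ⟨fun α => f.coeff α.1, ?_⟩
    refine congrArg (Submodule.mkQ _) (Subtype.ext ?_)
    exact congrArg (MvPolynomial.eval x) (mkP_surj hf)
  have hker : LinearMap.ker φ = Submodule.pi Set.univ (fun _ : D => A) := by
    ext c
    rw [LinearMap.mem_ker, Submodule.mem_pi]
    refine (Submodule.Quotient.mk_eq_zero _).trans ?_
    change (mkP c).eval x ∈ A * JJ x ^ n ↔ _
    constructor
    · intro hc α _
      obtain ⟨g, hg, hg', he⟩ := exists_of_mem_mul A hc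
      have := h.qreg n (mkP c - g) ((mkP_hom c).sub hg) (by simp [he]) α.1
      rw [MvPolynomial.coeff_sub, mkP_coeff] at this
      simpa using A.add_mem (hA this) (hg' α.1)
    · intro hc
      refine eval_mem_mul A (mkP_hom c) fun m => ?_
      by_cases hm : m.degree = n
      · have := mkP_coeff c (⟨m, mem_D.2 hm⟩ : D)
        rw [this]
        exact hc _ trivial
      · rw [mkP_coeff_zero c hm]; exact A.zero_mem
  have e := (φ.quotKerEquivOfSurjective hsurj).length_eq
  rw [rel, ← e, hker, (Submodule.quotientPi (fun _ : D => (A : Submodule R R))).length_eq,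
    Module.length_pi_of_fintype]
  simp only [Finset.sum_const, nsmul_eq_mul]
  congr 2
  rw [← card_D]
  simp [D]

theorem Ctx.lam_pow (h : Ctx x M) (n : ℕ) (hd : 0 < d) :
    lam (JJ x ^ n) = (n + d - 1).choose d * lam (JJ x) := by
  induction n with
  | zero =>
    rw [pow_zero, Ideal.one_eq_top]
    simp only [lam, Module.length_eq_zero]
    rw [Nat.choose_eq_zero_of_lt (by omega)]; simp
  | succ n ih =>
    rw [lam_add (Ideal.pow_le_pow_right (Nat.le_succ n)), ih, pow_succ', h.rel_pow n le_rfl,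
      ← add_mul]
    congr 1
    norm_cast
    obtain ⟨e, rfl⟩ : ∃ e, d = e + 1 := ⟨d - 1, by omega⟩
    rw [show n + 1 + (e + 1) - 1 = (n + e) + 1 by omega, Nat.choose_succ_succ,
      show e + 1 + n - 1 = n + e by omega, show n + (e + 1) - 1 = n + e by omega]
    congr 1
    rw [Nat.choose_symm_add]

end
end CMproof

end

section

open IsLocalRing Polynomial Finset
set_option maxHeartbeats 2000000

namespace CMproof
section
variable {R : Type*} [CommRing R] {M : Ideal R}

theorem length_pi3 (A : Ideal R) :
    Module.length R ((Fin 3 → R) ⧸ Submodule.pi Set.univ (fun _ : Fin 3 => (A : Submodule R R))) =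
      3 * lam A := by
  rw [(Submodule.quotientPi (fun _ : Fin 3 => (A : Submodule R R))).length_eq,
    Module.length_pi_of_fintype]
  simp

theorem length_quot_anti {N : Type*} [AddCommGroup N] [Module R N] {A B : Submodule R N}
    (h : B ≤ A) : Module.length R (N ⧸ A) ≤ Module.length R (N ⧸ B) := by
  rw [length_quot h]; exact le_add_self

theorem koszul (A₁ A₂ A₃ : Ideal R) (X Y Z : R)
    (h2 : ∀ a ∈ A₂, a * X ∈ A₃ ∧ a * Y ∈ A₃ ∧ a * Z ∈ A₃)
    (h1 : ∀ a b c, a * Y - b * X ∈ A₂ → a * Z - c * X ∈ A₂ → a ∈ A₁ ∧ b ∈ A₁ ∧ c ∈ A₁) :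
    lam A₃ + 3 * lam A₁ ≤ 3 * lam A₂ + lam (A₃ ⊔ Ideal.span {X, Y, Z}) := by
  have hX : X ∈ A₃ ⊔ Ideal.span {X, Y, Z} := Ideal.mem_sup_right (Ideal.subset_span (by simp))
  have hY : Y ∈ A₃ ⊔ Ideal.span {X, Y, Z} := Ideal.mem_sup_right (Ideal.subset_span (by simp))
  have hZ : Z ∈ A₃ ⊔ Ideal.span {X, Y, Z} := Ideal.mem_sup_right (Ideal.subset_span (by simp))
  let ψ0 : (Fin 3 → R) →ₗ[R] R :=
    { toFun := fun u => u 0 * Z - u 1 * Y + u 2 * X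
      map_add' := fun u v => by simp only [Pi.add_apply]; ring
      map_smul' := fun r u => by simp only [Pi.smul_apply, smul_eq_mul, RingHom.id_apply]; ring }
  have hm : ∀ u, ψ0 u ∈ A₃ ⊔ Ideal.span {X, Y, Z} := fun u =>
    Ideal.add_mem _ (Ideal.sub_mem _ (Ideal.mul_mem_left _ _ hZ) (Ideal.mul_mem_left _ _ hY))
      (Ideal.mul_mem_left _ _ hX)
  let ψ : (Fin 3 → R) →ₗ[R] idealQuot (A₃ ⊔ Ideal.span {X, Y, Z}) A₃ :=
    (Submodule.mkQ _).comp (LinearMap.codRestrict _ ψ0 hm)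
  have hker : ∀ u, u ∈ LinearMap.ker ψ ↔ u 0 * Z - u 1 * Y + u 2 * X ∈ A₃ := fun u =>
    LinearMap.mem_ker.trans (Submodule.Quotient.mk_eq_zero _)
  have hsurj : Function.Surjective ψ := by
    intro y
    obtain ⟨⟨y, hy⟩, rfl⟩ := Submodule.mkQ_surjective _ y
    obtain ⟨a, ha, b, hb, hab⟩ := Submodule.mem_sup.1 hy
    obtain ⟨p, b', hb', e1⟩ := Ideal.mem_span_insert.1 hb
    obtain ⟨q, b'', hb'', e2⟩ := Ideal.mem_span_insert.1 hb'
    obtain ⟨r, e3⟩ := Ideal.mem_span_singleton'.1 hb''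
    refine ⟨![r, -q, p], ?_⟩
    refine (Submodule.Quotient.eq _).2 ?_
    change ψ0 ![r, -q, p] - y ∈ A₃
    have : ψ0 ![r, -q, p] - y = - a := by
      change r * Z - (-q) * Y + p * X - y = -a
      rw [← hab, e1, e2, ← e3]; ring
    rw [this]; exact A₃.neg_mem ha
  have e := (ψ.quotKerEquivOfSurjective hsurj).length_eq
  have hle : Submodule.pi Set.univ (fun _ : Fin 3 => (A₂ : Submodule R R)) ≤ LinearMap.ker ψ := by
    intro u hu
    rw [Submodule.mem_pi] at hu
    rw [hker]
    exact A₃.add_mem (A₃.sub_mem (h2 _ (hu 0 trivial)).2.2 (h2 _ (hu 1 trivial)).2.1)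
      (h2 _ (hu 2 trivial)).1
  have key := length_quot hle
  rw [length_pi3, e] at key
  let φ0 : (Fin 3 → R) →ₗ[R] (Fin 3 → R) :=
    { toFun := fun u => ![u 0 * Y - u 1 * X, u 0 * Z - u 2 * X, u 1 * Z - u 2 * Y]
      map_add' := fun u v => by
        ext i; fin_cases i <;> simp <;> ring
      map_smul' := fun r u => by
        ext i; fin_cases i <;> simp <;> ring }
  have hφ0 : ∀ u, φ0 u ∈ LinearMap.ker ψ := by
    intro u
    rw [hker]
    change (u 0 * Y - u 1 * X) * Z - (u 0 * Z - u 2 * X) * Y + (u 1 * Z - u 2 * Y) * X ∈ A₃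
    ring_nf; exact A₃.zero_mem
  let φ := (Submodule.mkQ ((Submodule.pi Set.univ (fun _ : Fin 3 => (A₂ : Submodule R R))).comap
    (LinearMap.ker ψ).subtype)).comp (LinearMap.codRestrict _ φ0 hφ0)
  have hφk : LinearMap.ker φ ≤ Submodule.pi Set.univ (fun _ : Fin 3 => (A₁ : Submodule R R)) := by
    intro u hu
    have hu' : φ0 u ∈ Submodule.pi Set.univ (fun _ : Fin 3 => (A₂ : Submodule R R)) :=
      (Submodule.Quotient.mk_eq_zero ((Submodule.pi Set.univ (fun _ : Fin 3 => (A₂ : Submodule R R))).comap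
        (LinearMap.ker ψ).subtype)).1 (LinearMap.mem_ker.1 hu)
    rw [Submodule.mem_pi] at hu'
    obtain ⟨q0, q1, q2⟩ := h1 (u 0) (u 1) (u 2) (hu' 0 trivial) (hu' 1 trivial)
    rw [Submodule.mem_pi]
    intro i _
    fin_cases i
    exacts [q0, q1, q2]
  have l1 := length_quot_anti hφk
  rw [length_pi3] at l1
  have l2 := Module.length_le_of_injective _ (LinearMap.ker_eq_bot.1
    (Submodule.ker_liftQ_eq_bot _ φ le_rfl le_rfl))
  have hl : lam A₃ = _ := lam_add (le_sup_left : A₃ ≤ A₃ ⊔ Ideal.span {X, Y, Z})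
  rw [hl, key]
  calc _ ≤ rel (A₃ ⊔ Ideal.span {X, Y, Z}) A₃ + lam (A₃ ⊔ Ideal.span {X, Y, Z}) +
        Module.length R (LinearMap.ker ψ ⧸ (Submodule.pi Set.univ (fun _ : Fin 3 => (A₂ : Submodule R R))).comap
    (LinearMap.ker ψ).subtype) := by gcongr; exact l1.trans l2
    _ = _ := by rw [add_right_comm, add_comm (rel _ _)]

theorem cubic_pos (a b c e : ℤ) (ha : 0 < a) :
    ∃ n0 : ℕ, ∀ n : ℕ, n0 ≤ n → 0 < a * (n : ℤ) ^ 3 + b * (n : ℤ) ^ 2 + c * n + e := by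
  refine ⟨(|b| + |c| + |e| + 1).toNat, fun n hn => ?_⟩
  have h1 : |b| + |c| + |e| + 1 ≤ (n : ℤ) := Int.toNat_le.1 hn
  have hb := neg_abs_le b
  have hc := neg_abs_le c
  have he := neg_abs_le e
  have pb := abs_nonneg b
  have pc := abs_nonneg c
  have pe := abs_nonneg e
  have hn1 : (1 : ℤ) ≤ n := by linarith
  have q2 : (n : ℤ) ≤ (n : ℤ) ^ 2 := by nlinarith
  have t1 : (n : ℤ) ^ 3 ≤ a * (n : ℤ) ^ 3 := by
    have : 0 ≤ (n : ℤ) ^ 3 := by positivity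
    nlinarith
  have t2 : (|b| + |c| + |e| + 1) * (n : ℤ) ^ 2 ≤ (n : ℤ) ^ 3 := by
    have : (n : ℤ) ^ 3 = n * (n : ℤ) ^ 2 := by ring
    rw [this]; gcongr
  have t3 : -|b| * (n : ℤ) ^ 2 ≤ b * (n : ℤ) ^ 2 := by gcongr
  have t4 : -|c| * (n : ℤ) ^ 2 ≤ c * n := by nlinarith
  have t5 : -|e| * (n : ℤ) ^ 2 ≤ e := by nlinarith
  nlinarith

theorem Ctx.dim3 {x : Fin 3 → R} (h : Ctx x M) {c : ℕ}
    (hR : ∀ n : ℕ, wcl (JJ x) n ≤ JJ x ^ (n - c)) {L : ℕ → ℕ}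
    (hL : ∀ n : ℕ, lam (wcl (JJ x) n) = L n) {e : ℕ → ℤ} {N : ℕ}
    (hP : ∀ n ≥ N, (L n : ℤ) = ∑ i ∈ Finset.range 4, (-1 : ℤ) ^ i * e i * ((n + 2 - i).choose (3 - i)))
    (he : e 3 = 0) {ℓ : ℕ} (hl : lam (JJ x) = ℓ) (n : ℕ) : wcl (JJ x) n ≤ JJ x ^ (n - 2) := by
  -- the polynomial
  have hc3 : ∀ n : ℕ, (6 : ℤ) * (n + 2).choose 3 = n * (n + 1) * (n + 2) := by
    intro n
    induction n with
    | zero => simp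
    | succ n ih =>
      rw [show n + 1 + 2 = (n + 2) + 1 by ring, Nat.choose_succ_succ]
      have h2 : (2 : ℤ) * (n + 2).choose 2 = (n + 1) * (n + 2) := by
        have := Nat.choose_two_right (n + 2)
        have h2 : 2 ∣ (n + 2) * (n + 2 - 1) := (Nat.even_mul_pred_self _).two_dvd
        have := Nat.mul_div_cancel' h2
        rw [← Nat.choose_two_right] at this
        have := congrArg (Nat.cast : ℕ → ℤ) this
        push_cast at this
        rw [this]; ring
      push_cast
      linear_combination 3 * h2 + ih
  have hc2 : ∀ n : ℕ, (2 : ℤ) * (n + 1).choose 2 = n * (n + 1) := by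
    intro n
    have h2 : 2 ∣ (n + 1) * (n + 1 - 1) := (Nat.even_mul_pred_self _).two_dvd
    have := Nat.mul_div_cancel' h2
    rw [← Nat.choose_two_right] at this
    have := congrArg (Nat.cast : ℕ → ℤ) this
    push_cast at this
    rw [this]; ring
  have hPoly : ∀ n : ℕ, N ≤ n → (6 * L n : ℤ) = e 0 * (n * (n + 1) * (n + 2)) -
      3 * e 1 * (n * (n + 1)) + 6 * e 2 * n := by
    intro n hn
    rw [hP n hn]
    simp only [Finset.sum_range_succ, Finset.sum_range_zero, he]
    rw [← hc3, ← hc2]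
    simp
    ring
  -- e 0 ≥ ℓ
  have he0 : (ℓ : ℤ) ≤ e 0 := by
    by_contra hlt
    push Not at hlt
    have hlow : ∀ n : ℕ, c ≤ n → (ℓ : ℤ) * ((n - c : ℤ) * (n - c + 1) * (n - c + 2)) ≤ 6 * L n := by
      intro n hn
      have h1 := lam_anti (hR n)
      rw [h.lam_pow _ (by norm_num), hL, hl] at h1
      have h1' : (n - c + 2).choose 3 * ℓ ≤ L n := by exact_mod_cast h1
      have h2 := hc3 (n - c)
      rw [Nat.cast_sub hn] at h2
      have h3 : (((n - c + 2).choose 3 : ℕ) : ℤ) * ℓ ≤ L n := by exact_mod_cast h1'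
      rw [← h2]; linarith
    obtain ⟨n0, hn0⟩ := cubic_pos (ℓ - e 0) (ℓ * (3 - 3 * c) - 3 * e 0 + 3 * e 1)
      (ℓ * (3 * c ^ 2 - 6 * c + 2) - 2 * e 0 + 3 * e 1 - 6 * e 2)
      (ℓ * (-c ^ 3 + 3 * c ^ 2 - 2 * c)) (by linarith)
    have a1 := hn0 (n0 + c + N) (by omega)
    have a2 := hlow (n0 + c + N) (by omega)
    rw [hPoly (n0 + c + N) (by omega)] at a2
    nlinarith [a1, a2]
  -- containment
  have hcont : ∀ k : ℕ, N ≤ k → wcl (JJ x) (3 * k) ≤ Ideal.span {x 0 ^ k, x 1 ^ k, x 2 ^ k} := by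
    intro k hk
    have hcast : ∀ j : ℕ, ((j : ℝ) * (k : ℝ)) = ((j * k : ℕ) : ℝ) := by intro j; push_cast; ring
    have hxk : ∀ i, x i ^ k ∈ wcl (JJ x) k := fun i =>
      pow_le_wcl k (Ideal.pow_mem_pow (Ctx.x_mem i) k)
    have hmul : ∀ (i) (a) , a ∈ wcl (JJ x) (2 * k) → a * x i ^ k ∈ wcl (JJ x) (3 * k) := by
      intro i a ha
      have := mul_mem_wcl ha (hxk i)
      rwa [show (2 : ℝ) * k + k = 3 * k by ring] at this
    have hk0 := koszul (wcl (JJ x) k) (wcl (JJ x) (2 * k)) (wcl (JJ x) (3 * k))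
      (x 0 ^ k) (x 1 ^ k) (x 2 ^ k)
      (fun a ha => ⟨hmul 0 a ha, hmul 1 a ha, hmul 2 a ha⟩)
      (fun a b c' h1 h2 => ⟨(h.B hR (by decide) h1).1, (h.B hR (by decide) h1).2,
        (h.B hR (by decide) h2).2⟩)
    have e3 : lam (wcl (JJ x) (3 * k)) = L (3 * k) := by
      rw [← hL]; push_cast; rfl
    have e2 : lam (wcl (JJ x) (2 * k)) = L (2 * k) := by
      rw [← hL]; push_cast; rfl
    rw [e3, e2, hL] at hk0
    set Q := Ideal.span {x 0 ^ k, x 1 ^ k, x 2 ^ k} with hQ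
    have hQl : lam Q ≤ k ^ 3 * ℓ := by
      have s1 : Q = Ideal.span {x 0 ^ k} ⊔ (Ideal.span {x 1 ^ k} ⊔ Ideal.span {x 2 ^ k}) := by
        rw [hQ, Ideal.span_insert, Ideal.span_insert]
      have s2 : Ideal.span {x 0} ⊔ (Ideal.span {x 1 ^ k} ⊔ Ideal.span {x 2 ^ k}) =
          Ideal.span {x 1 ^ k} ⊔ (Ideal.span {x 0} ⊔ Ideal.span {x 2 ^ k}) := by
        rw [← sup_assoc, sup_comm (Ideal.span {x 0}), sup_assoc]
      have s3 : Ideal.span {x 1} ⊔ (Ideal.span {x 0} ⊔ Ideal.span {x 2 ^ k}) =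
          Ideal.span {x 2 ^ k} ⊔ (Ideal.span {x 0} ⊔ Ideal.span {x 1}) := by
        rw [← sup_assoc, sup_comm _ (Ideal.span {x 2 ^ k}), sup_comm (Ideal.span {x 0})]
      have s4 : Ideal.span {x 2} ⊔ (Ideal.span {x 0} ⊔ Ideal.span {x 1}) = JJ x := by
        rw [← Ideal.span_insert, ← Ideal.span_insert, JJ]
        congr 1
        ext y
        simp only [Set.mem_insert_iff, Set.mem_singleton_iff, Set.mem_range, Fin.exists_fin_succ]
        simp
        tauto
      calc lam Q ≤ k * (k * (k * ℓ)) := by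
            rw [s1]
            refine (lam_pow_le _ _ _).trans ?_
            gcongr
            rw [s2]
            refine (lam_pow_le _ _ _).trans ?_
            gcongr
            rw [s3]
            refine (lam_pow_le _ _ _).trans ?_
            rw [s4, hl]
        _ = k ^ 3 * ℓ := by ring
    have hQf : lam Q ≠ ⊤ := by
      intro hh; rw [hh] at hQl
      have : ((k ^ 3 * ℓ : ℕ) : ℕ∞) = ⊤ := by push_cast; exact top_le_iff.1 hQl
      exact ENat.coe_ne_top _ this
    obtain ⟨q, hq⟩ := ENat.ne_top_iff_exists.1 hQf
    have hle := lam_anti (le_sup_right : Q ≤ wcl (JJ x) (3 * k) ⊔ Q)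
    obtain ⟨q', hq'⟩ := ENat.ne_top_iff_exists.1 (ne_top_of_le_ne_top hQf hle)
    rw [← hq'] at hk0
    rw [← hq] at hQl
    have f1 : L (3 * k) + 3 * L k ≤ 3 * L (2 * k) + q' := by exact_mod_cast hk0
    have f2 : q ≤ k ^ 3 * ℓ := by exact_mod_cast hQl
    have f3 := hPoly (3 * k) (by omega)
    have f4 := hPoly (2 * k) (by omega)
    have f5 := hPoly k hk
    push_cast at f3 f4 f5
    have f6 : q ≤ q' := by
      have f1' : (L (3 * k) + 3 * L k : ℤ) ≤ 3 * L (2 * k) + q' := by exact_mod_cast f1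
      have f2' : (q : ℤ) ≤ k ^ 3 * ℓ := by exact_mod_cast f2
      have f7 : (k : ℤ) ^ 3 * ℓ ≤ k ^ 3 * e 0 := by gcongr
      have : (q : ℤ) ≤ q' := by nlinarith
      exact_mod_cast this
    have := eq_of_lam (le_sup_right : Q ≤ wcl (JJ x) (3 * k) ⊔ Q) hQf (by
      rw [← hq, ← hq']; exact_mod_cast f6)
    rw [← this]; exact le_sup_left
  -- conclusion
  intro a ha
  by_contra hna
  obtain ⟨r, hr, g, hg, rfl, β, hβ⟩ := Ctx.exists_lead hna
  have hβr : β.degree = r := by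
    by_contra hne
    rw [hg.coeff_eq_zero hne] at hβ
    exact hβ (Ideal.zero_mem _)
  set k := N + r + 1 with hk
  have hβi : ∀ i, β i ≤ k - 1 := fun i => by
    have := Finsupp.le_degree i β
    omega
  let δ : Fin 3 →₀ ℕ := Finsupp.equivFunOnFinite.symm (fun _ => k - 1)
  have hβδ : β ≤ δ := fun i => hβi i
  have hdeg : (δ - β).degree + r = 3 * (k - 1) := by
    have : (δ - β + β).degree = (δ - β).degree + β.degree := map_add _ _ _
    rw [tsub_add_cancel_of_le hβδ, hβr] at this
    rw [← this, Finsupp.degree_eq_sum]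
    simp [δ]
  have h1 : xm x (δ - β) * g.eval x ∈ wcl (JJ x) (3 * k) := by
    have := mul_mem_wcl (pow_le_wcl _ (xm_mem (x := x) (δ - β))) ha
    refine wcl_anti ?_ this
    have : 3 * k ≤ (δ - β).degree + n := by omega
    exact_mod_cast this
  have h2 := hcont k (by omega) h1
  let S : Set (Fin 3 →₀ ℕ) := {α | ∃ i, k ≤ α i}
  have hS : IsUpperSet S := fun α α' hle ⟨i, hi⟩ => ⟨i, hi.trans (hle i)⟩
  have h3 : Ideal.span {x 0 ^ k, x 1 ^ k, x 2 ^ k} ≤ monI x S := by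
    rw [Ideal.span_le]
    have : ∀ i, x i ^ k ∈ monI x S := fun i => by
      rw [← xm_single]
      exact Ideal.subset_span ⟨_, ⟨i, by simp⟩, rfl⟩
    intro y hy
    simp only [Set.mem_insert_iff, Set.mem_singleton_iff] at hy
    rcases hy with rfl | rfl | rfl <;> exact this _
  have h4 : ((MvPolynomial.monomial (δ - β) 1 * g).eval x) ∈ monI x S := by
    rw [map_mul]; exact h3 h2
  have h5 := h.lead_mem hS ((MvPolynomial.isHomogeneous_monomial _ rfl).mul hg) h4
    (β := (δ - β) + β) (by rw [MvPolynomial.coeff_monomial_mul, one_mul]; exact hβ)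
  rw [tsub_add_cancel_of_le hβδ] at h5
  obtain ⟨i, hi⟩ := h5
  have : δ i = k - 1 := rfl
  omega

end
end CMproof

end

section

open IsLocalRing Polynomial Finset
set_option maxHeartbeats 2000000

namespace CMproof
section
variable {R : Type*} [CommRing R] {d : ℕ} {x : Fin d → R} {M : Ideal R}

theorem JJ_map {S : Type*} [CommRing S] (f : R →+* S) (x : Fin d → R) :
    JJ (fun i => f (x i)) = (JJ x).map f := by
  rw [JJ, JJ, Ideal.map_span, ← Set.range_comp]; rfl

theorem JJ_map_pow {S : Type*} [CommRing S] (f : R →+* S) (x : Fin d → R) (n : ℕ) :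
    JJ (fun i => f (x i)) ^ n = (JJ x ^ n).map f := by
  rw [JJ_map, Ideal.map_pow]

theorem Ctx.cancel0 (h : Ctx x M) {t a : R} {n : ℕ} (ht : t ∉ M) (ha : t * a ∈ JJ x ^ n) :
    a ∈ JJ x ^ n :=
  h.cancel (c := 0) (F := t) (by simp) (by simpa using ht) (by simpa using ha)

section loc
variable (S : Type*) [CommRing S] [Algebra R S] [hp : M.IsPrime] [IsLocalization.AtPrime S M]

theorem Ctx.comap_pow (h : Ctx x M) {n : ℕ} {a : R} :
    algebraMap R S a ∈ JJ (fun i => algebraMap R S (x i)) ^ n ↔ a ∈ JJ x ^ n := by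
  rw [JJ_map_pow]
  refine ⟨fun ha => ?_, fun ha => Ideal.mem_map_of_mem _ ha⟩
  rw [IsLocalization.algebraMap_mem_map_algebraMap_iff M.primeCompl S] at ha
  obtain ⟨t, ht, hta⟩ := ha
  exact h.cancel0 ht hta

theorem Ctx.loc_wcl (h : Ctx x M) {r : ℝ} {a : R} :
    algebraMap R S a ∈ wcl (JJ (fun i => algebraMap R S (x i))) r ↔ a ∈ wcl (JJ x) r := by
  simp only [mem_wcl, ← map_pow, h.comap_pow S]

theorem mem_of_unit_mul {I : Ideal S} {u a : S} (hu : IsUnit u) (h : u * a ∈ I) : a ∈ I := by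
  obtain ⟨u, rfl⟩ := hu
  have := I.mul_mem_left (↑u⁻¹) h
  simpa using this

theorem Ctx.loc (h : Ctx x M) :
    Ctx (fun i => algebraMap R S (x i)) (M.map (algebraMap R S)) := by
  classical
  have hloc : IsLocalRing S := IsLocalization.AtPrime.isLocalRing S M
  have hmax : M.map (algebraMap R S) = maximalIdeal S := IsLocalization.AtPrime.map_eq_maximalIdeal M S
  have hmem : ∀ a : R, algebraMap R S a ∈ M.map (algebraMap R S) ↔ a ∈ M := by
    intro a
    rw [hmax]
    exact IsLocalization.AtPrime.to_map_mem_maximal_iff S M a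
  refine ⟨?_, ?_, ?_, ?_, ?_⟩
  · rw [hmax]; infer_instance
  · rw [JJ_map]; exact Ideal.map_mono h.le
  · obtain ⟨s, hs⟩ := h.pow
    refine ⟨s, ?_⟩
    rw [JJ_map, ← Ideal.map_pow]; exact Ideal.map_mono hs
  · intro a b ha hab
    refine mem_of_unit_mul S ?_ hab
    rw [hmax] at ha
    simpa using ha
  · intro n f hf hfx m
    obtain ⟨t, ht⟩ := IsLocalization.exist_integer_multiples_of_finset M.primeCompl
      (f.support.image f.coeff)
    have ht' : ∀ m, ∃ r : R, algebraMap R S r = algebraMap R S t * f.coeff m := by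
      intro m
      by_cases hm : m ∈ f.support
      · obtain ⟨r, hr⟩ := ht _ (Finset.mem_image_of_mem _ hm)
        exact ⟨r, by rw [hr, Algebra.smul_def]⟩
      · rw [MvPolynomial.notMem_support_iff.1 hm]
        exact ⟨0, by simp⟩
    choose r hr using ht'
    let f0 : MvPolynomial (Fin d) R := ∑ m ∈ f.support, MvPolynomial.monomial m (r m)
    have hf0 : MvPolynomial.map (algebraMap R S) f0 = MvPolynomial.C (algebraMap R S t) * f := by
      conv_rhs => rw [f.as_sum, Finset.mul_sum]
      simp only [f0, map_sum, MvPolynomial.map_monomial, MvPolynomial.C_mul_monomial, hr]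
    have hhom : f0.IsHomogeneous n :=
      MvPolynomial.IsHomogeneous.sum _ _ _ fun m hm => MvPolynomial.isHomogeneous_monomial _ (by
        by_contra hne
        exact (MvPolynomial.mem_support_iff.1 hm) (hf.coeff_eq_zero hne))
    have hev : algebraMap R S (f0.eval x) =
        algebraMap R S t * f.eval (fun i => algebraMap R S (x i)) := by
      have := congrArg (MvPolynomial.eval (fun i => algebraMap R S (x i))) hf0
      rw [map_mul, MvPolynomial.eval_C, MvPolynomial.eval_map] at this
      rw [← this]; simp [MvPolynomial.eval₂_eq, MvPolynomial.eval_eq]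
    have h1 : f0.eval x ∈ JJ x ^ (n + 1) := by
      rw [← h.comap_pow S, hev]
      exact Ideal.mul_mem_left _ _ hfx
    have h2 := h.qreg n f0 hhom h1 m
    have h3 : algebraMap R S t * f.coeff m ∈ JJ (fun i => algebraMap R S (x i)) := by
      rw [← MvPolynomial.coeff_C_mul, ← hf0, MvPolynomial.coeff_map, JJ_map]
      exact Ideal.mem_map_of_mem _ h2
    exact mem_of_unit_mul S (IsLocalization.map_units S t) h3
end loc

/-- dividing by a generic linear form -/
theorem Ctx.quot {e : ℕ} {x : Fin (e + 1) → R} (h : Ctx x M) (w : Fin e → R) (l : R)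
    (hl : l = x (Fin.last e) - ∑ i, w i * x i.castSucc) :
    Ctx (fun i : Fin e => Ideal.Quotient.mk (Ideal.span {l}) (x i.castSucc))
      (M.map (Ideal.Quotient.mk (Ideal.span {l}))) ∧
    (∀ n, JJ (fun i : Fin e => Ideal.Quotient.mk (Ideal.span {l}) (x i.castSucc)) ^ n =
      (JJ x ^ n).map (Ideal.Quotient.mk (Ideal.span {l}))) ∧
    l ∈ JJ x ^ 1 ∧ l ∉ M * JJ x ^ 1 := by
  classical
  have hlJ : l ∈ JJ x := by
    rw [hl]
    exact Ideal.sub_mem _ (Ctx.x_mem _) (Ideal.sum_mem _ fun i _ => Ideal.mul_mem_left _ _ (Ctx.x_mem _))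
  let lf : MvPolynomial (Fin (e + 1)) R := MvPolynomial.X (Fin.last e) -
    ∑ i, MvPolynomial.C (w i) * MvPolynomial.X (Fin.castSucc i)
  have hlf : lf.IsHomogeneous 1 := by
    refine MvPolynomial.IsHomogeneous.sub (MvPolynomial.isHomogeneous_X _ _)
      (MvPolynomial.IsHomogeneous.sum _ _ _ fun i _ => ?_)
    simpa using (MvPolynomial.isHomogeneous_C _ (w i)).mul (MvPolynomial.isHomogeneous_X R (Fin.castSucc i))
  have hlev : lf.eval x = l := by simp [lf, hl]
  have hlnot : l ∉ M * JJ x ^ 1 := by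
    rw [← hlev]
    refine h.not_mem_of_coeff hlf ⟨Finsupp.single (Fin.last e) 1, ?_⟩
    have : lf.coeff (Finsupp.single (Fin.last e) 1) = 1 := by
      simp only [lf, MvPolynomial.coeff_sub, MvPolynomial.coeff_X, MvPolynomial.coeff_sum,
        MvPolynomial.coeff_C_mul, if_true]
      rw [Finset.sum_eq_zero, sub_zero]
      intro i _
      rw [if_neg, mul_zero]
      intro hh
      have := Finsupp.single_left_injective one_ne_zero hh
      exact absurd this (Fin.castSucc_lt_last i).ne
    rw [this]
    exact fun h1 => h.prime.ne_top ((Ideal.eq_top_iff_one _).2 h1)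
  set q := Ideal.Quotient.mk (Ideal.span {l}) with hq
  have hql : q l = 0 := by rw [hq, Ideal.Quotient.eq_zero_iff_mem]; exact Ideal.mem_span_singleton_self l
  have hJ : JJ (fun i : Fin e => q (x i.castSucc)) = (JJ x).map q := by
    apply le_antisymm
    · rw [JJ, Ideal.span_le]
      rintro _ ⟨i, rfl⟩
      exact Ideal.mem_map_of_mem _ (Ctx.x_mem _)
    · rw [Ideal.map_le_iff_le_comap, JJ, Ideal.span_le]
      rintro _ ⟨i, rfl⟩
      rw [SetLike.mem_coe, Ideal.mem_comap]
      induction i using Fin.lastCases with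
      | cast i => exact Ideal.subset_span ⟨i, rfl⟩
      | last =>
        have : q (x (Fin.last e)) = ∑ i, q (w i) * q (x i.castSucc) := by
          have h0 := congrArg q hl
          rw [hql, map_sub, map_sum] at h0
          simp only [map_mul] at h0
          exact sub_eq_zero.1 h0.symm
        rw [this]
        exact Ideal.sum_mem _ fun i _ => Ideal.mul_mem_left _ _ (Ideal.subset_span ⟨i, rfl⟩)
  have hJn : ∀ n, JJ (fun i : Fin e => q (x i.castSucc)) ^ n = (JJ x ^ n).map q := fun n => by
    rw [hJ, Ideal.map_pow]
  have hlM : Ideal.span {l} ≤ M := (Ideal.span_singleton_le_iff_mem _).2 (h.le hlJ)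
  have hker : RingHom.ker q = Ideal.span {l} := Ideal.mk_ker
  have hqs : Function.Surjective q := Ideal.Quotient.mk_surjective
  have memq : ∀ (I : Ideal R) (a : R), q a ∈ I.map q ↔ a ∈ I ⊔ Ideal.span {l} := by
    intro I a
    rw [← Ideal.mem_comap, Ideal.comap_map_of_surjective' _ hqs, hker]
  refine ⟨⟨?_, ?_, ?_, ?_, ?_⟩, hJn, by simpa using hlJ, hlnot⟩
  · have := h.prime
    exact Ideal.map_isPrime_of_surjective hqs (by rw [hker]; exact hlM)
  · rw [hJ]; exact Ideal.map_mono h.le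
  · obtain ⟨s, hs⟩ := h.pow
    exact ⟨s, by rw [hJ, ← Ideal.map_pow]; exact Ideal.map_mono hs⟩
  · intro a b
    obtain ⟨a, rfl⟩ := hqs a
    obtain ⟨b, rfl⟩ := hqs b
    rw [← map_mul, hJ, memq, memq, memq, sup_eq_left.2 hlM,
      sup_eq_left.2 ((Ideal.span_singleton_le_iff_mem _).2 hlJ)]
    exact h.canc a b
  · intro n f' hf' hfx' m
    -- lift
    choose g hg using hqs
    let f : MvPolynomial (Fin e) R := ∑ m ∈ f'.support, MvPolynomial.monomial m (g (f'.coeff m))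
    have hfmap : MvPolynomial.map q f = f' := by
      conv_rhs => rw [f'.as_sum]
      simp only [f, map_sum, MvPolynomial.map_monomial, hg]
    have hf : f.IsHomogeneous n :=
      MvPolynomial.IsHomogeneous.sum _ _ _ fun m hm => MvPolynomial.isHomogeneous_monomial _ (by
        by_contra hne
        exact (MvPolynomial.mem_support_iff.1 hm) (hf'.coeff_eq_zero hne))
    have hev : q (f.eval (fun i => x i.castSucc)) = f'.eval (fun i => q (x i.castSucc)) := by
      rw [← hfmap, MvPolynomial.eval_map]; simp [MvPolynomial.eval₂_eq, MvPolynomial.eval_eq]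
    rw [hJn, ← hev, memq] at hfx'
    obtain ⟨z, hz, b, hb, hzb⟩ := Submodule.mem_sup.1 hfx'
    obtain ⟨b, rfl⟩ := Ideal.mem_span_singleton'.1 hb
    rw [← hfmap, MvPolynomial.coeff_map, hJ]
    apply Ideal.mem_map_of_mem
    -- f as polynomial in all variables
    let F : MvPolynomial (Fin (e + 1)) R := MvPolynomial.rename Fin.castSucc f
    have hF : F.IsHomogeneous n := hf.rename_isHomogeneous
    have hFev : F.eval x = f.eval (fun i => x i.castSucc) := by
      simp only [F, MvPolynomial.eval_rename]; rfl
    let sub : MvPolynomial (Fin (e + 1)) R →ₐ[R] MvPolynomial (Fin e) R :=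
      MvPolynomial.aeval (Fin.lastCases (∑ i, MvPolynomial.C (w i) * MvPolynomial.X i)
        (fun i => MvPolynomial.X i))
    have hsubF : sub F = f := by
      simp only [sub, F, MvPolynomial.aeval_rename]
      convert MvPolynomial.aeval_X_left_apply f using 2
      congr 1
      ext i : 1
      simp
    have hsubl : sub lf = 0 := by
      simp [sub, lf]
    obtain ⟨G, hG, hGF⟩ : ∃ G : MvPolynomial (Fin (e + 1)) R, G.IsHomogeneous n ∧
        (F - G).eval x ∈ JJ x ^ (n + 1) ∧ sub G = 0 := by
      rcases n with _ | n
      · refine ⟨0, MvPolynomial.isHomogeneous_zero _ _ _, ?_, map_zero _⟩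
        rw [sub_zero, hFev, ← hzb]
        refine Ideal.add_mem _ hz (Ideal.mul_mem_left _ _ (by simpa using hlJ))
      · have hb' : b ∈ JJ x ^ n := by
          refine h.cancel (c := 1) (by simpa using hlJ) hlnot ?_
          have : l * b = F.eval x - z := by rw [hFev, ← hzb]; ring
          rw [this]
          exact Ideal.sub_mem _ (mem_pow_iff.2 ⟨F, hF, rfl⟩) (Ideal.pow_le_pow_right (by omega) hz)
        obtain ⟨β, hβ, rfl⟩ := mem_pow_iff.1 hb'
        refine ⟨β * lf, hβ.mul hlf, ?_, by rw [map_mul, hsubl, mul_zero]⟩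
        rw [map_sub, map_mul, hlev, hFev, ← hzb, add_sub_cancel_right]
        exact hz
    have hc := h.qreg n (F - G) (hF.sub hG) hGF.1
    have hcs : sub (F - G) = f := by rw [map_sub, hsubF, hGF.2, sub_zero]
    rw [← hcs]
    -- coefficients of sub of a polynomial with coefficients in J
    have : F - G ∈ (JJ x).map (MvPolynomial.C : R →+* MvPolynomial (Fin (e + 1)) R) :=
      MvPolynomial.mem_map_C_iff.2 hc
    have h2 : sub (F - G) ∈ (JJ x).map (MvPolynomial.C : R →+* MvPolynomial (Fin e) R) := by
      have h3 := Ideal.mem_map_of_mem sub this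
      have h4 : ((JJ x).map (MvPolynomial.C : R →+* MvPolynomial (Fin (e + 1)) R)).map
          (sub : MvPolynomial (Fin (e + 1)) R →+* MvPolynomial (Fin e) R) =
          (JJ x).map (MvPolynomial.C : R →+* MvPolynomial (Fin e) R) := by
        rw [Ideal.map_map]
        congr 1
        ext r
        simp
      rw [← h4]
      exact h3
    exact MvPolynomial.mem_map_C_iff.1 h2 m

end
end CMproof

end

section

open IsLocalRing Polynomial Finset
set_option maxHeartbeats 2000000
namespace CMproof
section
variable {R : Type*} [CommRing R] {d e : ℕ} {M : Ideal R}

theorem coeff_map_C_pow {σ : Type*} {x : Fin d → R} {n : ℕ} {p : MvPolynomial σ R} :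
    p ∈ JJ (fun i => (MvPolynomial.C (x i) : MvPolynomial σ R)) ^ n ↔ ∀ m, p.coeff m ∈ JJ x ^ n := by
  rw [JJ_map_pow (MvPolynomial.C : R →+* MvPolynomial σ R) x n, MvPolynomial.mem_map_C_iff]

theorem coeff_map_C {σ : Type*} {x : Fin d → R} {p : MvPolynomial σ R} :
    p ∈ JJ (fun i => (MvPolynomial.C (x i) : MvPolynomial σ R)) ↔ ∀ m, p.coeff m ∈ JJ x := by
  simpa using coeff_map_C_pow (n := 1) (x := x) (p := p)

/-- polynomial extension -/
theorem Ctx.poly {x : Fin (e + 1) → R} (h : Ctx x M) :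
    Ctx (fun i => (MvPolynomial.C (x i) : MvPolynomial (Fin e) R))
      (M.map (MvPolynomial.C : R →+* MvPolynomial (Fin e) R)) := by
  classical
  have hren : ∀ (A : Ideal R) (p : MvPolynomial (Fin e) R),
      (∀ m, (MvPolynomial.rename Fin.castSucc p).coeff m ∈ A) ↔ ∀ m, p.coeff m ∈ A := by
    intro A p
    constructor
    · intro hp m
      rw [← MvPolynomial.coeff_rename_mapDomain Fin.castSucc (Fin.castSucc_injective e)]
      exact hp _
    · intro hp m
      by_cases hm : (MvPolynomial.rename Fin.castSucc p).coeff m = 0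
      · rw [hm]; exact A.zero_mem
      · obtain ⟨u, hu, -⟩ := MvPolynomial.coeff_rename_ne_zero _ _ _ hm
        rw [← hu, MvPolynomial.coeff_rename_mapDomain _ (Fin.castSucc_injective e)]
        exact hp _
  refine ⟨?_, ?_, ?_, ?_, ?_⟩
  · have := h.prime
    have hk : RingHom.ker (MvPolynomial.map (σ := Fin e) (Ideal.Quotient.mk M)) =
        M.map (MvPolynomial.C : R →+* MvPolynomial (Fin e) R) := by
      rw [MvPolynomial.ker_map, Ideal.mk_ker]
    rw [← hk]
    exact RingHom.ker_isPrime _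
  · intro p hp
    rw [coeff_map_C] at hp
    rw [MvPolynomial.mem_map_C_iff]
    exact fun m => h.le (hp m)
  · obtain ⟨s, hs⟩ := h.pow
    refine ⟨s, ?_⟩
    rw [← Ideal.map_pow, JJ_map MvPolynomial.C x]
    exact Ideal.map_mono hs
  · intro a b ha hab
    rw [MvPolynomial.mem_map_C_iff] at ha
    push Not at ha
    rw [coeff_map_C] at hab ⊢
    rw [← hren] at hab ⊢
    rw [map_mul] at hab
    refine h.nzd (f := MvPolynomial.rename Fin.castSucc a) ?_ hab
    by_contra hcon
    push Not at hcon
    rw [hren] at hcon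
    obtain ⟨m, hm⟩ := ha
    exact hm (hcon m)
  · intro n f hf hfx m
    rw [coeff_map_C_pow] at hfx
    rw [coeff_map_C]
    intro α
    let g : MvPolynomial (Fin (e + 1)) R :=
      ∑ m ∈ f.support, MvPolynomial.monomial m ((f.coeff m).coeff α)
    have hg : g.IsHomogeneous n :=
      MvPolynomial.IsHomogeneous.sum _ _ _ fun m hm => MvPolynomial.isHomogeneous_monomial _ (by
        by_contra hne
        exact (MvPolynomial.mem_support_iff.1 hm) (hf.coeff_eq_zero hne))
    have hgc : g.coeff m = (f.coeff m).coeff α := by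
      simp only [g, MvPolynomial.coeff_sum, MvPolynomial.coeff_monomial]
      rw [Finset.sum_ite_eq']
      split_ifs with h1
      · rfl
      · rw [MvPolynomial.notMem_support_iff.1 h1, MvPolynomial.coeff_zero]
    have hge : g.eval x = (f.eval (fun i => (MvPolynomial.C (x i) : MvPolynomial (Fin e) R))).coeff α := by
      simp only [g, map_sum, MvPolynomial.eval_monomial]
      rw [MvPolynomial.eval_eq, MvPolynomial.coeff_sum]
      refine Finset.sum_congr rfl fun m _ => ?_
      have : (∏ i ∈ m.support, (MvPolynomial.C (x i) : MvPolynomial (Fin e) R) ^ m i) =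
          MvPolynomial.C (∏ i ∈ m.support, x i ^ m i) := by simp
      rw [this, mul_comm (MvPolynomial.coeff m f), MvPolynomial.coeff_C_mul, mul_comm]
      rfl
    rw [← hgc]
    refine h.qreg n g hg ?_ m
    rw [hge]
    exact hfx α

theorem wcl_poly {x : Fin d → R} {r : ℝ} {p : MvPolynomial (Fin e) R} :
    p ∈ wcl (JJ (fun i => (MvPolynomial.C (x i) : MvPolynomial (Fin e) R))) r ↔
      ∀ m, p.coeff m ∈ wcl (JJ x) r := by
  classical
  constructor
  · let mo : MonomialOrder (Fin e) := MonomialOrder.lex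
    have hmap : ∀ a ∈ wcl (JJ x) r, (MvPolynomial.C a : MvPolynomial (Fin e) R) ∈
        wcl (JJ (fun i => (MvPolynomial.C (x i) : MvPolynomial (Fin e) R))) r := by
      rintro a ⟨c, hc⟩
      refine ⟨c, fun M s hs => ?_⟩
      rw [← map_pow, JJ_map_pow MvPolynomial.C x]
      exact Ideal.mem_map_of_mem _ (hc M s hs)
    have key : ∀ (n : ℕ) (p : MvPolynomial (Fin e) R), #p.support ≤ n →
        p ∈ wcl (JJ (fun i => (MvPolynomial.C (x i) : MvPolynomial (Fin e) R))) r →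
        ∀ m, p.coeff m ∈ wcl (JJ x) r := by
      intro n
      induction n with
      | zero =>
        intro p hp _ m
        have : p = 0 := by simpa using hp
        rw [this, MvPolynomial.coeff_zero]
        exact Ideal.zero_mem _
      | succ n ih =>
        intro p hp hw
        have hlc : mo.leadingCoeff p ∈ wcl (JJ x) r := by
          obtain ⟨c, hc⟩ := hw
          refine ⟨c, fun M s hs => ?_⟩
          rw [← MonomialOrder.coeff_pow_nsmul_degree]
          exact coeff_map_C_pow.1 (hc M s hs) _
        by_cases hp0 : p = 0
        · intro m
          rw [hp0, MvPolynomial.coeff_zero]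
          exact Ideal.zero_mem _
        let u := mo.degree p
        have hq := ih (p - MvPolynomial.monomial u (p.coeff u)) (by
            have hsub : (p - MvPolynomial.monomial u (p.coeff u)).support ⊆ p.support.erase u := by
              intro v hv
              rw [MvPolynomial.mem_support_iff, MvPolynomial.coeff_sub,
                MvPolynomial.coeff_monomial] at hv
              rw [Finset.mem_erase, MvPolynomial.mem_support_iff]
              split_ifs at hv with huv
              · subst huv; simp at hv
              · exact ⟨fun h => huv h.symm, by simpa using hv⟩
            have h1 := Finset.card_le_card hsub
            have hu : u ∈ p.support := mo.degree_mem_support hp0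
            rw [Finset.card_erase_of_mem hu] at h1
            omega) (by
            refine Ideal.sub_mem _ hw ?_
            rw [← mul_one (p.coeff u), ← MvPolynomial.C_mul_monomial]
            exact Ideal.mul_mem_right _ _ (hmap _ hlc))
        intro m
        have hm := hq m
        rw [MvPolynomial.coeff_sub, MvPolynomial.coeff_monomial] at hm
        split_ifs at hm with hum
        · rw [← hum]; exact hlc
        · simpa using hm
    exact key _ p le_rfl
  · intro hp
    have : p ∈ (wcl (JJ x) r).map (MvPolynomial.C : R →+* MvPolynomial (Fin e) R) :=
      MvPolynomial.mem_map_C_iff.2 hp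
    refine (Ideal.map_le_iff_le_comap.2 ?_) this
    rintro a ⟨c, hc⟩
    refine ⟨c, fun M s hs => ?_⟩
    rw [← map_pow, JJ_map_pow MvPolynomial.C x]
    exact Ideal.mem_map_of_mem _ (hc M s hs)

end
end CMproof

end

section

open IsLocalRing Polynomial Finset
set_option maxHeartbeats 2000000
namespace CMproof
section
variable {R : Type*} [CommRing R] {d e : ℕ} {M : Ideal R}

/-- degree-like filtration on a localization away from `x j`. -/
def LL {S : Type*} [CommRing S] (x : Fin d → S) (j : Fin d) (s : ℕ) :
    Set (Localization.Away (x j)) :=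
  {z | ∃ E : ℕ, ∃ h ∈ JJ x ^ (s + E), z * algebraMap S _ (x j) ^ E = algebraMap S _ h}

section LL
variable {S : Type*} [CommRing S] {x : Fin d → S} {j : Fin d} {s s' : ℕ}
  {z z' : Localization.Away (x j)} {N : Ideal S}

theorem LL_raise {E E' : ℕ} (hE : E ≤ E') {h : S} (hh : h ∈ JJ x ^ (s + E))
    (hz : z * algebraMap S _ (x j) ^ E = algebraMap S _ h) :
    ∃ h' ∈ JJ x ^ (s + E'), z * algebraMap S _ (x j) ^ E' = algebraMap S _ h' := by
  refine ⟨h * x j ^ (E' - E), ?_, ?_⟩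
  · have := Ideal.mul_mem_mul hh (Ideal.pow_mem_pow (Ctx.x_mem (x := x) j) (E' - E))
    rw [← pow_add] at this
    convert this using 2
    omega
  · rw [map_mul, ← hz, map_pow, mul_assoc, ← pow_add]
    congr 2
    omega

theorem LL_add (hz : z ∈ LL x j s) (hz' : z' ∈ LL x j s) : z + z' ∈ LL x j s := by
  obtain ⟨E, h, hh, e1⟩ := hz
  obtain ⟨E', h', hh', e2⟩ := hz'
  obtain ⟨g, hg, e3⟩ := LL_raise (le_max_left E E') hh e1
  obtain ⟨g', hg', e4⟩ := LL_raise (le_max_right E E') hh' e2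
  exact ⟨max E E', g + g', Ideal.add_mem _ hg hg', by rw [add_mul, e3, e4, map_add]⟩

theorem LL_mul (hz : z ∈ LL x j s) (hz' : z' ∈ LL x j s') : z * z' ∈ LL x j (s + s') := by
  obtain ⟨E, h, hh, e1⟩ := hz
  obtain ⟨E', h', hh', e2⟩ := hz'
  refine ⟨E + E', h * h', ?_, ?_⟩
  · have := Ideal.mul_mem_mul hh hh'
    rw [← pow_add] at this
    convert this using 2
    ring
  · rw [map_mul, ← e1, ← e2, pow_add]; ring

theorem LL_alg {h : S} (hh : h ∈ JJ x ^ s) : algebraMap S _ h ∈ LL x j s :=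
  ⟨0, h, by simpa using hh, by simp⟩

theorem Ctx.of_LL (hC : Ctx x N) {h : S} (hh : algebraMap S _ h ∈ LL x j s) : h ∈ JJ x ^ s := by
  obtain ⟨E, g, hg, e1⟩ := hh
  rw [← map_pow, ← map_mul, IsLocalization.eq_iff_exists (Submonoid.powers (x j))] at e1
  obtain ⟨⟨_, k, rfl⟩, hk⟩ := e1
  simp only at hk
  refine hC.cancel (F := x j ^ (E + k)) (c := E + k) (Ideal.pow_mem_pow (Ctx.x_mem _) _) ?_ ?_
  · have := hC.pow_not_mem (F := x j) (c := 1) (by simpa using Ctx.x_mem (x := x) j) (hC.x_not_mem j) (E + k)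
    rwa [one_mul] at this
  · have : x j ^ (E + k) * h = x j ^ k * (h * x j ^ E) := by ring
    rw [this, hk]
    have := Ideal.mul_mem_mul (Ideal.pow_mem_pow (Ctx.x_mem (x := x) j) k) hg
    rw [← pow_add] at this
    convert this using 2
    ring
end LL

/-- the generic linear form -/
noncomputable abbrev gl (x : Fin (e + 1) → R) : MvPolynomial (Fin e) R :=
  MvPolynomial.C (x (Fin.last e)) - ∑ i, MvPolynomial.X i * MvPolynomial.C (x i.castSucc)

noncomputable abbrev cx (e : ℕ) (x : Fin d → R) : Fin d → MvPolynomial (Fin e) R :=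
  fun i => MvPolynomial.C (x i)

/-- elimination of the variable `j` -/
theorem elim_exists (x : Fin (e + 1) → R) (j : Fin e) :
    ∃ φ : MvPolynomial (Fin e) R →ₐ[R] Localization.Away (cx e x j.castSucc),
      φ (gl x) = 0 ∧ (∀ p, φ p ∈ LL (cx e x) j.castSucc 0) ∧
      (∀ s, ∀ p ∈ JJ (cx e x) ^ s, φ p ∈ LL (cx e x) j.castSucc s) ∧
      (∀ p h E, φ p * algebraMap _ _ (cx e x j.castSucc) ^ E = algebraMap _ _ h → ∃ k,
        cx e x j.castSucc ^ k * (p * cx e x j.castSucc ^ E - h) ∈ Ideal.span {gl x}) := by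
  classical
  let P := MvPolynomial (Fin e) R
  let xj : P := cx e x j.castSucc
  let Lc := Localization.Away xj
  let u : P := MvPolynomial.C (x (Fin.last e)) -
    ∑ i ∈ Finset.univ.erase j, MvPolynomial.X i * MvPolynomial.C (x i.castSucc)
  let inv : Lc := IsLocalization.Away.invSelf xj
  have hinv : algebraMap P Lc xj * inv = 1 := IsLocalization.Away.mul_invSelf xj
  let φ : P →ₐ[R] Lc := MvPolynomial.aeval (fun i => if i = j then algebraMap P Lc u * inv
    else algebraMap P Lc (MvPolynomial.X i))
  have hφC : ∀ r, φ (MvPolynomial.C r) = algebraMap P Lc (MvPolynomial.C r) := by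
    intro r
    have h1 : φ (MvPolynomial.C r) = algebraMap R Lc r := φ.commutes r
    rw [h1, IsScalarTower.algebraMap_apply R P Lc]; rfl
  have hφj : φ (MvPolynomial.X j) = algebraMap P Lc u * inv :=
    (MvPolynomial.aeval_X _ j).trans (if_pos rfl)
  have hφi : ∀ i ≠ j, φ (MvPolynomial.X i) = algebraMap P Lc (MvPolynomial.X i) := by
    intro i hi; exact (MvPolynomial.aeval_X _ i).trans (if_neg hi)
  have hgl : gl x = u - MvPolynomial.X j * xj := by
    simp only [gl, u]
    rw [← Finset.sum_erase_add _ _ (Finset.mem_univ j)]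
    ring
  have hφu : φ u = algebraMap P Lc u := by
    simp only [u, map_sub, map_sum, map_mul, hφC]
    congr 1
    refine Finset.sum_congr rfl fun i hi => ?_
    rw [hφi i (Finset.ne_of_mem_erase hi)]
  have h0 : ∀ p, φ p ∈ LL (cx e x) j.castSucc 0 := by
    intro p
    induction p using MvPolynomial.induction_on with
    | C r => rw [hφC]; exact LL_alg (by simp)
    | add p q hp hq => rw [map_add]; exact LL_add hp hq
    | mul_X p i hp =>
      rw [map_mul]
      have : φ (MvPolynomial.X i) ∈ LL (cx e x) j.castSucc 0 := by
        by_cases hi : i = j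
        · subst hi
          rw [hφj]
          refine ⟨1, u, ?_, ?_⟩
          · rw [zero_add, pow_one]
            refine Ideal.sub_mem _ (Ctx.x_mem (x := cx e x) _) (Ideal.sum_mem _ fun l _ => Ideal.mul_mem_left _ _ (Ctx.x_mem (x := cx e x) _))
          · rw [pow_one, mul_assoc, mul_comm inv, hinv, mul_one]
        · rw [hφi i hi]; exact LL_alg (by simp)
      exact LL_mul hp this
  refine ⟨φ, ?_, h0, ?_, ?_⟩
  · rw [hgl, map_sub, map_mul, hφu, hφj, hφC, mul_assoc, mul_comm inv, hinv, mul_one, sub_self]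
  · intro s p hp
    rw [JJ_map_pow (MvPolynomial.C : R →+* P) x s] at hp
    refine Submodule.span_induction ?_ ?_ ?_ ?_ hp
    · rintro _ ⟨r, hr, rfl⟩
      rw [hφC]
      refine LL_alg ?_
      rw [JJ_map_pow (MvPolynomial.C : R →+* P) x s]
      exact Ideal.mem_map_of_mem _ hr
    · rw [map_zero]
      exact ⟨0, 0, Ideal.zero_mem _, by simp⟩
    · intro a b _ _ ha hb
      rw [map_add]; exact LL_add ha hb
    · intro a b _ hb
      rw [smul_eq_mul, map_mul]
      simpa using LL_mul (h0 a) hb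
  · intro p h E hp
    let Q := P ⧸ Ideal.span {gl x}
    let q : P →+* Q := Ideal.Quotient.mk _
    let Lq := Localization.Away (q xj)
    let ψ : Lc →+* Lq := IsLocalization.Away.lift (S := Lc) xj (g := (algebraMap Q Lq).comp q)
      (IsLocalization.Away.algebraMap_isUnit (q xj))
    have hψ : ∀ a, ψ (algebraMap P Lc a) = algebraMap Q Lq (q a) := fun a =>
      IsLocalization.Away.lift_eq _ _ _
    have hψφ : ∀ p, ψ (φ p) = algebraMap Q Lq (q p) := by
      intro p
      induction p using MvPolynomial.induction_on with
      | C r => rw [hφC, hψ]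
      | add p q hp hq => simp only [map_add, hp, hq]
      | mul_X p i hp =>
        rw [map_mul, map_mul, hp, map_mul, map_mul]
        congr 1
        by_cases hi : i = j
        · subst hi
          have h1 : q u = q (MvPolynomial.X i * xj) := by
            rw [Ideal.Quotient.eq, ← hgl]
            exact Ideal.mem_span_singleton_self _
          have h2 := congrArg ψ hinv
          rw [map_mul, hψ, map_one] at h2
          rw [hφj, map_mul, hψ, h1, map_mul, map_mul, mul_assoc, h2, mul_one]
        · rw [hφi i hi, hψ]
    have h1 := congrArg ψ hp
    rw [map_mul, map_pow, hψφ, hψ, hψ, ← map_pow, ← map_mul, ← map_pow, ← map_mul,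
      IsLocalization.eq_iff_exists (Submonoid.powers (q xj))] at h1
    obtain ⟨⟨_, k, rfl⟩, hk⟩ := h1
    refine ⟨k, ?_⟩
    rw [← Ideal.Quotient.eq_zero_iff_mem]
    simp only at hk
    change q (xj ^ k * (p * xj ^ E - h)) = 0
    rw [map_mul, map_sub, mul_sub, map_pow, hk, sub_self]

end
end CMproof

end

section

open IsLocalRing Polynomial Finset
set_option maxHeartbeats 2000000
namespace CMproof
section
variable {R : Type*} [CommRing R] {d e : ℕ} {M : Ideal R}

theorem LL_pow {S : Type*} [CommRing S] {x : Fin d → S} {j : Fin d} {z : Localization.Away (x j)}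
    {s : ℕ} (hz : z ∈ LL x j s) (n : ℕ) : z ^ n ∈ LL x j (s * n) := by
  induction n with
  | zero =>
    rw [pow_zero, ← map_one (algebraMap S _)]
    exact LL_alg (by simp)
  | succ n ih => rw [pow_succ, mul_add, mul_one]; exact LL_mul ih hz

/-- G5: saturation of the section. -/
theorem Ctx.sat {x : Fin (e + 1) → R} (h : Ctx x M) {n : ℝ} {p : MvPolynomial (Fin e) R}
    (hp : ∃ c : ℝ, ∀ m s : ℕ, (s : ℝ) ≤ n * m - c →
      p ^ m ∈ JJ (cx e x) ^ s ⊔ Ideal.span {gl x}) (j : Fin e) :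
    ∃ E : ℕ, p * cx e x j.castSucc ^ E ∈ wcl (JJ (cx e x)) (n + E) ⊔ Ideal.span {gl x} := by
  obtain ⟨φ, φ0, φL0, φL, φk⟩ := elim_exists x j
  obtain ⟨c, hc⟩ := hp
  obtain ⟨E, h', hh', he⟩ := φL0 p
  rw [zero_add] at hh'
  have hP := h.poly
  have hw : h' ∈ wcl (JJ (cx e x)) (n + E) := by
    rw [mem_wcl]
    refine ⟨max c 0 + 1, fun m s hs => ?_⟩
    by_cases hsE : s ≤ E * m
    · have := Ideal.pow_mem_pow hh' m
      rw [← pow_mul] at this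
      exact Ideal.pow_le_pow_right hsE this
    · push Not at hsE
      obtain ⟨s', rfl⟩ := Nat.exists_eq_add_of_lt hsE
      have h1 : p ^ m ∈ JJ (cx e x) ^ (s' + 1) ⊔ Ideal.span {gl x} := by
        refine hc m (s' + 1) ?_
        push_cast at hs ⊢
        have := le_max_left c 0
        nlinarith
      have h2 : φ (p ^ m) ∈ LL (cx e x) j.castSucc (s' + 1) := by
        obtain ⟨a, ha, b, hb, hab⟩ := Submodule.mem_sup.1 h1
        rw [← hab, map_add]
        obtain ⟨b', rfl⟩ := Ideal.mem_span_singleton'.1 hb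
        rw [map_mul, φ0, mul_zero, add_zero]
        exact φL _ _ ha
      refine hP.of_LL (j := j.castSucc) ?_
      rw [map_pow, ← he, mul_pow, ← map_pow]
      have h3 : (algebraMap (MvPolynomial (Fin e) R) (Localization.Away (cx e x j.castSucc))
          (cx e x j.castSucc) ^ E) ^ m ∈ LL (cx e x) j.castSucc (E * m) := by
        rw [← map_pow, ← map_pow]
        refine LL_alg ?_
        rw [← pow_mul]
        exact Ideal.pow_mem_pow (Ctx.x_mem (x := cx e x) _) _
      have := LL_mul h2 h3
      convert this using 2
      ring
  obtain ⟨k, hk⟩ := φk p h' E he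
  refine ⟨E + k, ?_⟩
  have : p * cx e x j.castSucc ^ (E + k) = cx e x j.castSucc ^ k * h' +
    cx e x j.castSucc ^ k * (p * cx e x j.castSucc ^ E - h') := by ring
  rw [this]
  refine Ideal.add_mem _ (Ideal.mem_sup_left ?_) (Ideal.mem_sup_right hk)
  have h5 := mul_mem_wcl (pow_le_wcl k (Ideal.pow_mem_pow (Ctx.x_mem (x := cx e x) j.castSucc) k)) hw
  convert h5 using 2
  push_cast
  ring
end
end CMproof

end

section

open IsLocalRing Polynomial Finset
set_option maxHeartbeats 2000000
namespace CMproof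
section
variable {R : Type*} [CommRing R] {d e : ℕ} {M : Ideal R}

theorem wcl_stable [IsNoetherianRing R] {J : Ideal R} {c : ℕ}
    (hR : ∀ n : ℕ, wcl J n ≤ J ^ (n - c)) :
    ∃ n0 : ℕ, ∀ k : ℕ, wcl J ((n0 + k : ℕ) : ℝ) = J ^ k * wcl J n0 := by
  let F : J.Filtration R :=
    { N := fun n => J ^ (n - c)
      mono := fun i => Ideal.pow_le_pow_right (by omega)
      smul_le := fun i => by
        rw [smul_eq_mul, ← pow_succ']
        exact Ideal.pow_le_pow_right (by omega) }
  let F' : J.Filtration R :=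
    { N := fun n => wcl J n
      mono := fun i => wcl_anti (by push_cast; linarith)
      smul_le := fun i => by
        rw [smul_eq_mul, Ideal.mul_le]
        intro a ha b hb
        have := mul_mem_wcl (pow_le_wcl 1 (by simpa using ha)) hb
        convert this using 2
        push_cast; ring }
  have hF : F.Stable := by
    refine ⟨c, fun n hn => ?_⟩
    change J • J ^ (n - c) = J ^ (n + 1 - c)
    rw [smul_eq_mul, ← pow_succ']
    congr 1
    omega
  have hF' : F'.Stable := hF.of_le (F' := F') (fun n => hR n)
  obtain ⟨n0, hn0⟩ := hF'.exists_pow_smul_eq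
  exact ⟨n0, fun k => by simpa [F'] using hn0 k⟩

theorem wcl_poly_le {x : Fin d → R} {c : ℕ}
    (hR : ∀ n : ℕ, wcl (JJ x) n ≤ JJ x ^ (n - c)) (n : ℕ) :
    wcl (JJ (cx e x)) n ≤ JJ (cx e x) ^ (n - c) := by
  intro p hp
  rw [coeff_map_C_pow]
  intro m
  exact hR n (wcl_poly.1 hp m)

/-- the variables in the generic section -/
noncomputable abbrev qx (x : Fin (e + 1) → R) : Fin e → (MvPolynomial (Fin e) R ⧸ Ideal.span {gl x}) :=
  fun i => Ideal.Quotient.mk (Ideal.span {gl x}) (cx e x i.castSucc)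

theorem Ctx.gq {x : Fin (e + 1) → R} (h : Ctx x M) :
    Ctx (qx x) ((M.map (MvPolynomial.C : R →+* MvPolynomial (Fin e) R)).map
      (Ideal.Quotient.mk (Ideal.span {gl x}))) ∧
    (∀ n, JJ (qx x) ^ n = (JJ (cx e x) ^ n).map (Ideal.Quotient.mk (Ideal.span {gl x}))) ∧
    gl x ∈ JJ (cx e x) ^ 1 ∧
    gl x ∉ M.map (MvPolynomial.C : R →+* MvPolynomial (Fin e) R) * JJ (cx e x) ^ 1 :=
  h.poly.quot (fun i => MvPolynomial.X i) (gl x) rfl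

theorem mem_map_mk {l : R} {I : Ideal R} {a : R} :
    Ideal.Quotient.mk (Ideal.span {l}) a ∈ I.map (Ideal.Quotient.mk (Ideal.span {l})) ↔
      a ∈ I ⊔ Ideal.span {l} := by
  rw [← Ideal.mem_comap, Ideal.comap_map_of_surjective _ Ideal.Quotient.mk_surjective,
    ← RingHom.ker_eq_comap_bot, Ideal.mk_ker]

theorem wcl_map {S : Type*} [CommRing S] (f : R →+* S) (J : Ideal R) (r : ℝ) :
    (wcl J r).map f ≤ wcl (J.map f) r := by
  rw [Ideal.map_le_iff_le_comap]
  rintro a ⟨c, hc⟩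
  refine ⟨c, fun m s hs => ?_⟩
  rw [← map_pow, ← Ideal.map_pow]
  exact Ideal.mem_map_of_mem _ (hc m s hs)

theorem Ctx.gsat {x : Fin (e + 1) → R} (h : Ctx x M) {n : ℝ} {z}
    (hz : z ∈ wcl (JJ (qx x)) n) (j : Fin e) :
    ∃ E0 : ℕ, ∀ E ≥ E0, z * qx x j ^ E ∈ (wcl (JJ (cx e x)) (n + E)).map
      (Ideal.Quotient.mk (Ideal.span {gl x})) := by
  obtain ⟨p, rfl⟩ := Ideal.Quotient.mk_surjective z
  obtain ⟨h1, h2, h3, h4⟩ := h.gq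
  obtain ⟨E0, hE0⟩ := h.sat (n := n) (p := p) (by
    obtain ⟨c, hc⟩ := hz
    refine ⟨c, fun m s hs => ?_⟩
    have := hc m s hs
    rwa [h2, ← map_pow, mem_map_mk] at this) j
  refine ⟨E0, fun E hE => ?_⟩
  have h5 := mem_map_mk.2 hE0
  obtain ⟨k, rfl⟩ := Nat.exists_eq_add_of_le hE
  have h6 : cx e x j.castSucc ^ k ∈ wcl (JJ (cx e x)) k :=
    pow_le_wcl k (Ideal.pow_mem_pow (Ctx.x_mem (x := cx e x) j.castSucc) k)
  have h7 := Ideal.mul_mem_mul h5 (Ideal.mem_map_of_mem (Ideal.Quotient.mk (Ideal.span {gl x})) h6)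
  rw [← Ideal.map_mul, ← map_mul] at h7
  rw [← map_pow, ← map_mul]
  have h8 : wcl (JJ (cx e x)) (n + E0) * wcl (JJ (cx e x)) k ≤ wcl (JJ (cx e x)) (n + (E0 + k : ℕ)) := by
    rw [Ideal.mul_le]
    intro a ha b hb
    convert mul_mem_wcl ha hb using 2
    push_cast; ring
  convert Ideal.map_mono h8 h7 using 2
  ring

theorem Ctx.greesQ {x : Fin (e + 1) → R} (h : Ctx x M) {c : ℕ} (he : 0 < e)
    (hR : ∀ n : ℕ, wcl (JJ x) n ≤ JJ x ^ (n - c)) (n : ℕ) :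
    wcl (JJ (qx x)) n ≤ JJ (qx x) ^ (n - c) := by
  obtain ⟨h1, h2, h3, h4⟩ := h.gq
  rcases le_total n c with hnc | hnc
  · rw [Nat.sub_eq_zero_of_le hnc]; simp
  intro z hz
  let j : Fin e := ⟨0, he⟩
  obtain ⟨E, hE⟩ := h.gsat hz j
  have h5 := hE E le_rfl
  have h6 := Ideal.map_mono (f := Ideal.Quotient.mk (Ideal.span {gl x}))
    (wcl_poly_le (e := e) hR (n + E)) (by push_cast; exact h5)
  rw [← h2] at h6
  refine h1.cancel (F := qx x j ^ E) (c := E) (Ideal.pow_mem_pow (Ctx.x_mem _) _) ?_ ?_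
  · have := h1.pow_not_mem (F := qx x j) (c := 1) (by simpa using Ctx.x_mem (x := qx x) j) (h1.x_not_mem j) E
    rwa [one_mul] at this
  · rw [mul_comm]
    convert h6 using 2
    omega

theorem Ctx.gstab [IsNoetherianRing R] {x : Fin (e + 1) → R} (h : Ctx x M) {c : ℕ} (he : 0 < e)
    (hR : ∀ n : ℕ, wcl (JJ x) n ≤ JJ x ^ (n - c)) :
    ∃ n3 : ℕ, ∀ n ≥ n3, wcl (JJ (qx x)) n = (wcl (JJ (cx e x)) n).map
      (Ideal.Quotient.mk (Ideal.span {gl x})) := by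
  classical
  obtain ⟨h1, h2, h3, h4⟩ := h.gq
  obtain ⟨n0, hn0⟩ := wcl_stable (h.greesQ he hR)
  obtain ⟨s, hs⟩ := (isNoetherianRing_iff_ideal_fg _).1 inferInstance (wcl (JJ (qx x)) n0)
  have hsm : ∀ g ∈ s, g ∈ wcl (JJ (qx x)) n0 := fun g hg => hs ▸ Ideal.subset_span hg
  choose! E0 hE0 using fun (g) (j : Fin e) (hg : g ∈ s) => h.gsat (hsm g hg) j
  let E := s.sup fun g => Finset.univ.sup fun j => E0 g j
  have hE : ∀ g ∈ s, ∀ j, E0 g j ≤ E := fun g hg j =>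
    (Finset.le_sup (f := fun j => E0 g j) (Finset.mem_univ j)).trans
      (Finset.le_sup (f := fun g => Finset.univ.sup fun j => E0 g j) hg)
  refine ⟨n0 + e * E, fun n hn => le_antisymm ?_ ?_⟩
  swap
  · have := wcl_map (Ideal.Quotient.mk (Ideal.span {gl x})) (JJ (cx e x)) n
    have h5 := h2 1
    rw [pow_one, pow_one] at h5
    rwa [← h5] at this
  obtain ⟨k, rfl⟩ := Nat.exists_eq_add_of_le (show n0 ≤ n by omega)
  have hk : e * E ≤ k := by omega
  rw [hn0 k, Ideal.mul_le]
  intro y hy g hg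
  rw [← hs] at hg
  refine Submodule.span_induction (p := fun g _ => y * g ∈ _) ?_ (by simp) ?_ ?_ hg
  rotate_left
  · intro a b _ _ ha hb; rw [mul_add]; exact Ideal.add_mem _ ha hb
  · intro a b _ hb; rw [smul_eq_mul, mul_left_comm]; exact Ideal.mul_mem_left _ _ hb
  intro g hg
  obtain ⟨p, hp, rfl⟩ := mem_pow_iff.1 hy
  rw [eval_eq_sum_xm, Finset.sum_mul]
  refine Ideal.sum_mem _ fun m hm => ?_
  rw [mul_assoc]
  refine Ideal.mul_mem_left _ _ ?_
  have hdeg : m.degree = k := by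
    have := hp (MvPolynomial.mem_support_iff.1 hm)
    rw [← this, Finsupp.degree_eq_weight_one]; rfl
  obtain ⟨j, hj⟩ : ∃ j, E ≤ m j := by
    by_contra! hcon
    have : m.degree < e * E ∨ e * E = 0 := by
      rw [Finsupp.degree_eq_sum]
      left
      calc ∑ i, m i < ∑ i : Fin e, E := Finset.sum_lt_sum_of_nonempty ⟨⟨0, he⟩, Finset.mem_univ _⟩ fun i _ => hcon i
        _ = e * E := by simp
    rcases this with h | h
    · omega
    · rcases Nat.mul_eq_zero.1 h with h | h
      · omega
      · have := hcon ⟨0, he⟩; omega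
  obtain ⟨m', rfl⟩ : ∃ m', m = m' + Finsupp.single j E := ⟨m - Finsupp.single j E, by
    rw [tsub_add_cancel_of_le]; simpa using hj⟩
  rw [xm_add, xm_single, mul_assoc, mul_comm _ g]
  have h6 := hE0 g j hg E (hE g hg j)
  have h7 := xm_mem (x := qx x) m'
  rw [h2] at h7
  have h8 := Ideal.mul_mem_mul h7 h6
  rw [← Ideal.map_mul] at h8
  refine Ideal.map_mono ?_ h8
  rw [Ideal.mul_le]
  intro a ha b hb
  have h9 := mul_mem_wcl (pow_le_wcl _ ha) hb
  convert h9 using 2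
  rw [map_add, Finsupp.degree_single] at hdeg
  rw [← hdeg]
  push_cast; ring
end
end CMproof

end

section

open IsLocalRing Polynomial Finset
set_option maxHeartbeats 2000000
namespace CMproof
section
variable {R : Type*} [CommRing R] {d e : ℕ} {M : Ideal R}

theorem lam_flat {S : Type*} [CommRing S] [IsLocalRing R] [IsLocalRing S] [Algebra R S]
    [Module.Flat R S] (hS : (maximalIdeal R).map (algebraMap R S) = maximalIdeal S) (I : Ideal R) :
    lam (I.map (algebraMap R S)) = lam I := by
  have : IsLocalHom (algebraMap R S) :=
    ((IsLocalRing.local_hom_TFAE (algebraMap R S)).out 2 0).1 hS.le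
  have h1 := IsLocalRing.length_baseChange R S (R ⧸ I)
  rw [hS] at h1
  have h2 : IsSimpleModule S (S ⧸ maximalIdeal S) :=
    isSimpleModule_iff_isCoatom.2 (maximalIdeal.isMaximal S).out
  rw [Module.length_eq_one S (S ⧸ maximalIdeal S), mul_one] at h1
  rw [lam, lam, ← h1]
  exact (Algebra.TensorProduct.quotIdealMapEquivTensorQuot S I).toLinearEquiv.length_eq

theorem lam_map_mk {l : R} {I : Ideal R} :
    lam (I.map (Ideal.Quotient.mk (Ideal.span {l}))) = lam (I ⊔ Ideal.span {l}) := by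
  rw [lam, ← Module.length_eq_of_surjective (S := R) (R := R ⧸ Ideal.span {l}) Ideal.Quotient.mk_surjective, lam, sup_comm]
  exact (DoubleQuot.quotQuotEquivQuotSupₐ R (Ideal.span {l}) I).toLinearEquiv.length_eq

theorem Ctx.lam_sect {x : Fin d → R} (h : Ctx x M) {l : R} (hl : l ∈ JJ x ^ 1) (hl' : l ∉ M * JJ x ^ 1)
    (r : ℝ) : lam (wcl (JJ x) (r + 1)) =
      lam (wcl (JJ x) r) + lam (wcl (JJ x) (r + 1) ⊔ Ideal.span {l}) := by
  rw [lam_add (show wcl (JJ x) (r + 1) ≤ wcl (JJ x) (r + 1) ⊔ Ideal.span {l} from le_sup_left)]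
  congr 1
  let φ : R →ₗ[R] idealQuot (wcl (JJ x) (r + 1) ⊔ Ideal.span {l}) (wcl (JJ x) (r + 1)) :=
    (Submodule.mkQ _).comp (LinearMap.codRestrict _ (LinearMap.mulLeft R l) (fun r =>
      Ideal.mem_sup_right (Ideal.mul_mem_right _ _ (Ideal.mem_span_singleton_self l))))
  have hk : LinearMap.ker φ = wcl (JJ x) r := by
    ext a
    rw [LinearMap.mem_ker]
    change Submodule.Quotient.mk _ = _ ↔ _
    rw [Submodule.Quotient.mk_eq_zero]
    change l * a ∈ wcl (JJ x) (r + 1) ↔ _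
    constructor
    · intro ha
      exact h.cancel_wcl (c := 1) hl hl' (by push_cast; exact ha)
    · intro ha
      have := mul_mem_wcl (pow_le_wcl 1 hl) ha
      rw [add_comm] at this
      simpa using this
  have hs : Function.Surjective φ := by
    intro z
    obtain ⟨⟨y, hy⟩, rfl⟩ := Submodule.Quotient.mk_surjective _ z
    obtain ⟨a, ha, b, hb, rfl⟩ := Submodule.mem_sup.1 hy
    obtain ⟨b', rfl⟩ := Ideal.mem_span_singleton'.1 hb
    refine ⟨b', ?_⟩
    refine (Submodule.Quotient.eq _).2 ?_
    change l * b' - (a + b' * l) ∈ wcl (JJ x) (r + 1)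
    have : l * b' - (a + b' * l) = - a := by ring
    rw [this]
    exact neg_mem ha
  rw [rel, ← (φ.quotKerEquivOfSurjective hs).length_eq, hk, lam]
end
end CMproof

end

section

open IsLocalRing Polynomial Finset
set_option maxHeartbeats 2000000
namespace CMproof
section
universe u
variable {e : ℕ}

theorem Ctx.step_aux {R : Type u} [CommRing R] [IsLocalRing R] [IsNoetherianRing R] {x : Fin (e + 1) → R}
    (h : Ctx x (maximalIdeal R))
    [hprime : ((maximalIdeal R).map (MvPolynomial.C : R →+* MvPolynomial (Fin e) R)).IsPrime]
    (S : Type u) [CommRing S] [IsLocalRing S] [IsNoetherianRing S] [Algebra R S]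
    [Algebra (MvPolynomial (Fin e) R) S] [IsScalarTower R (MvPolynomial (Fin e) R) S]
    [IsLocalization.AtPrime S ((maximalIdeal R).map (MvPolynomial.C : R →+* MvPolynomial (Fin e) R))] (he : 0 < e) {c : ℕ} (hR : ∀ n : ℕ, wcl (JJ x) n ≤ JJ x ^ (n - c)) :
    ∃ (R' : Type u) (_ : CommRing R') (_ : IsLocalRing R') (_ : IsNoetherianRing R') (x' : Fin e → R'),
      Ctx x' (maximalIdeal R') ∧ (∀ n : ℕ, wcl (JJ x') n ≤ JJ x' ^ (n - c)) ∧ lam (JJ x') = lam (JJ x) ∧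
      (∃ n3 : ℕ, ∀ n ≥ n3, lam (wcl (JJ x) (n + 1 : ℕ)) = lam (wcl (JJ x) n) + lam (wcl (JJ x') (n + 1 : ℕ))) ∧
      ((∀ n : ℕ, wcl (JJ x') n ≤ JJ x' ^ (n - 2)) → ∀ n : ℕ, wcl (JJ x) n ≤ JJ x ^ (n - 2)) := by
  classical
  let P := MvPolynomial (Fin e) R
  let 𝔐 : Ideal P := (maximalIdeal R).map MvPolynomial.C
  have hP : Ctx (cx e x) 𝔐 := h.poly
  obtain ⟨g1, g2, g3, g4⟩ := h.gq
  let y : Fin (e + 1) → S := fun i => algebraMap P S (cx e x i)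
  have hmS : 𝔐.map (algebraMap P S) = maximalIdeal S := IsLocalization.AtPrime.map_eq_maximalIdeal 𝔐 S
  have hy : Ctx y (maximalIdeal S) := hmS ▸ Ctx.loc S hP
  let l : S := algebraMap P S (gl x)
  have hl : l = y (Fin.last e) - ∑ i, algebraMap P S (MvPolynomial.X i) * y i.castSucc := by
    simp only [l, map_sub, map_sum, map_mul]; rfl
  obtain ⟨q1, q2, q3, q4⟩ := hy.quot (fun i => algebraMap P S (MvPolynomial.X i)) l hl
  let R' := S ⧸ Ideal.span {l}
  let mk : S →+* R' := Ideal.Quotient.mk (Ideal.span {l})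
  let x' : Fin e → R' := fun i => mk (y i.castSucc)
  have hne : (maximalIdeal S).map mk ≠ ⊤ := q1.prime.ne_top
  have : Nontrivial R' := by
    refine ⟨0, 1, fun h01 => hne ?_⟩
    rw [Ideal.eq_top_iff_one, ← h01]; exact Ideal.zero_mem _
  have locR' : IsLocalRing R' := IsLocalRing.of_surjective' mk Ideal.Quotient.mk_surjective
  have hmax : (maximalIdeal S).map mk = maximalIdeal R' := by
    have h1 := Ideal.map_eq_top_or_isMaximal_of_surjective mk Ideal.Quotient.mk_surjective
      (maximalIdeal.isMaximal S)
    exact IsLocalRing.eq_maximalIdeal (h1.resolve_left hne)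
  have noeR' : IsNoetherianRing R' := inferInstance
  have flat0 : Module.Flat P S := IsLocalization.flat S 𝔐.primeCompl
  have flat : Module.Flat R S := Module.Flat.trans R P S
  have hmRS : (maximalIdeal R).map (algebraMap R S) = maximalIdeal S := by
    rw [← hmS, Ideal.map_map, IsScalarTower.algebraMap_eq R P S]
    rfl
  have hJy : JJ y = (JJ x).map (algebraMap R S) := by
    rw [← JJ_map (algebraMap R S) x]
    congr 1
    funext i
    rw [IsScalarTower.algebraMap_apply R P S]; rfl
  have hx' : Ctx x' (maximalIdeal R') := hmax ▸ q1
  -- transfer of powers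
  have tp : ∀ (n : ℕ) (p : P), mk (algebraMap P S p) ∈ JJ x' ^ n ↔
      Ideal.Quotient.mk (Ideal.span {gl x}) p ∈ JJ (qx x) ^ n := by
    intro n p
    rw [q2, g2, mem_map_mk, mem_map_mk]
    have e1 : JJ y ^ n ⊔ Ideal.span {l} = (JJ (cx e x) ^ n ⊔ Ideal.span {gl x}).map (algebraMap P S) := by
      rw [Ideal.map_sup, Ideal.map_span, Set.image_singleton, ← JJ_map_pow (algebraMap P S) (cx e x) n]
    rw [e1]
    constructor
    · intro hp
      rw [IsLocalization.mem_map_algebraMap_iff 𝔐.primeCompl] at hp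
      obtain ⟨⟨⟨a, ha⟩, t⟩, hat⟩ := hp
      rw [← map_mul, IsLocalization.eq_iff_exists 𝔐.primeCompl] at hat
      obtain ⟨t', ht'⟩ := hat
      have h5 : (t' * t : P) * p ∈ JJ (cx e x) ^ n ⊔ Ideal.span {gl x} := by
        have : (t' * t : P) * p = t' * (p * t) := by ring
        rw [this, ht']
        exact Ideal.mul_mem_left _ _ ha
      rw [← mem_map_mk, ← g2] at h5 ⊢
      rw [map_mul] at h5
      refine g1.cancel0 ?_ h5
      intro h6
      rw [mem_map_mk, sup_eq_left.2] at h6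
      · exact (t' * t).2 h6
      · rw [Ideal.span_singleton_le_iff_mem]
        exact hP.le (by simpa using g3)
    · exact fun hp => Ideal.mem_map_of_mem _ hp
  have tw : ∀ (r : ℝ) (p : P), mk (algebraMap P S p) ∈ wcl (JJ x') r ↔
      Ideal.Quotient.mk (Ideal.span {gl x}) p ∈ wcl (JJ (qx x)) r := by
    intro r p
    simp only [mem_wcl, ← map_pow, tp]
  -- every element of R' is associated to the image of an element of P
  have surj : ∀ z : R', ∃ p : P, ∃ u : R', IsUnit u ∧ z * u = mk (algebraMap P S p) := by
    intro z
    obtain ⟨s, rfl⟩ := Ideal.Quotient.mk_surjective z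
    obtain ⟨⟨a, t⟩, hs⟩ := IsLocalization.surj 𝔐.primeCompl s
    refine ⟨a, mk (algebraMap P S t), (IsLocalization.map_units S t).map mk, ?_⟩
    rw [← hs, map_mul]
  have mem_unit : ∀ (A : Ideal R') (z u p : R'), IsUnit u → z * u = p → (z ∈ A ↔ p ∈ A) := by
    rintro A z u p hu rfl
    exact (A.mul_unit_mem_iff_mem hu).symm
  have hrees : ∀ n : ℕ, wcl (JJ x') n ≤ JJ x' ^ (n - c) := by
    intro n z hz
    obtain ⟨p, u, hu, hp⟩ := surj z
    rw [mem_unit _ z u _ hu hp] at hz ⊢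
    rw [tw] at hz
    exact (tp _ _).2 (h.greesQ he hR n hz)
  obtain ⟨n3, hn3⟩ := h.gstab he hR
  -- extension of weak closures to S
  have wS : ∀ r : ℝ, wcl (JJ y) r = (wcl (JJ x) r).map (algebraMap R S) := by
    intro r
    apply le_antisymm
    · intro s hs
      obtain ⟨⟨a, t⟩, ht⟩ := IsLocalization.surj 𝔐.primeCompl s
      have ht2 := IsLocalization.map_units S t
      simp only at ht
      have h1 : algebraMap P S a ∈ wcl (JJ y) r := by rw [← ht]; exact Ideal.mul_mem_right _ _ hs
      have h2 : a ∈ wcl (JJ (cx e x)) r := (Ctx.loc_wcl S hP).1 h1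
      have h3 : a ∈ (wcl (JJ x) r).map (MvPolynomial.C : R →+* P) := by
        rw [MvPolynomial.mem_map_C_iff]
        exact fun m => wcl_poly.1 h2 m
      have h4 := Ideal.mem_map_of_mem (algebraMap P S) h3
      rw [Ideal.map_map, ← ht] at h4
      rw [IsScalarTower.algebraMap_eq R P S]
      exact (Ideal.mul_unit_mem_iff_mem _ ht2).1 h4
    · rw [hJy]; exact wcl_map _ _ _
  have wR' : ∀ n : ℕ, n3 ≤ n → wcl (JJ x') n = (wcl (JJ y) n).map mk := by
    intro n hn
    apply le_antisymm
    · intro z hz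
      obtain ⟨p, u, hu, hp⟩ := surj z
      rw [mem_unit _ z u _ hu hp] at hz ⊢
      rw [tw, hn3 n hn, mem_map_mk] at hz
      rw [mem_map_mk]
      have := Ideal.mem_map_of_mem (algebraMap P S) hz
      rw [Ideal.map_sup, Ideal.map_span, Set.image_singleton] at this
      suffices hle : (wcl (JJ (cx e x)) n).map (algebraMap P S) ≤ wcl (JJ y) n by
        exact (sup_le_sup_right hle (Ideal.span {algebraMap P S (gl x)})) this
      rw [Ideal.map_le_iff_le_comap]
      intro a ha
      exact (Ctx.loc_wcl S hP).2 ha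
    · have := wcl_map mk (JJ y) n
      have h5 := q2 1
      rw [pow_one, pow_one] at h5
      rwa [← h5] at this
  refine ⟨R', inferInstance, locR', noeR', x', hx', hrees, ?_, ⟨n3, fun n hn => ?_⟩, ?_⟩
  · have h5 := q2 1
    rw [pow_one, pow_one] at h5
    rw [h5, lam_map_mk, sup_eq_left.2, hJy, lam_flat hmRS]
    rw [Ideal.span_singleton_le_iff_mem]
    simpa using q3
  · rw [wR' _ (by omega), lam_map_mk]
    have := hy.lam_sect q3 q4 n
    rw [wS n, lam_flat hmRS] at this
    push_cast at this ⊢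
    rw [← this, wS, lam_flat hmRS]
  · intro hyp n a ha
    have h1 : Ideal.Quotient.mk (Ideal.span {gl x}) (MvPolynomial.C a) ∈ wcl (JJ (qx x)) n := by
      have h5 := g2 1
      rw [pow_one, pow_one] at h5
      rw [h5]
      refine wcl_map _ _ _ (Ideal.mem_map_of_mem _ ?_)
      rw [JJ_map (MvPolynomial.C : R →+* P) x]
      exact wcl_map _ _ _ (Ideal.mem_map_of_mem _ ha)
    have h2 := (tp _ _).1 (hyp n ((tw _ _).2 h1))
    rw [g2, mem_map_mk] at h2
    obtain ⟨φ, φ0, φL0, φL, φk⟩ := elim_exists x ⟨0, he⟩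
    have h3 : φ (MvPolynomial.C a) ∈ LL (cx e x) (Fin.castSucc ⟨0, he⟩) (n - 2) := by
      obtain ⟨b, hb, b', hb', hab⟩ := Submodule.mem_sup.1 h2
      rw [← hab, map_add]
      obtain ⟨b', rfl⟩ := Ideal.mem_span_singleton'.1 hb'
      rw [map_mul, φ0, mul_zero, add_zero]
      exact φL _ _ hb
    have h4 : φ (MvPolynomial.C a) = algebraMap P _ (MvPolynomial.C a) := by
      have h5 : φ (MvPolynomial.C a) = algebraMap R _ a := φ.commutes a
      rw [h5, IsScalarTower.algebraMap_apply R P]; rfl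
    rw [h4] at h3
    have h6 := hP.of_LL h3
    rw [coeff_map_C_pow] at h6
    simpa using h6 0

theorem Ctx.step {R : Type u} [CommRing R] [IsLocalRing R] [IsNoetherianRing R] {x : Fin (e + 1) → R}
    (h : Ctx x (maximalIdeal R)) (he : 0 < e) {c : ℕ} (hR : ∀ n : ℕ, wcl (JJ x) n ≤ JJ x ^ (n - c)) :
    ∃ (R' : Type u) (_ : CommRing R') (_ : IsLocalRing R') (_ : IsNoetherianRing R') (x' : Fin e → R'),
      Ctx x' (maximalIdeal R') ∧ (∀ n : ℕ, wcl (JJ x') n ≤ JJ x' ^ (n - c)) ∧ lam (JJ x') = lam (JJ x) ∧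
      (∃ n3 : ℕ, ∀ n ≥ n3, lam (wcl (JJ x) (n + 1 : ℕ)) = lam (wcl (JJ x) n) + lam (wcl (JJ x') (n + 1 : ℕ))) ∧
      ((∀ n : ℕ, wcl (JJ x') n ≤ JJ x' ^ (n - 2)) → ∀ n : ℕ, wcl (JJ x) n ≤ JJ x ^ (n - 2)) := by
  have : ((maximalIdeal R).map (MvPolynomial.C : R →+* MvPolynomial (Fin e) R)).IsPrime := h.poly.prime
  exact h.step_aux (Localization.AtPrime ((maximalIdeal R).map (MvPolynomial.C : R →+* MvPolynomial (Fin e) R))) he hR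

theorem Ctx.lam_ne_top {R : Type u} [CommRing R] {M : Ideal R} {x : Fin e → R} (h : Ctx x M) (he : 0 < e)
    (hf : lam (JJ x) ≠ ⊤) (n : ℕ) : lam (wcl (JJ x) n) ≠ ⊤ := by
  have h1 := lam_anti (pow_le_wcl (J := JJ x) n)
  rw [h.lam_pow n he] at h1
  exact ne_top_of_le_ne_top (WithTop.mul_ne_top (ENat.natCast_ne_top _) hf) h1
end
end CMproof

end

section

open IsLocalRing Polynomial Finset
set_option maxHeartbeats 2000000
namespace CMproof
section
universe u

theorem Ctx.le_sub_two (m : ℕ) : ∀ {R : Type u} [CommRing R] [IsLocalRing R] [IsNoetherianRing R]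
    {x : Fin (m + 3) → R} (_ : Ctx x (maximalIdeal R)) {c : ℕ}
    (_ : ∀ n : ℕ, wcl (JJ x) n ≤ JJ x ^ (n - c)) (_ : lam (JJ x) ≠ ⊤) {L : ℕ → ℕ} {e : ℕ → ℤ} {N : ℕ}
    (_ : ∀ n : ℕ, lam (wcl (JJ x) n) = L n)
    (_ : ∀ n ≥ N, (L n : ℤ) = ∑ i ∈ range (m + 4), (-1) ^ i * e i * ((n + (m + 2) - i).choose (m + 3 - i) : ℕ))
    (_ : e 3 = 0) (n : ℕ), wcl (JJ x) n ≤ JJ x ^ (n - 2) := by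
  induction m with
  | zero =>
    intro R _ _ _ x h c hR hf L e N hL hP he n
    obtain ⟨ℓ, hℓ⟩ := ENat.ne_top_iff_exists.1 hf
    exact h.dim3 hR hL hP he hℓ.symm n
  | succ m ih =>
    intro R _ _ _ x h c hR hf L e N hL hP he
    obtain ⟨R', _, _, _, x', hx', hR', hl, ⟨n3, hn3⟩, hc⟩ := h.step (by omega) hR
    apply hc
    have hf' : lam (JJ x') ≠ ⊤ := by rwa [hl]
    have h1 : ∀ n : ℕ, ∃ k : ℕ, (k : ℕ∞) = lam (wcl (JJ x') n) := fun n =>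
      ENat.ne_top_iff_exists.1 (hx'.lam_ne_top (by omega) hf' n)
    choose L' hL' using h1
    refine ih hx' hR' hf' (L := L') (e := e) (N := max (N + 1) (n3 + 1)) (fun n => (hL' n).symm) ?_ he
    intro n hn
    obtain ⟨n, rfl⟩ := Nat.exists_eq_add_of_le' (show 1 ≤ n by omega)
    have h2 := hn3 n (by omega)
    rw [hL, hL, ← hL'] at h2
    have h3 : L (n + 1) = L n + L' (n + 1) := by exact_mod_cast h2
    have h4 := hP (n + 1) (by omega)
    have h5 := hP n (by omega)
    rw [Finset.sum_range_succ] at h4 h5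
    have h6 : (L' (n + 1) : ℤ) = L (n + 1) - L n := by rw [h3]; push_cast; ring
    rw [h6, h4, h5]
    simp only [Nat.sub_self, Nat.choose_zero_right, show m + 1 + 3 - (m + 1 + 3) = 0 by omega]
    rw [add_sub_add_right_eq_sub, ← Finset.sum_sub_distrib]
    refine Finset.sum_congr rfl fun i hi => ?_
    rw [Finset.mem_range] at hi
    have e1 : n + 1 + (m + 1 + 2) - i = (n + (m + 1 + 2) - i) + 1 := by omega
    have e2 : m + 1 + 3 - i = (m + 3 - i) + 1 := by omega
    have e3 : n + 1 + (m + 2) - i = n + (m + 1 + 2) - i := by omega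
    rw [e1, e2, e3, Nat.choose_succ_succ]
    push_cast
    ring
end
end CMproof

end

section

open IsLocalRing Polynomial Finset
set_option maxHeartbeats 2000000
namespace CMproof
section
variable {R : Type*} [CommRing R] {d e : ℕ} {M : Ideal R}

/-- binomial basis -/
def bb (d i n : ℕ) : ℤ := if i ≤ d then ((n + d - 1 - i).choose (d - i) : ℕ) else 0

theorem bb_succ (d i n : ℕ) (hn : 1 ≤ n) : bb d i (n+1) = bb d i n + bb d (i+1) (n+1) := by
  unfold bb
  rcases lt_trichotomy i d with h | h | h
  · rw [if_pos h.le, if_pos h.le, if_pos (by omega)]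
    obtain ⟨k, rfl⟩ := Nat.exists_eq_add_of_lt h
    have h1 : n + 1 + (i + k + 1) - 1 - i = (n + k) + 1 := by omega
    have h2 : n + (i + k + 1) - 1 - i = (n + k) := by omega
    have h3 : n + 1 + (i + k + 1) - 1 - (i+1) = (n + k) := by omega
    have h4 : i + k + 1 - i = k + 1 := by omega
    have h5 : i + k + 1 - (i+1) = k := by omega
    rw [h1, h2, h3, h4, h5, Nat.choose_succ_succ]; push_cast; ring
  · subst h; simp
  · rw [if_neg (by omega), if_neg (by omega), if_neg (by omega)]; simp

theorem bb_down (d i n : ℕ) (h : i ≤ d) (hn : 1 ≤ n) : bb (d+1) i (n+1) - bb (d+1) i n = bb d i (n+1) := by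
  rw [bb_succ (d+1) i n hn]
  have : bb (d+1) (i+1) (n+1) = bb d i (n+1) := by
    unfold bb
    rw [if_pos (by omega), if_pos h]
    congr 2 <;> omega
  rw [this]; ring

theorem bb_unique (d : ℕ) (a : ℕ → ℤ) (N : ℕ)
    (h : ∀ n ≥ N, ∑ i ∈ range (d+1), a i * bb d i n = 0) : ∀ i ≤ d, a i = 0 := by
  induction d generalizing N with
  | zero =>
    intro i hi
    obtain rfl : i = 0 := by omega
    have := h N le_rfl
    simpa [bb] using this
  | succ d ih =>
    have h1 : ∀ i ≤ d, a i = 0 := by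
      apply ih (N+2)
      intro n hn
      obtain ⟨k, rfl⟩ : ∃ k, n = k + 1 := ⟨n-1, by omega⟩
      have e1 := h (k+1) (by omega)
      have e2 := h k (by omega)
      rw [Finset.sum_range_succ] at e1 e2
      have e3 : bb (d+1) (d+1) (k+1) = 1 := by simp [bb]
      have e4 : bb (d+1) (d+1) k = 1 := by simp [bb]
      rw [e3] at e1; rw [e4] at e2
      have : ∑ i ∈ range (d+1), a i * bb d i (k+1) =
          ∑ i ∈ range (d+1), a i * bb (d+1) i (k+1) - ∑ i ∈ range (d+1), a i * bb (d+1) i k := by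
        rw [← Finset.sum_sub_distrib]
        apply Finset.sum_congr rfl
        intro i hi
        rw [← mul_sub, bb_down d i k (by simp at hi; omega) (by omega)]
      rw [this]; linarith
    intro i hi
    rcases Nat.lt_or_ge d i with hi' | hi'
    · obtain rfl : i = d + 1 := by omega
      have := h N le_rfl
      rw [Finset.sum_range_succ, Finset.sum_eq_zero] at this
      · simpa [bb] using this
      · intro j hj; rw [h1 j (by simp at hj; omega)]; simp
    · exact h1 i hi'

def sh (c : ℕ → ℤ) : ℕ → ℤ := fun i => c i - (if i = 0 then 0 else c (i-1))

theorem sh_sum (d : ℕ) (c : ℕ → ℤ) (n : ℕ) (hn : 1 ≤ n) :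
    ∑ i ∈ range (d+1), sh c i * bb d i (n+1) = ∑ i ∈ range (d+1), c i * bb d i n := by
  have h1 : ∀ i, c i * bb d i n = c i * bb d i (n+1) - c i * bb d (i+1) (n+1) := by
    intro i; rw [bb_succ d i n hn]; ring
  simp_rw [h1, Finset.sum_sub_distrib, sh, sub_mul, Finset.sum_sub_distrib]
  congr 1
  rw [Finset.sum_range_succ', Finset.sum_range_succ]
  have : bb d (d+1) (n+1) = 0 := by simp [bb]
  simp [this]

theorem sh_iter_sum (d : ℕ) (c : ℕ → ℤ) (n q : ℕ) (hn : 1 ≤ n) :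
    ∑ i ∈ range (d+1), (sh^[q] c) i * bb d i (n+q) = ∑ i ∈ range (d+1), c i * bb d i n := by
  induction q with
  | zero => simp
  | succ q ih =>
    rw [Function.iterate_succ_apply', ← add_assoc, sh_sum _ _ _ (by omega), ih]

def dl (j : ℕ) : ℕ → ℤ := fun i => if i = j then 1 else 0

theorem sh_dl (q : ℕ) : (sh^[q] (dl 1)) 0 = 0 ∧ (sh^[q] (dl 1)) 1 = 1 ∧ (sh^[q] (dl 1)) 2 = -q
    ∧ 2 * (sh^[q] (dl 1)) 3 = q * (q-1) := by
  induction q with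
  | zero => simp [dl]
  | succ q ih =>
    rw [Function.iterate_succ_apply']
    obtain ⟨h0, h1, h2, h3⟩ := ih
    simp only [sh]
    refine ⟨by simp [h0], by simp [h0, h1], by simp [h1, h2]; ring, ?_⟩
    simp only [show (3:ℕ) ≠ 0 by norm_num, if_false, show 3 - 1 = 2 by norm_num, h2, mul_sub, h3]
    push_cast; ring

theorem dl_sum (d j n : ℕ) (h : j ≤ d) : ∑ i ∈ range (d+1), dl j i * bb d i n = bb d j n := by
  simp [dl, show j < d + 1 by omega]

/-- final numeric contradiction -/
theorem e3_ne (m p ℓ a : ℕ) (hp : 1 ≤ p) (e : ℕ → ℤ) (N : ℕ)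
    (h : ∀ s ≥ N, ∑ i ∈ range (m+4), (-1)^i * e i * (((s+p+2) + (m+2) - i).choose (m+3-i) : ℕ) =
      ((s+p+(m+3)-1).choose (m+3) : ℕ) * (ℓ:ℤ) + ((m+3+(s+p)-1).choose (s+p) : ℕ) * (a:ℤ)
        + ((m+3+(s+p+1)-1).choose (s+p+1) : ℕ) - ((m+3+s-1).choose s : ℕ)) : e 3 ≠ 0 := by
  intro he
  set c : ℕ → ℤ := fun i => ℓ * (sh^[2] (dl 0)) i + a * (sh^[1] (dl 1)) i + dl 1 i - (sh^[p+1] (dl 1)) i with hc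
  have key := bb_unique (m+3) (fun i => (-1)^i * e i - c i) (N + p + 10) ?_ 3 (by omega)
  · simp only [he, hc] at key
    have h1 := (sh_dl (p+1)).2.2.2
    simp [sh, dl] at key
    rw [Function.iterate_succ_apply, key] at h1
    push_cast at h1
    have : (1:ℤ) ≤ p := by exact_mod_cast hp
    nlinarith
  · intro n hn
    obtain ⟨s, rfl⟩ : ∃ s, n = s + p + 2 := ⟨n - p - 2, by omega⟩
    have e1 := h s (by omega)
    have e2 : ∑ i ∈ range (m+4), (-1)^i * e i * (((s+p+2) + (m+2) - i).choose (m+3-i) : ℕ) =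
       ∑ i ∈ range (m+3+1), (-1)^i * e i * bb (m+3) i (s+p+2) := by
      apply Finset.sum_congr rfl
      intro i hi
      rw [bb, if_pos (by simp at hi; omega)]
      congr 2
    have f0 := sh_iter_sum (m+3) (dl 0) (s+p) 2 (by omega)
    have f1 := sh_iter_sum (m+3) (dl 1) (s+p+1) 1 (by omega)
    have f2 := sh_iter_sum (m+3) (dl 1) (s+1) (p+1) (by omega)
    have f3 := dl_sum (m+3) 1 (s+p+2) (by omega)
    rw [dl_sum _ _ _ (by omega)] at f0 f1 f2
    rw [show s + p + 1 + 1 = s + p + 2 by omega] at f1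
    rw [show s + 1 + (p + 1) = s + p + 2 by omega] at f2
    simp_rw [hc, sub_mul, add_mul, mul_assoc, Finset.sum_sub_distrib, Finset.sum_add_distrib, ← Finset.mul_sum]
    simp_rw [mul_assoc] at e2
    simp_rw [mul_assoc] at e1
    rw [f0, f1, f2, f3, ← e2, e1]
    simp only [bb]
    rw [if_pos (show 0 ≤ m + 3 by omega)]
    simp only [if_pos (show 1 ≤ m + 3 by omega)]
    have g1 : ∀ u v : ℕ, (m+3+u-1).choose u = (u + 1 + (m+3) -1 -1).choose (m+3-1) := by
      intro u _
      rw [show m + 3 + u - 1 = u + (m+2) by omega, show u + 1 + (m+3) - 1 - 1 = u + (m+2) by omega,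
        show m+3-1 = m+2 by omega, Nat.choose_symm_add]
    rw [g1 s 0, g1 (s+p) 0, g1 (s+p+1) 0]
    simp only [Nat.sub_zero]
    ring
end
end CMproof

end

section

open IsLocalRing Polynomial Finset
set_option maxHeartbeats 2000000
namespace CMproof
section
variable {R : Type*} [CommRing R] {d e : ℕ} {M : Ideal R}

noncomputable def scal (k : Type*) [Field k] (d : ℕ) : MvPolynomial (Fin d) k →ₐ[k] (MvPolynomial (Fin d) k)[X] :=
  MvPolynomial.aeval (fun i => Polynomial.C (MvPolynomial.X i) * Polynomial.X)

theorem scal_coeff {k : Type*} [Field k] (f : MvPolynomial (Fin d) k) (n : ℕ) :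
    (scal k d f).coeff n = MvPolynomial.homogeneousComponent n f := by
  induction f using MvPolynomial.monomial_add_induction_on with
  | C a =>
    simp only [scal, MvPolynomial.aeval_C]
    rw [Polynomial.algebraMap_apply, Polynomial.coeff_C, MvPolynomial.algebraMap_eq]
    split_ifs with h
    · subst h; simp
    · rw [MvPolynomial.homogeneousComponent_of_mem (MvPolynomial.isHomogeneous_C _ a), if_neg h]
  | monomial_add s c f _ _ hf =>
    rw [map_add, Polynomial.coeff_add, hf, map_add]
    congr 1
    have : scal k d (MvPolynomial.monomial s c) = Polynomial.C (MvPolynomial.monomial s c) * Polynomial.X ^ (s.degree) := by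
      rw [scal, MvPolynomial.aeval_monomial, Finsupp.prod]
      simp_rw [mul_pow]
      rw [Finset.prod_mul_distrib, Finset.prod_pow_eq_pow_sum, ← mul_assoc]
      congr 1
      rw [MvPolynomial.monomial_eq, Finsupp.prod, map_mul, map_prod]
      simp only [map_pow]
      rfl
    rw [this, Polynomial.coeff_C_mul_X_pow]
    rw [MvPolynomial.homogeneousComponent_of_mem (MvPolynomial.isHomogeneous_monomial (n := s.degree) c rfl)]

theorem scal_eval {k : Type*} [Field k] (f : MvPolynomial (Fin d) k) : (scal k d f).eval 1 = f := by
  have : ((Polynomial.evalRingHom (1 : MvPolynomial (Fin d) k)).comp (scal k d).toRingHom) = RingHom.id _ := by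
    apply MvPolynomial.ringHom_ext
    · intro r
      simp [scal]
    · intro i; simp [scal]
  exact congrArg (fun g => g f) this

theorem homog_of_mul {k : Type*} [Field k] {a b : MvPolynomial (Fin d) k} {n : ℕ}
    (h : (a * b).IsHomogeneous n) (h0 : a * b ≠ 0) : ∃ i, a.IsHomogeneous i := by
  classical
  have h1 : scal k d (a*b) = Polynomial.C (a*b) * Polynomial.X^n := by
    ext1 j
    rw [scal_coeff, Polynomial.coeff_C_mul_X_pow, MvPolynomial.homogeneousComponent_of_mem h]
  have ha : scal k d a ≠ 0 := by
    intro hh; apply h0; rw [← scal_eval a, hh]; simp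
  have hb : scal k d b ≠ 0 := by
    intro hh; apply h0; rw [← scal_eval b, hh]; simp
  rw [map_mul] at h1
  have e1 := Polynomial.natDegree_mul ha hb
  have e2 := Polynomial.natTrailingDegree_mul ha hb
  rw [h1] at e1 e2
  rw [Polynomial.C_mul_X_pow_eq_monomial, Polynomial.natDegree_monomial, if_neg h0] at e1
  rw [Polynomial.C_mul_X_pow_eq_monomial, Polynomial.natTrailingDegree_monomial h0] at e2
  have i1 := Polynomial.natTrailingDegree_le_natDegree (scal k d a)
  have i2 := Polynomial.natTrailingDegree_le_natDegree (scal k d b)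
  have i3 : (scal k d a).natTrailingDegree = (scal k d a).natDegree := by omega
  refine ⟨(scal k d a).natDegree, ?_⟩
  have : scal k d a = Polynomial.C ((scal k d a).coeff (scal k d a).natDegree) * Polynomial.X ^ (scal k d a).natDegree := by
    ext1 j
    rw [Polynomial.coeff_C_mul_X_pow]
    split_ifs with hj
    · rw [hj]
    · rcases lt_or_gt_of_ne hj with hj | hj
      · exact Polynomial.coeff_eq_zero_of_lt_natTrailingDegree (by omega)
      · exact Polynomial.coeff_eq_zero_of_natDegree_lt hj
  have h2 := congrArg (Polynomial.eval 1) this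
  rw [scal_eval] at h2
  rw [Polynomial.eval_mul, Polynomial.eval_C, Polynomial.eval_pow, Polynomial.eval_X, one_pow, mul_one, scal_coeff] at h2
  nth_rewrite 1 [h2]
  exact MvPolynomial.homogeneousComponent_isHomogeneous _ _

theorem rel_inf (A B : Ideal R) : rel (A ⊔ B) B = rel A (A ⊓ B) :=
  (LinearMap.quotientInfEquivSupQuotient A B).length_eq.symm

theorem rel_mul {A A' B B' : Ideal R} (z : R) (hz : ∀ a ∈ A, a * z ∈ B)
    (h1 : ∀ b ∈ B, ∃ a ∈ A, b - a * z ∈ B') (h2 : ∀ a ∈ A, a * z ∈ B' ↔ a ∈ A') : rel B B' = rel A A' := by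
  let f : A →ₗ[R] B := (((LinearMap.mul R R).flip z).domRestrict A).codRestrict B (fun a => hz a a.2)
  let g : A →ₗ[R] idealQuot B B' := (Submodule.mkQ _).comp f
  have hg : Function.Surjective g := by
    intro y
    obtain ⟨b, rfl⟩ := Submodule.mkQ_surjective _ y
    obtain ⟨a, ha, hab⟩ := h1 b b.2
    refine ⟨⟨a, ha⟩, ?_⟩
    symm
    apply (Submodule.Quotient.eq _).2
    simpa [f, mul_comm z] using hab
  have hk : LinearMap.ker g = Submodule.comap A.subtype A' := by
    ext a
    rw [LinearMap.mem_ker]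
    have : g a = 0 ↔ a.1 * z ∈ B' := by
      simp only [g, LinearMap.comp_apply, Submodule.mkQ_apply, Submodule.Quotient.mk_eq_zero]
      simp [f, mul_comm z]
    rw [this, h2 a a.2]; simp
  exact (((Submodule.quotEquivOfEq _ _ hk).symm.trans (g.quotKerEquivOfSurjective hg)).length_eq).symm

/-- lift of homogeneous polynomial -/
theorem lift_homog (M : Ideal R) {n : ℕ} {f : MvPolynomial (Fin d) (R ⧸ M)} (hf : f.IsHomogeneous n) :
    ∃ F : MvPolynomial (Fin d) R, F.IsHomogeneous n ∧ F.map (Ideal.Quotient.mk M) = f := by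
  obtain ⟨F, rfl⟩ := MvPolynomial.map_surjective (Ideal.Quotient.mk M) Ideal.Quotient.mk_surjective f
  refine ⟨MvPolynomial.homogeneousComponent n F, MvPolynomial.homogeneousComponent_isHomogeneous _ _, ?_⟩
  ext m
  rw [MvPolynomial.coeff_map, MvPolynomial.coeff_homogeneousComponent]
  split_ifs with h
  · rw [MvPolynomial.coeff_map]
  · by_contra h'
    rw [map_zero] at h'
    have := hf (Ne.symm h')
    apply h; rw [← this, Finsupp.degree_eq_weight_one]; rfl

theorem eval_congr {x : Fin d → R} {n : ℕ} {F G : MvPolynomial (Fin d) R} (hF : F.IsHomogeneous n) (hG : G.IsHomogeneous n)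
    (h : F.map (Ideal.Quotient.mk M) = G.map (Ideal.Quotient.mk M)) :
    F.eval x - G.eval x ∈ M * JJ x ^ n := by
  rw [← map_sub]
  apply eval_mem_mul M (hF.sub hG)
  intro m
  rw [MvPolynomial.coeff_sub]
  apply (Ideal.Quotient.eq).1
  rw [← MvPolynomial.coeff_map, ← MvPolynomial.coeff_map, h]

theorem Ctx.map_eq {x : Fin d → R} (h : Ctx x M) {n : ℕ} {F G : MvPolynomial (Fin d) R}
    (hF : F.IsHomogeneous n) (hG : G.IsHomogeneous n)
    (h' : F.eval x - G.eval x ∈ M * JJ x ^ n) : F.map (Ideal.Quotient.mk M) = G.map (Ideal.Quotient.mk M) := by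
  by_contra hne
  apply h.not_mem_of_coeff (hF.sub hG) ?_ (by rw [map_sub]; exact h')
  by_contra hh
  push Not at hh
  apply hne
  ext m
  rw [MvPolynomial.coeff_map, MvPolynomial.coeff_map]
  apply Ideal.Quotient.eq.2
  rw [← MvPolynomial.coeff_sub]; exact hh m

theorem map_ne_zero_iff' {F : MvPolynomial (Fin d) R} :
    F.map (Ideal.Quotient.mk M) ≠ 0 ↔ ∃ m, F.coeff m ∉ M := by
  rw [Ne, MvPolynomial.ext_iff]
  push Not
  simp [MvPolynomial.coeff_map, Ideal.Quotient.eq_zero_iff_mem]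
end
end CMproof

end

section

open IsLocalRing Polynomial Finset
set_option maxHeartbeats 2000000
namespace CMproof
section
variable {R : Type*} [CommRing R] [IsLocalRing R] {d e : ℕ} {x : Fin d → R}

theorem Ctx.one_nmem {M : Ideal R} (h : Ctx x M) {r : ℝ} (hr : 0 < r) : (1:R) ∉ wcl (JJ x) r := by
  intro h1
  obtain ⟨c, hc⟩ := mem_wcl.1 h1
  obtain ⟨n, hn⟩ := exists_nat_ge ((1 + c)/r)
  have := hc n 1 (by rw [div_le_iff₀ hr] at hn; push_cast; linarith)
  rw [one_pow, pow_one] at this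
  exact h.prime.ne_top ((Ideal.eq_top_iff_one _).2 (h.le this))

theorem Ctx.E1 {M : Ideal R} (h : Ctx x M) {k : ℕ} {a : R} (h1 : a ∈ wcl (JJ x) ((k+1:ℕ):ℝ)) (h2 : a ∈ JJ x ^ k) :
    a ∈ M * JJ x ^ k := by
  by_contra hn
  apply h.one_nmem (r := 1) one_pos
  apply h.cancel_wcl h2 hn
  rw [mul_one]; push_cast at h1; rwa [add_comm]

variable (h : Ctx x (maximalIdeal R)) (hm : maximalIdeal R ≤ wcl (JJ x) (1:ℕ))
  (h2 : ∀ n : ℕ, wcl (JJ x) n ≤ JJ x ^ (n-2))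
include h hm

theorem Ctx.mJ_le : maximalIdeal R * JJ x ≤ wcl (JJ x) (2:ℕ) := by
  apply Ideal.mul_le.2
  intro a ha b hb
  have := mul_mem_wcl (hm ha) (pow_le_wcl 1 (by rwa [pow_one]) : b ∈ wcl (JJ x) (1:ℕ))
  convert this using 2
  norm_num

theorem Ctx.mJ_le' (k : ℕ) : maximalIdeal R * JJ x ^ (k+1) ≤ JJ x ^ k * wcl (JJ x) (2:ℕ) := by
  rw [pow_succ', ← mul_assoc, mul_comm]
  exact Ideal.mul_mono_right (h.mJ_le hm)

omit h hm [IsLocalRing R] in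
theorem B_le (k : ℕ) (p : ℕ) : JJ x ^ k * wcl (JJ x) (p:ℕ) ≤ wcl (JJ x) ((k+p:ℕ):ℝ) := by
  apply Ideal.mul_le.2
  intro a ha b hb
  have := mul_mem_wcl (pow_le_wcl k ha) hb
  push_cast; exact this

theorem Ctx.EL {k : ℕ} {a b g : R} (ha : a ∈ wcl (JJ x) ((k+2:ℕ):ℝ)) (hb : b ∈ JJ x ^ k * wcl (JJ x) (2:ℕ))
    (hg : g ∈ JJ x ^ (k+1)) (hab : a = b + g) : a ∈ JJ x ^ k * wcl (JJ x) (2:ℕ) := by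
  have h1 : g ∈ wcl (JJ x) ((k+2:ℕ):ℝ) := by
    have : g = a - b := by rw [hab]; ring
    rw [this]; exact sub_mem ha (B_le k 2 hb)
  rw [hab]
  exact add_mem hb (h.mJ_le' hm k (h.E1 h1 hg))

include h2 in
theorem Ctx.E2 {Q : Ideal R} (hQ : ∀ a, (∀ u ∈ maximalIdeal R, u * a ∈ JJ x) → a ∈ Q) (k : ℕ) :
    wcl (JJ x) ((k+2:ℕ):ℝ) ≤ Q * JJ x ^ k := by
  intro a ha
  have h0 := h2 (k+2) ha
  obtain ⟨f, hf, rfl⟩ := mem_pow_iff.1 h0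
  rw [show k + 2 - 2 = k by omega] at hf
  apply eval_mem_mul Q hf
  intro m
  apply hQ
  intro u hu
  have h1 : u * f.eval x ∈ wcl (JJ x) ((k + 3:ℕ):ℝ) := by
    have := mul_mem_wcl (hm hu) ha
    convert this using 2; push_cast; ring
  have h3 := h2 _ h1
  have := h.qreg k (MvPolynomial.C u * f) (by simpa using (MvPolynomial.isHomogeneous_C _ u).mul hf) (by simpa using h3) m
  simpa using this

omit h hm [IsLocalRing R] in
theorem decomp {I : Ideal R} {w : R} {k : ℕ} {a : R}
    (ha : a ∈ (I ⊔ JJ x ⊔ Ideal.span {w}) * JJ x ^ k) :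
    ∃ b ∈ JJ x ^ k * I, ∃ g ∈ JJ x ^ (k+1), ∃ F ∈ JJ x ^ k, a = b + g + F * w := by
  rw [Ideal.sup_mul, Ideal.sup_mul] at ha
  obtain ⟨y, hy, c, hc, rfl⟩ := Submodule.mem_sup.1 ha
  obtain ⟨b, hb, g, hg, rfl⟩ := Submodule.mem_sup.1 hy
  obtain ⟨F, hF, rfl⟩ := Ideal.mem_span_singleton_mul.1 hc
  exact ⟨b, by rwa [mul_comm], g, by rwa [pow_succ'], F, hF, by ring⟩

omit h hm in
/-- length one quotient -/
theorem exists_w {P Q : Ideal R} (hPQ : P ≤ Q) (hfin : lam P ≠ ⊤) (h1 : rel Q P ≤ 1) (hne : ¬ Q ≤ P) :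
    ∃ w ∈ Q, w ∉ P ∧ Q = P ⊔ Ideal.span {w} ∧ ∀ u ∈ maximalIdeal R, u * w ∈ P := by
  obtain ⟨w, hw, hwP⟩ := SetLike.not_le_iff_exists.1 hne
  have key : ∀ v ∈ Q, v ∉ P → Q = P ⊔ Ideal.span {v} := by
    intro v hv hvP
    have hle : P ⊔ Ideal.span {v} ≤ Q := sup_le hPQ ((Ideal.span_singleton_le_iff_mem _).2 hv)
    have hvm : v ∈ P ⊔ Ideal.span {v} := Ideal.mem_sup_right (Ideal.mem_span_singleton_self v)
    refine eq_of_lam hle ?_ ?_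
    · exact ne_top_of_le_ne_top hfin (lam_anti le_sup_left)
    · by_contra hlt
      push Not at hlt
      have a1 := lam_add hPQ
      have a3 : lam (P ⊔ Ideal.span {v}) < lam P := by
        by_contra hh
        push Not at hh
        exact hvP ((eq_of_lam (le_sup_left : P ≤ P ⊔ Ideal.span {v}) hfin hh) ▸ hvm)
      have a4 : lam Q + 1 ≤ lam (P ⊔ Ideal.span {v}) := Order.add_one_le_of_lt hlt
      have : lam P ≤ lam (P ⊔ Ideal.span {v}) := by
        rw [a1, add_comm]; exact (add_le_add_right h1 _).trans a4
      exact absurd a3 (not_lt.2 this)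
  refine ⟨w, hw, hwP, key w hw hwP, ?_⟩
  intro u hu
  by_contra hn
  have := key (u*w) (Q.mul_mem_left _ hw) hn
  rw [this] at hw
  obtain ⟨p, hp, c, hc, hpc⟩ := Submodule.mem_sup.1 hw
  obtain ⟨r, rfl⟩ := Ideal.mem_span_singleton'.1 hc
  apply hwP
  have hu' : IsUnit (1 - r * u) := by
    by_contra hh
    have := (maximalIdeal R).add_mem ((mem_maximalIdeal _).2 hh) ((maximalIdeal R).mul_mem_left r hu)
    rw [sub_add_cancel] at this
    exact (Ideal.ne_top_iff_one _).1 (maximalIdeal.isMaximal R).ne_top this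
  have : (1 - r * u) * w ∈ P := by
    have : (1 - r * u) * w = p := by linear_combination -hpc
    rwa [this]
  exact (Ideal.unit_mul_mem_iff_mem P hu').1 this
end
end CMproof

end

section

open IsLocalRing Polynomial Finset
set_option maxHeartbeats 2000000
namespace CMproof
section
variable {R : Type*} [CommRing R] [IsLocalRing R] {d e : ℕ} {x : Fin d → R}
variable (h : Ctx x (maximalIdeal R)) (hm : maximalIdeal R ≤ wcl (JJ x) (1:ℕ))
include h hm

theorem Ctx.mw {w F g : R} {k : ℕ} (hwP : ∀ u ∈ maximalIdeal R, u * w ∈ wcl (JJ x) (2:ℕ) ⊔ JJ x)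
    (hF : F ∈ JJ x ^ k) (hF' : F ∉ maximalIdeal R * JJ x ^ k) (hg : g ∈ JJ x ^ (k+1))
    (hz : F * w + g ∈ wcl (JJ x) ((k+2:ℕ):ℝ)) :
    ∀ u ∈ maximalIdeal R, u * w ∈ wcl (JJ x) (2:ℕ) := by
  intro u hu
  obtain ⟨b, hb, g', hg', hbg⟩ := Submodule.mem_sup.1 (hwP u hu)
  rw [← hbg]
  refine add_mem hb ?_
  apply h.cancel_wcl hF hF'
  have e1 : F * g' = u * (F * w + g) - F * b - u * g := by linear_combination F * hbg
  have e2 : ((2:ℕ):ℝ) + (k:ℝ) = ((k+2:ℕ):ℝ) := by push_cast; ring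
  rw [e1, e2]
  refine sub_mem (sub_mem (Ideal.mul_mem_left _ _ hz) (B_le k 2 (Ideal.mul_mem_mul hF hb))) ?_
  exact B_le k 2 (h.mJ_le' hm k (Ideal.mul_mem_mul hu hg))

theorem Ctx.gen {w F0 g0 : R} {k0 : ℕ}
    (hwn : w ∉ wcl (JJ x) (2:ℕ) ⊔ JJ x)
    (hw2 : ∀ u ∈ maximalIdeal R, u * w ∈ wcl (JJ x) (2:ℕ))
    (hF : F0 ∈ JJ x ^ k0) (hF' : F0 ∉ maximalIdeal R * JJ x ^ k0) (hg : g0 ∈ JJ x ^ (k0+1))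
    (hz : F0 * w + g0 ∈ wcl (JJ x) ((k0+2:ℕ):ℝ)) :
    ∃ (p : ℕ) (F g : R), 1 ≤ p ∧ F ∈ JJ x ^ p ∧ F ∉ maximalIdeal R * JJ x ^ p ∧ g ∈ JJ x ^ (p+1) ∧
      F * w + g ∈ wcl (JJ x) ((p+2:ℕ):ℝ) ∧
      ∀ (s : ℕ) (G g' : R), G ∈ JJ x ^ (s+p) → g' ∈ JJ x ^ (s+p+1) →
        G * w + g' ∈ wcl (JJ x) ((s+p+2:ℕ):ℝ) → ∃ H ∈ JJ x ^ s, G - H * F ∈ maximalIdeal R * JJ x ^ (s+p) := by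
  letI : Field (R ⧸ maximalIdeal R) := Ideal.Quotient.field _
  set π := Ideal.Quotient.mk (maximalIdeal R) with hπ
  obtain ⟨f0, hf0, hf0', rfl⟩ := Ctx.exists_of_not_mem hF hF'
  obtain ⟨q0, hq0, rfl⟩ := mem_pow_iff.1 hg
  have hf0n : f0.map π ≠ 0 := map_ne_zero_iff'.2 hf0'
  obtain ⟨a', b', c', hrel, hca, hcb⟩ := UniqueFactorizationMonoid.exists_reduced_factors (f0.map π) hf0n (q0.map π)
  have hfm : (f0.map π).IsHomogeneous k0 := hf0.map _
  have hqm : (q0.map π).IsHomogeneous (k0+1) := hq0.map _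
  obtain ⟨c, hc⟩ := homog_of_mul (a := c') (b := a') (by rw [hca]; exact hfm) (by rw [hca]; exact hf0n)
  obtain ⟨p, hp⟩ := homog_of_mul (a := a') (b := c') (by rw [mul_comm, hca]; exact hfm) (by rw [mul_comm, hca]; exact hf0n)
  have hcn : c' ≠ 0 := by rintro rfl; apply hf0n; rw [← hca, zero_mul]
  have han : a' ≠ 0 := by rintro rfl; apply hf0n; rw [← hca, mul_zero]
  have hcp : c + p = k0 := by
    have := hc.mul hp
    rw [hca] at this
    exact this.inj_right hfm hf0n
  have hb : b'.IsHomogeneous (p+1) := by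
    rcases eq_or_ne b' 0 with rfl | hb0
    · exact MvPolynomial.isHomogeneous_zero _ _ _
    · have hn : q0.map π ≠ 0 := by rw [← hcb]; exact mul_ne_zero hcn hb0
      obtain ⟨q, hq⟩ := homog_of_mul (a := b') (b := c') (by rw [mul_comm, hcb]; exact hqm) (by rw [mul_comm, hcb]; exact hn)
      have := hc.mul hq
      rw [hcb] at this
      have := this.inj_right hqm hn
      rwa [show p + 1 = q by omega]
  obtain ⟨C, hC, rfl⟩ := lift_homog _ hc
  obtain ⟨F, hFh, rfl⟩ := lift_homog _ hp
  obtain ⟨g, hgh, rfl⟩ := lift_homog _ hb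
  have hFn := h.not_mem_of_coeff hFh (map_ne_zero_iff'.1 han)
  have hCn := h.not_mem_of_coeff hC (map_ne_zero_iff'.1 hcn)
  have hFm : F.eval x ∈ JJ x ^ p := mem_pow_iff.2 ⟨F, hFh, rfl⟩
  have hCm : C.eval x ∈ JJ x ^ c := mem_pow_iff.2 ⟨C, hC, rfl⟩
  have hgm : g.eval x ∈ JJ x ^ (p+1) := mem_pow_iff.2 ⟨g, hgh, rfl⟩
  have hmw : ∀ k, ∀ a ∈ maximalIdeal R * JJ x ^ k, a * w ∈ JJ x ^ k * wcl (JJ x) (2:ℕ) := by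
    intro k a ha
    induction ha using Submodule.mul_induction_on' with
    | mem_mul_mem u hu j hj =>
      rw [show u * j * w = j * (u * w) by ring]
      exact Ideal.mul_mem_mul hj (hw2 u hu)
    | add a _ b _ ha hb => rw [add_mul]; exact add_mem ha hb
  have hz2 : F.eval x * w + g.eval x ∈ wcl (JJ x) ((p+2:ℕ):ℝ) := by
    apply h.cancel_wcl hCm hCn
    have e1 : (p+2:ℕ) + (c:ℝ) = ((k0+2:ℕ):ℝ) := by rw [← hcp]; push_cast; ring
    rw [e1]
    have i1 : (C * F).eval x - f0.eval x ∈ maximalIdeal R * JJ x ^ k0 :=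
      eval_congr (by rw [← hcp]; exact hC.mul hFh) hf0 (by rw [map_mul]; exact hca)
    have i2 : (C * g).eval x - q0.eval x ∈ maximalIdeal R * JJ x ^ (k0+1) :=
      eval_congr (by rw [← hcp, add_assoc]; exact hC.mul hgh) hq0 (by rw [map_mul]; exact hcb)
    have e2 : C.eval x * (F.eval x * w + g.eval x) = (f0.eval x * w + q0.eval x) +
        (((C * F).eval x - f0.eval x) * w + ((C * g).eval x - q0.eval x)) := by
      simp only [map_mul]; ring
    rw [e2]
    exact add_mem hz (B_le k0 2 (add_mem (hmw _ _ i1) (h.mJ_le' hm k0 i2)))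
  refine ⟨p, F.eval x, g.eval x, ?_, hFm, hFn, hgm, hz2, ?_⟩
  · by_contra hp0
    obtain rfl : p = 0 := by omega
    rw [pow_zero, Ideal.one_eq_top, Ideal.mul_top] at hFn
    have hu : IsUnit (F.eval x) := by
      by_contra hh; exact hFn ((mem_maximalIdeal _).2 hh)
    apply hwn
    apply (Ideal.unit_mul_mem_iff_mem _ hu).1
    have : F.eval x * w = (F.eval x * w + g.eval x) - g.eval x := by ring
    rw [this]
    refine sub_mem (Ideal.mem_sup_left (by simpa using hz2)) (Ideal.mem_sup_right (by simpa using hgm))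
  · intro s G g' hG hg' hGw
    obtain ⟨Gp, hGp, rfl⟩ := mem_pow_iff.1 hG
    obtain ⟨gp, hgp, rfl⟩ := mem_pow_iff.1 hg'
    have i1 : gp.eval x * F.eval x - g.eval x * Gp.eval x ∈ maximalIdeal R * JJ x ^ (s + p + p + 1) := by
      apply h.E1
      · have e1 : gp.eval x * F.eval x - g.eval x * Gp.eval x = F.eval x * (Gp.eval x * w + gp.eval x)
          - Gp.eval x * (F.eval x * w + g.eval x) := by ring
        rw [e1]
        refine sub_mem ?_ ?_
        · have := B_le p (s+p+2) (Ideal.mul_mem_mul hFm hGw)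
          rwa [show p + (s + p + 2) = s + p + p + 1 + 1 by omega] at this
        · have := B_le (s+p) (p+2) (Ideal.mul_mem_mul hG hz2)
          rwa [show s + p + (p + 2) = s + p + p + 1 + 1 by omega] at this
      · refine sub_mem ?_ ?_
        · rw [show s + p + p + 1 = (s+p+1) + p by omega, pow_add]; exact Ideal.mul_mem_mul hg' hFm
        · rw [show s + p + p + 1 = (p+1) + (s+p) by omega, pow_add]; exact Ideal.mul_mem_mul hgm hG
    have i2 : (gp * F).map π = (g * Gp).map π := by
      apply h.map_eq (n := s + p + p + 1)
      · rw [show s + p + p + 1 = (s+p+1) + p by omega]; exact hgp.mul hFh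
      · rw [show s + p + p + 1 = (p+1) + (s+p) by omega]; exact hgh.mul hGp
      · simpa using i1
    rw [map_mul, map_mul] at i2
    have hdvd : F.map π ∣ Gp.map π := hrel.dvd_of_dvd_mul_left ⟨gp.map π, by rw [← i2, mul_comm]⟩
    obtain ⟨q, hq⟩ := hdvd
    have hqh : q.IsHomogeneous s := by
      rcases eq_or_ne q 0 with rfl | hq0
      · exact MvPolynomial.isHomogeneous_zero _ _ _
      · have hn : Gp.map π ≠ 0 := by rw [hq]; exact mul_ne_zero han hq0
        have hGm : (Gp.map π).IsHomogeneous (s+p) := hGp.map _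
        obtain ⟨q1, hq1⟩ := homog_of_mul (a := q) (b := F.map π) (by rw [mul_comm, ← hq]; exact hGm) (by rw [mul_comm, ← hq]; exact hn)
        have := hp.mul hq1
        rw [← hq] at this
        have := this.inj_right hGm hn
        rwa [show s = q1 by omega]
    obtain ⟨H, hH, rfl⟩ := lift_homog _ hqh
    refine ⟨H.eval x, mem_pow_iff.2 ⟨H, hH, rfl⟩, ?_⟩
    rw [← map_mul]
    apply eval_congr hGp (hH.mul hFh)
    rw [map_mul, mul_comm]; exact hq
end
end CMproof

end

section

open IsLocalRing Polynomial Finset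
set_option maxHeartbeats 2000000
namespace CMproof
section
variable {R : Type*} [CommRing R] [IsLocalRing R] {d e : ℕ} {x : Fin d → R}

theorem lam_max : lam (maximalIdeal R) = 1 := by
  have : IsSimpleModule R (R ⧸ maximalIdeal R) := by
    rw [isSimpleModule_iff_isCoatom]; exact Ideal.isMaximal_def.1 inferInstance
  exact Module.length_eq_one _ _

variable (h : Ctx x (maximalIdeal R)) (hm : maximalIdeal R ≤ wcl (JJ x) (1:ℕ))
include h hm

/-- length of R/B_n -/
theorem Ctx.lam_B (hd : 0 < d) (k : ℕ) : lam (JJ x ^ k * wcl (JJ x) (2:ℕ)) =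
    ((k + d - 1).choose d : ℕ) * lam (JJ x) + ((d + k - 1).choose k : ℕ) * lam (wcl (JJ x) (2:ℕ) ⊔ JJ x)
     + ((d + (k+1) - 1).choose (k+1) : ℕ) := by
  set B := JJ x ^ k * wcl (JJ x) (2:ℕ) with hB
  have e1 : JJ x ^ (k+1) ⊔ B = (wcl (JJ x) (2:ℕ) ⊔ JJ x) * JJ x ^ k := by
    rw [Ideal.sup_mul, hB, pow_succ', mul_comm (JJ x ^ k), sup_comm]
  have e2 : JJ x ^ (k+1) ⊓ B = maximalIdeal R * JJ x ^ (k+1) := by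
    apply le_antisymm
    · rintro a ⟨ha, hb⟩
      exact h.E1 (B_le k 2 hb) ha
    · exact le_inf Ideal.mul_le_right (h.mJ_le' hm k)
  have e3 := lam_add (le_sup_right : B ≤ JJ x ^ (k+1) ⊔ B)
  rw [rel_inf, e2, h.rel_pow (k+1) h.le, lam_max, mul_one, e1] at e3
  have e4 := lam_add (A := JJ x ^ k) (B := (wcl (JJ x) (2:ℕ) ⊔ JJ x) * JJ x ^ k) Ideal.mul_le_right
  rw [h.rel_pow k le_sup_right, h.lam_pow k hd] at e4
  rw [e3, e4]; ring

theorem Ctx.rel_gen {w F g : R} {p : ℕ}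
    (hwn : w ∉ wcl (JJ x) (2:ℕ) ⊔ JJ x)
    (hw2 : ∀ u ∈ maximalIdeal R, u * w ∈ wcl (JJ x) (2:ℕ))
    (hdec : ∀ k : ℕ, wcl (JJ x) ((k+2:ℕ):ℝ) ≤ (wcl (JJ x) (2:ℕ) ⊔ JJ x ⊔ Ideal.span {w}) * JJ x ^ k)
    (hF : F ∈ JJ x ^ p) (hF' : F ∉ maximalIdeal R * JJ x ^ p) (hg : g ∈ JJ x ^ (p+1))
    (hz : F * w + g ∈ wcl (JJ x) ((p+2:ℕ):ℝ))
    (hgen : ∀ (s : ℕ) (G g' : R), G ∈ JJ x ^ (s+p) → g' ∈ JJ x ^ (s+p+1) →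
        G * w + g' ∈ wcl (JJ x) ((s+p+2:ℕ):ℝ) → ∃ H ∈ JJ x ^ s, G - H * F ∈ maximalIdeal R * JJ x ^ (s+p)) (s : ℕ) :
    rel (wcl (JJ x) ((s+p+2:ℕ):ℝ)) (JJ x ^ (s+p) * wcl (JJ x) (2:ℕ)) = ((d + s - 1).choose s : ℕ) := by
  have hmw : ∀ k, ∀ a ∈ maximalIdeal R * JJ x ^ k, a * w ∈ JJ x ^ k * wcl (JJ x) (2:ℕ) := by
    intro k a ha
    induction ha using Submodule.mul_induction_on' with
    | mem_mul_mem u hu j hj =>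
      rw [show u * j * w = j * (u * w) by ring]
      exact Ideal.mul_mem_mul hj (hw2 u hu)
    | add a _ b _ ha hb => rw [add_mul]; exact add_mem ha hb
  have hHz : ∀ H ∈ JJ x ^ s, H * (F * w + g) ∈ wcl (JJ x) ((s+p+2:ℕ):ℝ) := by
    intro H hH
    have := B_le s (p+2) (Ideal.mul_mem_mul hH hz)
    rwa [← add_assoc] at this
  rw [rel_mul (F * w + g) (A := JJ x ^ s) (A' := maximalIdeal R * JJ x ^ s), h.rel_pow s h.le, lam_max, mul_one]
  · exact hHz
  · intro a ha
    obtain ⟨b, hb, g', hg', G, hG, hab⟩ := decomp (hdec _ ha)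
    have h1 : G * w + g' ∈ wcl (JJ x) ((s+p+2:ℕ):ℝ) := by
      have : G * w + g' = a - b := by rw [hab]; ring
      rw [this]; exact sub_mem ha (B_le _ 2 hb)
    obtain ⟨H, hH, hHF⟩ := hgen s G g' hG hg' h1
    refine ⟨H, hH, ?_⟩
    refine h.EL hm (b := b + (G - H * F) * w) (g := g' - H * g) (sub_mem ha (hHz H hH)) (add_mem hb (hmw _ _ hHF)) (sub_mem hg' ?_) ?_
    · rw [add_assoc, pow_add]; exact Ideal.mul_mem_mul hH hg
    · rw [hab]; ring
  · intro a ha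
    constructor
    · intro haz
      by_contra hn
      have hFn := h.mul_not_mem ha hn hF hF'
      have hFm : a * F ∈ JJ x ^ (s+p) := by rw [pow_add]; exact Ideal.mul_mem_mul ha hF
      obtain ⟨f, hf, ⟨m, hfm⟩, hfe⟩ := Ctx.exists_of_not_mem hFm hFn
      have h1 : f.eval x * w ∈ (wcl (JJ x) (2:ℕ) ⊔ JJ x) * JJ x ^ (s+p) := by
        have : f.eval x * w = a * (F * w + g) - a * g := by rw [hfe]; ring
        rw [this, Ideal.sup_mul]
        refine sub_mem (Ideal.mem_sup_left (by rwa [mul_comm])) (Ideal.mem_sup_right ?_)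
        rw [← pow_succ', add_assoc, pow_add]
        exact Ideal.mul_mem_mul ha hg
      obtain ⟨q, hq, hqc, hqe⟩ := exists_of_mem_mul _ h1
      have h2 := h.qreg (s+p) (MvPolynomial.C w * f - q)
        ((by simpa using (MvPolynomial.isHomogeneous_C _ w).mul hf : (MvPolynomial.C w * f).IsHomogeneous (s+p)).sub hq)
        (by
          rw [map_sub, map_mul, MvPolynomial.eval_C, hqe, mul_comm, sub_self]; exact zero_mem _) m
      rw [MvPolynomial.coeff_sub, MvPolynomial.coeff_C_mul] at h2
      have h3 : f.coeff m * w ∈ wcl (JJ x) (2:ℕ) ⊔ JJ x := by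
        have : f.coeff m * w = (w * f.coeff m - q.coeff m) + q.coeff m := by ring
        rw [this]
        exact add_mem (Ideal.mem_sup_right h2) (hqc m)
      have hu : IsUnit (f.coeff m) := by
        by_contra hh; exact hfm ((mem_maximalIdeal _).2 hh)
      exact hwn ((Ideal.unit_mul_mem_iff_mem _ hu).1 h3)
    · intro ha'
      rw [mul_add, ← mul_assoc]
      refine add_mem ?_ ?_
      · apply hmw
        rw [pow_add, ← mul_assoc]; exact Ideal.mul_mem_mul ha' hF
      · apply h.mJ_le' hm
        rw [add_assoc, pow_add, ← mul_assoc]; exact Ideal.mul_mem_mul ha' hg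
end

section
variable {R : Type*} [CommRing R] [IsLocalRing R] {m : ℕ} {x : Fin (m+3) → R}

theorem Ctx.endgame (h : Ctx x (maximalIdeal R)) (hm : maximalIdeal R ≤ wcl (JJ x) (1:ℕ))
    (h2 : ∀ n : ℕ, wcl (JJ x) n ≤ JJ x ^ (n-2)) (hfin : lam (JJ x) ≠ ⊤)
    {L : ℕ → ℕ} {e : ℕ → ℤ} {N : ℕ} (hL : ∀ n : ℕ, lam (wcl (JJ x) n) = (L n : ℕ))
    (hP : ∀ n ≥ N, (L n : ℤ) = ∑ i ∈ range (m+4), (-1)^i * e i * ((n + (m+2) - i).choose (m+3-i) : ℕ))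
    (he : e 3 = 0) {Q : Ideal R} (hQ : ∀ a, a ∈ Q ↔ (∀ u ∈ maximalIdeal R, u * a ∈ JJ x))
    {t ℓ : ℕ} (ht : rel Q (JJ x) = t) (hℓ : rel (wcl (JJ x) (2:ℕ)) (JJ x * maximalIdeal R) = ℓ) (htl : t ≤ ℓ + 1)
    (k : ℕ) : wcl (JJ x) ((k+2:ℕ):ℝ) = JJ x ^ k * wcl (JJ x) (2:ℕ) := by
  refine le_antisymm ?_ (B_le k 2)
  set P := wcl (JJ x) (2:ℕ) ⊔ JJ x with hPd
  have hE2 := h.E2 hm h2 (fun a => (hQ a).2)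
  have hPQ : P ≤ Q := by
    refine sup_le ?_ ?_
    · have := hE2 0
      simpa using this
    · intro a ha
      exact (hQ a).2 (fun u _ => Ideal.mul_mem_left _ _ ha)
  have hPJ : rel P (JJ x) = ℓ := by
    rw [hPd, rel_inf, ← hℓ]
    congr 1
    apply le_antisymm
    · rintro a ⟨ha, hb⟩
      have := h.E1 (k := 1) ha (by simpa using hb)
      rw [mul_comm]; simpa using this
    · refine le_inf ?_ Ideal.mul_le_left
      rw [mul_comm]; exact h.mJ_le hm
  have hPfin : lam P ≠ ⊤ := ne_top_of_le_ne_top hfin (lam_anti le_sup_right)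
  have hrel : rel Q P ≤ 1 := by
    have a1 := lam_add (le_sup_right : JJ x ≤ P)
    have a2 := lam_add hPQ
    have a3 := lam_add ((le_sup_right : JJ x ≤ P).trans hPQ)
    have hQfin : lam Q ≠ ⊤ := ne_top_of_le_ne_top hPfin (lam_anti hPQ)
    have hrfin : rel Q P ≠ ⊤ := by
      intro hh; rw [hh] at a2; simp at a2; exact hPfin a2
    rw [hPJ] at a1
    rw [ht] at a3
    generalize rel Q P = r at *
    generalize lam Q = q at *
    generalize lam P = y at *
    generalize lam (JJ x) = j at *
    lift r to ℕ using hrfin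
    lift q to ℕ using hQfin
    lift y to ℕ using hPfin
    lift j to ℕ using hfin
    norm_cast at *
    omega
  by_cases hcase : Q ≤ P
  · intro a ha
    have h1 : a ∈ P * JJ x ^ k := Ideal.mul_mono_left hcase (hE2 k ha)
    rw [hPd, Ideal.sup_mul, ← pow_succ'] at h1
    obtain ⟨b, hb, g, hg, hbg⟩ := Submodule.mem_sup.1 h1
    exact h.EL hm ha (by rwa [mul_comm]) hg hbg.symm
  obtain ⟨w, hwQ, hwP, hQw, hwm⟩ := exists_w hPQ hPfin hrel hcase
  have hdec : ∀ k : ℕ, wcl (JJ x) ((k+2:ℕ):ℝ) ≤ (wcl (JJ x) (2:ℕ) ⊔ JJ x ⊔ Ideal.span {w}) * JJ x ^ k := by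
    intro k; rw [← hPd, ← hQw]; exact hE2 k
  by_cases hV : ∀ k, ∀ F ∈ JJ x ^ k, ∀ g ∈ JJ x ^ (k+1), F * w + g ∈ wcl (JJ x) ((k+2:ℕ):ℝ) →
      F ∈ maximalIdeal R * JJ x ^ k
  · intro a ha
    obtain ⟨b, hb, g, hg, F, hF, hab⟩ := decomp (hdec k ha)
    have h1 : F * w + g ∈ wcl (JJ x) ((k+2:ℕ):ℝ) := by
      have : F * w + g = a - b := by rw [hab]; ring
      rw [this]; exact sub_mem ha (B_le _ 2 hb)
    have h3 := hV k F hF g hg h1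
    have h4 : F * w ∈ P * JJ x ^ k := by
      clear hF h1 hab
      induction h3 using Submodule.mul_induction_on' with
      | mem_mul_mem u hu j hj =>
        rw [show u * j * w = (u * w) * j by ring]
        exact Ideal.mul_mem_mul (hwm u hu) hj
      | add a _ b _ ha hb => rw [add_mul]; exact add_mem ha hb
    rw [hPd, Ideal.sup_mul, ← pow_succ'] at h4
    obtain ⟨b', hb', g', hg', hbg⟩ := Submodule.mem_sup.1 h4
    exact h.EL hm (b := b + b') (g := g + g') ha (add_mem hb (by rwa [mul_comm])) (add_mem hg hg') (by rw [hab, ← hbg]; ring)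
  exfalso
  push Not at hV
  obtain ⟨k0, F0, hF0, g0, hg0, hz0, hF0'⟩ := hV
  have hw2 := h.mw hm hwm hF0 hF0' hg0 hz0
  obtain ⟨p, F, g, hp, hF, hF', hg, hz, hgen⟩ := h.gen hm hwP hw2 hF0 hF0' hg0 hz0
  have hR := h.rel_gen hm hwP hw2 hdec hF hF' hg hz hgen
  refine e3_ne m p (lam (JJ x)).toNat (lam P).toNat hp e N ?_ he
  intro s hs
  rw [← hP _ (by omega)]
  have a1 := lam_add (B_le (s+p) 2 : JJ x ^ (s+p) * wcl (JJ x) (2:ℕ) ≤ wcl (JJ x) ((s+p+2:ℕ):ℝ))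
  rw [hR s, h.lam_B hm (by omega), hL] at a1
  rw [← hPd] at a1
  generalize lam P = y at *
  generalize lam (JJ x) = j at *
  lift y to ℕ using hPfin
  lift j to ℕ using hfin
  simp only [ENat.toNat_natCast]
  have a2 : ((s+p+(m+3)-1).choose (m+3)) * j + ((m+3+(s+p)-1).choose (s+p)) * y
        + ((m+3+(s+p+1)-1).choose (s+p+1)) = ((m+3+s-1).choose s) + L (s+p+2) := by
    exact_mod_cast a1
  have a3 : (((s+p+(m+3)-1).choose (m+3)) * j + ((m+3+(s+p)-1).choose (s+p)) * y
        + ((m+3+(s+p+1)-1).choose (s+p+1)) : ℤ) = ((m+3+s-1).choose s) + L (s+p+2) := by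
    exact_mod_cast a2
  linarith
end
end CMproof

end

section

open IsLocalRing Polynomial Finset
set_option maxHeartbeats 2000000
namespace CMproof
section
variable {R : Type*} [CommRing R]

def vgt (J : Ideal R) (θ : ℝ) : Ideal R where
  carrier := {a | ∃ r, θ < r ∧ a ∈ wcl J r}
  zero_mem' := ⟨θ + 1, by linarith, Ideal.zero_mem _⟩
  add_mem' := by
    rintro a b ⟨r, hr, ha⟩ ⟨r', hr', hb⟩
    exact ⟨min r r', lt_min hr hr', Ideal.add_mem _ (wcl_anti (min_le_left _ _) ha) (wcl_anti (min_le_right _ _) hb)⟩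
  smul_mem' := by
    rintro c a ⟨r, hr, ha⟩
    exact ⟨r, hr, Ideal.mul_mem_left _ _ ha⟩

theorem mem_vgt {J : Ideal R} {θ : ℝ} {a : R} : a ∈ vgt J θ ↔ ∃ r, θ < r ∧ a ∈ wcl J r := Iff.rfl

theorem chain_lemma {J D : Ideal R} {κ : Type*} [DecidableEq κ] (s : Finset κ) (τ : κ → ℝ) (b : κ → R)
    (hD : ∀ k ∈ s, D ≤ vgt J (τ k)) (hDf : lam D ≠ ⊤)
    (hb : ∀ k ∈ s, ∀ r < τ k, b k ∈ wcl J r)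
    (hi : ∀ k ∈ s, ∀ t ⊆ s, k ∉ t → (∀ l ∈ t, τ l = τ k) → ∀ u : κ → R,
      b k - ∑ l ∈ t, u l * b l ∉ vgt J (τ k)) :
    lam (D ⊔ Ideal.span (b '' (s : Set κ))) + s.card ≤ lam D := by
  induction s using Finset.induction_on_min_value τ with
  | empty => simp
  | insert k s hk hmin ih =>
    have ih := ih (fun l hl => hD l (mem_insert_of_mem hl)) (fun l hl => hb l (mem_insert_of_mem hl))
      (fun l hl t ht => hi l (mem_insert_of_mem hl) t (ht.trans (subset_insert _ _)))
    set A := D ⊔ Ideal.span (b '' ((insert k s : Finset κ) : Set κ)) with hA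
    set B := D ⊔ Ideal.span (b '' (s : Set κ)) with hB
    have hBA : B ≤ A := sup_le_sup_left (Ideal.span_mono (Set.image_mono (by simp))) _
    have hkA : b k ∈ A := Ideal.mem_sup_right (Ideal.subset_span ⟨k, by simp, rfl⟩)
    have hkB : b k ∉ B := by
      intro hmem
      obtain ⟨δ, hδ, y, hy, hsum⟩ := Submodule.mem_sup.1 hmem
      obtain ⟨u, hu⟩ : ∃ u : κ → R, ∑ l ∈ s, u l • b l = y := by
        obtain ⟨u, hu⟩ := (Submodule.mem_span_image_finset_iff_exists_fun R).1 hy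
        refine ⟨fun l => if h : l ∈ s then u ⟨l, h⟩ else 0, ?_⟩
        rw [← hu, ← Finset.sum_coe_sort s]
        exact Finset.sum_congr rfl fun l _ => by simp
      have := hi k (mem_insert_self _ _) (s.filter (fun l => τ l = τ k))
        ((filter_subset _ _).trans (subset_insert _ _)) (by simp [hk]) (by simp) u
      apply this
      have e : b k - ∑ l ∈ s.filter (fun l => τ l = τ k), u l * b l
          = δ + ∑ l ∈ s.filter (fun l => ¬ τ l = τ k), u l * b l := by
        rw [← hsum, ← hu, ← Finset.sum_filter_add_sum_filter_not s (fun l => τ l = τ k)]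
        simp only [smul_eq_mul]; ring
      rw [e]
      refine Ideal.add_mem _ (hD k (mem_insert_self _ _) hδ) (Ideal.sum_mem _ fun l hl => ?_)
      rw [mem_filter] at hl
      have hlt : τ k < τ l := lt_of_le_of_ne (hmin l hl.1) (Ne.symm hl.2)
      exact Ideal.mul_mem_left _ _ ⟨(τ k + τ l) / 2, by linarith,
        hb l (mem_insert_of_mem hl.1) _ (by linarith)⟩
    have hBf : lam B ≠ ⊤ := ne_top_of_le_ne_top hDf (lam_anti le_sup_left)
    have hlt : lam A < lam B := by
      refine lt_of_not_ge fun hle => hkB ?_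
      rw [← eq_of_lam hBA hBf hle]; exact hkA
    have h1 : lam A + 1 ≤ lam B := Order.add_one_le_of_lt hlt
    rw [card_insert_of_notMem hk]
    calc lam A + ((s.card + 1 : ℕ) : ℕ∞) = (lam A + 1) + s.card := by push_cast; ring
      _ ≤ lam B + s.card := by gcongr
      _ ≤ _ := ih

theorem choose_shift (e Θ M : ℕ) : (M + Θ).choose (e + 1) ≤ M.choose (e + 1) + Θ * (M + Θ).choose e := by
  induction Θ with
  | zero => simp
  | succ n ih =>
    rw [← add_assoc, Nat.choose_succ_succ]
    have : (M + n).choose e ≤ (M + n + 1).choose e := Nat.choose_le_choose _ (by omega)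
    nlinarith

theorem choose_asym (e Θ l : ℕ) : ∃ M, e ≤ M ∧ l * (M + Θ).choose (e + 1) < (l + 1) * M.choose (e + 1) := by
  set c := 2 ^ (e + 1) * (e + 1).factorial with hc
  set M := Θ + 2 * (e + 1) + c * l * Θ + 1 with hM
  refine ⟨M, by omega, ?_⟩
  have h1 := choose_shift e Θ M
  have h2 : (M + Θ).choose e ≤ (M + Θ) ^ e := Nat.choose_le_pow _ _
  have h3 : (M + 1 - (e + 1)) ^ (e + 1) ≤ (e + 1).factorial * M.choose (e + 1) := by
    have := Nat.pow_le_choose (α := ℚ) (e + 1) M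
    rw [div_le_iff₀ (by positivity)] at this
    rw [mul_comm]; exact_mod_cast this
  have h4 : (M + Θ) ^ (e + 1) ≤ (2 * (M + 1 - (e + 1))) ^ (e + 1) := Nat.pow_le_pow_left (by omega) _
  rw [mul_pow] at h4
  have h5 : (M + Θ) ^ (e + 1) ≤ c * M.choose (e + 1) := by
    calc _ ≤ _ := h4
      _ ≤ 2 ^ (e + 1) * ((e + 1).factorial * M.choose (e + 1)) := by gcongr
      _ = _ := by rw [hc]; ring
  have h6 : c * (l * Θ * (M + Θ) ^ e) < (M + Θ) ^ (e + 1) := by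
    rw [pow_succ]
    have : 0 < (M + Θ) ^ e := by positivity
    have : c * l * Θ < M + Θ := by omega
    nlinarith
  have h7 : l * Θ * (M + Θ) ^ e < M.choose (e + 1) := by
    exact lt_of_mul_lt_mul_left (h6.trans_le h5) (Nat.zero_le _)
  calc l * (M + Θ).choose (e + 1) ≤ l * (M.choose (e + 1) + Θ * (M + Θ).choose e) := by gcongr
    _ ≤ l * (M.choose (e + 1) + Θ * (M + Θ) ^ e) := by gcongr
    _ < _ := by nlinarith


theorem card_ball (e m : ℕ) : ((range m).biUnion fun n => (univ : Finset (Fin (e+1))).finsuppAntidiag n).card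
    = (m + e).choose (e + 1) := by
  rw [card_biUnion]
  · induction m with
    | zero => simp
    | succ m ih =>
      rw [sum_range_succ, ih, card_D, show m + 1 + e = m + e + 1 by ring, Nat.choose_succ_succ,
        show e + 1 + m - 1 = m + e by omega, Nat.choose_symm_add]
      ring
  · intro i _ j _ hij
    rw [Function.onFun, Finset.disjoint_left]
    intro α h1 h2
    rw [mem_D] at h1 h2
    exact hij (h1.symm.trans h2)

variable {e : ℕ} {x : Fin (e+1) → R} {M : Ideal R}

theorem Ctx.RK (h : Ctx x M) (hm : M ≤ wcl (JJ x) 1) {l : ℕ} (hl : lam (JJ x) = l)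
    {ι : Type*} [Fintype ι] [DecidableEq ι] (hc : l < Fintype.card ι) (a : ι → R) (θ : ι → ℝ)
    (ha : ∀ i, ∀ r < θ i, a i ∈ wcl (JJ x) r) :
    ∃ (τ : ℝ) (p : ι → MvPolynomial (Fin (e+1)) R),
      (∀ i, p i = 0 ∨ ∃ n : ℕ, n + θ i = τ ∧ (p i).IsHomogeneous n ∧ ∃ α, (p i).coeff α ∉ M) ∧
      (∃ i, p i ≠ 0) ∧ ∑ i, (p i).eval x * a i ∈ vgt (JJ x) τ := by
  classical
  obtain ⟨Θ, hΘ⟩ : ∃ Θ : ℕ, ∀ i, θ i ≤ Θ := by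
    obtain ⟨Θ, hΘ⟩ := exists_nat_ge (∑ i, |θ i|)
    exact ⟨Θ, fun i => (le_abs_self _).trans ((Finset.single_le_sum (f := fun i => |θ i|) (fun i _ => abs_nonneg _) (mem_univ i)).trans hΘ)⟩
  obtain ⟨N, hN, hasym⟩ := choose_asym e Θ l
  obtain ⟨m, rfl⟩ := Nat.exists_eq_add_of_le' hN
  set ball := (range m).biUnion fun n => (univ : Finset (Fin (e+1))).finsuppAntidiag n with hball
  have mem_ball : ∀ α, α ∈ ball ↔ α.degree < m := by
    intro α; simp only [hball, mem_biUnion, mem_range, mem_D]; simp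
  set s : Finset (ι × (Fin (e+1) →₀ ℕ)) := univ ×ˢ ball with hs
  set τ : ι × (Fin (e+1) →₀ ℕ) → ℝ := fun k => (k.2.degree : ℕ) + θ k.1 with hτ
  set b : ι × (Fin (e+1) →₀ ℕ) → R := fun k => xm x k.2 * a k.1 with hb
  have hbw : ∀ k, ∀ r < τ k, b k ∈ wcl (JJ x) r := by
    intro k r hr
    have h1 : xm x k.2 ∈ wcl (JJ x) (k.2.degree : ℕ) := pow_le_wcl _ (xm_mem _)
    have := mul_mem_wcl h1 (ha k.1 (r - (k.2.degree : ℕ)) (by simp only [hτ] at hr; linarith))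
    simpa [hb] using this
  have hlamD : lam (JJ x ^ (m + Θ)) = ((m + e + Θ).choose (e + 1) * l : ℕ) := by
    rw [h.lam_pow _ (by omega), hl, show m + Θ + (e + 1) - 1 = m + e + Θ by omega]; push_cast; ring
  have key : ∃ k ∈ s, ∃ t ⊆ s, k ∉ t ∧ (∀ l ∈ t, τ l = τ k) ∧ ∃ u : ι × (Fin (e+1) →₀ ℕ) → R,
      b k - ∑ l ∈ t, u l * b l ∈ vgt (JJ x) (τ k) := by
    by_contra hcon
    push Not at hcon
    have := chain_lemma (J := JJ x) (D := JJ x ^ (m + Θ)) s τ b (fun k hk a ha => by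
      refine ⟨(m + Θ : ℕ), ?_, pow_le_wcl _ ha⟩
      have h1 : k.2.degree < m := (mem_ball _).1 (mem_product.1 hk).2
      have h2 := hΘ k.1
      have h3 : ((k.2.degree : ℕ) : ℝ) + 1 ≤ m := by exact_mod_cast h1
      simp only [hτ]; push_cast; linarith) (by rw [hlamD]; exact ENat.natCast_ne_top _) (fun k _ => hbw k) hcon
    have h2 : (s.card : ℕ∞) ≤ lam (JJ x ^ (m + Θ)) := le_trans le_add_self this
    rw [hlamD, hs, card_product, hball, card_ball, card_univ] at h2
    have h3 : Fintype.card ι * (m + e).choose (e + 1) ≤ (m + e + Θ).choose (e + 1) * l := by exact_mod_cast h2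
    have h4 : (l + 1) * (m + e).choose (e + 1) ≤ Fintype.card ι * (m + e).choose (e + 1) := by gcongr; omega
    rw [mul_comm l] at hasym
    omega
  obtain ⟨k, hk, t, ht, hkt, htτ, u, hu⟩ := key
  -- coefficient function
  set c : ι × (Fin (e+1) →₀ ℕ) → R := fun l => if l = k then 1 else if l ∈ t ∧ u l ∉ M then - u l else 0 with hcdef
  have hck : c k = 1 := by simp [hcdef]
  have hcM : ∀ l, c l = 0 ∨ (τ l = τ k ∧ c l ∉ M) := by
    intro l
    by_cases h1 : l = k
    · right; subst h1; refine ⟨rfl, ?_⟩; rw [hck]; exact fun h1 => h.prime.ne_top ((Ideal.eq_top_iff_one _).2 h1)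
    · by_cases h2 : l ∈ t ∧ u l ∉ M
      · right; refine ⟨htτ l h2.1, ?_⟩; simp only [hcdef, if_neg h1, if_pos h2]; rw [neg_mem_iff]; exact h2.2
      · left; simp only [hcdef, if_neg h1, if_neg h2]
  set p : ι → MvPolynomial (Fin (e+1)) R := fun i => ∑ α ∈ ball, MvPolynomial.monomial α (c (i, α)) with hp
  have hpc : ∀ i α, α ∈ ball → (p i).coeff α = c (i, α) := by
    intro i α hα
    simp only [hp, MvPolynomial.coeff_sum, MvPolynomial.coeff_monomial]
    rw [Finset.sum_ite_eq' ball α]; simp [hα]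
  have hkball : k.2 ∈ ball := (mem_product.1 hk).2
  refine ⟨τ k, p, fun i => ?_, ⟨k.1, fun h0 => ?_⟩, ?_⟩
  · by_cases hz : ∀ α ∈ ball, c (i, α) = 0
    · left; exact Finset.sum_eq_zero fun α hα => by rw [hz α hα, map_zero]
    · right
      push Not at hz
      obtain ⟨α, hα, hcα⟩ := hz
      have h1 := (hcM (i, α)).resolve_left hcα
      refine ⟨α.degree, h1.1, ?_, α, by rw [hpc i α hα]; exact h1.2⟩
      refine MvPolynomial.IsHomogeneous.sum _ _ _ fun β hβ => ?_
      rcases hcM (i, β) with h2 | h2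
      · rw [h2, map_zero]; exact MvPolynomial.isHomogeneous_zero _ _ _
      · refine MvPolynomial.isHomogeneous_monomial _ ?_
        have : ((β.degree : ℕ) : ℝ) + θ i = (α.degree : ℕ) + θ i := h2.1.trans h1.1.symm
        exact_mod_cast add_right_cancel this
  · have := hpc k.1 k.2 hkball
    rw [h0] at this
    rw [show ((k.1, k.2) : ι × _) = k from rfl, hck] at this
    simp only [MvPolynomial.coeff_zero] at this
    exact h.prime.ne_top ((Ideal.eq_top_iff_one _).2 (this ▸ M.zero_mem))
  · have e1 : ∑ i, (p i).eval x * a i = ∑ l ∈ s, c l * b l := by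
      rw [hs, sum_product]
      refine Finset.sum_congr rfl fun i _ => ?_
      simp only [hp, map_sum, sum_mul, hb]
      refine Finset.sum_congr rfl fun α _ => ?_
      rw [xm, ← mul_assoc]
      congr 1
      rw [MvPolynomial.eval_monomial, MvPolynomial.eval_monomial, one_mul]
    have e2 : ∑ l ∈ s, c l * b l = b k + ∑ l ∈ t, (if u l ∉ M then - u l else 0) * b l := by
      rw [← Finset.sum_subset (insert_subset hk ht), sum_insert hkt, hck, one_mul]
      · congr 1
        refine Finset.sum_congr rfl fun l hl => ?_
        have : l ≠ k := fun h => hkt (h ▸ hl)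
        simp only [hcdef, if_neg this, hl, true_and]
      · intro l _ hl
        rw [mem_insert, not_or] at hl
        simp [hcdef, hl.1, hl.2]
    rw [e1, e2]
    have e3 : b k + ∑ l ∈ t, (if u l ∉ M then - u l else 0) * b l
        = (b k - ∑ l ∈ t, u l * b l) + ∑ l ∈ t, (if u l ∉ M then 0 else u l) * b l := by
      rw [sub_add, ← sum_sub_distrib, sub_eq_add_neg, ← sum_neg_distrib]
      congr 1
      refine Finset.sum_congr rfl fun l hl => ?_
      split_ifs <;> ring
    rw [e3]
    refine Ideal.add_mem _ hu (Ideal.sum_mem _ fun l hl => ?_)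
    split_ifs with h1
    · refine ⟨1 + (τ l - 1/2), by rw [htτ l hl]; linarith, mul_mem_wcl (hm h1) (hbw l _ (by linarith))⟩
    · rw [zero_mul]; exact Ideal.zero_mem _

end
end CMproof

end

section

open IsLocalRing Polynomial Finset
set_option maxHeartbeats 2000000
set_option linter.unusedSectionVars false
namespace CMproof
section
variable {R : Type*} [CommRing R]

def XX (J : Ideal R) (e : R) (k n : ℕ) : Ideal R := ⨆ l : ℕ, Ideal.span {e ^ l} * J ^ (n - k * l)

theorem XX_zero (J : Ideal R) (e : R) (k : ℕ) : XX J e k 0 = ⊤ := by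
  rw [eq_top_iff]
  refine le_trans ?_ (le_iSup (fun l : ℕ => Ideal.span {e ^ l} * J ^ (0 - k * l)) 0)
  simp

theorem XX_anti (J : Ideal R) (e : R) (k : ℕ) {n m : ℕ} (h : n ≤ m) : XX J e k m ≤ XX J e k n :=
  iSup_mono fun l => Ideal.mul_mono_right (Ideal.pow_le_pow_right (by omega))

theorem XX_mul (J : Ideal R) (e : R) (k n m : ℕ) : J ^ m * XX J e k n ≤ XX J e k (n + m) := by
  rw [XX, Ideal.mul_iSup]
  refine iSup_le fun l => le_trans ?_ (le_iSup (fun l : ℕ => Ideal.span {e ^ l} * J ^ (n + m - k * l)) l)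
  rw [mul_left_comm, ← pow_add]
  exact Ideal.mul_mono_right (Ideal.pow_le_pow_right (by omega))

theorem XX_e (J : Ideal R) (e : R) (k n : ℕ) {a : R} (ha : a ∈ XX J e k n) : e * a ∈ XX J e k (n + k) := by
  have : Ideal.span {e} * XX J e k n ≤ XX J e k (n + k) := by
    rw [XX, Ideal.mul_iSup]
    refine iSup_le fun l => le_trans ?_ (le_iSup (fun l : ℕ => Ideal.span {e ^ l} * J ^ (n + k - k * l)) (l+1))
    rw [← mul_assoc, Ideal.span_singleton_mul_span_singleton, ← pow_succ', show n + k - k * (l+1) = n - k * l by rw [mul_add]; omega]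
  exact this (Ideal.mul_mem_mul (Ideal.mem_span_singleton_self _) ha)

theorem wcl_integral {J : Ideal R} {u t : ℕ} (ht : 0 < t) {y e : R} (c : ℕ → R)
    (hc : ∀ i < t, c i ∈ J ^ ((t - i) * u)) (he : e ∈ wcl J ((t * u : ℕ) : ℝ))
    (hy : y ^ t + ∑ i ∈ range t, c i * y ^ i = e) : y ∈ wcl J u := by
  have h1 : ∀ M, y ^ M ∈ XX J e (t * u) (u * (M - t)) := by
    intro M
    induction M using Nat.strong_induction_on with
    | _ M ih =>
      by_cases hM : M ≤ t
      · rw [Nat.sub_eq_zero_of_le hM, mul_zero, XX_zero]; trivial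
      · push Not at hM
        obtain ⟨m, rfl⟩ := Nat.exists_eq_add_of_le hM.le
        have e1 : y ^ (t + m) = e * y ^ m - ∑ i ∈ range t, c i * y ^ (m + i) := by
          rw [← hy, add_mul, pow_add, sum_mul]
          have : ∀ i, c i * y ^ i * y ^ m = c i * y ^ (m + i) := fun i => by ring
          simp only [this]; ring
        rw [e1]
        refine Ideal.sub_mem _ (XX_anti _ _ _ ?_ (XX_e _ _ _ _ (ih m (by omega)))) (Ideal.sum_mem _ fun i hi => ?_)
        · rw [mul_comm t u, ← mul_add]; exact Nat.mul_le_mul_left _ (by omega)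
        · rw [mem_range] at hi
          refine XX_anti _ _ _ ?_ (XX_mul _ _ _ _ _ (Ideal.mul_mem_mul (hc i hi) (ih (m+i) (by omega))))
          rw [mul_comm _ u, ← mul_add]; exact Nat.mul_le_mul_left _ (by omega)
  obtain ⟨C', hC'⟩ := he
  obtain ⟨C, hC⟩ := exists_nat_ge C'
  have h2 : ∀ n, XX J e (t * u) n ≤ J ^ (n - C) := by
    intro n
    refine iSup_le fun l => ?_
    have : e ^ l ∈ J ^ (t * u * l - C) := by
      by_cases h : C ≤ t * u * l
      · apply hC'
        rw [Nat.cast_sub h]; push_cast; linarith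
      · rw [Nat.sub_eq_zero_of_le (by omega), pow_zero]; simp
    calc _ ≤ J ^ (t * u * l - C) * J ^ (n - t * u * l) := Ideal.mul_mono_left ((Ideal.span_singleton_le_iff_mem _).2 this)
      _ = J ^ ((t * u * l - C) + (n - t * u * l)) := (pow_add _ _ _).symm
      _ ≤ _ := Ideal.pow_le_pow_right (by omega)
  refine ⟨u * t + C, fun M s hs => ?_⟩
  refine Ideal.pow_le_pow_right ?_ (h2 _ (h1 M))
  have : s + u * t + C ≤ u * M := by
    have : (s:ℝ) + u * t + C ≤ u * M := by linarith
    exact_mod_cast this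
  rw [Nat.mul_sub]; omega

variable [IsLocalRing R] {e : ℕ} {x : Fin (e+1) → R} {M : Ideal R}

theorem Ctx.cancel_vgt (h : Ctx x M) {c : ℕ} {F a : R} {r : ℝ} (hF : F ∈ JJ x ^ c) (hF' : F ∉ M * JJ x ^ c)
    (ha : F * a ∈ vgt (JJ x) (r + c)) : a ∈ vgt (JJ x) r := by
  obtain ⟨s, hs, h1⟩ := ha
  refine ⟨s - c, by linarith, h.cancel_wcl hF hF' ?_⟩
  rwa [sub_add_cancel]

theorem vgt_pow (h : Ctx x M) {θ : ℝ} {a : R} (ha : a ∉ vgt (JJ x) θ) (i : ℕ) : a ^ i ∉ vgt (JJ x) (i * θ) := by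
  rintro ⟨r, hr, h1⟩
  rcases Nat.eq_zero_or_pos i with rfl | hi
  · rw [pow_zero] at h1
    exact h.one_nmem (by simpa using hr) h1
  · have hi' : (0:ℝ) < i := by exact_mod_cast hi
    refine ha ⟨r / i, by rw [lt_div_iff₀ hi']; linarith, mem_wcl_of_pow hi ?_⟩
    rwa [mul_div_cancel₀ _ hi'.ne']

theorem uwcl_pow {J : Ideal R} {θ : ℝ} {a : R} (ha : ∀ r < θ, a ∈ wcl J r) (i : ℕ) : ∀ r < i * θ, a ^ i ∈ wcl J r := by
  intro r hr
  rcases Nat.eq_zero_or_pos i with rfl | hi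
  · rw [wcl_nonpos (by simpa using hr.le)]; trivial
  · have hi' : (0:ℝ) < i := by exact_mod_cast hi
    have := pow_mem_wcl (k := i) (ha (r / i) (by rw [div_lt_iff₀ hi']; linarith))
    rwa [mul_div_cancel₀ _ hi'.ne'] at this

theorem exists_sup {J : Ideal R} (hI : ∀ a, (∀ r, a ∈ wcl J r) → a = 0) {a : R} (ha : a ≠ 0) :
    ∃ θ : ℝ, 0 ≤ θ ∧ (∀ r < θ, a ∈ wcl J r) ∧ a ∉ vgt J θ := by
  have hb : BddAbove {r : ℝ | a ∈ wcl J r} := by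
    by_contra hcon
    apply ha
    apply hI
    intro r
    rw [not_bddAbove_iff] at hcon
    obtain ⟨s, hs, hrs⟩ := hcon r
    exact wcl_anti hrs.le hs
  have h0 : (0:ℝ) ∈ {r : ℝ | a ∈ wcl J r} := by
    simp only [Set.mem_ofPred_eq]; rw [wcl_nonpos le_rfl]; trivial
  refine ⟨sSup {r : ℝ | a ∈ wcl J r}, le_csSup hb h0, fun r hr => ?_, ?_⟩
  · obtain ⟨s, hs, hrs⟩ := exists_lt_of_lt_csSup ⟨0, h0⟩ hr
    exact wcl_anti hrs.le hs
  · rintro ⟨r, hr, h1⟩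
    exact absurd (le_csSup hb h1) (not_le.2 hr)

/-- the relation among powers, with at least two terms -/
theorem Ctx.pow_rel (h : Ctx x M) (hm : M ≤ wcl (JJ x) 1) {l : ℕ} (hl : lam (JJ x) = l) {a : R} {θ : ℝ}
    (h1 : ∀ r < θ, a ∈ wcl (JJ x) r) (h2 : a ∉ vgt (JJ x) θ) :
    ∃ (τ : ℝ) (p : Fin (l+1) → MvPolynomial (Fin (e+1)) R),
      (∀ i, p i = 0 ∨ ∃ n : ℕ, n + i * θ = τ ∧ (p i).IsHomogeneous n ∧ ∃ α, (p i).coeff α ∉ M) ∧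
      (∃ i j, i < j ∧ p i ≠ 0 ∧ p j ≠ 0) ∧ ∑ i : Fin (l+1), (p i).eval x * a ^ (i:ℕ) ∈ vgt (JJ x) τ := by
  obtain ⟨τ, p, hp, ⟨i, hi⟩, hs⟩ := h.RK hm hl (ι := Fin (l+1)) (by simp) (fun i => a ^ (i:ℕ)) (fun i => i * θ)
    (fun i => uwcl_pow h1 i)
  refine ⟨τ, p, hp, ?_, hs⟩
  have : ∃ j, j ≠ i ∧ p j ≠ 0 := by
    by_contra hcon
    push Not at hcon
    rw [Finset.sum_eq_single i (fun j _ hj => by rw [hcon j hj]; simp) (by simp)] at hs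
    obtain ⟨n, hn, hh, hc⟩ := (hp i).resolve_left hi
    rw [← hn, add_comm (n:ℝ)] at hs
    exact vgt_pow h h2 i (h.cancel_vgt (mem_pow_iff.2 ⟨_, hh, rfl⟩) (h.not_mem_of_coeff hh hc) hs)
  obtain ⟨j, hj, hpj⟩ := this
  rcases lt_or_gt_of_ne hj with h3 | h3
  · exact ⟨j, i, h3, hpj, hi⟩
  · exact ⟨i, j, h3, hi, hpj⟩

theorem Ctx.rational (h : Ctx x M) (hm : M ≤ wcl (JJ x) 1) {l : ℕ} (hl : lam (JJ x) = l) {a : R} {θ : ℝ} (h0 : 0 ≤ θ)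
    (h1 : ∀ r < θ, a ∈ wcl (JJ x) r) (h2 : a ∉ vgt (JJ x) θ) : ∃ j : ℕ, (l.factorial : ℝ) * θ = j := by
  obtain ⟨τ, p, hp, ⟨i, j, hij, hi, hj⟩, -⟩ := h.pow_rel hm hl h1 h2
  obtain ⟨n, hn, -⟩ := (hp i).resolve_left hi
  obtain ⟨n', hn', -⟩ := (hp j).resolve_left hj
  have hlt : (i:ℕ) < j := hij
  obtain ⟨k, hk⟩ := Nat.exists_eq_add_of_lt hlt
  have e1 : ((k + 1 : ℕ) : ℝ) * θ = n - n' := by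
    have : (j : ℝ) = i + (k + 1) := by rw [hk]; push_cast; ring
    have h3 := hn.trans hn'.symm
    rw [this] at h3
    push_cast; linarith
  have hle : n' ≤ n := by
    have : (0:ℝ) ≤ n - n' := by rw [← e1]; positivity
    have : (n' : ℝ) ≤ n := by linarith
    exact_mod_cast this
  obtain ⟨q, hq⟩ : (k + 1) ∣ l.factorial := Nat.dvd_factorial (by omega) (by have := j.2; omega)
  refine ⟨q * (n - n'), ?_⟩
  rw [hq]; push_cast [Nat.cast_sub hle] at e1 ⊢
  rw [← e1]; ring

theorem Ctx.attained (h : Ctx x M) (hm : M ≤ wcl (JJ x) 1) {l : ℕ} (hl : lam (JJ x) = l) {b : R} {j : ℕ}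
    (h1 : ∀ r < (j:ℝ), b ∈ wcl (JJ x) r) (h2 : b ∉ vgt (JJ x) j) : b ∈ wcl (JJ x) j := by
  classical
  obtain ⟨τ, p, hp, ⟨i0, j0, hij, hi0, hj0⟩, hs⟩ := h.pow_rel hm hl h1 h2
  obtain ⟨t, ht, hmax⟩ := Finset.exists_max_image (univ.filter fun i => p i ≠ 0) (fun i => (i:ℕ)) ⟨j0, by simp [hj0]⟩
  simp only [mem_filter, mem_univ, true_and] at ht hmax
  have ht0 : 0 < (t:ℕ) := lt_of_lt_of_le (lt_of_le_of_lt (Nat.zero_le _) hij) (hmax j0 hj0)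
  obtain ⟨n, hn, hhom, hc⟩ := (hp t).resolve_left ht
  set f := (p t).eval x with hf
  have hfJ : f ∈ JJ x ^ n := mem_pow_iff.2 ⟨_, hhom, rfl⟩
  set P : ℕ → R := fun i => if hi : i < l + 1 then (p ⟨i, hi⟩).eval x else 0 with hP
  have hsum : ∑ i : Fin (l+1), (p i).eval x * b ^ (i:ℕ) = f * b ^ (t:ℕ) + ∑ i ∈ range t, P i * b ^ i := by
    have e1 : ∑ i : Fin (l+1), (p i).eval x * b ^ (i:ℕ) = ∑ i ∈ range (l+1), P i * b ^ i := by
      rw [Finset.sum_range]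
      exact Finset.sum_congr rfl fun i _ => by simp only [hP, dif_pos i.2]
    rw [e1, ← Finset.sum_subset (s₁ := range (t+1)), sum_range_succ, add_comm]
    · congr 1; simp only [hP, hf, dif_pos t.2]
    · intro i hi; rw [mem_range] at *; omega
    · intro i hi hi'
      rw [mem_range] at *
      have : p ⟨i, hi⟩ = 0 := by
        by_contra h3
        have : i ≤ t := hmax ⟨i, hi⟩ h3
        omega
      simp [hP, hi, this]
  rw [hsum] at hs
  have hPJ : ∀ i < (t:ℕ), P i ∈ JJ x ^ (n + (t - i) * j) := by
    intro i hi
    have hi' : i < l + 1 := by omega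
    simp only [hP, dif_pos hi']
    rcases hp ⟨i, hi'⟩ with h3 | ⟨n', hn', hh', -⟩
    · rw [h3]; simp
    · have : n' = n + (t - i) * j := by
        have h4 := hn'.trans hn.symm
        have : (n':ℝ) = ((n + (t - i) * j : ℕ) : ℝ) := by
          push_cast [Nat.cast_sub hi.le]; linarith
        exact_mod_cast this
      rw [← this]
      exact mem_pow_iff.2 ⟨_, hh', rfl⟩
  have key : f * b ∈ wcl (JJ x) ((n + j : ℕ) : ℝ) := by
    refine wcl_integral ht0 (e := f ^ ((t:ℕ) - 1) * (f * b ^ (t:ℕ) + ∑ i ∈ range t, P i * b ^ i))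
      (fun i => P i * f ^ ((t:ℕ) - 1 - i)) ?_ ?_ ?_
    · intro i hi
      have := Ideal.mul_mem_mul (hPJ i hi) (Ideal.pow_mem_pow hfJ ((t:ℕ) - 1 - i))
      rw [← pow_mul, ← pow_add] at this
      refine Ideal.pow_le_pow_right (le_of_eq ?_) this
      obtain ⟨k, hk⟩ := Nat.exists_eq_add_of_lt hi
      rw [hk, show i + k + 1 - i = k + 1 by omega, show i + k + 1 - 1 - i = k by omega]; ring
    · obtain ⟨r, hr, h3⟩ := hs
      have h4 : f ^ ((t:ℕ) - 1) ∈ wcl (JJ x) ((n * ((t:ℕ) - 1) : ℕ) : ℝ) := by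
        apply pow_le_wcl; rw [pow_mul]; exact Ideal.pow_mem_pow hfJ _
      refine wcl_anti ?_ (mul_mem_wcl h4 h3)
      obtain ⟨k, hk⟩ := Nat.exists_eq_add_of_lt ht0
      rw [zero_add] at hk
      rw [hk] at hn ⊢
      rw [show k + 1 - 1 = k by omega]
      push_cast at hn ⊢
      nlinarith
    · obtain ⟨k, hk⟩ := Nat.exists_eq_add_of_lt ht0
      rw [zero_add] at hk
      rw [hk, show k + 1 - 1 = k by omega, mul_add, mul_pow, mul_sum]
      congr 1
      · ring
      · refine Finset.sum_congr rfl fun i hi => ?_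
        rw [mem_range] at hi
        have : f ^ k = f ^ (k - i) * f ^ i := by rw [← pow_add]; congr 1; omega
        rw [this]; ring
  refine h.cancel_wcl hfJ (h.not_mem_of_coeff hhom hc) ?_
  rw [show (j:ℝ) + n = ((n + j : ℕ) : ℝ) by push_cast; ring]
  exact key

theorem Ctx.discrete (h : Ctx x M) (hm : M ≤ wcl (JJ x) 1) {l : ℕ} (hl : lam (JJ x) = l)
    (hI : ∀ a, (∀ r, a ∈ wcl (JJ x) r) → a = 0) :
    ∃ N : ℕ, 0 < N ∧ ∀ (j : ℕ) (a : R), a ∈ vgt (JJ x) (j / N) → a ∈ wcl (JJ x) ((j + 1 : ℕ) / N) := by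
  refine ⟨l.factorial, Nat.factorial_pos _, fun j a ha => ?_⟩
  have hN : (0:ℝ) < l.factorial := by exact_mod_cast Nat.factorial_pos l
  by_cases h0 : a = 0
  · rw [h0]; exact Ideal.zero_mem _
  obtain ⟨θ, hθ, h1, h2⟩ := exists_sup hI h0
  obtain ⟨k, hk⟩ := h.rational hm hl hθ h1 h2
  have hθk : θ = k / l.factorial := by rw [eq_div_iff hN.ne']; linarith
  have hb : a ^ l.factorial ∈ wcl (JJ x) (k:ℝ) := by
    apply h.attained hm hl
    · rw [← hk]; exact uwcl_pow h1 _
    · rw [← hk]; exact vgt_pow h h2 _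
  have hak : a ∈ wcl (JJ x) (k / l.factorial) := by
    refine mem_wcl_of_pow (Nat.factorial_pos l) ?_
    rwa [mul_div_cancel₀ _ hN.ne']
  refine wcl_anti ?_ hak
  obtain ⟨r, hr, har⟩ := ha
  have : (j:ℝ) / l.factorial < k / l.factorial := by
    rw [← hθk]
    by_contra hcon
    exact h2 ⟨r, by linarith, har⟩
  rw [div_lt_div_iff_of_pos_right hN] at this
  have h3 : j + 1 ≤ k := by exact_mod_cast this
  gcongr

end
end CMproof

end

section

open IsLocalRing Polynomial Finset
set_option maxHeartbeats 2000000
set_option linter.unusedSectionVars false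
namespace CMproof
section
variable {T K L : Type*} [CommRing T] [IsDomain T] [Field K] [Algebra T K] [IsFractionRing T K]
  [AddCommGroup L] [Module K L] [Module T L] [IsScalarTower T K L]

include K in
omit [IsDomain T] in
theorem fg_of_dual [IsNoetherianRing T] [FiniteDimensional K L] (C : Submodule T L)
    (hC : ∀ c : C, c ≠ 0 → ∃ f : C →ₗ[T] T, f c ≠ 0) (hT : ∀ a b : T, a ≠ 0 → b ≠ 0 → a * b ≠ 0): C.FG := by
  have key : ∀ n, ∀ D : Submodule T C, Module.finrank K (Submodule.span K ((D.map C.subtype : Submodule T L) : Set L)) < n → D.FG := by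
    intro n
    induction n with
    | zero => intro D h; exact absurd h (Nat.not_lt_zero _)
    | succ n ih =>
      intro D hD
      by_cases h0 : D = ⊥
      · rw [h0]; exact Submodule.fg_bot
      obtain ⟨c, hcD, hc0⟩ := D.ne_bot_iff.1 h0
      obtain ⟨f, hf⟩ := hC c hc0
      refine Submodule.fg_of_fg_map_of_fg_inf_ker f (IsNoetherian.noetherian _) (ih _ (lt_of_lt_of_le ?_ (Nat.lt_succ_iff.1 hD)))
      apply Submodule.finrank_lt_finrank_of_lt
      refine lt_of_le_of_ne (Submodule.span_mono (Submodule.map_mono inf_le_left)) fun heq => ?_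
      have hc : (c : L) ∈ Submodule.span K (((D ⊓ LinearMap.ker f).map C.subtype : Submodule T L) : Set L) := by
        rw [heq]; exact Submodule.subset_span ⟨c, hcD, rfl⟩
      have : ∃ g : T, g ≠ 0 ∧ ∃ y ∈ (D ⊓ LinearMap.ker f), g • (c : L) = (y : L) := by
        refine Submodule.span_induction (p := fun z _ => ∃ g : T, g ≠ 0 ∧ ∃ y ∈ (D ⊓ LinearMap.ker f), g • z = (y : L)) ?_ ?_ ?_ ?_ hc
        · rintro _ ⟨y, hy, rfl⟩
          exact ⟨1, fun h1 => hf (by rw [← one_mul (f c), h1, zero_mul]), y, hy, by simp⟩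
        · exact ⟨1, fun h1 => hf (by rw [← one_mul (f c), h1, zero_mul]), 0, Submodule.zero_mem _, by simp⟩
        · rintro a b - - ⟨g, hg, y, hy, e1⟩ ⟨g', hg', y', hy', e2⟩
          refine ⟨g * g', hT _ _ hg hg', g' • y + g • y', Submodule.add_mem _ (Submodule.smul_mem _ _ hy) (Submodule.smul_mem _ _ hy'), ?_⟩
          simp only [Submodule.coe_add, Submodule.coe_smul, ← e1, ← e2, smul_add, smul_smul]
          rw [mul_comm g' g]
        · rintro a z - ⟨g, hg, y, hy, e1⟩
          obtain ⟨⟨t, s⟩, hs⟩ := IsLocalization.surj (nonZeroDivisors T) a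
          have hs0 : (s : T) ≠ 0 := by
            have : Nontrivial T := ⟨⟨g, 0, hg⟩⟩
            exact nonZeroDivisors.coe_ne_zero s
          refine ⟨s * g, hT _ _ hs0 hg, t • y, Submodule.smul_mem _ _ hy, ?_⟩
          rw [Submodule.coe_smul, ← e1, mul_smul, ← algebraMap_smul K (s:T), ← algebraMap_smul K g, ← algebraMap_smul K g,
            ← algebraMap_smul K t, smul_smul, smul_smul, smul_smul]
          congr 1
          simp only at hs
          linear_combination (algebraMap T K g) * hs
      obtain ⟨g, hg, y, hy, e1⟩ := this
      have e2 : g • c = y := Subtype.ext e1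
      have h3 : f y = 0 := hy.2
      rw [← e2, map_smul, smul_eq_mul] at h3
      exact hT _ _ hg hf h3
  have := key _ ⊤ (Nat.lt_succ_self _)
  exact Submodule.fg_top C |>.1 this

include K in
theorem exists_functional (B : Submodule T L) (hB : B.FG) (c : B) (hc : c ≠ 0) : ∃ f : B →ₗ[T] T, f c ≠ 0 := by
  classical
  have hc' : (c : L) ≠ 0 := fun h => hc (Subtype.ext h)
  obtain ⟨g, hg⟩ : ∃ g : Module.Dual K L, g c ≠ 0 := by
    by_contra hcon
    push Not at hcon
    exact hc' ((Module.forall_dual_apply_eq_zero_iff K _).1 hcon)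
  obtain ⟨s, hs⟩ := hB
  obtain ⟨δ, hδ⟩ := IsLocalization.exist_integer_multiples (nonZeroDivisors T) s (fun y => g y)
  set G : L →ₗ[T] K := (δ : T) • (g.restrictScalars T) with hG
  have h1 : ∀ b : B, G b ∈ LinearMap.range (Algebra.linearMap T K) := by
    intro b
    have : B ≤ (LinearMap.range (Algebra.linearMap T K)).comap G := by
      rw [← hs, Submodule.span_le]
      intro y hy
      obtain ⟨t, ht⟩ := hδ y hy
      exact ⟨t, ht⟩
    exact this b.2
  have hinj : Function.Injective (Algebra.linearMap T K) := IsFractionRing.injective T K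
  let F : B →ₗ[T] LinearMap.range (Algebra.linearMap T K) := (G.comp B.subtype).codRestrict _ h1
  refine ⟨(LinearEquiv.ofInjective _ hinj).symm.toLinearMap.comp F, fun h0 => ?_⟩
  have : F c = 0 := by
    simpa using h0
  have h2 : G c = 0 := congrArg Subtype.val this
  rw [hG] at h2
  simp only [LinearMap.smul_apply, LinearMap.restrictScalars_apply] at h2
  rw [← algebraMap_smul K (δ:T), smul_eq_mul, mul_eq_zero] at h2
  rcases h2 with h2 | h2
  · exact nonZeroDivisors.coe_ne_zero δ ((injective_iff_map_eq_zero _).1 (IsFractionRing.injective T K) _ h2)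
  · exact hg h2
end

section
variable {k : Type*} [Field k] {d : ℕ}

theorem exists_coord (φ : k →+* k) (u : k) (hu : u ≠ 0) :
    ∃ f : k →+ k, (∀ s v, f (φ s * v) = s * f v) ∧ f u ≠ 0 := by
  have key : ∀ (V : Type _) [AddCommGroup V] [Module k V] (v : V), v ≠ 0 → ∃ g : V →ₗ[k] k, g v ≠ 0 := by
    intro V _ _ v hv
    by_contra hcon
    push Not at hcon
    exact hv ((Module.forall_dual_apply_eq_zero_iff k _).1 hcon)
  obtain ⟨g, hg⟩ := @key k _ (Module.compHom k φ) u hu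
  refine ⟨@LinearMap.toAddMonoidHom k k k k _ _ _ _ (Module.compHom k φ) _ (RingHom.id k) g, fun s v => ?_, hg⟩
  exact @LinearMap.map_smul k k k _ _ _ (Module.compHom k φ) _ g s v

/-- q-division functional -/
theorem exists_Theta (p n : ℕ) [ExpChar k p] (f : MvPolynomial (Fin d) k) (hf : f ≠ 0) :
    ∃ Θ : MvPolynomial (Fin d) k →+ MvPolynomial (Fin d) k, (∀ t g, Θ (t ^ p ^ n * g) = t * Θ g) ∧ Θ f ≠ 0 := by
  classical
  obtain ⟨m, hm⟩ := MvPolynomial.ne_zero_iff.1 hf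
  obtain ⟨c, hc, hcm⟩ := exists_coord (iterateFrobenius k p n) _ hm
  set q := p ^ n with hq
  have hq0 : 0 < q := expChar_pow_pos k p n
  let dv : (Fin d →₀ ℕ) → (Fin d →₀ ℕ) := fun m => m.mapRange (· / q) (Nat.zero_div _)
  let α : Fin d →₀ ℕ := m.mapRange (· % q) (Nat.zero_mod _)
  have hαi : ∀ i, α i < q := fun i => Nat.mod_lt _ hq0
  have hdv : ∀ β, dv (α + q • β) = β := by
    intro β; ext i
    simp only [dv, Finsupp.mapRange_apply, Finsupp.add_apply, Finsupp.smul_apply, smul_eq_mul]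
    rw [Nat.add_mul_div_left _ _ hq0, Nat.div_eq_of_lt (hαi i), zero_add]
  have hmα : α + q • dv m = m := by
    ext i
    simp only [dv, α, Finsupp.mapRange_apply, Finsupp.add_apply, Finsupp.smul_apply, smul_eq_mul]
    exact Nat.mod_add_div _ _
  let Θ0 : MvPolynomial (Fin d) k → MvPolynomial (Fin d) k := fun g =>
    ∑ m ∈ g.support, if α + q • dv m = m then MvPolynomial.monomial (dv m) (c (g.coeff m)) else 0
  have hΘ0 : ∀ g β, (Θ0 g).coeff β = c (g.coeff (α + q • β)) := by
    intro g β
    simp only [Θ0, MvPolynomial.coeff_sum]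
    rw [Finset.sum_eq_single (α + q • β)]
    · rw [hdv, if_pos rfl, MvPolynomial.coeff_monomial, if_pos rfl]
    · intro m' _ hm'
      split_ifs with h1
      · rw [MvPolynomial.coeff_monomial, if_neg]
        rintro rfl
        exact hm' h1.symm
      · simp
    · intro h1
      rw [MvPolynomial.notMem_support_iff.1 h1]; simp
  let Θ : MvPolynomial (Fin d) k →+ MvPolynomial (Fin d) k := AddMonoidHom.mk' Θ0 (by
    intro a b; ext β; simp [hΘ0])
  have hΘ : ∀ g β, (Θ g).coeff β = c (g.coeff (α + q • β)) := hΘ0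
  refine ⟨Θ, fun t g => ?_, fun h0 => hcm ?_⟩
  · induction t using MvPolynomial.induction_on' with
    | monomial γ s =>
      ext β
      rw [hΘ, MvPolynomial.monomial_pow, MvPolynomial.coeff_monomial_mul', MvPolynomial.coeff_monomial_mul', hΘ]
      have : q • γ ≤ α + q • β ↔ γ ≤ β := by
        constructor
        · intro h1 i
          have h2 := h1 i
          simp only [Finsupp.add_apply, Finsupp.smul_apply, smul_eq_mul] at h2
          have h3 := hαi i
          by_contra h4
          push Not at h4
          have : q * (β i + 1) ≤ q * γ i := Nat.mul_le_mul_left _ h4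
          rw [mul_add] at this
          omega
        · intro h1 i
          simp only [Finsupp.add_apply, Finsupp.smul_apply, smul_eq_mul]
          exact le_trans (Nat.mul_le_mul_left _ (h1 i)) (Nat.le_add_left _ _)
      by_cases h1 : γ ≤ β
      · rw [if_pos h1, if_pos (this.2 h1)]
        rw [show s ^ q = iterateFrobenius k p n s from (iterateFrobenius_def p n s).symm, hc]
        congr 3
        ext i
        have := h1 i
        simp only [Finsupp.tsub_apply, Finsupp.add_apply, Finsupp.smul_apply, smul_eq_mul, Nat.mul_sub]
        have : q * γ i ≤ q * β i := Nat.mul_le_mul_left _ this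
        omega
      · rw [if_neg h1, if_neg (fun h => h1 (this.1 h)), map_zero]
    | add a b ha hb =>
      rw [hq, add_pow_expChar_pow, ← hq, add_mul, map_add, ha, hb, add_mul]
  · have := hΘ f (dv m)
    rw [h0, hmα] at this
    simpa using this.symm

theorem N2 (K L : Type*) [Field K] [Algebra (MvPolynomial (Fin d) k) K] [IsFractionRing (MvPolynomial (Fin d) k) K]
    [Field L] [Algebra (MvPolynomial (Fin d) k) L] [Algebra K L] [IsScalarTower (MvPolynomial (Fin d) k) K L]
    [FiniteDimensional K L] :
    IsNoetherian (MvPolynomial (Fin d) k) (integralClosure (MvPolynomial (Fin d) k) L) := by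
  set T := MvPolynomial (Fin d) k with hT
  obtain ⟨p, hp⟩ := ExpChar.exists k
  have hinjT : Function.Injective (algebraMap k T) := MvPolynomial.C_injective _ _
  have : ExpChar T p := expChar_of_injective_ringHom hinjT p
  have : ExpChar K p := expChar_of_injective_ringHom (IsFractionRing.injective T K) p
  have : ExpChar L p := expChar_of_injective_ringHom (algebraMap K L).injective p
  let S := separableClosure K L
  haveI hST : IsScalarTower T S L := IsScalarTower.of_algebraMap_eq' (by
    rw [IsScalarTower.algebraMap_eq T K L, IsScalarTower.algebraMap_eq K S L, IsScalarTower.algebraMap_eq T K S, RingHom.comp_assoc])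
  have : IsPurelyInseparable S L := inferInstance
  have : FiniteDimensional S L := inferInstance
  obtain ⟨n, hn⟩ : ∃ n, ∀ a : L, a ^ p ^ n ∈ (algebraMap S L).range :=
    (IsPurelyInseparable.hasExponent_iff' S L p).1 inferInstance
  have hBn : IsNoetherian T (integralClosure T S) := IsIntegralClosure.isNoetherian T K S (integralClosure T S)
  set B : Submodule T S := Subalgebra.toSubmodule (integralClosure T S) with hB
  have hBfg : B.FG := Module.Finite.iff_fg.1 (Module.IsNoetherian.finite T (integralClosure T S))
  set C : Submodule T L := Subalgebra.toSubmodule (integralClosure T L) with hC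
  have hCfg : C.FG := by
    refine fg_of_dual (K := K) C (fun c hc => ?_) (fun a b => mul_ne_zero)
    have hΨ : ∀ c : C, ∃ b : B, algebraMap S L b = (c : L) ^ p ^ n := by
      intro c
      obtain ⟨b, hb⟩ := hn c
      refine ⟨⟨b, ?_⟩, hb⟩
      have h1 : IsIntegral T ((c : L) ^ p ^ n) := IsIntegral.pow c.2 _
      rw [← hb] at h1
      exact (isIntegral_algebraMap_iff (algebraMap S L).injective).1 h1
    choose Ψ hΨ' using hΨ
    have hinj := (algebraMap S L).injective
    have Ψadd : ∀ a b, Ψ (a + b) = Ψ a + Ψ b := by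
      intro a b
      apply Subtype.ext; apply hinj
      rw [hΨ', Submodule.coe_add, Submodule.coe_add, map_add, hΨ', hΨ', add_pow_expChar_pow]
    have Ψsmul : ∀ (t : T) b, Ψ (t • b) = t ^ p ^ n • Ψ b := by
      intro t b
      apply Subtype.ext; apply hinj
      rw [hΨ', Submodule.coe_smul, Submodule.coe_smul, Algebra.smul_def, Algebra.smul_def, map_mul, hΨ', mul_pow,
        ← map_pow, ← IsScalarTower.algebraMap_apply]
    have hΨc : Ψ c ≠ 0 := by
      intro h0
      have := hΨ' c
      rw [h0] at this
      simp only [ZeroMemClass.coe_zero, map_zero] at this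
      exact hc (Subtype.ext (pow_eq_zero_iff (expChar_pow_pos k p n).ne' |>.1 this.symm))
    obtain ⟨κ, hκ⟩ := exists_functional (K := K) B hBfg (Ψ c) hΨc
    obtain ⟨Θ, hΘ, hΘ0⟩ := exists_Theta p n (κ (Ψ c)) hκ
    exact ⟨{ toFun := fun c => Θ (κ (Ψ c))
             map_add' := fun a b => by rw [Ψadd, map_add, map_add]
             map_smul' := fun t a => by
              rw [Ψsmul, map_smul, smul_eq_mul, hΘ]; rfl }, hΘ0⟩
  have : Module.Finite T (integralClosure T L) := Module.Finite.iff_fg.2 hCfg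
  exact isNoetherian_of_isNoetherianRing_of_finite T _

end
end CMproof

end

section

open IsLocalRing Polynomial Finset
set_option maxHeartbeats 2000000
set_option linter.style.haveILetI false
set_option linter.unusedSectionVars false
namespace CMproof
section
variable {k : Type*} [Field k] {d : ℕ}

theorem finite_of_reduced (H : Type*) [CommRing H] [Algebra (MvPolynomial (Fin d) k) H] [IsReduced H]
    (htf : ∀ (g : MvPolynomial (Fin d) k) (h : H), g ≠ 0 → g • h = 0 → h = 0)
    (hIntegral : Algebra.IsIntegral (MvPolynomial (Fin d) k) H)
    (hfin : ∃ s : Finset H, ∀ h : H, ∃ g : MvPolynomial (Fin d) k, g ≠ 0 ∧ g • h ∈ Submodule.span (MvPolynomial (Fin d) k) (s : Set H)) :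
    Module.Finite (MvPolynomial (Fin d) k) H := by
  classical
  set T := MvPolynomial (Fin d) k with hT
  let K := FractionRing T
  let Sm := Algebra.algebraMapSubmonoid H (nonZeroDivisors T)
  let Λ := Localization Sm
  letI : Algebra K Λ := localizationAlgebra (nonZeroDivisors T) H
  haveI : IsScalarTower T K Λ := isScalarTower_localizationAlgebra (nonZeroDivisors T) H
  have hinj : Function.Injective (algebraMap H Λ) := by
    rw [injective_iff_map_eq_zero]
    intro h hh
    rw [IsLocalization.map_eq_zero_iff Sm] at hh
    obtain ⟨⟨_, g, hg, rfl⟩, hm⟩ := hh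
    refine htf g h (nonZeroDivisors.ne_zero hg) ?_
    rw [Algebra.smul_def]; exact hm
  have hfd : FiniteDimensional K Λ := by
    obtain ⟨s, hs⟩ := hfin
    refine ⟨⟨s.image (algebraMap H Λ), ?_⟩⟩
    rw [eq_top_iff]
    rintro z -
    obtain ⟨⟨h, ⟨_, g, hg, rfl⟩⟩, hz⟩ := IsLocalization.surj Sm z
    obtain ⟨g', hg', hs'⟩ := hs h
    have h1 : algebraMap H Λ (g' • h) ∈ Submodule.span K ((s.image (algebraMap H Λ) : Finset Λ) : Set Λ) := by
      have : Submodule.span T (s : Set H) ≤ ((Submodule.span K ((s.image (algebraMap H Λ) : Finset Λ) : Set Λ)).restrictScalars T).comap (IsScalarTower.toAlgHom T H Λ).toLinearMap := by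
        rw [Submodule.span_le]
        intro y hy
        exact Submodule.subset_span (by simpa using ⟨y, hy, rfl⟩)
      exact this hs'
    have hgg : algebraMap T K (g' * g) ≠ 0 := by
      intro h0
      exact mul_ne_zero hg' (nonZeroDivisors.ne_zero hg) ((injective_iff_map_eq_zero _).1 (IsFractionRing.injective T K) _ h0)
    have h2 : algebraMap H Λ (g' • h) = algebraMap T K (g' * g) • z := by
      rw [Algebra.smul_def, Algebra.smul_def, ← IsScalarTower.algebraMap_apply T K Λ, map_mul, map_mul, IsScalarTower.algebraMap_apply T H Λ, IsScalarTower.algebraMap_apply T H Λ, mul_assoc]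
      congr 1
      rw [mul_comm]; exact hz.symm
    rw [h2] at h1
    exact (Submodule.smul_mem_iff _ hgg).1 h1
  have hart : IsArtinianRing Λ := isArtinian_of_tower K (inferInstance : IsArtinian K Λ)
  have hred : IsReduced Λ := isReduced_localizationPreserves Sm Λ inferInstance 
  have : Finite (MaximalSpectrum Λ) := inferInstance
  letI : ∀ Q : MaximalSpectrum Λ, Field (Λ ⧸ Q.asIdeal) := fun Q => Ideal.Quotient.field _
  have hN : ∀ Q : MaximalSpectrum Λ, IsNoetherian T (integralClosure T (Λ ⧸ Q.asIdeal)) := by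
    intro Q
    haveI : FiniteDimensional K (Λ ⧸ Q.asIdeal) := inferInstance
    exact N2 K (Λ ⧸ Q.asIdeal)
  have hN2 : IsNoetherian T (∀ Q : MaximalSpectrum Λ, integralClosure T (Λ ⧸ Q.asIdeal)) := inferInstance
  let F : H →ₗ[T] (∀ Q : MaximalSpectrum Λ, integralClosure T (Λ ⧸ Q.asIdeal)) := LinearMap.pi fun Q =>
    ((Ideal.Quotient.mkₐ T Q.asIdeal).comp (IsScalarTower.toAlgHom T H Λ)).toLinearMap.codRestrict (Subalgebra.toSubmodule (integralClosure T (Λ ⧸ Q.asIdeal)))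
      (fun h => (hIntegral.isIntegral h).map ((Ideal.Quotient.mkₐ T Q.asIdeal).comp (IsScalarTower.toAlgHom T H Λ)))
  have hF : Function.Injective F := by
    rw [injective_iff_map_eq_zero]
    intro h hh
    apply hinj
    rw [map_zero]
    apply (IsArtinianRing.equivPi Λ).injective
    rw [map_zero]
    funext Q
    have := congrArg Subtype.val (congrFun hh Q)
    exact this
  have : IsNoetherian T H := isNoetherian_of_injective F hF
  exact Module.IsNoetherian.finite T H
end
end CMproof

end

section

open IsLocalRing Polynomial Finset
set_option maxHeartbeats 2000000
set_option linter.style.haveILetI false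
set_option linter.unusedSectionVars false
namespace CMproof
section
variable {R : Type*} [CommRing R]

theorem mul_mem_vgt {J : Ideal R} {r s : ℝ} {a b : R} (ha : a ∈ wcl J r) (hb : b ∈ vgt J s) : a * b ∈ vgt J (r + s) := by
  obtain ⟨t, ht, hb⟩ := hb
  exact ⟨r + t, by linarith, mul_mem_wcl ha hb⟩

def AN (J : Ideal R) (N : ℕ) : Subalgebra R R[X] where
  carrier := {p | ∀ j : ℕ, p.coeff j ∈ wcl J ((j:ℝ) / N)}
  zero_mem' := fun j => by simp
  one_mem' := fun j => by
    rw [coeff_one]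
    split_ifs with h
    · rw [wcl_nonpos (by rw [h]; simp)]; trivial
    · exact Ideal.zero_mem _
  add_mem' := fun {p q} hp hq j => by
    rw [coeff_add]; exact Ideal.add_mem _ (hp j) (hq j)
  mul_mem' := fun {p q} hp hq j => by
    rw [coeff_mul]
    refine Ideal.sum_mem _ fun c hc => ?_
    have := mul_mem_wcl (hp c.1) (hq c.2)
    rwa [← add_div, ← Nat.cast_add, Finset.HasAntidiagonal.mem_antidiagonal.1 hc] at this
  algebraMap_mem' := fun r j => by
    rw [Polynomial.algebraMap_apply, Algebra.algebraMap_self, RingHom.id_apply, coeff_C]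
    split_ifs with h
    · rw [wcl_nonpos (by rw [h]; simp)]; trivial
    · exact Ideal.zero_mem _

theorem mem_AN {J : Ideal R} {N : ℕ} {p : R[X]} : p ∈ AN J N ↔ ∀ j : ℕ, p.coeff j ∈ wcl J ((j:ℝ) / N) := Iff.rfl

def KN (J : Ideal R) (N : ℕ) : Ideal (AN J N) where
  carrier := {p | ∀ j : ℕ, (p : R[X]).coeff j ∈ vgt J ((j:ℝ) / N)}
  zero_mem' := fun j => by simp
  add_mem' := fun {p q} hp hq j => by
    rw [Subalgebra.coe_add, coeff_add]; exact Ideal.add_mem _ (hp j) (hq j)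
  smul_mem' := fun p q hq j => by
    rw [smul_eq_mul, Subalgebra.coe_mul, coeff_mul]
    refine Ideal.sum_mem _ fun c hc => ?_
    have := mul_mem_vgt (p.2 c.1) (hq c.2)
    rwa [← add_div, ← Nat.cast_add, Finset.HasAntidiagonal.mem_antidiagonal.1 hc] at this

theorem mem_KN {J : Ideal R} {N : ℕ} {p : AN J N} : p ∈ KN J N ↔ ∀ j : ℕ, (p : R[X]).coeff j ∈ vgt J ((j:ℝ) / N) := Iff.rfl

theorem monomial_mem_AN {J : Ideal R} {N j : ℕ} {a : R} (h : a ∈ wcl J ((j:ℝ)/N)) : monomial j a ∈ AN J N := by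
  intro i
  rw [coeff_monomial]
  split_ifs with hh
  · rw [← hh]; exact h
  · exact Ideal.zero_mem _

theorem monomial_mem_KN {J : Ideal R} {N j : ℕ} {a : R} (h : a ∈ wcl J ((j:ℝ)/N)) (h' : a ∈ vgt J ((j:ℝ)/N)) :
    (⟨monomial j a, monomial_mem_AN h⟩ : AN J N) ∈ KN J N := by
  intro i
  simp only [coeff_monomial]
  split_ifs with hh
  · rw [← hh]; exact h'
  · exact Ideal.zero_mem _

theorem eraseLead_mem {J : Ideal R} {N : ℕ} {p : R[X]} (h : p ∈ AN J N) : p.eraseLead ∈ AN J N := by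
  intro i
  rw [eraseLead_coeff]
  split_ifs
  · exact Ideal.zero_mem _
  · exact h i

theorem mk_eraseLead {J : Ideal R} {N : ℕ} (p : AN J N) (hl : (p : R[X]).leadingCoeff ∈ vgt J ((p : R[X]).natDegree / N)) :
    p - ⟨_, eraseLead_mem p.2⟩ ∈ KN J N := by
  intro i
  simp only [Subalgebra.coe_sub, coeff_sub, eraseLead_coeff]
  split_ifs with hh
  · rw [sub_zero, hh]; exact hl
  · simp

/-- induction principle for showing membership in `KN` by leading coefficients -/
theorem KN_induction {J : Ideal R} {N : ℕ} (P : AN J N → Prop) (hP : ∀ p q, p - q ∈ KN J N → P p → P q)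
    (hl : ∀ p, P p → (p : R[X]) ≠ 0 → (p : R[X]).leadingCoeff ∈ vgt J ((p : R[X]).natDegree / N)) (p : AN J N) (hp : P p) : p ∈ KN J N := by
  have key : ∀ n, ∀ p : AN J N, (p : R[X]).support.card < n → P p → p ∈ KN J N := by
    intro n
    induction n with
    | zero => intro p h; omega
    | succ n ih =>
      intro p hn hp
      by_cases h0 : (p : R[X]) = 0
      · rw [show p = 0 from Subtype.ext h0]; exact Ideal.zero_mem _
      have h1 := mk_eraseLead p (hl p hp h0)
      have := ih ⟨_, eraseLead_mem p.2⟩ (by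
        have := card_support_eraseLead_add_one h0
        simp only
        omega) (hP _ _ h1 hp)
      have := Ideal.add_mem _ h1 this
      rwa [sub_add_cancel] at this
  exact key _ p (Nat.lt_succ_self _) hp

end
section
variable {R : Type*} [CommRing R] [IsLocalRing R] {e : ℕ} {x : Fin (e+1) → R}

theorem x_mem_wcl {N : ℕ} (hN : 0 < N) (i) : x i ∈ wcl (JJ x) ((N:ℝ)/N) := by
  rw [div_self (by positivity)]
  have := pow_le_wcl (J := JJ x) 1 (by rw [pow_one]; exact Ctx.x_mem (x := x) i)
  simpa using this

noncomputable def psi (x : Fin (e+1) → R) {N : ℕ} (hN : 0 < N) : MvPolynomial (Fin (e+1)) R →ₐ[R] AN (JJ x) N :=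
  MvPolynomial.aeval fun i => ⟨monomial N (x i), monomial_mem_AN (x_mem_wcl hN i)⟩

theorem psi_mon {N : ℕ} (hN : 0 < N) (α : Fin (e+1) →₀ ℕ) (c : R) :
    ((psi x hN (MvPolynomial.monomial α c) : AN (JJ x) N) : R[X]) = monomial (α.degree * N) (c * MvPolynomial.eval x (MvPolynomial.monomial α 1)) := by
  have h1 : ((psi x hN (MvPolynomial.monomial α c) : AN (JJ x) N) : R[X]) = (AN (JJ x) N).val.comp (psi x hN) (MvPolynomial.monomial α c) := rfl
  rw [h1]
  have h2 : (AN (JJ x) N).val.comp (psi x hN) = MvPolynomial.aeval (fun i => (monomial N (x i) : R[X])) := by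
    ext i; simp [psi]
  rw [h2, MvPolynomial.aeval_monomial, MvPolynomial.eval_monomial, one_mul, Polynomial.algebraMap_apply, Algebra.algebraMap_self, RingHom.id_apply,
    Finsupp.prod_fintype _ _ (by simp), Finsupp.prod_fintype _ _ (by simp), Finsupp.degree_eq_sum, Finset.sum_mul]
  rw [← C_mul_monomial]
  congr 1
  have : ∀ s : Finset (Fin (e+1)), ∏ i ∈ s, (monomial N (x i) : R[X]) ^ α i = monomial (∑ i ∈ s, α i * N) (∏ i ∈ s, x i ^ α i) := by
    intro s
    classical
    induction s using Finset.induction_on with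
    | empty => simp
    | insert a s ha ih => rw [Finset.prod_insert ha, ih, Finset.sum_insert ha, Finset.prod_insert ha, monomial_pow, monomial_mul_monomial, mul_comm N]
  exact this _

theorem psi_homog {N : ℕ} (hN : 0 < N) {n : ℕ} {f : MvPolynomial (Fin (e+1)) R} (hf : f.IsHomogeneous n) :
    ((psi x hN f : AN (JJ x) N) : R[X]) = monomial (n * N) (f.eval x) := by
  conv_lhs => rw [f.as_sum]
  conv_rhs => rw [f.as_sum]
  rw [map_sum, map_sum, map_sum, AddSubmonoidClass.coe_finsetSum]
  refine Finset.sum_congr rfl fun α hα => ?_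
  have : α.degree = n := by
    have := hf (MvPolynomial.mem_support_iff.1 hα); rw [← this, Finsupp.degree_eq_weight_one]; rfl
  rw [psi_mon, this]
  congr 1
  rw [MvPolynomial.eval_monomial, MvPolynomial.eval_monomial]; ring

theorem psi_coeff_deg {N : ℕ} (hN : 0 < N) (f : MvPolynomial (Fin (e+1)) R) (c : ℕ) :
    ((psi x hN f : AN (JJ x) N) : R[X]).coeff (c * N) = (MvPolynomial.homogeneousComponent c f).eval x := by
  conv_lhs => rw [← MvPolynomial.sum_homogeneousComponent f]
  rw [map_sum, AddSubmonoidClass.coe_finsetSum, finsetSum_coeff]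
  simp_rw [psi_homog hN (MvPolynomial.homogeneousComponent_isHomogeneous _ f), coeff_monomial]
  have : ∀ i, (i * N = c * N) ↔ i = c := fun i => Nat.mul_left_inj hN.ne'
  simp_rw [this]
  rw [Finset.sum_ite_eq']
  split_ifs with h
  · rfl
  · rw [MvPolynomial.homogeneousComponent_eq_zero, map_zero]
    simp at h; omega

theorem psi_coeff_mem {N : ℕ} (hN : 0 < N) (f : MvPolynomial (Fin (e+1)) R) (u c : ℕ) (hc : c * N ≤ u) :
    ((psi x hN f : AN (JJ x) N) : R[X]).coeff u ∈ JJ x ^ c := by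
  rw [← MvPolynomial.sum_homogeneousComponent f]
  rw [map_sum, AddSubmonoidClass.coe_finsetSum, finsetSum_coeff]
  refine Ideal.sum_mem _ fun i _ => ?_
  rw [psi_homog hN (MvPolynomial.homogeneousComponent_isHomogeneous _ f), coeff_monomial]
  split_ifs with h
  · have : c ≤ i := by
      rw [← h] at hc
      exact Nat.le_of_mul_le_mul_right hc hN
    exact Ideal.pow_le_pow_right this (mem_pow_iff.2 ⟨_, MvPolynomial.homogeneousComponent_isHomogeneous _ f, rfl⟩)
  · exact Ideal.zero_mem _

theorem psi_natDegree {N : ℕ} (hN : 0 < N) (f : MvPolynomial (Fin (e+1)) R) :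
    ((psi x hN f : AN (JJ x) N) : R[X]).natDegree ≤ f.totalDegree * N := by
  conv_lhs => rw [← MvPolynomial.sum_homogeneousComponent f]
  rw [map_sum, AddSubmonoidClass.coe_finsetSum]
  refine natDegree_sum_le_of_forall_le _ _ fun i hi => ?_
  rw [psi_homog hN (MvPolynomial.homogeneousComponent_isHomogeneous _ f)]
  refine (natDegree_monomial_le _).trans (Nat.mul_le_mul_right _ ?_)
  simp at hi; omega

theorem exists_phi {N : ℕ} (hN : 0 < N) (hm : maximalIdeal R ≤ wcl (JJ x) 1) :
    ∃ φ : MvPolynomial (Fin (e+1)) (ResidueField R) →+* (AN (JJ x) N ⧸ KN (JJ x) N),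
      ∀ G, φ (MvPolynomial.map (residue R) G) = Ideal.Quotient.mk _ (psi x hN G) := by
  let φ0 : ResidueField R →+* (AN (JJ x) N ⧸ KN (JJ x) N) := Ideal.Quotient.lift (maximalIdeal R)
    ((Ideal.Quotient.mk (KN (JJ x) N)).comp (algebraMap R (AN (JJ x) N))) (fun a ha => by
      rw [RingHom.comp_apply, Ideal.Quotient.eq_zero_iff_mem]
      intro j
      rw [Subalgebra.coe_algebraMap, Polynomial.algebraMap_apply, Algebra.algebraMap_self, RingHom.id_apply, coeff_C]
      split_ifs with h
      · exact ⟨1, by rw [h]; simp, hm ha⟩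
      · exact Ideal.zero_mem _)
  have h0 : ∀ a, φ0 (residue R a) = Ideal.Quotient.mk (KN (JJ x) N) (algebraMap R (AN (JJ x) N) a) := fun a => rfl
  refine ⟨MvPolynomial.eval₂Hom φ0 (fun i => Ideal.Quotient.mk _ (psi x hN (MvPolynomial.X i))), fun G => ?_⟩
  have : (MvPolynomial.eval₂Hom φ0 (fun i => Ideal.Quotient.mk (KN (JJ x) N) (psi x hN (MvPolynomial.X i)))).comp (MvPolynomial.map (residue R))
     = (Ideal.Quotient.mk (KN (JJ x) N)).comp (psi x hN).toRingHom := by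
    apply MvPolynomial.ringHom_ext
    · intro a
      simp [h0, ← MvPolynomial.algebraMap_eq]
    · intro i; simp
  exact RingHom.congr_fun this G
end
end CMproof

end

section

open IsLocalRing Polynomial Finset
set_option maxHeartbeats 2000000
set_option linter.style.haveILetI false
set_option linter.unusedSectionVars false
namespace CMproof
section
variable {R : Type*} [CommRing R] [IsLocalRing R] {e : ℕ} {x : Fin (e+1) → R}

theorem hc_map {A B σ : Type*} [CommRing A] [CommRing B] (f : A →+* B) (n : ℕ) (G : MvPolynomial σ A) :
    MvPolynomial.homogeneousComponent n (MvPolynomial.map f G) = MvPolynomial.map f (MvPolynomial.homogeneousComponent n G) := by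
  ext α
  rw [MvPolynomial.coeff_map, MvPolynomial.coeff_homogeneousComponent, MvPolynomial.coeff_homogeneousComponent, MvPolynomial.coeff_map]
  split_ifs <;> simp

theorem HN_reduced (h : Ctx x (maximalIdeal R)) (N : ℕ) : IsReduced (AN (JJ x) N ⧸ KN (JJ x) N) := by
  refine ⟨fun z hz => ?_⟩
  obtain ⟨n, hn⟩ := hz
  obtain ⟨p, rfl⟩ := Ideal.Quotient.mk_surjective z
  rw [Ideal.Quotient.eq_zero_iff_mem]
  refine KN_induction (fun p => Ideal.Quotient.mk (KN (JJ x) N) p ^ n = 0) ?_ ?_ p hn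
  · intro p q hpq hp
    rw [← Ideal.Quotient.eq.2 hpq, hp]
  · intro p hp _
    by_contra hcon
    rw [← map_pow, Ideal.Quotient.eq_zero_iff_mem] at hp
    have := hp (n * (p : R[X]).natDegree)
    rw [Subalgebra.coe_pow, coeff_pow_mul_natDegree] at this
    refine vgt_pow h hcon n ?_
    convert this using 2
    push_cast; ring

theorem HN_tf (h : Ctx x (maximalIdeal R)) {N : ℕ} (hN : 0 < N)
    (φ : MvPolynomial (Fin (e+1)) (ResidueField R) →+* (AN (JJ x) N ⧸ KN (JJ x) N))
    (hφ : ∀ G, φ (MvPolynomial.map (residue R) G) = Ideal.Quotient.mk _ (psi x hN G))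
    (g : MvPolynomial (Fin (e+1)) (ResidueField R)) (z) (hg : g ≠ 0) (hz : φ g * z = 0) : z = 0 := by
  obtain ⟨p, rfl⟩ := Ideal.Quotient.mk_surjective z
  obtain ⟨G, hG⟩ : ∃ G, MvPolynomial.map (residue R) G = g := MvPolynomial.map_surjective _ residue_surjective g
  -- truncate G to degree
  set c := g.totalDegree with hc
  obtain ⟨G, hG, hGd⟩ : ∃ G, MvPolynomial.map (residue R) G = g ∧ ∀ u, c * N < u → ((psi x hN G : AN (JJ x) N) : R[X]).coeff u = 0 := by
    refine ⟨∑ i ∈ range (c + 1), MvPolynomial.homogeneousComponent i G, ?_, ?_⟩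
    · rw [map_sum]
      simp_rw [← hc_map, hG]
      exact MvPolynomial.sum_homogeneousComponent g
    · intro u hu
      rw [map_sum, AddSubmonoidClass.coe_finsetSum, finsetSum_coeff]
      refine Finset.sum_eq_zero fun i hi => ?_
      rw [psi_homog hN (MvPolynomial.homogeneousComponent_isHomogeneous _ G), coeff_monomial, if_neg]
      have : i ≤ c := by simpa [Nat.lt_succ_iff] using hi
      have := Nat.mul_le_mul_right N this
      omega
  rw [Ideal.Quotient.eq_zero_iff_mem]
  refine KN_induction (fun p => φ g * Ideal.Quotient.mk (KN (JJ x) N) p = 0) ?_ ?_ p hz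
  · intro p q hpq hp
    rw [← Ideal.Quotient.eq.2 hpq, hp]
  · intro p hp _
    rw [← hG, hφ, ← map_mul, Ideal.Quotient.eq_zero_iff_mem] at hp
    have := hp (c * N + (p : R[X]).natDegree)
    rw [Subalgebra.coe_mul, coeff_mul_add_eq_of_natDegree_le (natDegree_le_iff_coeff_eq_zero.2 hGd) le_rfl, psi_coeff_deg] at this
    have hh := MvPolynomial.homogeneousComponent_isHomogeneous c G
    refine h.cancel_vgt (c := c) (mem_pow_iff.2 ⟨_, hh, rfl⟩) (h.not_mem_of_coeff hh ?_) (r := (p : R[X]).natDegree / N) (by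
      rw [leadingCoeff]
      convert this using 2
      push_cast
      field_simp
      ring)
    by_contra hcon
    push Not at hcon
    have h0 : MvPolynomial.homogeneousComponent c g = 0 := by
      rw [← hG, hc_map]
      ext α
      rw [MvPolynomial.coeff_map, MvPolynomial.coeff_zero]
      exact (residue_eq_zero_iff _).2 (hcon α)
    have : ∃ α ∈ g.support, α.degree = c := by
      have hne : g.support.Nonempty := MvPolynomial.support_nonempty.2 hg
      obtain ⟨α, hα, h1⟩ := Finset.exists_mem_eq_sup g.support hne (fun s => s.sum fun _ n => n)
      exact ⟨α, hα, h1.symm⟩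
    obtain ⟨α, hα, h1⟩ := this
    have h2 := congrArg (MvPolynomial.coeff α) h0
    rw [MvPolynomial.coeff_homogeneousComponent, if_pos h1, MvPolynomial.coeff_zero] at h2
    exact MvPolynomial.mem_support_iff.1 hα h2

theorem mk_eq_sum {J : Ideal R} {N : ℕ} (p : AN J N) :
    p = ∑ j ∈ (p : R[X]).support, ⟨monomial j ((p : R[X]).coeff j), monomial_mem_AN (mem_AN.1 p.2 j)⟩ := by
  apply Subtype.ext
  rw [AddSubmonoidClass.coe_finsetSum]
  exact (p : R[X]).as_sum_support

theorem integral_aux {T H : Type*} [CommRing T] [CommRing H] (φ : T →+* H) (z : H) (n : ℕ) (_hn : 0 < n) (g : ℕ → T)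
    (h : z ^ n + ∑ i ∈ Icc 1 n, φ (g i) * z ^ (n - i) = 0) : φ.IsIntegralElem z := by
  refine ⟨X ^ n + ∑ i ∈ Icc 1 n, C (g i) * X ^ (n - i), ?_, ?_⟩
  · refine monic_X_pow_add ?_
    refine (degree_sum_le _ _).trans_lt ?_
    rw [Finset.sup_lt_iff (by simp)]
    intro i hi
    refine (degree_C_mul_X_pow_le _ _).trans_lt ?_
    rw [Finset.mem_Icc] at hi
    exact_mod_cast (by omega : n - i < n)
  · rw [eval₂_add, eval₂_finsetSum, eval₂_X_pow]
    simp_rw [eval₂_mul, eval₂_C, eval₂_X_pow]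
    exact h

theorem HN_int [IsNoetherianRing R] {N : ℕ} (hN : 0 < N)
    (φ : MvPolynomial (Fin (e+1)) (ResidueField R) →+* (AN (JJ x) N ⧸ KN (JJ x) N))
    (hφ : ∀ G, φ (MvPolynomial.map (residue R) G) = Ideal.Quotient.mk _ (psi x hN G)) : φ.IsIntegral := by
  intro z
  obtain ⟨p, rfl⟩ := Ideal.Quotient.mk_surjective z
  rw [mk_eq_sum p, map_sum]
  letI : Algebra (MvPolynomial (Fin (e+1)) (ResidueField R)) (AN (JJ x) N ⧸ KN (JJ x) N) := RingHom.toAlgebra (R := MvPolynomial (Fin (e+1)) (ResidueField R)) (S := AN (JJ x) N ⧸ KN (JJ x) N) φ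
  change IsIntegral (MvPolynomial (Fin (e+1)) (ResidueField R)) (_ : AN (JJ x) N ⧸ KN (JJ x) N)
  apply IsIntegral.sum (R := MvPolynomial (Fin (e+1)) (ResidueField R)) (A := AN (JJ x) N ⧸ KN (JJ x) N)
  intro j _
  have ha := mem_AN.1 p.2 j
  set a := (p : R[X]).coeff j with haa
  refine IsIntegral.of_pow hN ?_
  have hN' : (0:ℝ) < N := by exact_mod_cast hN
  have h1 : a ^ N ∈ wcl (JJ x) j := by
    have := pow_mem_wcl (k := N) ha
    rwa [mul_div_cancel₀ _ hN'.ne'] at this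
  obtain ⟨n, hn, b, hb, heq⟩ := int_of_wcl h1
  choose! P hP1 hP2 using fun i (hi : i ∈ Icc 1 n) => mem_pow_iff.1 (by rw [pow_mul]; exact hb i hi : b i ∈ JJ x ^ (j * i))
  set T := MvPolynomial (Fin (e+1)) (ResidueField R)
  refine integral_aux (T := MvPolynomial (Fin (e+1)) (ResidueField R)) (H := AN (JJ x) N ⧸ KN (JJ x) N) φ _ n hn (fun i => MvPolynomial.map (residue R) (P i)) ?_
  · simp_rw [hφ, ← map_pow, ← map_mul, ← map_sum, ← map_add]
    rw [Ideal.Quotient.eq_zero_iff_mem]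
    convert Ideal.zero_mem _ 
    apply Subtype.ext
    rw [Subalgebra.coe_add, AddSubmonoidClass.coe_finsetSum]
    simp only [Subalgebra.coe_pow, Subalgebra.coe_mul, ZeroMemClass.coe_zero, monomial_pow]
    have : ∀ i ∈ Icc 1 n, ((psi x hN (P i) : AN (JJ x) N) : R[X]) * monomial (j * N * (n - i)) ((a^N)^(n - i)) = monomial (j * N * n) (b i * (a ^ N) ^ (n - i)) := by
      intro i hi
      rw [psi_homog hN (hP1 i hi), hP2 i hi, monomial_mul_monomial]
      congr 1
      rw [Finset.mem_Icc] at hi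
      obtain ⟨k, rfl⟩ := Nat.exists_eq_add_of_le hi.2
      rw [Nat.add_sub_cancel_left]; ring_nf
    rw [Finset.sum_congr rfl this, ← map_sum, ← map_add, heq, map_zero]
end
end CMproof

end

section

open IsLocalRing Polynomial Finset
set_option maxHeartbeats 2000000
set_option linter.style.haveILetI false
set_option linter.unusedSectionVars false
namespace CMproof
section

theorem max_indep {T H : Type*} [CommRing T] [IsDomain T] [CommRing H] (φ : T →+* H) (P : H → Prop) (l : ℕ)
    (hP : ∀ n (v : Fin n → H), (∀ i, P (v i)) → l < n → ∃ g : Fin n → T, (∃ i, g i ≠ 0) ∧ ∑ i, φ (g i) * v i = 0)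
    (hs : ∀ z : H, ∃ (s : Finset ℕ) (f : ℕ → H), (∀ j, P (f j)) ∧ z = ∑ j ∈ s, f j) :
    ∃ s : Finset H, ∀ h : H, ∃ g : T, g ≠ 0 ∧ ∃ c : H → T, φ g * h = ∑ i ∈ s, φ (c i) * i := by
  classical
  let Q : ℕ → Prop := fun n => ∃ v : Fin n → H, (∀ i, P (v i)) ∧ ∀ g : Fin n → T, ∑ i, φ (g i) * v i = 0 → ∀ i, g i = 0
  have hQ0 : Q 0 := ⟨Fin.elim0, fun i => i.elim0, fun g _ i => i.elim0⟩
  have hQl : ∀ n, Q n → n ≤ l := by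
    rintro n ⟨v, h1, h2⟩
    by_contra hcon
    obtain ⟨g, ⟨i, hi⟩, h3⟩ := hP n v h1 (by omega)
    exact hi (h2 g h3 i)
  obtain ⟨n, hn, hmax⟩ : ∃ n, Q n ∧ ¬ Q (n + 1) := by
    by_contra hcon
    push Not at hcon
    have : ∀ n, Q n := fun n => Nat.rec hQ0 (fun n ih => hcon n ih) n
    exact absurd (hQl _ (this (l + 1))) (by omega)
  obtain ⟨v, hv, hind⟩ := hn
  have h1 : ∀ z, P z → ∃ g : T, g ≠ 0 ∧ ∃ c : Fin n → T, φ g * z = ∑ i, φ (c i) * v i := by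
    intro z hz
    by_contra hcon
    refine hmax ⟨Fin.cons z v, fun i => Fin.cases hz hv i, fun g hg => ?_⟩
    rw [Fin.sum_univ_succ] at hg
    simp only [Fin.cons_zero, Fin.cons_succ] at hg
    have h0 : g 0 = 0 := by
      by_contra h0
      refine hcon ⟨g 0, h0, fun i => - g i.succ, ?_⟩
      simp only [map_neg, neg_mul, Finset.sum_neg_distrib]
      exact eq_neg_of_add_eq_zero_left hg
    rw [h0, map_zero, zero_mul, zero_add] at hg
    exact fun i => Fin.cases h0 (hind _ hg) i
  have h2 : ∀ z, ∃ g : T, g ≠ 0 ∧ ∃ c : Fin n → T, φ g * z = ∑ i, φ (c i) * v i := by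
    intro z
    obtain ⟨s, f, hf, rfl⟩ := hs z
    induction s using Finset.induction_on with
    | empty => exact ⟨1, one_ne_zero, 0, by simp⟩
    | insert a s ha ih =>
      obtain ⟨g, hg, c, hc⟩ := ih
      obtain ⟨g', hg', c', hc'⟩ := h1 _ (hf a)
      refine ⟨g' * g, mul_ne_zero hg' hg, fun i => g * c' i + g' * c i, ?_⟩
      rw [Finset.sum_insert ha, map_mul, mul_add, mul_assoc, mul_assoc, hc, mul_left_comm, hc', Finset.mul_sum, Finset.mul_sum, ← Finset.sum_add_distrib]
      refine Finset.sum_congr rfl fun i _ => ?_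
      simp only [map_add, map_mul]; ring
  refine ⟨Finset.univ.image v, fun h => ?_⟩
  obtain ⟨g, hg, c, hc⟩ := h2 h
  refine ⟨g, hg, fun y => ∑ i with v i = y, c i, ?_⟩
  rw [hc, ← Finset.sum_fiberwise_of_maps_to (s := Finset.univ) (t := Finset.univ.image v) (g := v) (fun i _ => Finset.mem_image_of_mem _ (Finset.mem_univ _))]
  refine Finset.sum_congr rfl fun y _ => ?_
  rw [map_sum, Finset.sum_mul]
  refine Finset.sum_congr rfl fun i hi => ?_
  rw [(Finset.mem_filter.1 hi).2]

variable {R : Type*} [CommRing R] [IsLocalRing R] {e : ℕ} {x : Fin (e+1) → R}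

theorem HN_rank (h : Ctx x (maximalIdeal R)) (hm : maximalIdeal R ≤ wcl (JJ x) 1) {l : ℕ} (hl : lam (JJ x) = l) {N : ℕ} (hN : 0 < N)
    (φ : MvPolynomial (Fin (e+1)) (ResidueField R) →+* (AN (JJ x) N ⧸ KN (JJ x) N))
    (hφ : ∀ G, φ (MvPolynomial.map (residue R) G) = Ideal.Quotient.mk _ (psi x hN G)) :
    ∃ s : Finset (AN (JJ x) N ⧸ KN (JJ x) N), ∀ z : AN (JJ x) N ⧸ KN (JJ x) N, ∃ g : MvPolynomial (Fin (e+1)) (ResidueField R), g ≠ 0 ∧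
      ∃ c : (AN (JJ x) N ⧸ KN (JJ x) N) → MvPolynomial (Fin (e+1)) (ResidueField R), φ g * z = ∑ i ∈ s, φ (c i) * i := by
  classical
  have hN' : (0:ℝ) < N := by exact_mod_cast hN
  refine max_indep (T := MvPolynomial (Fin (e+1)) (ResidueField R)) (H := AN (JJ x) N ⧸ KN (JJ x) N) φ
    (fun z => ∃ (j : ℕ) (a : R) (ha : a ∈ wcl (JJ x) ((j:ℝ)/N)), z = Ideal.Quotient.mk _ ⟨monomial j a, monomial_mem_AN ha⟩) l ?_ ?_
  · intro n v hv hn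
    choose j a ha hv using hv
    obtain ⟨τ, p, hp, ⟨i0, hi0⟩, hs⟩ := h.RK hm hl (ι := Fin n) (by simpa using hn) a (fun i => (j i : ℝ)/N)
      (fun i r hr => wcl_anti hr.le (ha i))
    have hne : ∀ i, p i ≠ 0 → MvPolynomial.map (residue R) (p i) ≠ 0 := by
      intro i hi h0
      obtain ⟨_, _, _, α, hα⟩ := (hp i).resolve_left hi
      have := congrArg (MvPolynomial.coeff α) h0
      rw [MvPolynomial.coeff_map, MvPolynomial.coeff_zero, residue_eq_zero_iff] at this
      exact hα this
    refine ⟨fun i => MvPolynomial.map (residue R) (p i), ⟨i0, hne i0 hi0⟩, ?_⟩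
    simp_rw [hφ, hv, ← map_mul, ← map_sum]
    rw [Ideal.Quotient.eq_zero_iff_mem]
    obtain ⟨n0, hτ, -, -⟩ := (hp i0).resolve_left hi0
    obtain ⟨u, hu⟩ : ∃ u : ℕ, (u:ℝ)/N = τ := ⟨n0 * N + j i0, by rw [← hτ]; push_cast; field_simp⟩
    have : ∀ i, ((psi x hN (p i) * ⟨monomial (j i) (a i), monomial_mem_AN (ha i)⟩ : AN (JJ x) N) : R[X]) = monomial u ((p i).eval x * a i) := by
      intro i
      rcases hp i with h0 | ⟨n1, h1, h2, -⟩
      · rw [h0]; simp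
      · rw [Subalgebra.coe_mul, psi_homog hN h2, monomial_mul_monomial]
        rw [← h1] at hu
        field_simp at hu
        have : u = n1 * N + j i := by exact_mod_cast (by linarith : (u:ℝ) = n1 * N + j i)
        rw [this]
    intro i
    rw [AddSubmonoidClass.coe_finsetSum, Finset.sum_congr rfl fun i _ => this i, ← map_sum, coeff_monomial]
    split_ifs with hh
    · rw [← hh, hu]; exact hs
    · exact Ideal.zero_mem _
  · intro z
    obtain ⟨p, rfl⟩ := Ideal.Quotient.mk_surjective z
    refine ⟨(p : R[X]).support, fun j => Ideal.Quotient.mk _ ⟨monomial j ((p : R[X]).coeff j), monomial_mem_AN (mem_AN.1 p.2 j)⟩,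
      fun j => ⟨j, _, mem_AN.1 p.2 j, rfl⟩, ?_⟩
    conv_lhs => rw [mk_eq_sum p]
    rw [map_sum]

theorem HN_finite [IsNoetherianRing R] (h : Ctx x (maximalIdeal R)) (hm : maximalIdeal R ≤ wcl (JJ x) 1) {l : ℕ} (hl : lam (JJ x) = l) {N : ℕ} (hN : 0 < N)
    (φ : MvPolynomial (Fin (e+1)) (ResidueField R) →+* (AN (JJ x) N ⧸ KN (JJ x) N))
    (hφ : ∀ G, φ (MvPolynomial.map (residue R) G) = Ideal.Quotient.mk _ (psi x hN G)) :
    ∃ s : Finset (AN (JJ x) N ⧸ KN (JJ x) N), ∀ z : AN (JJ x) N ⧸ KN (JJ x) N,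
      ∃ c : (AN (JJ x) N ⧸ KN (JJ x) N) → MvPolynomial (Fin (e+1)) (ResidueField R), z = ∑ i ∈ s, φ (c i) * i := by
  classical
  letI : Algebra (MvPolynomial (Fin (e+1)) (ResidueField R)) (AN (JJ x) N ⧸ KN (JJ x) N) :=
    RingHom.toAlgebra (R := MvPolynomial (Fin (e+1)) (ResidueField R)) (S := AN (JJ x) N ⧸ KN (JJ x) N) φ
  haveI := HN_reduced h N
  have hsm : ∀ (g : MvPolynomial (Fin (e+1)) (ResidueField R)) (z : AN (JJ x) N ⧸ KN (JJ x) N), g • z = φ g * z := fun _ _ => rfl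
  have hfin : Module.Finite (MvPolynomial (Fin (e+1)) (ResidueField R)) (AN (JJ x) N ⧸ KN (JJ x) N) := by
    refine finite_of_reduced (k := ResidueField R) (d := e + 1) (AN (JJ x) N ⧸ KN (JJ x) N) ?_ ⟨HN_int hN φ hφ⟩ ?_
    · intro g z hg hz
      exact HN_tf h hN φ hφ g z hg hz
    · obtain ⟨s, hs⟩ := HN_rank h hm hl hN φ hφ
      refine ⟨s, fun z => ?_⟩
      obtain ⟨g, hg, c, hc⟩ := hs z
      refine ⟨g, hg, ?_⟩
      rw [hsm, hc]
      exact Submodule.sum_mem _ fun i hi => Submodule.smul_mem _ (c i) (Submodule.subset_span hi)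
  obtain ⟨s, hs⟩ := hfin
  refine ⟨s, fun z => ?_⟩
  have : z ∈ Submodule.span (MvPolynomial (Fin (e+1)) (ResidueField R)) (s : Set (AN (JJ x) N ⧸ KN (JJ x) N)) := by rw [hs]; trivial
  obtain ⟨c, hc⟩ := Submodule.mem_span_finset.1 this
  exact ⟨c, hc.2.symm⟩

/-- Rees-type bound from finite generation plus Chevalley. -/
theorem Ctx.rees [IsNoetherianRing R] (h : Ctx x (maximalIdeal R)) (hm : maximalIdeal R ≤ wcl (JJ x) 1) {l : ℕ} (hl : lam (JJ x) = l)
    (hI : ∀ a, (∀ r, a ∈ wcl (JJ x) r) → a = 0) (hch : ∀ r : ℕ, ∃ n : ℕ, wcl (JJ x) (n:ℝ) ≤ JJ x ^ r) :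
    ∃ c : ℕ, ∀ n : ℕ, wcl (JJ x) (n:ℝ) ≤ JJ x ^ (n - c) := by
  classical
  obtain ⟨N, hN, hdis⟩ := h.discrete hm hl hI
  have hN' : (0:ℝ) < N := by exact_mod_cast hN
  obtain ⟨φ, hφ⟩ := exists_phi (x := x) hN hm
  obtain ⟨s, hs⟩ := HN_finite h hm hl hN φ hφ
  choose rp hrp using fun z : AN (JJ x) N ⧸ KN (JJ x) N => Ideal.Quotient.mk_surjective z
  set D := s.sup fun z => (rp z : R[X]).natDegree with hD
  have step : ∀ (j c : ℕ), c * N + D ≤ j → wcl (JJ x) ((j:ℝ)/N) ≤ JJ x ^ c ⊔ wcl (JJ x) (((j+1:ℕ):ℝ)/N) := by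
    intro j c hjc a ha
    obtain ⟨g, hg⟩ := hs (Ideal.Quotient.mk _ ⟨monomial j a, monomial_mem_AN ha⟩)
    choose G hG using fun z => MvPolynomial.map_surjective (residue R) residue_surjective (g z)
    have h1 : (⟨monomial j a, monomial_mem_AN ha⟩ : AN (JJ x) N) - ∑ z ∈ s, psi x hN (G z) * rp z ∈ KN (JJ x) N := by
      rw [← Ideal.Quotient.eq_zero_iff_mem, map_sub, map_sum, sub_eq_zero, hg]
      refine Finset.sum_congr rfl fun z _ => ?_
      rw [map_mul, hrp, ← hG, hφ]
    have h2 := h1 j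
    rw [Subalgebra.coe_sub, coeff_sub, AddSubmonoidClass.coe_finsetSum, finsetSum_coeff] at h2
    simp only [coeff_monomial, if_true] at h2
    have h3 : ∑ z ∈ s, ((psi x hN (G z) * rp z : AN (JJ x) N) : R[X]).coeff j ∈ JJ x ^ c := by
      refine Ideal.sum_mem _ fun z hz => ?_
      rw [Subalgebra.coe_mul, coeff_mul]
      refine Ideal.sum_mem _ fun u hu => ?_
      have hu' := Finset.HasAntidiagonal.mem_antidiagonal.1 hu
      by_cases hd : (rp z : R[X]).natDegree < u.2
      · rw [coeff_eq_zero_of_natDegree_lt hd, mul_zero]; exact Ideal.zero_mem _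
      · have : (rp z : R[X]).natDegree ≤ D := Finset.le_sup (f := fun z => (rp z : R[X]).natDegree) hz
        exact Ideal.mul_mem_right _ _ (psi_coeff_mem hN _ _ _ (by omega))
    have := Submodule.add_mem_sup h3 (hdis j _ h2)
    rwa [add_sub_cancel] at this
  have iter : ∀ (i j c : ℕ), c * N + D ≤ j → wcl (JJ x) ((j:ℝ)/N) ≤ JJ x ^ c ⊔ wcl (JJ x) (((j+i:ℕ):ℝ)/N) := by
    intro i
    induction i with
    | zero => intro j c _; exact le_sup_right
    | succ i ih =>
      intro j c hj
      refine (ih j c hj).trans (sup_le le_sup_left ?_)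
      exact step (j + i) c (by omega)
  refine ⟨D, fun n => ?_⟩
  rcases Nat.lt_or_ge n D with h0 | h0
  · rw [Nat.sub_eq_zero_of_le h0.le, pow_zero, Ideal.one_eq_top]; exact le_top
  obtain ⟨q, hq⟩ := hch (n - D)
  have h1 := iter (q * N) (n * N) (n - D) (by
    have : D ≤ D * N := Nat.le_mul_of_pos_right _ hN
    have h2 : (n - D) * N + D * N = n * N := by rw [← add_mul, Nat.sub_add_cancel h0]
    omega)
  have e1 : (((n * N : ℕ):ℝ))/N = n := by push_cast; field_simp
  have e2 : (q:ℝ) ≤ (((n * N + q * N : ℕ):ℝ))/N := by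
    rw [le_div_iff₀ hN']; push_cast; nlinarith [(Nat.cast_nonneg n : (0:ℝ) ≤ n)]
  rw [e1] at h1
  exact h1.trans (sup_le le_rfl ((wcl_anti e2).trans hq))
end
end CMproof

end

section

open IsLocalRing Polynomial Finset
set_option maxHeartbeats 2000000
set_option linter.style.haveILetI false
set_option linter.unusedSectionVars false
namespace CMproof
section

theorem princ_sep {A : Type*} [CommRing A] [IsDomain A] [IsNoetherianRing A] (u b : A) (hu : ¬ IsUnit u) (hb : b ≠ 0)
    (h : ∀ r : ℕ, ∃ c : ℕ, ∀ M s : ℕ, s + c ≤ r * M → u ^ s ∣ b ^ M) : False := by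
  have hne : Ideal.span {u} ≠ ⊤ := fun h => hu (Ideal.span_singleton_eq_top.1 h)
  obtain ⟨m0, hm0, hle⟩ := Ideal.exists_le_maximal _ hne
  haveI := hm0.isPrime
  obtain ⟨p, hp, -⟩ := Ideal.exists_minimalPrimes_le hle
  haveI : p.IsPrime := hp.1.1
  have hup : u ∈ p := hp.1.2 (Ideal.mem_span_singleton_self u)
  have hht := Ideal.height_le_one_of_isPrincipal_of_mem_minimalPrimes _ p hp
  let L := Localization.AtPrime p
  have hinj : Function.Injective (algebraMap A L) := IsLocalization.injective L p.primeCompl_le_nonZeroDivisors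
  haveI : IsDomain L := IsLocalization.isDomain_localization p.primeCompl_le_nonZeroDivisors
  set U := algebraMap A L u with hU
  set B := algebraMap A L b with hB
  have hUn : ¬ IsUnit U := by
    rw [IsLocalization.AtPrime.isUnit_to_map_iff L p]
    exact fun h => h hup
  have hrad : U ∈ (Ideal.span {B}).radical := by
    rw [Ideal.radical_eq_sInf, Ideal.mem_sInf]
    rintro q ⟨hBq, hq⟩
    haveI := hq
    have hbq : b ∈ q.comap (algebraMap A L) := hBq (Ideal.mem_span_singleton_self B)
    have hle : q.comap (algebraMap A L) ≤ p := by
      intro z hz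
      by_contra hcon
      exact hq.ne_top (Ideal.eq_top_of_isUnit_mem _ hz ((IsLocalization.AtPrime.isUnit_to_map_iff L p z).2 hcon))
    by_contra hcon
    have hlt : q.comap (algebraMap A L) < p := lt_of_le_of_ne hle fun h => hcon (by
      have : u ∈ q.comap (algebraMap A L) := h.symm ▸ hup
      exact this)
    have h1 : (⊥ : Ideal A) < q.comap (algebraMap A L) := bot_lt_iff_ne_bot.2 fun h => hb (by rw [h] at hbq; exact hbq)
    haveI : (⊥ : Ideal A).IsPrime := Ideal.isPrime_bot
    have a1 := Ideal.height_add_one_le_of_lt_of_isPrime h1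
    have a2 := Ideal.height_add_one_le_of_lt_of_isPrime hlt
    have : (2 : ℕ∞) ≤ 1 := by
      calc (2 : ℕ∞) = 0 + 1 + 1 := by norm_num
        _ ≤ (⊥ : Ideal A).height + 1 + 1 := by gcongr; simp
        _ ≤ _ := by gcongr
        _ ≤ _ := a2
        _ ≤ 1 := hht
    exact absurd this (by decide)
  obtain ⟨s, hs⟩ := hrad
  obtain ⟨a, ha⟩ := Ideal.mem_span_singleton'.1 hs
  obtain ⟨c, hc⟩ := h (s + 1)
  have hd := hc (c + 1) (s * (c + 1) + 1) (by ring_nf; omega)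
  have hd2 : U ^ (s * (c + 1) + 1) ∣ B ^ (c + 1) := by
    have := map_dvd (algebraMap A L) hd
    simpa using this
  have hU0 : U ≠ 0 := by
    intro h0
    have hB0 : B ≠ 0 := fun h => hb ((injective_iff_map_eq_zero _).1 hinj _ h)
    rw [h0, zero_pow (by omega), zero_dvd_iff] at hd2
    exact pow_ne_zero _ hB0 hd2
  have hd3 : U ^ (s * (c + 1) + 1) ∣ U ^ (s * (c + 1)) := by
    refine hd2.trans ?_
    rw [pow_mul, ← ha, mul_pow]
    exact Dvd.intro_left _ rfl
  obtain ⟨z, hz⟩ := hd3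
  refine hUn (IsUnit.of_mul_eq_one z ?_)
  apply mul_left_cancel₀ (pow_ne_zero (s * (c + 1)) hU0)
  rw [mul_one]
  conv_rhs => rw [hz]
  ring

theorem dom_sep {D : Type*} [CommRing D] [IsDomain D] [IsNoetherianRing D] (J : Ideal D) (hJ : J ≠ ⊤) (b : D)
    (h : ∀ r : ℝ, b ∈ wcl J r) : b = 0 := by
  by_contra hb
  obtain ⟨S, hS⟩ := IsNoetherian.noetherian J
  let F := FractionRing D[X]
  let ι : D →+* F := (algebraMap D[X] F).comp C
  let X' : F := algebraMap D[X] F X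
  have hinj : Function.Injective (algebraMap D[X] F) := IsFractionRing.injective _ _
  have hX' : X' ≠ 0 := fun h => X_ne_zero ((injective_iff_map_eq_zero _).1 hinj _ h)
  set A := Algebra.adjoin D[X] ((fun y => ι y / X') '' (S : Set D)) with hA
  haveI : IsNoetherianRing A := isNoetherianRing_of_fg (Subalgebra.fg_def.2 ⟨_, S.finite_toSet.image _, rfl⟩)
  let u : A := algebraMap D[X] A X
  set 𝔞 : Ideal D[X] := J.map C ⊔ Ideal.span {X} with h𝔞
  have hX𝔞 : X ∈ 𝔞 := Ideal.mem_sup_right (Ideal.mem_span_singleton_self _)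
  have key : ∀ f ∈ A, ∃ k, ∃ g ∈ 𝔞 ^ k, X' ^ k * f = algebraMap D[X] F g := by
    intro f hf
    induction hf using Algebra.adjoin_induction with
    | mem z hz =>
      obtain ⟨y, hy, rfl⟩ := hz
      refine ⟨1, C y, ?_, ?_⟩
      · rw [pow_one]; exact Ideal.mem_sup_left (Ideal.mem_map_of_mem _ (hS ▸ Submodule.subset_span hy))
      · rw [pow_one]; exact mul_div_cancel₀ (ι y) hX'
    | algebraMap r => exact ⟨0, r, by simp, by simp⟩
    | add z w _ _ hz hw =>
      obtain ⟨k, g, hg, e1⟩ := hz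
      obtain ⟨k', g', hg', e2⟩ := hw
      refine ⟨k + k', X ^ k' * g + X ^ k * g', ?_, ?_⟩
      · refine Ideal.add_mem _ ?_ ?_
        · rw [add_comm k, pow_add]; exact Ideal.mul_mem_mul (Ideal.pow_mem_pow hX𝔞 _) hg
        · rw [pow_add]; exact Ideal.mul_mem_mul (Ideal.pow_mem_pow hX𝔞 _) hg'
      · rw [map_add, map_mul, map_mul, ← e1, ← e2, map_pow, map_pow]; ring
    | mul z w _ _ hz hw =>
      obtain ⟨k, g, hg, e1⟩ := hz
      obtain ⟨k', g', hg', e2⟩ := hw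
      refine ⟨k + k', g * g', ?_, ?_⟩
      · rw [pow_add]; exact Ideal.mul_mem_mul hg hg'
      · rw [map_mul, ← e1, ← e2]; ring
  have hu : ¬ IsUnit u := by
    intro hun
    obtain ⟨v, hv⟩ := isUnit_iff_exists_inv.1 hun
    obtain ⟨k, g, hg, e1⟩ := key v v.2
    have hv' : X' * (v : F) = 1 := congrArg Subtype.val hv
    have h1 : X' ^ k = X' * algebraMap D[X] F g := by
      rw [← e1, mul_left_comm, hv', mul_one]
    have h2 : (X:D[X]) ^ k = X * g := by
      apply hinj; rw [map_pow, map_mul]; exact h1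
    -- reduce modulo `J`
    let π := Polynomial.mapRingHom (Ideal.Quotient.mk J)
    have h3 : 𝔞.map π ≤ Ideal.span {X} := by
      rw [h𝔞, Ideal.map_sup, Ideal.map_map, Ideal.map_span]
      refine sup_le ?_ ?_
      · rw [Ideal.map_le_iff_le_comap]
        intro y hy
        simp [π, Ideal.Quotient.eq_zero_iff_mem.2 hy]
      · simp [π]
    have h4 : π g ∈ Ideal.span {(X : (D ⧸ J)[X]) ^ k} := by
      rw [← Ideal.span_singleton_pow]
      have := Ideal.mem_map_of_mem π hg
      rw [Ideal.map_pow] at this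
      exact Ideal.pow_right_mono h3 k this
    haveI : Nontrivial (D ⧸ J) := Ideal.Quotient.nontrivial_iff.2 hJ
    obtain ⟨w, hw⟩ := Ideal.mem_span_singleton.1 h4
    have h5 := congrArg π h2
    rw [map_pow, map_mul, hw] at h5
    have h6 : (X : (D ⧸ J)[X]) ^ k = X * (X ^ k * w) := by simpa [π] using h5
    have := congrArg (fun q => q.coeff k) h6
    simp only [coeff_X_pow, if_true] at this
    rw [← mul_assoc, ← pow_succ', mul_comm, coeff_mul_X_pow', if_neg (by omega)] at this
    exact one_ne_zero this
  have hinjA : Function.Injective (algebraMap D[X] A) := fun a b hab => hinj (congrArg Subtype.val hab)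
  have hmap : J.map ((algebraMap D[X] A).comp C) ≤ Ideal.span {u} := by
    rw [← hS, Ideal.map_span, Ideal.span_le]
    rintro _ ⟨y, hy, rfl⟩
    refine Ideal.mem_span_singleton.2 ⟨⟨ι y / X', Algebra.subset_adjoin ⟨y, hy, rfl⟩⟩, ?_⟩
    apply Subtype.ext
    exact (mul_div_cancel₀ (ι y) hX').symm
  refine princ_sep u (algebraMap D[X] A (C b)) hu (fun h0 => hb ?_) fun r => ?_
  · exact C_eq_zero.1 ((injective_iff_map_eq_zero _).1 hinjA _ h0)
  · obtain ⟨c, hc⟩ := h r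
    refine ⟨⌈c⌉₊, fun M s hs => ?_⟩
    have h1 : b ^ M ∈ J ^ s := by
      apply hc
      have h2 : ((s + ⌈c⌉₊ : ℕ) : ℝ) ≤ (r * M : ℕ) := by exact_mod_cast hs
      push_cast at h2
      have := Nat.le_ceil c
      linarith
    have h2 := Ideal.mem_map_of_mem ((algebraMap D[X] A).comp C) h1
    rw [Ideal.map_pow] at h2
    have h3 := Ideal.pow_right_mono hmap s h2
    rw [Ideal.span_singleton_pow, Ideal.mem_span_singleton] at h3
    simpa using h3

theorem sep {S : Type*} [CommRing S] [IsLocalRing S] [IsNoetherianRing S] [IsReduced S] (J : Ideal S) (hJ : J ≤ maximalIdeal S) (b : S)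
    (h : ∀ r : ℝ, b ∈ wcl J r) : b = 0 := by
  have : b ∈ nilradical S := by
    rw [nilradical_eq_sInf, Ideal.mem_sInf]
    intro P hP
    have hP' : P.IsPrime := hP
    rw [← Ideal.Quotient.eq_zero_iff_mem]
    refine dom_sep (J.map (Ideal.Quotient.mk P)) ?_ _ fun r => wcl_map _ _ _ (Ideal.mem_map_of_mem _ (h r))
    intro htop
    have h1 : J.map (Ideal.Quotient.mk P) ≤ (maximalIdeal S).map (Ideal.Quotient.mk P) := Ideal.map_mono hJ
    rw [htop, top_le_iff] at h1
    have h2 := congrArg (Ideal.comap (Ideal.Quotient.mk P)) h1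
    rw [Ideal.comap_map_of_surjective _ Ideal.Quotient.mk_surjective, Ideal.comap_top, ← RingHom.ker_eq_comap_bot, Ideal.mk_ker,
      sup_eq_left.2 (le_maximalIdeal hP'.ne_top)] at h2
    exact (maximalIdeal.isMaximal S).ne_top h2
  rw [nilradical_eq_zero] at this
  exact this
end
end CMproof

end

section

open IsLocalRing Polynomial Finset
set_option maxHeartbeats 2000000
set_option linter.style.haveILetI false
set_option linter.unusedSectionVars false
namespace CMproof
section

/-- descending chains of ideals containing an ideal of finite colength stabilize -/
theorem chain_stab {S : Type*} [CommRing S] (E : ℕ → Ideal S) (hE : Antitone E) (K : Ideal S) (hK : ∀ n, K ≤ E n)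
    (hf : lam K ≠ ⊤) : ∃ n, ∀ k ≥ n, E k = E n := by
  obtain ⟨l, hl⟩ := ENat.ne_top_iff_exists.1 hf
  have hfin : ∀ n, lam (E n) ≠ ⊤ := fun n => ne_top_of_le_ne_top hf (lam_anti (hK n))
  have hmono : Monotone (fun n => lam (E n)) := fun a b hab => lam_anti (hE hab)
  have hle : ∀ n, (lam (E n)).toNat ≤ l := by
    intro n
    have h1 := lam_anti (hK n)
    rw [← hl] at h1
    exact ENat.toNat_le_of_le_coe h1
  obtain ⟨n, hn⟩ : ∃ n, ∀ k, (lam (E k)).toNat ≤ (lam (E n)).toNat := by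
    have hb : BddAbove (Set.range fun n => (lam (E n)).toNat) := ⟨l, by rintro _ ⟨n, rfl⟩; exact hle n⟩
    obtain ⟨n, hn⟩ := Nat.sSup_mem (Set.range_nonempty fun n => (lam (E n)).toNat) hb
    exact ⟨n, fun k => by
      have := le_csSup hb ⟨k, rfl⟩
      rw [← hn] at this
      exact this⟩
  refine ⟨n, fun k hk => ?_⟩
  symm
  refine eq_of_lam (hE hk) (hfin k) ?_
  rw [← ENat.coe_toNat (hfin k), ← ENat.coe_toNat (hfin n)]
  exact_mod_cast hn k

theorem chevalley {S : Type*} [CommRing S] (J : Ideal S) (hf : ∀ s, lam (J ^ s) ≠ ⊤)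
    (hprec : ∀ f : ℕ → S, (∀ n, f (n + 1) - f n ∈ J ^ n) → ∃ L, ∀ n, L - f n ∈ J ^ n)
    (hI : ∀ a, (∀ r : ℝ, a ∈ wcl J r) → a = 0) (r : ℕ) : ∃ n : ℕ, wcl J (n : ℝ) ≤ J ^ r := by
  by_contra hcon
  push Not at hcon
  have hst : ∀ s, ∃ n, ∀ k ≥ n, wcl J ((k : ℕ) : ℝ) ⊔ J ^ s = wcl J ((n : ℕ) : ℝ) ⊔ J ^ s := fun s =>
    chain_stab (fun n => wcl J ((n : ℕ) : ℝ) ⊔ J ^ s)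
      (fun a b hab => sup_le_sup_right (wcl_anti (by exact_mod_cast hab)) _) (J ^ s) (fun n => le_sup_right) (hf s)
  choose N hN using hst
  have hE : ∀ s k, wcl J ((N s : ℕ) : ℝ) ⊔ J ^ s ≤ wcl J ((k : ℕ) : ℝ) ⊔ J ^ s := by
    intro s k
    rw [← hN s (max (N s) k) (le_max_left _ _)]
    exact sup_le_sup_right (wcl_anti (by exact_mod_cast le_max_right _ _)) _
  -- lifting
  have hlift : ∀ s y, y ∈ wcl J ((N s : ℕ) : ℝ) ⊔ J ^ s →
      ∃ z, z ∈ wcl J ((N (s+1) : ℕ) : ℝ) ⊔ J ^ (s+1) ∧ z - y ∈ J ^ s := by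
    intro s y hy
    obtain ⟨a, ha, b, hb, rfl⟩ := Submodule.mem_sup.1 (hE s (N (s+1)) hy)
    refine ⟨a, Ideal.mem_sup_left ha, ?_⟩
    have : a - (a + b) = -b := by ring
    rw [this]; exact neg_mem hb
  choose g hg using hlift
  obtain ⟨y0, hy0, hy0'⟩ := SetLike.not_le_iff_exists.1 (hcon (N r))
  let f : (k : ℕ) → {y : S // y ∈ wcl J ((N (r + k) : ℕ) : ℝ) ⊔ J ^ (r + k)} := fun k =>
    Nat.rec ⟨y0, Ideal.mem_sup_left hy0⟩ (fun k y => ⟨g (r + k) y.1 y.2, (hg (r+k) y.1 y.2).1⟩) k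
  have hf1 : ∀ k, (f (k+1)).1 - (f k).1 ∈ J ^ (r + k) := fun k => (hg (r+k) (f k).1 (f k).2).2
  obtain ⟨L, hL⟩ := hprec (fun k => (f k).1) (fun k => Ideal.pow_le_pow_right (by omega) (hf1 k))
  -- L = 0
  have hL0 : L = 0 := by
    refine hI L fun q => ?_
    obtain ⟨n, hn⟩ := exists_nat_ge q
    refine wcl_anti hn ?_
    have h1 := pow_le_wcl n (hL n)
    have h2 := hE (r+n) n (f n).2
    have h3 : wcl J (n:ℝ) ⊔ J ^ (r+n) ≤ wcl J n :=
      sup_le le_rfl ((Ideal.pow_le_pow_right (by omega)).trans (pow_le_wcl n))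
    have := add_mem h1 (h3 h2)
    simpa using this
  have hk : ∀ k, (f k).1 - y0 ∈ J ^ r := by
    intro k
    induction k with
    | zero => simp [f]
    | succ k ih =>
      have := add_mem (Ideal.pow_le_pow_right (by omega) (hf1 k) : _ ∈ J ^ r) ih
      simpa using this
  apply hy0'
  have h1 := hL r
  have h2 := hk r
  rw [hL0] at h1
  have := neg_mem (add_mem h1 h2)
  simpa using this

end
end CMproof

end

section

open IsLocalRing Polynomial Finset
set_option maxHeartbeats 2000000
set_option linter.style.haveILetI false
set_option linter.unusedSectionVars false
namespace CMproof
section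

theorem completion_noeth {A : Type*} [CommRing A] [IsNoetherianRing A] (I : Ideal A) :
    IsNoetherianRing (AdicCompletion I A) := by
  obtain ⟨n, y, hy⟩ := Submodule.fg_iff_exists_fin_generating_family.1 (IsNoetherian.noetherian I)
  let P := MvPolynomial (Fin n) A
  let I0 : Ideal P := MvPolynomial.idealOfVars (Fin n) A
  have hI0fg : I0.FG := MvPolynomial.idealOfVars_fg (Fin n) A
  haveI hnP : IsNoetherianRing (AdicCompletion I0 P) :=
    isNoetherianRing_of_ringEquiv (MvPowerSeries (Fin n) A) (MvPowerSeries.toAdicCompletionAlgEquiv (Fin n) A).toRingEquiv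
  let φ : P →+* A := (MvPolynomial.aeval y : P →ₐ[A] A).toRingHom
  have hφ : I0.map φ = I := by
    rw [← hy, Ideal.map_span, ← Set.range_comp]
    have : (φ ∘ MvPolynomial.X : Fin n → A) = y := by
      funext i; exact MvPolynomial.aeval_X y i
    rw [this]
  have hφn : ∀ k, I0 ^ k ≤ (I ^ k).comap φ := fun k => by
    rw [← Ideal.map_le_iff_le_comap, Ideal.map_pow, hφ]
  let f : (k : ℕ) → AdicCompletion I0 P →+* A ⧸ I ^ k := fun k =>
    (Ideal.quotientMap (I ^ k) φ (hφn k)).comp (AdicCompletion.evalₐ I0 k).toRingHom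
  have hf : ∀ {a b : ℕ} (hab : a ≤ b), (Ideal.Quotient.factorPow I hab).comp (f b) = f a := by
    intro a b hab
    ext x
    obtain ⟨x, rfl⟩ := AdicCompletion.mk_surjective I0 P x
    simp only [f, RingHom.comp_apply, AlgHom.toRingHom_eq_coe, RingHom.coe_coe, AdicCompletion.evalₐ_mk,
      Ideal.quotientMap_mk]
    erw [Ideal.Quotient.factor_mk]
    rw [Ideal.Quotient.eq, ← map_sub]
    apply hφn a
    have := x.2 hab
    have h2 := Submodule.sub_mem _ (SModEq.sub_mem.1 this.symm) (Submodule.zero_mem _)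
    simpa using h2
  let F : AdicCompletion I0 P →+* AdicCompletion I A := AdicCompletion.liftRingHom I f hf
  have hFof : ∀ p : P, F (AdicCompletion.of I0 P p) = AdicCompletion.of I A (φ p) := by
    intro p
    apply AdicCompletion.ext_evalₐ
    intro k
    have h1 : AdicCompletion.evalₐ I k (F (AdicCompletion.of I0 P p)) = f k (AdicCompletion.of I0 P p) := by
      simp [F]
    rw [h1, AdicCompletion.evalₐ_of]
    simp only [f, RingHom.comp_apply, AlgHom.toRingHom_eq_coe, RingHom.coe_coe, AdicCompletion.evalₐ_of,
      Ideal.quotientMap_mk]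
  haveI := AdicCompletion.isAdicComplete_self I0 hI0fg
  have hIfg : I.FG := IsNoetherian.noetherian I
  have hcI := AdicCompletion.isAdicComplete_self I hIfg
  have hmap : (I0.map (algebraMap P (AdicCompletion I0 P))).map F = I.map (algebraMap A (AdicCompletion I A)) := by
    have h1 : I.map (algebraMap A (AdicCompletion I A)) = (I0.map φ).map (algebraMap A (AdicCompletion I A)) := by rw [hφ]
    rw [h1, Ideal.map_map, Ideal.map_map]
    congr 1
  haveI : IsHausdorff ((I0.map (algebraMap P (AdicCompletion I0 P))).map F) (AdicCompletion I A) := by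
    rw [hmap]; exact hcI.toIsHausdorff
  refine isNoetherianRing_of_surjective _ _ F (surjective_of_mk_map_comp_surjective
    (I := I0.map (algebraMap P (AdicCompletion I0 P))) F ?_)
  intro z
  obtain ⟨z, rfl⟩ := Ideal.Quotient.mk_surjective z
  obtain ⟨a, ha⟩ := Ideal.Quotient.mk_surjective (AdicCompletion.evalOneₐ I z)
  refine ⟨AdicCompletion.of I0 P (MvPolynomial.C a), ?_⟩
  rw [RingHom.comp_apply, Ideal.Quotient.eq, hmap, hFof, ← AdicCompletion.ker_evalOneₐ_eq_map I hIfg]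
  have : φ (MvPolynomial.C a) = a := MvPolynomial.aeval_C y a
  rw [this, RingHom.mem_ker, map_sub, sub_eq_zero]
  exact (AdicCompletion.evalOneₐ_of I a).trans ha

end
end CMproof

end

section

open IsLocalRing Polynomial Finset
set_option maxHeartbeats 2000000
set_option linter.style.haveILetI false
set_option linter.unusedSectionVars false
namespace CMproof
section
variable {R : Type*} [CommRing R] {S : Type*} [CommRing S] (ι : R →+* S) (M : Ideal R)

theorem approx_map (h2 : ∀ n y, ∃ a, y - ι a ∈ (M.map ι) ^ n) (K : Ideal R) (k : ℕ)
    {y : S} (hy : y ∈ K.map ι) : ∃ a ∈ K, y - ι a ∈ (M.map ι) ^ k := by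
  refine Submodule.span_induction (p := fun y _ => ∃ a ∈ K, y - ι a ∈ (M.map ι) ^ k) ?_ ?_ ?_ ?_ hy
  · rintro _ ⟨a, ha, rfl⟩
    exact ⟨a, ha, by simp⟩
  · exact ⟨0, zero_mem _, by simp⟩
  · rintro y z _ _ ⟨a, ha, ha'⟩ ⟨b, hb, hb'⟩
    refine ⟨a + b, add_mem ha hb, ?_⟩
    have := add_mem ha' hb'
    rw [map_add]; convert this using 1; ring
  · rintro c y _ ⟨a, ha, ha'⟩
    obtain ⟨r, hr⟩ := h2 k c
    refine ⟨r * a, Ideal.mul_mem_left _ _ ha, ?_⟩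
    have := add_mem (Ideal.mul_mem_left _ c ha') (Ideal.mul_mem_right (ι a) _ hr)
    rw [map_mul, smul_eq_mul]; convert this using 1; ring

theorem comap_map_of (h1 : ∀ n a, ι a ∈ (M.map ι) ^ n → a ∈ M ^ n) (h2 : ∀ n y, ∃ a, y - ι a ∈ (M.map ι) ^ n)
    (K : Ideal R) (k : ℕ) (hK : M ^ k ≤ K) {a : R} (ha : ι a ∈ K.map ι) : a ∈ K := by
  obtain ⟨b, hb, hab⟩ := approx_map ι M h2 K k ha
  rw [← map_sub] at hab
  have := add_mem (hK (h1 _ _ hab)) hb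
  simpa using this

theorem Ctx.compl {d : ℕ} {x : Fin d → R} (h : Ctx x M) (h1 : ∀ n a, ι a ∈ (M.map ι) ^ n → a ∈ M ^ n)
    (h2 : ∀ n y, ∃ a, y - ι a ∈ (M.map ι) ^ n) (hp : (M.map ι).IsPrime)
    (hu : ∀ a, a ∉ M.map ι → IsUnit a) : Ctx (fun i => ι (x i)) (M.map ι) := by
  classical
  obtain ⟨s, hs⟩ := h.pow
  have hs' : (M.map ι) ^ s ≤ JJ (fun i => ι (x i)) := by
    rw [JJ_map, ← Ideal.map_pow]; exact Ideal.map_mono hs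
  refine ⟨hp, ?_, ⟨s, hs'⟩, ?_, ?_⟩
  · rw [JJ_map]; exact Ideal.map_mono h.le
  · intro a b ha hab
    exact (Ideal.unit_mul_mem_iff_mem _ (hu a ha)).1 hab
  · intro n f hf hev
    choose g hg using h2 s
    let F : MvPolynomial (Fin d) R := ∑ m ∈ f.support, MvPolynomial.monomial m (g (f.coeff m))
    have hFc : ∀ m, F.coeff m = if m ∈ f.support then g (f.coeff m) else 0 := by
      intro m
      simp only [F, MvPolynomial.coeff_sum, MvPolynomial.coeff_monomial]
      simp
    have hF : F.IsHomogeneous n := by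
      intro m hm
      rw [hFc] at hm
      split_ifs at hm with h0
      · exact hf (MvPolynomial.mem_support_iff.1 h0)
      · simp at hm
    have hFι : (F.map ι).IsHomogeneous n := hF.map ι
    have hd : ∀ m, (f - F.map ι).coeff m ∈ JJ (fun i => ι (x i)) := by
      intro m
      rw [MvPolynomial.coeff_sub, MvPolynomial.coeff_map, hFc]
      split_ifs with h0
      · exact hs' (hg _)
      · rw [MvPolynomial.notMem_support_iff.1 h0]; simp
    have h3 := eval_mem_mul (x := fun i => ι (x i)) _ (hf.sub hFι) hd
    rw [← pow_succ', map_sub] at h3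
    have h4 : MvPolynomial.eval (fun i => ι (x i)) (F.map ι) = ι (MvPolynomial.eval x F) := by
      rw [MvPolynomial.eval_map, MvPolynomial.eval₂_comp]; rfl
    have h5 := sub_mem hev h3
    rw [sub_sub_cancel, h4, JJ_map_pow] at h5
    have h6 := comap_map_of ι M h1 h2 _ (s * (n+1)) (by rw [pow_mul]; exact Ideal.pow_right_mono hs _) h5
    have h7 := h.qreg n F hF h6
    intro m
    have := add_mem (hd m) (show (F.map ι).coeff m ∈ JJ (fun i => ι (x i)) by
      rw [MvPolynomial.coeff_map, JJ_map]; exact Ideal.mem_map_of_mem _ (h7 m))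
    rw [MvPolynomial.coeff_sub] at this
    simpa using this

theorem prec_of {M' J : Ideal S} [IsAdicComplete M' S] {s : ℕ} (hs : M' ^ s ≤ J) (hJ : J ≤ M') (f : ℕ → S)
    (hf : ∀ n, f (n + 1) - f n ∈ J ^ n) : ∃ L, ∀ n, L - f n ∈ J ^ n := by
  have hf' : ∀ n k, f (n + k) - f n ∈ J ^ n := by
    intro n k
    induction k with
    | zero => simp
    | succ k ih =>
      have := add_mem (Ideal.pow_le_pow_right (Nat.le_add_right n k) (hf (n+k))) ih
      simpa [add_assoc] using this
  obtain ⟨L, hL⟩ := IsPrecomplete.prec (I := M') (M := S) inferInstance (f := f) (by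
    intro m n hmn
    obtain ⟨k, rfl⟩ := Nat.exists_eq_add_of_le hmn
    apply SModEq.symm
    rw [SModEq.sub_mem]
    simpa using Ideal.pow_right_mono hJ m (hf' m k))
  refine ⟨L, fun n => ?_⟩
  have h1 := (SModEq.sub_mem.1 (hL (n + s * n)).symm)
  have h2 : L - f (n + s * n) ∈ J ^ n := by
    have h3 : M' ^ (n + s * n) ≤ J ^ n := (Ideal.pow_le_pow_right (Nat.le_add_left (s * n) n)).trans
      (by rw [pow_mul]; exact Ideal.pow_right_mono hs n)
    apply h3; simpa using h1
  have := add_mem h2 (hf' n (s * n))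
  simpa using this
end

section
variable {R : Type*} [CommRing R] [IsLocalRing R] [IsNoetherianRing R]

theorem Ctx.rees' {e : ℕ} {x : Fin (e+1) → R} (h : Ctx x (maximalIdeal R)) (hm : maximalIdeal R ≤ wcl (JJ x) 1)
    (hfin : lam (JJ x) ≠ ⊤) (hAU : IsReduced (AdicCompletion (maximalIdeal R) R)) :
    ∃ c : ℕ, ∀ n : ℕ, wcl (JJ x) (n:ℝ) ≤ JJ x ^ (n - c) := by
  let S := AdicCompletion (maximalIdeal R) R
  haveI : IsReduced S := hAU
  haveI : IsNoetherianRing S := completion_noeth _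
  let ι : R →+* S := algebraMap R S
  have hM : maximalIdeal S = (maximalIdeal R).map ι := AdicCompletion.maximalIdeal_eq_map
  have hker : ∀ n (y : S), y ∈ ((maximalIdeal R).map ι) ^ n ↔ AdicCompletion.eval (maximalIdeal R) R n y = 0 := by
    intro n y
    rw [← LinearMap.mem_ker, ← AdicCompletion.pow_smul_top_eq_ker_eval (IsNoetherian.noetherian _),
      ← Ideal.map_pow, Ideal.smul_top_eq_map]
    rfl
  have h1 : ∀ n a, ι a ∈ ((maximalIdeal R).map ι) ^ n → a ∈ maximalIdeal R ^ n := by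
    intro n a ha
    rw [hker] at ha
    have : AdicCompletion.eval (maximalIdeal R) R n (AdicCompletion.of (maximalIdeal R) R a) = 0 := ha
    rw [AdicCompletion.eval_of, Submodule.mkQ_apply, Submodule.Quotient.mk_eq_zero] at this
    simpa using this
  have h2 : ∀ n y, ∃ a, y - ι a ∈ ((maximalIdeal R).map ι) ^ n := by
    intro n y
    obtain ⟨a, ha⟩ := Submodule.mkQ_surjective _ (AdicCompletion.eval (maximalIdeal R) R n y)
    refine ⟨a, ?_⟩
    rw [hker, map_sub, ← ha, sub_eq_zero]
    exact (AdicCompletion.eval_of (maximalIdeal R) R n a).symm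
  have hC : Ctx (fun i => ι (x i)) (maximalIdeal S) := by
    rw [hM]
    refine h.compl ι _ h1 h2 (hM ▸ inferInstance) fun a ha => ?_
    rw [← hM] at ha
    simpa using ha
  have hmS : maximalIdeal S ≤ wcl (JJ fun i => ι (x i)) 1 := by
    rw [hM, JJ_map]
    exact (Ideal.map_mono hm).trans (wcl_map _ _ _)
  have hlam : lam (JJ fun i => ι (x i)) ≠ ⊤ := by
    rw [JJ_map, lam_flat hM.symm]; exact hfin
  obtain ⟨l, hl⟩ := ENat.ne_top_iff_exists.1 hlam
  have hI : ∀ a, (∀ r, a ∈ wcl (JJ fun i => ι (x i)) r) → a = 0 := fun a ha => sep _ hC.le a ha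
  obtain ⟨s, hs⟩ := hC.pow
  obtain ⟨c, hc⟩ := hC.rees hmS hl.symm hI (fun r => chevalley _
    (fun s => by rw [hC.lam_pow s (by omega), ← hl]; exact ENat.coe_ne_top _)
    (fun f hf => prec_of hs hC.le f hf) hI r)
  refine ⟨c, fun n a ha => ?_⟩
  obtain ⟨s, hs⟩ := h.pow
  refine comap_map_of ι _ h1 h2 _ (s * (n - c)) (by rw [pow_mul]; exact Ideal.pow_right_mono hs _) ?_
  rw [← JJ_map_pow]
  apply hc
  rw [JJ_map]
  exact wcl_map _ _ _ (Ideal.mem_map_of_mem _ ha)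

end
end CMproof

end

section

open IsLocalRing Polynomial Finset
set_option maxHeartbeats 2000000
set_option linter.style.haveILetI false
set_option linter.unusedSectionVars false
namespace CMproof
section
universe u
variable {R : Type u} [CommRing R] [IsLocalRing R] [IsNoetherianRing R]
open RingTheory.Sequence
open scoped Pointwise

theorem dim_ge (rs : List R) : ∀ (N : Type u) [AddCommGroup N] [Module R N] [Module.Finite R N]
    (_ : ∀ r ∈ rs, r ∈ maximalIdeal R) (_ : IsWeaklyRegular N rs) (p : Ideal R) (_ : IsAssociatedPrime p N),
    ((rs.length : ℕ∞) : WithBot ℕ∞) ≤ ringKrullDim (R ⧸ p) := by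
  induction rs with
  | nil =>
    intro N _ _ _ _ _ p hp
    haveI := hp.isPrime
    simpa using ringKrullDim_nonneg_of_nontrivial
  | cons r rs ih =>
    intro N _ _ _ hmem hreg p hp
    rw [isWeaklyRegular_cons_iff] at hreg
    obtain ⟨hpp, u, hu⟩ := isAssociatedPrime_iff.1 hp
    have hmu : ∀ a, a ∈ p ↔ a • u = 0 := by
      intro a; rw [hu, Submodule.mem_colon_singleton]; simp
    have hu0 : u ≠ 0 := by
      rintro rfl
      exact hpp.ne_top ((Ideal.eq_top_iff_one _).2 ((hmu 1).2 (by simp)))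
    have hrp : r ∉ p := fun h => hu0 (hreg.1 (by simpa using (hmu r).1 h))
    let N' : Submodule R N := Submodule.torsionBySet R N p
    have hN' : ∀ v, v ∈ N' ↔ ∀ a ∈ p, a • v = 0 := by
      intro v
      simp [N', Submodule.mem_torsionBySet_iff]
    have hex : ∃ v ∈ N', v ∉ (r • ⊤ : Submodule R N) := by
      by_contra hcon
      push Not at hcon
      have h1 : N' ≤ maximalIdeal R • N' := by
        intro v hv
        obtain ⟨w, -, rfl⟩ := (Submodule.mem_smul_pointwise_iff_exists _ _ _).1 (hcon v hv)
        refine Submodule.smul_mem_smul (hmem r (by simp)) ((hN' w).2 fun a ha => hreg.1 ?_)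
        have := (hN' _).1 hv a ha
        simp only [smul_zero]
        rw [smul_comm, this]
      have h2 := Submodule.eq_bot_of_le_smul_of_le_jacobson_bot _ N' (IsNoetherian.noetherian _) h1
        (IsLocalRing.maximalIdeal_le_jacobson _)
      have h3 : u ∈ N' := (hN' u).2 fun a ha => (hmu a).1 ha
      rw [h2] at h3
      exact hu0 (by simpa using h3)
    obtain ⟨v, hv, hv'⟩ := hex
    have hv0 : (Submodule.Quotient.mk v : QuotSMulTop r N) ≠ 0 := by
      rwa [ne_eq, Submodule.Quotient.mk_eq_zero]
    obtain ⟨P, hP, hle⟩ := exists_le_isAssociatedPrime_of_isNoetherianRing (R := R) _ hv0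
    have h1 := ih (QuotSMulTop r N) (fun s hs => hmem s (by simp [hs])) hreg.2 P hP
    have hpP : p ≤ P := by
      intro a ha
      apply hle
      rw [Submodule.mem_colon_singleton, Submodule.mem_bot, ← Submodule.Quotient.mk_smul, (hN' v).1 hv a ha]
      rfl
    have hrP : r ∈ P := by
      apply hle
      rw [Submodule.mem_colon_singleton, Submodule.mem_bot, ← Submodule.Quotient.mk_smul, Submodule.Quotient.mk_eq_zero]
      exact Submodule.smul_mem_pointwise_smul _ _ _ trivial
    have h2 := ringKrullDim_succ_le_of_surjective (Ideal.Quotient.factor hpP) (Ideal.Quotient.factor_surjective hpP)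
      (r := Ideal.Quotient.mk p r) (by
        rw [mem_nonZeroDivisors_iff_ne_zero, ne_eq, Ideal.Quotient.eq_zero_iff_mem]; exact hrp)
      (by rw [Ideal.Quotient.factor_mk, Ideal.Quotient.eq_zero_iff_mem]; exact hrP)
    refine le_trans ?_ h2
    simp only [List.length_cons, Nat.cast_add, Nat.cast_one, WithBot.coe_add, WithBot.coe_one]
    gcongr

theorem dim_le (p : Ideal R) [hp : p.IsPrime] (xs : List R) (hx : ∀ x ∈ xs, x ∈ maximalIdeal R)
    (h : ∀ q : Ideal R, q.IsPrime → p ≤ q → (∀ x ∈ xs, x ∈ q) → q = maximalIdeal R) :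
    ringKrullDim (R ⧸ p) ≤ ((xs.length : ℕ∞) : WithBot ℕ∞) := by
  classical
  haveI : IsLocalRing (R ⧸ p) := IsLocalRing.of_surjective' (Ideal.Quotient.mk p) Ideal.Quotient.mk_surjective
  rw [← IsLocalRing.maximalIdeal_height_eq_ringKrullDim, WithBot.coe_le_coe]
  let s : Finset (R ⧸ p) := (xs.map (Ideal.Quotient.mk p)).toFinset
  have hs : s.card ≤ xs.length := by
    simpa using List.toFinset_card_le (xs.map (Ideal.Quotient.mk p))
  refine le_trans (Ideal.height_le_card_of_mem_minimalPrimes_span_finset (s := s) ?_) (by exact_mod_cast hs)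
  have hpm : maximalIdeal (R ⧸ p) = (maximalIdeal R).map (Ideal.Quotient.mk p) := by
    apply le_antisymm
    · intro a ha
      obtain ⟨a, rfl⟩ := Ideal.Quotient.mk_surjective a
      apply Ideal.mem_map_of_mem
      intro hu
      exact ha (hu.map _)
    · rw [Ideal.map_le_iff_le_comap]
      intro a ha
      have : (Ideal.comap (Ideal.Quotient.mk p) (maximalIdeal (R ⧸ p))) = maximalIdeal R :=
        IsLocalRing.eq_maximalIdeal (Ideal.comap_isMaximal_of_surjective _ Ideal.Quotient.mk_surjective)
      rw [this]; exact ha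
  refine ⟨⟨inferInstance, ?_⟩, ?_⟩
  · rw [Ideal.span_le]
    intro a ha
    simp only [s, List.coe_toFinset, List.mem_map, Set.mem_ofPred_eq] at ha
    obtain ⟨a, ha, rfl⟩ := ha
    rw [hpm]
    exact Ideal.mem_map_of_mem _ (hx a ha)
  · rintro Q ⟨hQ, hQs⟩ -
    have := h (Q.comap (Ideal.Quotient.mk p)) (hQ.comap _) (by
      intro a ha
      rw [Ideal.mem_comap, Ideal.Quotient.eq_zero_iff_mem.2 ha]; exact zero_mem _) (by
      intro a ha
      rw [Ideal.mem_comap]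
      exact hQs (Ideal.subset_span (by simp [s]; exact ⟨a, ha, rfl⟩)))
    rw [hpm, Ideal.map_le_iff_le_comap, this]

open CategoryTheory Abelian in
theorem depth_quot (N : Type u) [AddCommGroup N] [Module R N] [Module.Finite R N] [Nontrivial N] {n : ℕ}
    (rs : List R) (hl : rs.length = n + 1) (hmem : ∀ r ∈ rs, r ∈ maximalIdeal R) (hreg : IsRegular N rs)
    {x : R} (hx : x ∈ maximalIdeal R) (hxr : IsSMulRegular N x) :
    ∃ rs : List R, rs.length = n ∧ (∀ r ∈ rs, r ∈ maximalIdeal R) ∧ IsRegular (QuotSMulTop x N) rs := by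
  have hlt : ∀ (K : Type u) [AddCommGroup K] [Module R K] [Module.Finite R K] [Nontrivial K],
      maximalIdeal R • (⊤ : Submodule R K) < ⊤ := by
    intro K _ _ _ _
    refine lt_top_iff_ne_top.2 fun h => ?_
    have := Submodule.eq_bot_of_le_smul_of_le_jacobson_bot _ (⊤ : Submodule R K) (IsNoetherian.noetherian _) h.ge
        (IsLocalRing.maximalIdeal_le_jacobson _)
    exact bot_ne_top this.symm
  haveI := nontrivial_quotSMulTop_of_mem_maximalIdeal N hx
  have T1 := (ModuleCat.exists_isRegular_tfae (maximalIdeal R) (n+1) (ModuleCat.of R N) (hlt N)).out 3 1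
  have h1 := T1.1 ⟨rs, hl, hmem, hreg⟩
  have T2 := (ModuleCat.exists_isRegular_tfae (maximalIdeal R) n (ModuleCat.of R (QuotSMulTop x N)) (hlt _)).out 3 1
  refine T2.2 ?_
  intro i hi
  have zero1 := AddCommGrpCat.isZero_of_iff_subsingleton.mpr (h1 i (by omega))
  have zero2 := AddCommGrpCat.isZero_of_iff_subsingleton.mpr (h1 (i + 1) (by omega))
  exact AddCommGrpCat.subsingleton_of_isZero <| ShortComplex.Exact.isZero_of_both_zeros
    ((Ext.covariant_sequence_exact₃' _ (IsSMulRegular.smulShortComplex_shortExact (M := ModuleCat.of R N) hxr)) i (i + 1) rfl)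
    (zero1.eq_zero_of_src _) (zero2.eq_zero_of_tgt _)

theorem sop_reg (xs : List R) : ∀ (N : Type u) [AddCommGroup N] [Module R N] [Module.Finite R N] [Nontrivial N]
    (_ : ∀ r ∈ xs, r ∈ maximalIdeal R) (rs : List R) (_ : rs.length = xs.length) (_ : ∀ r ∈ rs, r ∈ maximalIdeal R)
    (_ : IsRegular N rs)
    (_ : ∀ q : Ideal R, q.IsPrime → Module.annihilator R N ≤ q → (∀ x ∈ xs, x ∈ q) → q = maximalIdeal R),
    IsWeaklyRegular N xs := by
  induction xs with
  | nil => intros; simp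
  | cons x xs ih =>
    intro N _ _ _ _ hx rs hl hmem hreg hq
    have hxm : x ∈ maximalIdeal R := hx x (by simp)
    have hxr : IsSMulRegular N x := by
      by_contra hcon
      have : x ∈ ⋃ p ∈ associatedPrimes R N, (p : Set R) := by
        rw [biUnion_associatedPrimes_eq_compl_regular R N]; exact hcon
      simp only [Set.mem_iUnion] at this
      obtain ⟨p, hp, hxp⟩ := this
      haveI := hp.isPrime
      have h1 := dim_ge rs N hmem hreg.1 p hp
      have h2 := dim_le p xs (fun r hr => hx r (by simp [hr])) (fun q hqp hpq hxq => hq q hqp (by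
        refine le_trans ?_ hpq
        obtain ⟨-, u, hu⟩ := isAssociatedPrime_iff.1 hp
        intro a ha
        rw [hu, Submodule.mem_colon_singleton, Submodule.mem_bot]
        exact Module.mem_annihilator.1 ha u) (by
        intro y hy
        rcases List.mem_cons.1 hy with rfl | hy
        · exact hpq hxp
        · exact hxq y hy))
      have h3 := h1.trans h2
      rw [hl] at h3
      have h4 : (x :: xs).length ≤ xs.length := by exact_mod_cast h3
      simp at h4
    rw [isWeaklyRegular_cons_iff]
    refine ⟨hxr, ?_⟩
    haveI := nontrivial_quotSMulTop_of_mem_maximalIdeal N hxm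
    obtain ⟨rs', hl', hmem', hreg'⟩ := depth_quot N rs (by simpa using hl) hmem hreg hxm hxr
    refine ih (QuotSMulTop x N) (fun r hr => hx r (by simp [hr])) rs' hl' hmem' hreg' fun q hqp hqa hxq => ?_
    have ha : x ∈ Module.annihilator R (QuotSMulTop x N) := by
      rw [Module.mem_annihilator]
      intro v
      obtain ⟨v, rfl⟩ := Submodule.Quotient.mk_surjective _ v
      rw [← Submodule.Quotient.mk_smul, Submodule.Quotient.mk_eq_zero]
      exact Submodule.smul_mem_pointwise_smul _ _ _ trivial
    have ha' : Module.annihilator R N ≤ Module.annihilator R (QuotSMulTop x N) :=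
      LinearMap.annihilator_le_of_surjective _ (Submodule.mkQ_surjective _)
    refine hq q hqp (ha'.trans hqa) ?_
    intro y hy
    rcases List.mem_cons.1 hy with rfl | hy
    · exact hqa ha
    · exact hxq y hy
end
end CMproof

end

section

open IsLocalRing Polynomial Finset
set_option maxHeartbeats 2000000
set_option linter.style.haveILetI false
set_option linter.unusedSectionVars false
namespace CMproof
section
variable {R : Type*} [CommRing R]

/-- quasi-regularity. -/
def QR {d : ℕ} (x : Fin d → R) : Prop := ∀ (n : ℕ) (f : MvPolynomial (Fin d) R), f.IsHomogeneous n →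
    MvPolynomial.eval x f ∈ JJ x ^ (n + 1) → ∀ m, f.coeff m ∈ JJ x

theorem sup_pow_succ_le (Y I : Ideal R) (n : ℕ) : (Y ⊔ I) ^ (n + 1) ≤ I ^ (n + 1) ⊔ Y * (Y ⊔ I) ^ n := by
  induction n with
  | zero => simp [sup_comm]
  | succ n ih =>
    rw [pow_succ' (Y ⊔ I) (n + 1), Ideal.sup_mul]
    refine sup_le le_sup_right ?_
    refine (Ideal.mul_mono_right ih).trans ?_
    rw [Ideal.mul_sup, ← pow_succ']
    refine sup_le_sup le_rfl ?_
    rw [← mul_assoc, mul_comm I Y, mul_assoc]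
    refine Ideal.mul_mono_right ?_
    rw [pow_succ']
    exact Ideal.mul_mono_left le_sup_right

theorem QR.cancel {d : ℕ} {s : Fin d → R} (h : QR s) {y : R} (hy : ∀ a, y * a ∈ JJ s → a ∈ JJ s) {k : ℕ} :
    ∀ {a : R}, y * a ∈ JJ s ^ k → a ∈ JJ s ^ k := by
  induction k with
  | zero => simp
  | succ k ih =>
    intro a ha
    obtain ⟨p, hp, rfl⟩ := mem_pow_iff.1 (ih (Ideal.pow_le_pow_right k.le_succ ha))
    have h1 := h k (MvPolynomial.C y * p) (by simpa using (MvPolynomial.isHomogeneous_C (Fin d) y).mul hp)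
      (by simpa using ha)
    have h2 : ∀ m, p.coeff m ∈ JJ s := fun m => hy _ (by simpa using h1 m)
    rw [pow_succ']
    exact eval_mem_mul _ hp h2

theorem JJ_cons {d : ℕ} (s : Fin d → R) (y : R) :
    JJ (Fin.cons y s : Fin (d + 1) → R) = Ideal.span {y} ⊔ JJ s := by
  rw [JJ, Fin.range_cons, Ideal.span_insert]

theorem QR.claim {d : ℕ} {s : Fin d → R} (h : QR s) {y : R} (hy : ∀ a, y * a ∈ JJ s → a ∈ JJ s) (n : ℕ) :
    ∀ (c : ℕ → MvPolynomial (Fin d) R), (∀ i ≤ n, (c i).IsHomogeneous (n - i)) →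
    ∑ i ∈ range (n + 1), (c i).eval s * y ^ i ∈ (Ideal.span {y} ⊔ JJ s) ^ (n + 1) →
    ∀ i ≤ n, ∀ m, (c i).coeff m ∈ Ideal.span {y} ⊔ JJ s := by
  induction n with
  | zero =>
    intro c hc hs i hi m
    obtain rfl : i = 0 := by omega
    have h0 := hc 0 le_rfl
    have h1 : c 0 = MvPolynomial.C ((c 0).coeff 0) := by
      apply MvPolynomial.totalDegree_eq_zero_iff_eq_C.1
      by_contra hne
      have := h0.totalDegree (φ := c 0) (by rintro h; simp [h] at hne)
      omega
    simp only [zero_add, Finset.sum_range_one, pow_zero, mul_one, pow_one] at hs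
    rw [h1] at hs ⊢
    rw [MvPolynomial.coeff_C]
    split_ifs
    · simpa using hs
    · exact zero_mem _
  | succ n ih =>
    intro c hc hs
    obtain ⟨g, hg, w, hw, hgw⟩ := Submodule.mem_sup.1 (sup_pow_succ_le _ _ _ hs)
    obtain ⟨v, hv, rfl⟩ := Ideal.mem_span_singleton_mul.1 hw
    rw [Finset.sum_range_succ'] at hgw
    have hsum : ∑ i ∈ range (n + 1), (c (i + 1)).eval s * y ^ (i + 1) =
        y * ∑ i ∈ range (n + 1), (c (i + 1)).eval s * y ^ i := by
      rw [Finset.mul_sum]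
      exact Finset.sum_congr rfl fun i _ => by ring
    rw [hsum] at hgw
    set S := ∑ i ∈ range (n + 1), (c (i + 1)).eval s * y ^ i with hS
    have h0 : (c 0).eval s ∈ JJ s ^ (n + 1) := mem_pow_iff.2 ⟨c 0, hc 0 (by omega), rfl⟩
    have hw1 : v - S ∈ JJ s ^ (n + 1) := by
      apply h.cancel hy
      have : y * (v - S) = (c 0).eval s - g := by linear_combination hgw
      rw [this]
      exact sub_mem h0 (Ideal.pow_le_pow_right (by omega) hg)
    have hSm : S ∈ (Ideal.span {y} ⊔ JJ s) ^ (n + 1) := by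
      have := sub_mem hv (Ideal.pow_right_mono (le_sup_right : JJ s ≤ Ideal.span {y} ⊔ JJ s) _ hw1)
      simpa using this
    have h1 := ih (fun i => c (i + 1)) (fun i hi => by simpa using hc (i + 1) (by omega)) hSm
    intro i hi m
    rcases i with _ | i
    · obtain ⟨p, hp, hpe⟩ := mem_pow_iff.1 hw1
      have h2 := h (n + 1) (c 0 - MvPolynomial.C y * p)
        ((hc 0 (by omega)).sub (by simpa using (MvPolynomial.isHomogeneous_C (Fin d) y).mul hp))
        (by
          have : MvPolynomial.eval s (c 0 - MvPolynomial.C y * p) = g := by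
            simp only [map_sub, map_mul, MvPolynomial.eval_C, hpe]
            linear_combination -hgw
          rw [this]
          exact hg) m
      have h3 : (c 0).coeff m = (c 0 - MvPolynomial.C y * p).coeff m + y * p.coeff m := by simp
      rw [h3]
      exact add_mem (Ideal.mem_sup_right h2)
        (Ideal.mem_sup_left (Ideal.mul_mem_right _ _ (Ideal.mem_span_singleton_self y)))
    · exact h1 i (by omega) m

theorem QR.cons {d : ℕ} {s : Fin d → R} (h : QR s) {y : R} (hy : ∀ a, y * a ∈ JJ s → a ∈ JJ s) :
    QR (Fin.cons y s : Fin (d + 1) → R) := by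
  intro n f hf hmem m
  rw [JJ_cons] at hmem ⊢
  have hdeg : (MvPolynomial.finSuccEquiv R d f).natDegree < n + 1 := by
    rw [MvPolynomial.natDegree_finSuccEquiv]
    have := (MvPolynomial.degreeOf_le_totalDegree f 0).trans hf.totalDegree_le
    omega
  have key := h.claim hy n (fun i => (MvPolynomial.finSuccEquiv R d f).coeff i)
    (fun i hi => hf.finSuccEquiv_coeff_isHomogeneous i (n - i) (by omega)) (by
      rw [MvPolynomial.eval_eq_eval_mv_eval', Polynomial.eval_map,
        Polynomial.eval₂_eq_sum_range' _ hdeg] at hmem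
      exact hmem)
  rw [← Finsupp.cons_tail m, ← MvPolynomial.finSuccEquiv_coeff_coeff]
  by_cases hm : m 0 ≤ n
  · exact key _ hm _
  · rw [Polynomial.coeff_eq_zero_of_natDegree_lt (by omega)]
    simp

theorem QR.nil (x : Fin 0 → R) : QR x := by
  intro n f hf hm m
  have h0 : JJ x = ⊥ := by simp [JJ]
  rw [h0] at hm ⊢
  rw [Ideal.bot_pow (by omega)] at hm
  obtain rfl : m = 0 := Subsingleton.elim _ _
  have : f = MvPolynomial.C (f.coeff 0) := MvPolynomial.eq_C_of_isEmpty f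
  rw [this] at hm
  simpa using hm

open RingTheory.Sequence in
theorem QR.of_reg : ∀ {d : ℕ} (x : Fin d → R), IsWeaklyRegular R (List.ofFn x).reverse → QR x := by
  intro d
  induction d with
  | zero => exact fun x _ => QR.nil x
  | succ d ih =>
    intro x hx
    rw [List.ofFn_succ, List.reverse_cons, isWeaklyRegular_append_iff] at hx
    have h1 := ih _ hx.1
    have hc := h1.cons (y := x 0) (by
      have h2 := ((isWeaklyRegular_singleton_iff _ _).1 hx.2)
      have hJ : Ideal.ofList (List.ofFn fun i : Fin d => x i.succ).reverse = JJ (fun i : Fin d => x i.succ) := by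
        rw [Ideal.ofList]
        congr 1
        ext z
        simp [List.mem_ofFn]
      rw [hJ] at h2
      intro a ha
      have h3 : (Submodule.Quotient.mk a : R ⧸ (JJ (fun i : Fin d => x i.succ) • ⊤ : Submodule R R)) = 0 := by
        apply h2
        simp only [smul_zero]
        rw [← Submodule.Quotient.mk_smul, Submodule.Quotient.mk_eq_zero]
        simpa using ha
      rw [Submodule.Quotient.mk_eq_zero] at h3
      simpa using h3)
    convert hc
    exact (Fin.cons_self_tail x).symm
end
end CMproof

end

section

open IsLocalRing Polynomial Finset
set_option maxHeartbeats 2000000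
set_option linter.style.haveILetI false
set_option linter.unusedSectionVars false
namespace CMproof
section
universe u
variable {R : Type u} [CommRing R] [IsLocalRing R] [IsNoetherianRing R]
open RingTheory.Sequence

theorem mkCtx {d : ℕ} (x : Fin d → R) (rs : List R) (hrs : rs.length = d) (hrm : ∀ r ∈ rs, r ∈ maximalIdeal R)
    (hreg : IsRegular R rs) (hle : JJ x ≤ maximalIdeal R) {s : ℕ} (hpow : maximalIdeal R ^ s ≤ JJ x) :
    Ctx x (maximalIdeal R) ∧ IsRegular R (List.ofFn x) := by
  have hmem : ∀ i, x i ∈ maximalIdeal R := fun i => hle (Ideal.subset_span ⟨i, rfl⟩)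
  have hprime : ∀ q : Ideal R, q.IsPrime → (∀ i, x i ∈ q) → q = maximalIdeal R := by
    intro q hq hx
    apply le_antisymm (le_maximalIdeal hq.ne_top)
    apply hq.le_of_pow_le (n := s)
    refine hpow.trans (Ideal.span_le.2 ?_)
    rintro _ ⟨i, rfl⟩
    exact hx i
  have h1 : IsWeaklyRegular R (List.ofFn x).reverse :=
    sop_reg _ R (by simpa [List.mem_ofFn] using hmem) rs (by simp [hrs]) hrm hreg
      (fun q hq _ hx => hprime q hq (fun i => hx _ (by simp [List.mem_ofFn])))
  have h2 : IsWeaklyRegular R (List.ofFn x) :=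
    sop_reg _ R (by simpa [List.mem_ofFn] using hmem) rs (by simp [hrs]) hrm hreg
      (fun q hq _ hx => hprime q hq (fun i => hx _ (by simp [List.mem_ofFn])))
  refine ⟨⟨inferInstance, hle, ⟨s, hpow⟩, ?_, QR.of_reg x h1⟩,
    (IsLocalRing.isRegular_iff_isWeaklyRegular_of_subset_maximalIdeal (by simpa [List.mem_ofFn] using hmem)).2 h2⟩
  intro a b ha hab
  have hu : IsUnit a := by
    by_contra h
    exact ha ((mem_maximalIdeal a).2 h)
  exact (Ideal.unit_mul_mem_iff_mem _ hu).1 hab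

theorem lam_fin {J : Ideal R} (hle : J ≤ maximalIdeal R) {s : ℕ} (hpow : maximalIdeal R ^ s ≤ J) : lam J ≠ ⊤ := by
  have h1 : maximalIdeal R ∈ J.minimalPrimes := by
    refine ⟨⟨inferInstance, hle⟩, ?_⟩
    rintro q ⟨hq, hJq⟩ _
    exact hq.le_of_pow_le (hpow.trans hJq)
  haveI := IsLocalRing.quotient_artinian_of_mem_minimalPrimes_of_isLocalRing J h1
  haveI : IsArtinian R (R ⧸ J) := isArtinian_of_surjective_algebraMap (S := R) (R := R ⧸ J) Ideal.Quotient.mk_surjective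
  rw [lam, Module.length_ne_top_iff, isFiniteLength_iff_isNoetherian_isArtinian]
  exact ⟨inferInstance, inferInstance⟩

theorem exists_reg {d : ℕ} (hd : 0 < d) (hdim : ringKrullDim R = d) (hCM : IsCMLocal R) :
    ∃ rs : List R, rs.length = d ∧ (∀ r ∈ rs, r ∈ maximalIdeal R) ∧ IsRegular R rs := by
  unfold IsCMLocal at hCM
  rw [hdim] at hCM
  have hC : rdepth R (maximalIdeal R) R = (d : ℕ∞) := by exact_mod_cast hCM
  by_contra hcon
  have h1 : rdepth R (maximalIdeal R) R ≤ ((d - 1 : ℕ) : ℕ∞) := by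
    apply sSup_le
    rintro n ⟨rs, hn, hm, hr⟩
    have h2 : n ≤ d := by
      rw [← hC]
      exact le_sSup ⟨rs, hn, hm, hr⟩
    have h3 : rs.length ≠ d := fun h => hcon ⟨rs, h, hm, hr⟩
    rw [← hn] at h2 ⊢
    norm_cast at h2 ⊢
    omega
  rw [hC] at h1
  norm_cast at h1
  omega

theorem mlen_eq {N : Type*} [AddCommGroup N] [Module R N] {k : ℕ} (h : mlen R N = (k : WithBot ℕ∞)) :
    Module.length R N = k := by
  rw [mlen, ← Module.coe_length] at h
  exact_mod_cast h

theorem main1 {m : ℕ} (hdim : ringKrullDim R = (m + 3 : ℕ))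
    (hCM : IsCMLocal R) (hAU : AnalyticallyUnramified R)
    (t : ℕ) (ht : CMTypeData R (m + 3) t)
    (I : Ideal R) (hIm : intCl I = maximalIdeal R) (x : Fin (m + 3) → R)
    (hJ : IsMinimalReduction (m + 3) (JJ x) I)
    (L : ℕ → ℕ) (e : ℕ → ℤ) (hHilb : NormalHilbertData (m + 3) I L e)
    (he3 : e 3 = 0) (ℓ : ℕ)
    (hℓ : mlen R (idealQuot (intCl (I ^ 2)) (JJ x * intCl I)) = (ℓ : WithBot ℕ∞))
    (hbig : (t : ℤ) - 1 ≤ (ℓ : ℤ)) :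
    Ctx x (maximalIdeal R) ∧ (∀ n : ℕ, intCl (I ^ n) = wcl (JJ x) n) ∧
    (∀ n : ℕ, wcl (JJ x) n ≤ JJ x ^ (n - 2)) ∧
    ∀ k : ℕ, wcl (JJ x) ((k+2:ℕ):ℝ) = JJ x ^ k * wcl (JJ x) (2:ℕ) := by
  obtain ⟨hJI, -, N, hN⟩ := hJ
  have hcl : ∀ n : ℕ, intCl (I ^ n) = wcl (JJ x) n := fun n => intCl_eq hJI hN n
  have hm1 : maximalIdeal R = wcl (JJ x) ((1 : ℕ) : ℝ) := by rw [← hcl 1, pow_one, hIm]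
  have hle : JJ x ≤ maximalIdeal R := by
    rw [hm1]
    simpa using pow_le_wcl (J := JJ x) 1
  have hpow : ∃ s, maximalIdeal R ^ s ≤ JJ x := by
    have h1 : maximalIdeal R ≤ (JJ x).radical := by
      intro a ha
      rw [hm1, mem_wcl] at ha
      obtain ⟨c, hc⟩ := ha
      obtain ⟨M, hM⟩ := exists_nat_ge (1 + c)
      refine ⟨M, ?_⟩
      have := hc M 1 (by push_cast; linarith)
      simpa using this
    obtain ⟨s, hs⟩ := Ideal.exists_radical_pow_le_of_fg (JJ x) (IsNoetherian.noetherian _)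
    exact ⟨s, (Ideal.pow_right_mono h1 s).trans hs⟩
  obtain ⟨s, hs⟩ := hpow
  obtain ⟨rs, hrl, hrm, hrr⟩ := exists_reg (by omega) hdim hCM
  obtain ⟨h, hreg⟩ := mkCtx x rs hrl hrm hrr hle hs
  have hfin := lam_fin hle hs
  obtain ⟨c, hc⟩ := Ctx.rees' h (by simpa using hm1.le) hfin hAU
  obtain ⟨hL, N', hN'⟩ := hHilb
  let L' : ℕ → ℕ := fun n => if n = 0 then 0 else L (n - 1)
  have hL' : ∀ n : ℕ, lam (wcl (JJ x) n) = (L' n : ℕ) := by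
    intro n
    rcases n with _ | n
    · simp only [Nat.cast_zero, wcl_nonpos (J := JJ x) (le_refl (0:ℝ)), L', if_true]
      simp [lam]
    · rw [← hcl]
      simpa [L'] using mlen_eq (hL n)
  have hP' : ∀ n ≥ N' + 1, (L' n : ℤ) = ∑ i ∈ range (m+4), (-1)^i * e i * ((n + (m+2) - i).choose (m+3-i) : ℕ) := by
    intro n hn
    obtain ⟨n, rfl⟩ : ∃ k, n = k + 1 := ⟨n - 1, by omega⟩
    have := hN' n (by omega)
    simp only [L', Nat.add_eq_zero_iff, one_ne_zero, and_false, if_false, Nat.add_sub_cancel]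
    rw [this]
    refine Finset.sum_congr rfl fun i _ => ?_
    rw [show n + 1 + (m + 2) - i = n + (m + 3) - i by omega]
  have h2 := Ctx.le_sub_two m h hc hfin hL' hP' he3
  refine ⟨h, hcl, h2, ?_⟩
  have hspan : Ideal.span {y | y ∈ List.ofFn x} = JJ x := by
    congr 1
    ext z
    exact List.mem_ofFn' x z
  have ht' := ht (List.ofFn x) (by simp) (by
    intro z hz
    obtain ⟨i, rfl⟩ := (List.mem_ofFn' x z).1 hz
    exact hle (Ideal.subset_span ⟨i, rfl⟩)) hreg
  rw [hspan] at ht'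
  refine h.endgame hm1.le h2 hfin hL' hP' he3 (Q := (JJ x).colon (maximalIdeal R)) ?_
    (mlen_eq ht') (ℓ := ℓ) ?_ (by omega)
  · intro a
    rw [Submodule.mem_colon]
    simp [mul_comm]
  · rw [← hcl, ← hIm]
    exact mlen_eq hℓ
end
end CMproof

end

section

open IsLocalRing Polynomial Finset
set_option maxHeartbeats 2000000
set_option linter.style.haveILetI false
set_option linter.unusedSectionVars false
namespace CMproof
section
open RingTheory.Sequence
open scoped Pointwise

theorem length_le_supportDim {B : Type*} [CommRing B] (rs : List B) :
    ∀ (N : Type _) [AddCommGroup N] [Module B N] [Module.Finite B N] (_ : IsRegular N rs),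
    ((rs.length : ℕ∞) : WithBot ℕ∞) ≤ Module.supportDim B N := by
  induction rs with
  | nil =>
    intro N _ _ _ h
    haveI := h.nontrivial
    have h1 := Module.supportDim_ne_bot_of_nontrivial (R := B) (M := N)
    rcases hh : Module.supportDim B N with _ | k
    · exact absurd hh h1
    · exact WithBot.coe_le_coe.2 (by simp)
  | cons r rs ih =>
    intro N _ _ _ h
    rw [isRegular_cons_iff] at h
    have h1 := ih (QuotSMulTop r N) h.2
    have h2 := Module.supportDim_quotSMulTop_succ_le_of_notMem_minimalPrimes (R := B) (M := N) (x := r)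
      (fun _ => h.1.notMem_of_mem_minimalPrimes)
    refine le_trans ?_ h2
    simp only [List.length_cons]
    push_cast
    gcongr
    exact_mod_cast h1

theorem rdepth_le {B : Type*} [CommRing B] [Nontrivial B] (J : Ideal B) :
    (rdepth B J B : WithBot ℕ∞) ≤ ringKrullDim B := by
  have h1 := Module.supportDim_ne_bot_of_nontrivial (R := B) (M := B)
  rw [← Module.supportDim_self_eq_ringKrullDim]
  rcases hh : Module.supportDim B B with _ | k
  · exact absurd hh h1
  · apply WithBot.coe_le_coe.2
    apply sSup_le
    rintro n ⟨rs, rfl, -, hr⟩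
    have := length_le_supportDim rs B hr
    rw [hh] at this
    exact WithBot.coe_le_coe.1 this

theorem dim_le_of_integral {P B : Type*} [CommRing P] [CommRing B] [Algebra P B] [Algebra.IsIntegral P B] :
    ringKrullDim B ≤ ringKrullDim P := by
  refine Order.krullDim_le_of_strictMono (PrimeSpectrum.comap (algebraMap P B)) ?_
  intro p q hpq
  obtain ⟨hle, b, hbq, hbp⟩ := SetLike.lt_iff_le_and_exists.1 (show p.asIdeal < q.asIdeal from hpq)
  exact Ideal.comap_lt_comap_of_integral_mem_sdiff hle ⟨hbq, hbp⟩ (Algebra.IsIntegral.isIntegral (R := P) b)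

theorem X_reg (k : Type*) [Field k] (d : ℕ) :
    IsRegular (MvPolynomial (Fin d) k) (List.ofFn (fun i : Fin d => (MvPolynomial.X i : MvPolynomial (Fin d) k))) := by
  refine ⟨⟨?_⟩, ?_⟩
  · intro j hj
    simp only [List.length_ofFn] at hj
    have hI : Ideal.ofList ((List.ofFn (fun i : Fin d => (MvPolynomial.X i : MvPolynomial (Fin d) k))).take j) =
        Ideal.span (MvPolynomial.X '' {i : Fin d | i.1 < j}) := by
      rw [Ideal.ofList]
      congr 1
      ext z
      simp only [Set.mem_image, Set.mem_ofPred_eq, List.mem_take_iff_getElem, List.length_ofFn, List.getElem_ofFn]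
      constructor
      · rintro ⟨i, hi, rfl⟩
        exact ⟨⟨i, by omega⟩, by simp; omega, rfl⟩
      · rintro ⟨i, hi, rfl⟩
        exact ⟨i, by omega, rfl⟩
    rw [hI]
    simp only [List.getElem_ofFn]
    rw [isSMulRegular_iff_right_eq_zero_of_smul]
    intro z hz
    obtain ⟨p, rfl⟩ := Submodule.Quotient.mk_surjective _ z
    rw [← Submodule.Quotient.mk_smul, Submodule.Quotient.mk_eq_zero] at hz
    rw [Submodule.Quotient.mk_eq_zero]
    simp only [smul_eq_mul, Ideal.mul_top, MvPolynomial.mem_ideal_span_X_image, MvPolynomial.mem_support_iff] at hz ⊢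
    intro m hm
    obtain ⟨i, hi, hmi⟩ := hz (Finsupp.single ⟨j, hj⟩ 1 + m) (by rwa [MvPolynomial.coeff_X_mul])
    refine ⟨i, hi, ?_⟩
    have : (⟨j, hj⟩ : Fin d) ≠ i := by
      rintro rfl
      simp at hi
    simpa [Finsupp.single_apply, this] using hmi
  · intro h
    have h1 : (1 : MvPolynomial (Fin d) k) ∈ Ideal.span (MvPolynomial.X '' (Set.univ : Set (Fin d))) := by
      have h2 : Ideal.ofList (List.ofFn (fun i : Fin d => (MvPolynomial.X i : MvPolynomial (Fin d) k))) ≤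
        Ideal.span (MvPolynomial.X '' Set.univ) := by
        rw [Ideal.ofList]
        apply Ideal.span_mono
        intro z hz
        obtain ⟨i, rfl⟩ := (List.mem_ofFn' _ z).1 hz
        exact ⟨i, trivial, rfl⟩
      apply h2
      have h3 : (1 : MvPolynomial (Fin d) k) ∈ (⊤ : Submodule (MvPolynomial (Fin d) k) (MvPolynomial (Fin d) k)) := trivial
      rw [h] at h3
      simpa using h3
    rw [MvPolynomial.mem_ideal_span_X_image] at h1
    obtain ⟨i, -, hi⟩ := h1 0 (by simp)
    simp at hi

theorem min_gens {R : Type*} [CommRing R] [IsLocalRing R] [IsNoetherianRing R] (P Q : Ideal R) :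
    ∃ (n : ℕ) (c : Fin n → R), (∀ i, c i ∈ P) ∧ P ≤ JJ c ⊔ Q ∧
      ∀ r : Fin n → R, ∑ i, r i * c i ∈ Q → ∀ i, r i ∈ maximalIdeal R := by
  classical
  have hex : ∃ n, ∃ c : Fin n → R, (∀ i, c i ∈ P) ∧ P ≤ JJ c ⊔ Q := by
    obtain ⟨n, c, hc⟩ := Submodule.fg_iff_exists_fin_generating_family.1 (IsNoetherian.noetherian P)
    refine ⟨n, c, fun i => ?_, ?_⟩
    · rw [← hc]; exact Submodule.subset_span ⟨i, rfl⟩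
    · rw [← hc]; exact le_sup_left
  obtain ⟨c, hc, hP⟩ := Nat.find_spec hex
  have hmin := fun k hk => Nat.find_min (m := k) hex hk
  generalize Nat.find hex = n at c hc hP hmin
  refine ⟨n, c, hc, hP, ?_⟩
  intro r hr j
  by_contra hj
  have hu : IsUnit (r j) := by
    by_contra h
    exact hj ((mem_maximalIdeal _).2 h)
  rcases n with _ | n
  · exact j.elim0
  refine hmin n (by omega) ⟨fun i => c (j.succAbove i), fun i => hc _, hP.trans (sup_le ?_ le_sup_right)⟩
  rw [Ideal.span_le]
  rintro _ ⟨i, rfl⟩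
  induction i using Fin.succAboveCases j with
  | x =>
    rw [Fin.sum_univ_succAbove _ j] at hr
    apply (Ideal.unit_mul_mem_iff_mem _ hu).1
    have : r j * c j = (r j * c j + ∑ i, r (j.succAbove i) * c (j.succAbove i)) -
      ∑ i, r (j.succAbove i) * c (j.succAbove i) := by ring
    rw [this]
    refine sub_mem (Ideal.mem_sup_right hr) (Ideal.mem_sup_left (Ideal.sum_mem _ fun i _ => ?_))
    exact Ideal.mul_mem_left _ _ (Ideal.subset_span ⟨i, rfl⟩)
  | p i => exact Ideal.mem_sup_left (Ideal.subset_span ⟨i, rfl⟩)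
end
end CMproof

end

section

open IsLocalRing Polynomial Finset
set_option maxHeartbeats 2000000
set_option linter.style.haveILetI false
set_option linter.unusedSectionVars false
namespace CMproof
section
variable {R : Type*} [CommRing R]

noncomputable def mono {J : Ideal R} (n : ℕ) {a : R} (ha : a ∈ wcl J (n:ℝ)) : AN J 1 :=
  ⟨monomial n a, monomial_mem_AN (by simpa using ha)⟩

theorem mono_coe {J : Ideal R} (n : ℕ) {a : R} (ha : a ∈ wcl J (n:ℝ)) : (mono n ha : R[X]) = monomial n a := rfl

theorem wcl_mul {J : Ideal R} {m n : ℕ} {a b : R} (ha : a ∈ wcl J (m:ℝ)) (hb : b ∈ wcl J (n:ℝ)) :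
    a * b ∈ wcl J ((m + n : ℕ) : ℝ) := by
  push_cast
  exact mul_mem_wcl ha hb

variable [IsLocalRing R] {e : ℕ} {x : Fin (e+1) → R}

theorem pow_mul_wcl (hm : maximalIdeal R ≤ wcl (JJ x) (1:ℕ)) {n : ℕ} :
    maximalIdeal R * JJ x ^ n ≤ wcl (JJ x) ((n + 1 : ℕ) : ℝ) := by
  rw [Ideal.mul_le]
  intro a ha b hb
  have := wcl_mul (hm ha) (pow_le_wcl n hb)
  rwa [add_comm 1 n] at this

/-- graded relation -/
theorem Ctx.relation (h : Ctx x (maximalIdeal R)) (hm : maximalIdeal R ≤ wcl (JJ x) (1:ℕ))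
    (hend : ∀ k : ℕ, wcl (JJ x) ((k+2:ℕ):ℝ) = JJ x ^ k * wcl (JJ x) (2:ℕ))
    {n1 n2 : ℕ} {b : Fin n1 → R} {c : Fin n2 → R}
    (hb : ∀ i, b i ∈ maximalIdeal R)
    (hb' : ∀ r : Fin n1 → R, ∑ i, r i * b i ∈ JJ x ⊔ wcl (JJ x) (2:ℕ) → ∀ i, r i ∈ maximalIdeal R)
    (hc : ∀ i, c i ∈ wcl (JJ x) (2:ℕ))
    (hc' : ∀ r : Fin n2 → R, ∑ i, r i * c i ∈ maximalIdeal R * JJ x → ∀ i, r i ∈ maximalIdeal R)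
    (f : ℕ → MvPolynomial (Fin (e+1)) R) (g : Fin n1 → ℕ → MvPolynomial (Fin (e+1)) R)
    (k : Fin n2 → ℕ → MvPolynomial (Fin (e+1)) R) (hf : ∀ p, (f p).IsHomogeneous p)
    (hg : ∀ i p, (g i p).IsHomogeneous p) (hk : ∀ i p, (k i p).IsHomogeneous p)
    (h0 : (f 0).eval x ∈ wcl (JJ x) (1:ℕ))
    (h1 : (f 1).eval x + ∑ i, (g i 0).eval x * b i ∈ wcl (JJ x) (2:ℕ))
    (h2 : ∀ p, (f (p+2)).eval x + ∑ i, (g i (p+1)).eval x * b i + ∑ i, (k i p).eval x * c i ∈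
      wcl (JJ x) ((p + 3 : ℕ) : ℝ)) :
    (∀ p m, (f p).coeff m ∈ maximalIdeal R) ∧ (∀ i p m, (g i p).coeff m ∈ maximalIdeal R) ∧
    (∀ i p m, (k i p).coeff m ∈ maximalIdeal R) := by
  have hCmul : ∀ {p : ℕ} {q : MvPolynomial (Fin (e+1)) R} (a : R), q.IsHomogeneous p →
      (MvPolynomial.C a * q).IsHomogeneous p := fun a hq => by
    simpa using (MvPolynomial.isHomogeneous_C (Fin (e+1)) a).mul hq
  have ev : ∀ {p : ℕ} {q : MvPolynomial (Fin (e+1)) R}, q.IsHomogeneous p → q.eval x ∈ JJ x ^ p :=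
    fun hq => mem_pow_iff.2 ⟨_, hq, rfl⟩
  have hk1 : ∀ i p m, (k i p).coeff m ∈ maximalIdeal R := by
    intro i p m
    have hS : ∑ i, (k i p).eval x * c i ∈ JJ x ^ (p + 1) := by
      have h3 := h2 p
      rw [show p + 3 = (p + 1) + 2 by ring, hend] at h3
      have h4 : (f (p+2)).eval x + ∑ i, (g i (p+1)).eval x * b i ∈ JJ x ^ (p + 1) :=
        add_mem (Ideal.pow_le_pow_right (by omega) (ev (hf _)))
          (Ideal.sum_mem _ fun i _ => Ideal.mul_mem_right _ _ (ev (hg _ _)))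
      have := sub_mem (Ideal.mul_le_left h3) h4
      simpa using this
    have h5 := h.qreg p (∑ i, MvPolynomial.C (c i) * k i p)
      (MvPolynomial.IsHomogeneous.sum _ _ _ fun i _ => hCmul _ (hk i p))
      (by simpa [mul_comm] using hS) m
    simp only [MvPolynomial.coeff_sum, MvPolynomial.coeff_C_mul] at h5
    refine hc' (fun i => (k i p).coeff m) ?_ i
    have h6 := h.E1 (k := 1) (a := ∑ i, c i * (k i p).coeff m)
      (Ideal.sum_mem _ fun i _ => Ideal.mul_mem_right _ _ (hc i)) (by simpa using h5)
    simpa [mul_comm] using h6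
  have hkc : ∀ p, ∑ i, (k i p).eval x * c i ∈ wcl (JJ x) ((p + 3 : ℕ) : ℝ) := by
    intro p
    refine Ideal.sum_mem _ fun i _ => ?_
    have := wcl_mul (pow_mul_wcl hm (eval_mem_mul _ (hk i p) (hk1 i p))) (hc i)
    rwa [show p + 1 + 2 = p + 3 by ring] at this
  have h12 : ∀ p, (f (p+1)).eval x + ∑ i, (g i p).eval x * b i ∈ wcl (JJ x) ((p + 2 : ℕ):ℝ) := by
    intro p
    rcases p with _ | p
    · exact h1
    · have := sub_mem (h2 p) (hkc p)
      rw [add_sub_cancel_right] at this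
      exact this
  have hg1 : ∀ i p m, (g i p).coeff m ∈ maximalIdeal R := by
    intro i p m
    have h3 := h12 p
    rw [hend, mul_comm] at h3
    obtain ⟨u, hu, hu', hue⟩ := exists_of_mem_mul _ h3
    have h5 := h.qreg p (∑ i, MvPolynomial.C (b i) * g i p - u)
      ((MvPolynomial.IsHomogeneous.sum _ _ _ fun i _ => hCmul _ (hg i p)).sub hu)
      (by
        have : MvPolynomial.eval x (∑ i, MvPolynomial.C (b i) * g i p - u) = - (f (p+1)).eval x := by
          rw [map_sub, hue, map_sum]
          simp [mul_comm]
        rw [this]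
        exact neg_mem (ev (hf _))) m
    simp only [MvPolynomial.coeff_sub, MvPolynomial.coeff_sum, MvPolynomial.coeff_C_mul] at h5
    refine hb' (fun i => (g i p).coeff m) ?_ i
    have h6 := add_mem (Ideal.mem_sup_left h5 : _ ∈ JJ x ⊔ wcl (JJ x) (2:ℕ)) (Ideal.mem_sup_right (hu' m))
    simpa [mul_comm] using h6
  refine ⟨?_, hg1, hk1⟩
  intro p m
  have hfp : (f p).eval x ∈ wcl (JJ x) ((p + 1 : ℕ):ℝ) := by
    rcases p with _ | p
    · exact h0
    · have h3 : ∑ i, (g i p).eval x * b i ∈ wcl (JJ x) ((p + 2 : ℕ) : ℝ) := by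
        refine Ideal.sum_mem _ fun i _ => ?_
        have := wcl_mul (pow_mul_wcl hm (eval_mem_mul _ (hg i p) (hg1 i p))) (hm (hb i))
        rwa [show p + 1 + 1 = p + 2 by ring] at this
      have := sub_mem (h12 p) h3
      rw [add_sub_cancel_right] at this
      exact this
  by_contra hcon
  exact h.not_mem_of_coeff (hf p) ⟨m, hcon⟩ (h.E1 hfp (ev (hf p)))
end
end CMproof

end

section

open IsLocalRing Polynomial Finset
set_option maxHeartbeats 2000000
set_option linter.style.haveILetI false
set_option linter.unusedSectionVars false
namespace CMproof
section
variable {R : Type*} [CommRing R] [IsLocalRing R] [IsNoetherianRing R] {e : ℕ} {x : Fin (e+1) → R}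
  {B : Type*} [CommRing B]

theorem psi_coeff (f : MvPolynomial (Fin (e+1)) R) (c : ℕ) :
    ((psi x one_pos f : AN (JJ x) 1) : R[X]).coeff c = (MvPolynomial.homogeneousComponent c f).eval x := by
  have := psi_coeff_deg (x := x) one_pos f c
  rwa [mul_one] at this

theorem coeff_mul_mon (p : R[X]) (n : ℕ) (a : R) (k : ℕ) :
    (p * monomial n a).coeff k = if n ≤ k then p.coeff (k - n) * a else 0 := by
  rw [← C_mul_X_pow_eq_monomial, ← mul_assoc, coeff_mul_X_pow', coeff_mul_C]

theorem Ctx.basis (h : Ctx x (maximalIdeal R)) (hm : maximalIdeal R = wcl (JJ x) (1:ℕ))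
    (hend : ∀ k : ℕ, wcl (JJ x) ((k+2:ℕ):ℝ) = JJ x ^ k * wcl (JJ x) (2:ℕ))
    (π : AN (JJ x) 1 →+* B) (hs : Function.Surjective π)
    (hπ : ∀ p, π p = 0 ↔ ∀ n : ℕ, (p : R[X]).coeff n ∈ wcl (JJ x) ((n+1:ℕ):ℝ))
    [Algebra (MvPolynomial (Fin (e+1)) (ResidueField R)) B]
    (hφ : ∀ F : MvPolynomial (Fin (e+1)) R, algebraMap (MvPolynomial (Fin (e+1)) (ResidueField R)) B
      (MvPolynomial.map (residue R) F) = π (psi x one_pos F)) :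
    Module.Free (MvPolynomial (Fin (e+1)) (ResidueField R)) B ∧
    Module.Finite (MvPolynomial (Fin (e+1)) (ResidueField R)) B := by
  classical
  obtain ⟨n1, b, hb, hbs, hb'⟩ := min_gens (maximalIdeal R) (JJ x ⊔ wcl (JJ x) (2:ℕ))
  obtain ⟨n2, c, hc, hcs, hc'⟩ := min_gens (wcl (JJ x) (2:ℕ)) (maximalIdeal R * JJ x)
  have hbw : ∀ j, b j ∈ wcl (JJ x) (1:ℕ) := fun j => hm.le (hb j)
  let vb : Fin n1 → B := fun j => π (mono 1 (hbw j))
  let vc : Fin n2 → B := fun j => π (mono 2 (hc j))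
  let v : Unit ⊕ (Fin n1 ⊕ Fin n2) → B := Sum.elim (fun _ => 1) (Sum.elim vb vc)
  have hsur : Function.Surjective (MvPolynomial.map (σ := Fin (e+1)) (residue R)) :=
    MvPolynomial.map_surjective _ residue_surjective
  have hmap0 : ∀ F : MvPolynomial (Fin (e+1)) R, MvPolynomial.map (residue R) F = 0 ↔
      ∀ p m, (MvPolynomial.homogeneousComponent p F).coeff m ∈ maximalIdeal R := by
    intro F
    constructor
    · intro h0 p m
      rw [MvPolynomial.coeff_homogeneousComponent]
      split_ifs
      · rw [← residue_eq_zero_iff, ← MvPolynomial.coeff_map, h0, MvPolynomial.coeff_zero]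
      · exact zero_mem _
    · intro h0
      ext m
      rw [MvPolynomial.coeff_map, MvPolynomial.coeff_zero, residue_eq_zero_iff]
      have := h0 m.degree m
      rwa [MvPolynomial.coeff_homogeneousComponent, if_pos rfl] at this
  have hli : LinearIndependent (MvPolynomial (Fin (e+1)) (ResidueField R)) v := by
    rw [Fintype.linearIndependent_iff]
    intro g hg
    choose G hG using fun i => hsur (g i)
    simp only [Fintype.sum_sum_type, v, Sum.elim_inl, Sum.elim_inr, Finset.univ_unique, Finset.sum_singleton,
      Algebra.smul_def, mul_one] at hg
    simp only [← hG, hφ, vb, vc, ← map_mul, ← map_sum, ← map_add] at hg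
    rw [hπ] at hg
    simp only [Subalgebra.coe_add, Subalgebra.coe_mul, AddSubmonoidClass.coe_finsetSum, mono_coe, coeff_add,
      finsetSum_coeff] at hg
    have key := h.relation hm.le hend hb hb' hc hc'
      (fun p => MvPolynomial.homogeneousComponent p (G (Sum.inl ())))
      (fun i p => MvPolynomial.homogeneousComponent p (G (Sum.inr (Sum.inl i))))
      (fun i p => MvPolynomial.homogeneousComponent p (G (Sum.inr (Sum.inr i))))
      (fun p => MvPolynomial.homogeneousComponent_isHomogeneous p _)
      (fun i p => MvPolynomial.homogeneousComponent_isHomogeneous p _)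
      (fun i p => MvPolynomial.homogeneousComponent_isHomogeneous p _)
      (by
        have h0 := hg 0
        simpa [psi_coeff, coeff_mul_mon] using h0)
      (by
        have h0 := hg 1
        simpa [psi_coeff, coeff_mul_mon] using h0)
      (fun p => by
        have h0 := hg (p+2)
        simp only [psi_coeff, coeff_mul_mon, show 1 ≤ p + 2 by omega, show 2 ≤ p + 2 by omega, if_true,
          show p + 2 - 1 = p + 1 by omega, show p + 2 - 2 = p by omega] at h0
        rw [show p + 2 + 1 = p + 3 by ring] at h0
        simpa [add_assoc] using h0)
    rintro (i | i | i)
    · rw [← hG]; exact (hmap0 _).2 key.1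
    · rw [← hG]; exact (hmap0 _).2 (key.2.1 i)
    · rw [← hG]; exact (hmap0 _).2 (key.2.2 i)
  have hsp : ⊤ ≤ Submodule.span (MvPolynomial (Fin (e+1)) (ResidueField R)) (Set.range v) := by
    set W := Submodule.span (MvPolynomial (Fin (e+1)) (ResidueField R)) (Set.range v) with hW
    have hv : ∀ i, v i ∈ W := fun i => Submodule.subset_span ⟨i, rfl⟩
    have hsm : ∀ (F : MvPolynomial (Fin (e+1)) R) (y : B), y ∈ W → π (psi x one_pos F) * y ∈ W := by
      intro F y hy
      rw [← hφ, ← Algebra.smul_def]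
      exact W.smul_mem _ hy
    let Sp : ℕ → Ideal R := fun n =>
      { carrier := {a | ∃ ha : a ∈ wcl (JJ x) (n:ℝ), π (mono n ha) ∈ W}
        zero_mem' := ⟨zero_mem _, by
          have : mono n (zero_mem (wcl (JJ x) (n:ℝ))) = 0 := Subtype.ext (by simp [mono_coe])
          rw [this, map_zero]; exact zero_mem _⟩
        add_mem' := by
          rintro a b ⟨ha, ha'⟩ ⟨hb, hb'⟩
          refine ⟨add_mem ha hb, ?_⟩
          have : mono n (add_mem ha hb) = mono n ha + mono n hb := Subtype.ext (by simp [mono_coe])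
          rw [this, map_add]; exact add_mem ha' hb'
        smul_mem' := by
          rintro r a ⟨ha, ha'⟩
          refine ⟨Ideal.mul_mem_left _ _ ha, ?_⟩
          have : mono n (Ideal.mul_mem_left (wcl (JJ x) (n:ℝ)) r ha) =
            psi x one_pos (MvPolynomial.C r) * mono n ha := Subtype.ext (by
              rw [Subalgebra.coe_mul, psi_homog one_pos (MvPolynomial.isHomogeneous_C _ r), mono_coe, mono_coe,
                monomial_mul_monomial]
              simp)
          change π (mono n (Ideal.mul_mem_left (wcl (JJ x) (n:ℝ)) r ha)) ∈ W
          rw [this, map_mul]; exact hsm _ _ ha' }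
    have hSp : ∀ n a, a ∈ Sp n ↔ ∃ ha : a ∈ wcl (JJ x) (n:ℝ), π (mono n ha) ∈ W := fun n a => Iff.rfl
    have hnext : ∀ n a, a ∈ wcl (JJ x) ((n + 1 : ℕ) : ℝ) → a ∈ Sp n := by
      intro n a ha
      have ha' : a ∈ wcl (JJ x) (n:ℝ) := wcl_anti (by push_cast; linarith) ha
      refine (hSp n a).2 ⟨ha', ?_⟩
      have : π (mono n ha') = 0 := by
        rw [hπ]
        intro k
        rw [mono_coe, coeff_monomial]
        split_ifs with hk
        · rwa [← hk]
        · exact zero_mem _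
      rw [this]; exact zero_mem _
    have hx : ∀ n i a, a ∈ Sp n → x i * a ∈ Sp (n + 1) := by
      intro n i a ha
      obtain ⟨ha, ha'⟩ := (hSp n a).1 ha
      have hxi : x i ∈ wcl (JJ x) ((1:ℕ):ℝ) := pow_le_wcl 1 (by rw [pow_one]; exact Ctx.x_mem (x := x) i)
      have hxa : x i * a ∈ wcl (JJ x) ((n + 1 : ℕ):ℝ) := by
        have := wcl_mul hxi ha
        rwa [add_comm 1 n] at this
      refine (hSp _ _).2 ⟨hxa, ?_⟩
      have : mono (n+1) hxa = psi x one_pos (MvPolynomial.X i) * mono n ha := Subtype.ext (by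
        rw [Subalgebra.coe_mul, psi_homog one_pos (MvPolynomial.isHomogeneous_X _ i), mono_coe, mono_coe,
          monomial_mul_monomial]
        simp [add_comm])
      rw [this, map_mul]
      exact hsm _ _ ha'
    have hJx : ∀ n (K : Ideal R), K ≤ Sp n → JJ x * K ≤ Sp (n + 1) := by
      intro n K hK
      rw [Ideal.mul_le]
      intro r hr s hs
      refine Submodule.span_induction (p := fun r _ => r * s ∈ Sp (n+1)) ?_ ?_ ?_ ?_ hr
      · rintro _ ⟨i, rfl⟩
        exact hx n i s (hK hs)
      · simp
      · intro y z _ _ hy hz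
        rw [add_mul]; exact add_mem hy hz
      · intro a y _ hy
        rw [smul_eq_mul, mul_assoc]; exact Ideal.mul_mem_left _ _ hy
    have hall : ∀ n : ℕ, wcl (JJ x) (n:ℝ) ≤ Sp n := by
      have h0 : Sp 0 = ⊤ := by
        rw [Ideal.eq_top_iff_one, hSp]
        have h1 : (1 : R) ∈ wcl (JJ x) ((0:ℕ):ℝ) := by
          rw [wcl_nonpos (by simp)]; trivial
        refine ⟨h1, ?_⟩
        have : mono 0 h1 = 1 := Subtype.ext (by simp [mono_coe])
        rw [this, map_one]
        exact hv (Sum.inl ())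
      have h1 : wcl (JJ x) ((1:ℕ):ℝ) ≤ Sp 1 := by
        rw [← hm]
        refine hbs.trans (sup_le ?_ (sup_le ?_ ?_))
        · rw [Ideal.span_le]
          rintro _ ⟨i, rfl⟩
          exact (hSp 1 _).2 ⟨hbw i, hv (Sum.inr (Sum.inl i))⟩
        · have := hJx 0 ⊤ h0.ge
          rwa [Ideal.mul_top] at this
        · exact fun a ha => hnext 1 a ha
      have h2 : wcl (JJ x) ((2:ℕ):ℝ) ≤ Sp 2 := by
        refine hcs.trans (sup_le ?_ ?_)
        · rw [Ideal.span_le]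
          rintro _ ⟨i, rfl⟩
          exact (hSp 2 _).2 ⟨hc i, hv (Sum.inr (Sum.inr i))⟩
        · rw [mul_comm, hm]
          exact hJx 1 _ h1
      have h3 : ∀ k, wcl (JJ x) ((k + 2 : ℕ):ℝ) ≤ Sp (k + 2) := by
        intro k
        induction k with
        | zero => exact h2
        | succ k ih =>
          rw [hend (k+1), pow_succ', mul_assoc, ← hend k]
          exact hJx (k+2) _ ih
      intro n
      rcases n with _ | _ | n
      · rw [h0]; exact le_top
      · exact h1
      · exact h3 n
    intro y _
    obtain ⟨p, rfl⟩ := hs y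
    have hpc : ∀ n : ℕ, (p : R[X]).coeff n ∈ wcl (JJ x) (n:ℝ) := fun n => by
      simpa using mem_AN.1 p.2 n
    have hp : p = ∑ n ∈ (p : R[X]).support, mono n (hpc n) := Subtype.ext (by
      rw [AddSubmonoidClass.coe_finsetSum]
      simp only [mono_coe]
      exact (p : R[X]).as_sum_support)
    rw [hp, map_sum]
    exact Submodule.sum_mem _ fun n _ => ((hSp n _).1 (hall n (hpc n))).2
  have bas := Module.Basis.mk hli hsp
  exact ⟨Module.Free.of_basis bas, Module.Finite.of_basis bas⟩
end
end CMproof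

end

section

open IsLocalRing Polynomial Finset
set_option maxHeartbeats 2000000
set_option linter.style.haveILetI false
set_option linter.unusedSectionVars false
namespace CMproof
section
variable {R : Type*} [CommRing R] [IsLocalRing R] [IsNoetherianRing R] {e : ℕ} {x : Fin (e+1) → R}
  {B : Type*} [CommRing B]

theorem exists_lift (hm : maximalIdeal R = wcl (JJ x) (1:ℕ)) (π : AN (JJ x) 1 →+* B)
    (hπ : ∀ p, π p = 0 ↔ ∀ n : ℕ, (p : R[X]).coeff n ∈ wcl (JJ x) ((n+1:ℕ):ℝ)) :
    ∃ φ : MvPolynomial (Fin (e+1)) (ResidueField R) →+* B, ∀ F : MvPolynomial (Fin (e+1)) R,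
      φ (MvPolynomial.map (residue R) F) = π (psi x one_pos F) := by
  let g : R →+* B := (π.comp (psi x one_pos).toRingHom).comp MvPolynomial.C
  have hg : ∀ a ∈ maximalIdeal R, g a = 0 := by
    intro a ha
    change π (psi x one_pos (MvPolynomial.C a)) = 0
    rw [hπ]
    intro n
    rw [psi_homog one_pos (MvPolynomial.isHomogeneous_C _ a), coeff_monomial]
    split_ifs with h
    · obtain rfl : n = 0 := by omega
      rw [MvPolynomial.eval_C, zero_add, ← hm]
      exact ha
    · exact zero_mem _
  let g' : ResidueField R →+* B := Ideal.Quotient.lift (maximalIdeal R) g hg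
  have hg' : ∀ a, g' (residue R a) = g a := fun a => Ideal.Quotient.lift_mk _ _ _
  refine ⟨MvPolynomial.eval₂Hom g' (fun i => π (psi x one_pos (MvPolynomial.X i))), fun F => ?_⟩
  have : (MvPolynomial.eval₂Hom g' (fun i => π (psi x one_pos (MvPolynomial.X i)))).comp
      (MvPolynomial.map (residue R)) = π.comp (psi x one_pos).toRingHom := by
    apply MvPolynomial.ringHom_ext
    · intro a
      simp only [RingHom.comp_apply, MvPolynomial.map_C, MvPolynomial.eval₂Hom_C, hg']
      rfl
    · intro i
      simp only [RingHom.comp_apply, MvPolynomial.map_X, MvPolynomial.eval₂Hom_X']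
      rfl
  exact RingHom.congr_fun this F

open RingTheory.Sequence in
theorem Ctx.final (h : Ctx x (maximalIdeal R)) (hm : maximalIdeal R = wcl (JJ x) (1:ℕ))
    (hend : ∀ k : ℕ, wcl (JJ x) ((k+2:ℕ):ℝ) = JJ x ^ k * wcl (JJ x) (2:ℕ))
    (π : AN (JJ x) 1 →+* B) (hs : Function.Surjective π)
    (hπ : ∀ p, π p = 0 ↔ ∀ n : ℕ, (p : R[X]).coeff n ∈ wcl (JJ x) ((n+1:ℕ):ℝ))
    (MG : Ideal B) (hMG : ∀ i, π (psi x one_pos (MvPolynomial.X i)) ∈ MG) :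
    (rdepth B MG B : WithBot ℕ∞) = ringKrullDim B := by
  obtain ⟨φ, hφ⟩ := exists_lift hm π hπ
  letI := φ.toAlgebra
  obtain ⟨hfree, hfin⟩ := h.basis hm hend π hs hπ hφ
  haveI hnt : Nontrivial B := by
    refine ⟨1, 0, fun h1 => ?_⟩
    have h2 := (hπ 1).1 (by rw [map_one, h1]) 0
    rw [zero_add, ← hm] at h2
    simp at h2
  haveI : Module.FaithfullyFlat (MvPolynomial (Fin (e+1)) (ResidueField R)) B := inferInstance
  have hreg := (X_reg (ResidueField R) (e+1)).of_faithfullyFlat (S := B)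
  have hdim : ringKrullDim B ≤ ((e + 1 : ℕ) : WithBot ℕ∞) := by
    refine (dim_le_of_integral (P := MvPolynomial (Fin (e+1)) (ResidueField R))).trans ?_
    rw [MvPolynomial.ringKrullDim_of_isNoetherianRing, ringKrullDim_eq_zero_of_field]
    simp
  apply le_antisymm (rdepth_le MG)
  refine hdim.trans ?_
  have : ((e + 1 : ℕ) : ℕ∞) ≤ rdepth B MG B := by
    apply le_sSup
    refine ⟨_, ?_, ?_, hreg⟩
    · simp
    · intro z hz
      obtain ⟨y, hy, rfl⟩ := List.mem_map.1 hz
      obtain ⟨i, rfl⟩ := (List.mem_ofFn' _ y).1 hy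
      have := hφ (MvPolynomial.X i)
      rw [MvPolynomial.map_X] at this
      change φ (MvPolynomial.X i) ∈ MG
      rw [this]
      exact hMG i
  exact_mod_cast WithBot.coe_le_coe.2 this
end
end CMproof

end

theorem CM_agr_of_e3_zero_almost_max_type
    (R : Type*) [CommRing R] [IsLocalRing R] [IsNoetherianRing R]
    (d : ℕ) (hd : 3 ≤ d) (hdim : ringKrullDim R = d)
    (hCM : IsCMLocal R) (hAU : AnalyticallyUnramified R)
    (hres : Infinite (ResidueField R))
    (t : ℕ) (ht : CMTypeData R d t)
    (I J : Ideal R) (hIm : intCl I = maximalIdeal R)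
    (hJ : IsMinimalReduction d J I)
    (L : ℕ → ℕ) (e : ℕ → ℤ) (hHilb : NormalHilbertData d I L e)
    (he3 : e 3 = 0)
    -- `ℓ = λ(Ī²/JĪ)`
    (ℓ : ℕ)
    (hℓ : mlen R (idealQuot (intCl (I ^ 2)) (J * intCl I)) = (ℓ : WithBot ℕ∞))
    (hbig : (t : ℤ) - 1 ≤ (ℓ : ℤ))
    -- the Rees algebra of the normal filtration and its associated graded ring
    (A : Subalgebra R (Polynomial R))
    (hA : ∀ p : Polynomial R, p ∈ A ↔ ∀ n, p.coeff n ∈ intCl (I ^ n))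
    (K : Ideal A)
    (hK : ∀ p : A, p ∈ K ↔ ∀ n, (p : Polynomial R).coeff n ∈ intCl (I ^ (n + 1)))
    (MG : Ideal A)
    (hMG : ∀ p : A, p ∈ MG ↔ (p : Polynomial R).coeff 0 ∈ maximalIdeal R) :
    -- `Ḡ` is Cohen-Macaulay
    (rdepth (A ⧸ K) (MG.map (Ideal.Quotient.mk K)) (A ⧸ K) : WithBot ℕ∞) =
      ringKrullDim (A ⧸ K) := by
  obtain ⟨m, rfl⟩ : ∃ m, d = m + 3 := ⟨d - 3, by omega⟩
  obtain ⟨x, rfl⟩ := hJ.2.1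
  obtain ⟨h, hcl, -, hend⟩ := CMproof.main1 hdim hCM hAU t ht I hIm x hJ L e hHilb he3 ℓ hℓ hbig
  have hm : maximalIdeal R = CMproof.wcl (CMproof.JJ x) ((1:ℕ):ℝ) := by rw [← hcl 1, pow_one, hIm]
  obtain rfl : A = CMproof.AN (CMproof.JJ x) 1 := by
    ext p
    rw [hA, CMproof.mem_AN]
    simp [hcl]
  refine CMproof.Ctx.final (e := m + 2) h hm hend (Ideal.Quotient.mk K) Ideal.Quotient.mk_surjective ?_ _ ?_
  · intro p
    rw [Ideal.Quotient.eq_zero_iff_mem, hK]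
    simp only [hcl]
  · intro i
    apply Ideal.mem_map_of_mem
    rw [hMG, CMproof.psi_homog one_pos (MvPolynomial.isHomogeneous_X _ i)]
    simp
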